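/- Interior regularity bootstrap for fully nonlinear parabolic systems (Proposition 4.2): Let k ≥ 0 be an integer, let Ω be an open ball in ℝ^n and Ω' an open ball with closure(Ω') ⊂ Ω, and let δ > 0. Let u₀ ∈ C^{r+k+α}(closure(Ω),ℝ^l), let Z ⊂ ℝ^N be a compact neighborhood of the range of j_r u₀ over closure(Ω), and let F : closure(Ω) × [0,δ] × Z → ℝ^l be of class C^{2+k}. Assume there is λ > 0 such that (−1)^{r/2−1} Σ_{a,b,i_1,…,i_r} (∂F^a/∂q^b_{i_1⋯i_r})(x,t,z) ξ_{i_1}⋯ξ_{i_r} v^a v^b ≥ λ |ξ|^r |v|² uniformly for (x,t,z) ∈ closure(Ω) × [0,δ] × Z, ξ ∈ ℝ^n, v ∈ ℝ^l. Let δ̃ > 0 and let u ∈ C^{r+α,1+α/r}(closure(Ω)×[0,δ̃],ℝ^l) satisfy ∂u/∂t = F(x, t, j_r u(x,t)) and u(·,0) = u₀ on closure(Ω)×[0,δ̃], with j_r u(x,t) ∈ Z for all (x,t) ∈ closure(Ω)×[0,min(δ,δ̃)]. Then there exists δ' > 0, δ' ≤ min(δ,δ̃), such that for every spatial multi-index β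 with |β| ≤ k the derivative ∂_x^β u belongs to C^{r+α,1+α/r}(closure(Ω')×[0,δ'],ℝ^l). -/

import Mathlib

open scoped BigOperators
noncomputable section

/-- Euclidean space `ℝ^n`. -/
abbrev Vec (n : ℕ) := EuclideanSpace ℝ (Fin n)

/-- Iterated spatial partial derivative (within `D`) in the directions `I = (i_1, …, i_k)`. -/
def pderivW {n l : ℕ} (D : Set (Vec n)) (k : ℕ) (I : Fin k → Fin n)
    (w : Vec n → Vec l) : Vec n → Vec l :=
  fun x => iteratedFDerivWithin ℝ k w D x (fun j => EuclideanSpace.single (I j) 1)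

/-- Spatial partial derivative `∂_I u(⋅,t)` of a space-time function (within `D`). -/
def spDerivW {n l : ℕ} (D : Set (Vec n)) (k : ℕ) (I : Fin k → Fin n)
    (u : Vec n → ℝ → Vec l) : Vec n → ℝ → Vec l :=
  fun x t => pderivW D k I (fun y => u y t) x

/-- Time derivative `∂_t u` within the time interval `J`. -/
def tDerivW {n l : ℕ} (J : Set ℝ) (u : Vec n → ℝ → Vec l) : Vec n → ℝ → Vec l :=
  fun x t => derivWithin (fun s => u x s) J t

/-- Supremum norm `|w|_{0;Q}`. -/
def supQ {n l : ℕ} (Q : Set (Vec n × ℝ)) (w : Vec n → ℝ → Vec l) : ℝ :=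
  sSup {c | ∃ p ∈ Q, c = ‖w p.1 p.2‖}

/-- The set of parabolic Hölder difference quotients of exponent `α` (parabolic order `r`). -/
def holQuot {n l : ℕ} (r : ℕ) (α : ℝ) (Q : Set (Vec n × ℝ))
    (w : Vec n → ℝ → Vec l) : Set ℝ :=
  {c | ∃ p ∈ Q, ∃ q ∈ Q, p ≠ q ∧
    c = ‖w p.1 p.2 - w q.1 q.2‖ / (‖p.1 - q.1‖ ^ α + |p.2 - q.2| ^ (α / r))}

/-- Parabolic Hölder seminorm `[w]_{α;Q}`. -/
def parSemi {n l : ℕ} (r : ℕ) (α : ℝ) (Q : Set (Vec n × ℝ))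
    (w : Vec n → ℝ → Vec l) : ℝ :=
  sSup (holQuot r α Q w)

/-- Parabolic Hölder norm `‖u‖_{C^{r+α,1+α/r}(D × J)}`. -/
def parNorm {n l : ℕ} (r : ℕ) (α : ℝ) (D : Set (Vec n)) (J : Set ℝ)
    (u : Vec n → ℝ → Vec l) : ℝ :=
  (∑ k ∈ Finset.range (r + 1), ∑ I : Fin k → Fin n, supQ (D ×ˢ J) (spDerivW D k I u))
    + supQ (D ×ˢ J) (tDerivW J u)
    + (∑ I : Fin r → Fin n, parSemi r α (D ×ˢ J) (spDerivW D r I u))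
    + parSemi r α (D ×ˢ J) (tDerivW J u)

/-- Membership in the parabolic Hölder space `C^{r+α,1+α/r}(D × J, ℝ^l)`. -/
def MemPar {n l : ℕ} (r : ℕ) (α : ℝ) (D : Set (Vec n)) (J : Set ℝ)
    (u : Vec n → ℝ → Vec l) : Prop :=
  ContinuousOn (fun p : Vec n × ℝ => u p.1 p.2) (D ×ˢ J) ∧
  (∀ t ∈ J, ContDiffOn ℝ r (fun x => u x t) D) ∧
  (∀ x ∈ D, DifferentiableOn ℝ (fun s => u x s) J) ∧
  (∀ k, k ≤ r → ∀ I : Fin k → Fin n,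
    ContinuousOn (fun p : Vec n × ℝ => spDerivW D k I u p.1 p.2) (D ×ˢ J)) ∧
  ContinuousOn (fun p : Vec n × ℝ => tDerivW J u p.1 p.2) (D ×ˢ J) ∧
  (∀ I : Fin r → Fin n, BddAbove (holQuot r α (D ×ˢ J) (spDerivW D r I u))) ∧
  BddAbove (holQuot r α (D ×ˢ J) (tDerivW J u))

/-- The norm of `C^{α,α/r}(Q)`. -/
def lowNorm {n l : ℕ} (r : ℕ) (α : ℝ) (Q : Set (Vec n × ℝ))
    (f : Vec n → ℝ → Vec l) : ℝ :=
  supQ Q f + parSemi r α Q f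

/-- Membership in `C^{α,α/r}(Q, ℝ^l)`. -/
def MemLow {n l : ℕ} (r : ℕ) (α : ℝ) (Q : Set (Vec n × ℝ))
    (f : Vec n → ℝ → Vec l) : Prop :=
  ContinuousOn (fun p : Vec n × ℝ => f p.1 p.2) Q ∧ BddAbove (holQuot r α Q f)

/-- Spatial Hölder quotient set. -/
def spHolQuot {n l : ℕ} (D : Set (Vec n)) (α : ℝ) (w : Vec n → Vec l) : Set ℝ :=
  {c | ∃ x ∈ D, ∃ y ∈ D, x ≠ y ∧ c = ‖w x - w y‖ / ‖x - y‖ ^ α}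

/-- The elliptic Hölder norm `‖u₀‖_{C^{r+α}(D)}`. -/
def spNorm {n l : ℕ} (r : ℕ) (α : ℝ) (D : Set (Vec n)) (u₀ : Vec n → Vec l) : ℝ :=
  (∑ k ∈ Finset.range (r + 1), ∑ I : Fin k → Fin n,
    sSup {c | ∃ x ∈ D, c = ‖pderivW D k I u₀ x‖})
    + ∑ I : Fin r → Fin n, sSup (spHolQuot D α (pderivW D r I u₀))

/-- Membership in `C^{r+α}(D, ℝ^l)`. -/
def MemSp {n l : ℕ} (r : ℕ) (α : ℝ) (D : Set (Vec n)) (u₀ : Vec n → Vec l) : Prop :=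
  ContDiffOn ℝ r u₀ D ∧ ∀ I : Fin r → Fin n, BddAbove (spHolQuot D α (pderivW D r I u₀))

/-- Action `(L_t u)(x)` of the time-dependent linear differential operator of order `r` with
coefficients `A k I a b` (`k = |I| ≤ r`). -/
def applyL {n l : ℕ} (r : ℕ) (D : Set (Vec n))
    (A : (k : ℕ) → (Fin k → Fin n) → Fin l → Fin l → Vec n → ℝ → ℝ)
    (u : Vec n → ℝ → Vec l) : Vec n → ℝ → Vec l :=
  fun x t => (EuclideanSpace.equiv (Fin l) ℝ).symm fun a =>
    ∑ k ∈ Finset.range (r + 1), ∑ I : Fin k → Fin n, ∑ b : Fin l,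
      A k I a b x t * spDerivW D k I u x t b

/-- Legendre–Hadamard strong ellipticity with constant `lam` on `Q`. -/
def StrongEllip {n l : ℕ} (r : ℕ)
    (A : (k : ℕ) → (Fin k → Fin n) → Fin l → Fin l → Vec n → ℝ → ℝ)
    (Q : Set (Vec n × ℝ)) (lam : ℝ) : Prop :=
  ∀ p ∈ Q, ∀ ξ : Vec n, ∀ v : Vec l,
    lam * ‖ξ‖ ^ r * ‖v‖ ^ 2 ≤
      (-1 : ℝ) ^ (r / 2 - 1) *
        ∑ I : Fin r → Fin n, ∑ a : Fin l, ∑ b : Fin l,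
          A r I a b p.1 p.2 * (∏ j, ξ (I j)) * v a * v b

/-- `ℤ^n`-periodicity. -/
def PerZ {n : ℕ} {β : Type*} (g : Vec n → β) : Prop :=
  ∀ x : Vec n, ∀ m : Fin n → ℤ,
    g (x + (EuclideanSpace.equiv (Fin n) ℝ).symm fun i => (m i : ℝ)) = g x

/-- Real-valued functions viewed as `ℝ^1`-valued. -/
def toV1 {n : ℕ} (g : Vec n → ℝ → ℝ) : Vec n → ℝ → Vec 1 :=
  fun x t => (EuclideanSpace.equiv (Fin 1) ℝ).symm fun _ => g x t

/-- The `r`-jet space: components indexed by the derivative order `k ≤ r`,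
a tuple of `k` spatial directions, and the component index `b`. -/
abbrev Jet (n l r : ℕ) := (k : Fin (r + 1)) → ((Fin (k : ℕ) → Fin n) → Fin l → ℝ)

/-- The `r`-jet `j_r w(x) = (w(x), Dw(x), …, D^r w(x))` (derivatives within `D`). -/
def jetOf {n l : ℕ} (D : Set (Vec n)) (r : ℕ) (w : Vec n → Vec l) (x : Vec n) :
    Jet n l r :=
  fun k I b => pderivW D (k : ℕ) I w x b

/-- The basis jet vector corresponding to the jet component `(k, I, b)`;
differentiating in this direction gives `∂F/∂z^b_I`. -/
def jetBasisG {n l : ℕ} (r k : ℕ) (I : Fin k → Fin n) (b : Fin l) : Jet n l r :=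
  fun k' I' b' => if h : (k' : ℕ) = k then
    (if (I' ∘ Fin.cast h.symm) = I ∧ b' = b then (1 : ℝ) else 0) else 0

set_option linter.unusedSectionVars false

namespace ParabolicBootstrap

open MeasureTheory
open scoped SchwartzMap FourierTransform LineDeriv

theorem norm_fderiv_le_of_entire {A G : Type} [NormedAddCommGroup A] [NormedSpace ℂ A]
    [NormedAddCommGroup G] [NormedSpace ℂ G] {f : A → G} (hf : Differentiable ℂ f) {x : A} {B : ℝ}
    (hB0 : 0 ≤ B)
    (hB : ∀ y, ‖y - x‖ ≤ 1 → ‖f y‖ ≤ B) : ‖fderiv ℂ f x‖ ≤ B := by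
  refine ContinuousLinearMap.opNorm_le_bound _ hB0 fun v => ?_
  rcases eq_or_ne v 0 with rfl | hv
  · simp
  have hv' : 0 < ‖v‖ := norm_pos_iff.2 hv
  have hl : Differentiable ℂ (fun z : ℂ => x + z • v) := by fun_prop
  have hd : Differentiable ℂ (fun z : ℂ => f (x + z • v)) := hf.comp hl
  have h1 : HasDerivAt (fun z : ℂ => x + z • v) v 0 := by
    simpa using ((hasDerivAt_id (0 : ℂ)).smul_const v).const_add x
  have h2 : HasDerivAt (fun z : ℂ => f (x + z • v)) (fderiv ℂ f x v) 0 := by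
    have h3 : HasFDerivAt f (fderiv ℂ f x) (x + (0 : ℂ) • v) := by
      simpa using (hf x).hasFDerivAt
    exact h3.comp_hasDerivAt (0 : ℂ) h1
  rw [← h2.deriv]
  have := Complex.norm_deriv_le_of_forall_mem_sphere_norm_le (c := 0) (R := ‖v‖⁻¹) (C := B)
    (inv_pos.2 hv') hd.diffContOnCl (fun z hz => hB _ (by
      have : ‖z‖ = ‖v‖⁻¹ := by simpa using hz
      simp [norm_smul, this, hv'.ne']))
  simpa [div_inv_eq_mul] using this

theorem norm_iteratedFDeriv_le_of_entire {A : Type} [NormedAddCommGroup A] [NormedSpace ℂ A]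
    [NormedSpace ℝ A] [IsScalarTower ℝ ℂ A] (i : ℕ) :
    ∀ {G : Type} [NormedAddCommGroup G] [NormedSpace ℂ G] [NormedSpace ℝ G] [IsScalarTower ℝ ℂ G]
    {f : A → G} (_ : ContDiff ℂ (⊤ : ℕ∞) f) {x : A} {B : ℝ} (_ : 0 ≤ B)
    (_ : ∀ y, ‖y - x‖ ≤ i → ‖f y‖ ≤ B), ‖iteratedFDeriv ℝ i f x‖ ≤ B := by
  induction i with
  | zero =>
    intro G _ _ _ _ f hf x B hB0 hB
    simpa using hB x (by simp)
  | succ i ih =>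
    intro G _ _ _ _ f hf x B hB0 hB
    rw [← norm_iteratedFDeriv_fderiv]
    have hdf : Differentiable ℂ f := hf.differentiable (by simp)
    have e : fderiv ℝ f = fun y =>
        ContinuousLinearMap.restrictScalarsL ℂ A G ℝ ℂ (fderiv ℂ f y) := by
      ext1 y
      exact (hdf y).fderiv_restrictScalars ℝ
    refine ih ?_ hB0 fun y hy => ?_
    · rw [e]
      exact (ContinuousLinearMap.restrictScalarsL ℂ A G ℝ ℂ).contDiff.comp
        (hf.fderiv_right (by simp))
    · rw [e]
      refine (le_of_eq ?_).trans (norm_fderiv_le_of_entire hdf hB0 (x := y) fun z hz => hB z ?_)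
      · simp
      · calc ‖z - x‖ = ‖(z - y) + (y - x)‖ := by abel_nf
          _ ≤ 1 + i := (norm_add_le _ _).trans (add_le_add hz hy)
          _ = _ := by push_cast; ring

section Exp
variable {E : Type} [NormedAddCommGroup E] [InnerProductSpace ℂ E] [CompleteSpace E]

theorem norm_exp_le_of_dissipative {M : E →L[ℂ] E} {μ : ℝ}
    (h : ∀ z, (inner ℂ (M z) z).re ≤ -μ * ‖z‖ ^ 2) :
    ‖NormedSpace.exp M‖ ≤ Real.exp (-μ) := by
  let _ : InnerProductSpace ℝ E := InnerProductSpace.rclikeToReal ℂ E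
  have _ : IsScalarTower ℝ ℂ E := ⟨fun a b c => by
    rw [Complex.real_smul, mul_smul]; rfl⟩
  refine ContinuousLinearMap.opNorm_le_bound _ (Real.exp_pos _).le fun z => ?_
  set X : ℝ → E := fun t => NormedSpace.exp ((t : ℂ) • M) z with hX
  have hXd : ∀ t : ℝ, HasDerivAt X (M (X t)) t := by
    intro t
    have h1 := hasDerivAt_exp_smul_const' (𝕂 := ℂ) M (t : ℂ)
    have h2 := (ContinuousLinearMap.apply ℂ E z).hasFDerivAt.comp_hasDerivAt (t : ℂ) h1
    have h3 := h2.scomp t Complex.ofRealCLM.hasDerivAt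
    rw [Complex.ofRealCLM_apply, Complex.ofReal_one, one_smul] at h3
    exact h3
  have hψ : ∀ t : ℝ, HasDerivAt (fun t => Real.exp (2 * μ * t) * ‖X t‖ ^ 2)
      (Real.exp (2 * μ * t) * (2 * μ) * ‖X t‖ ^ 2
        + Real.exp (2 * μ * t) * (2 * inner ℝ (X t) (M (X t)))) t := by
    intro t
    have h1 : HasDerivAt (fun t => Real.exp (2 * μ * t)) (Real.exp (2 * μ * t) * (2 * μ)) t := by
      simpa using ((hasDerivAt_id t).const_mul (2 * μ)).exp
    exact h1.mul (hXd t).norm_sq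
  have hanti : Antitone (fun t => Real.exp (2 * μ * t) * ‖X t‖ ^ 2) := by
    refine antitone_of_deriv_nonpos (fun t => (hψ t).differentiableAt) fun t => ?_
    rw [(hψ t).deriv]
    have h1 := h (X t)
    have h2 : inner ℝ (X t) (M (X t)) = (inner ℂ (M (X t)) (X t)).re := by
      rw [real_inner_comm]; rfl
    rw [h2]
    have := Real.exp_pos (2 * μ * t)
    nlinarith
  have h01 := hanti (zero_le_one)
  have e0 : X 0 = z := by simp [hX]
  have e1 : X 1 = NormedSpace.exp M z := by simp [hX]
  simp only [e0, e1, mul_zero, Real.exp_zero, one_mul, mul_one] at h01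
  have h5 : Real.exp (2 * μ) = Real.exp μ ^ 2 := by rw [← Real.exp_nat_mul]; norm_num
  rw [h5, ← mul_pow] at h01
  have h6 := sq_le_sq.1 h01
  rw [Real.exp_neg, ← div_eq_inv_mul, le_div_iff₀ (Real.exp_pos _)]
  rw [abs_of_nonneg (by positivity), abs_of_nonneg (by positivity)] at h6
  linarith

theorem norm_iteratedFDeriv_exp_le [NormedSpace ℝ E] [IsScalarTower ℝ ℂ E] (i : ℕ)
    {M : E →L[ℂ] E} {μ : ℝ} (h : ∀ z, (inner ℂ (M z) z).re ≤ -μ * ‖z‖ ^ 2) :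
    ‖iteratedFDeriv ℝ i (NormedSpace.exp : (E →L[ℂ] E) → (E →L[ℂ] E)) M‖
      ≤ Real.exp (i - μ) := by
  refine norm_iteratedFDeriv_le_of_entire i ?_ (Real.exp_pos _).le fun y hy => ?_
  · exact contDiff_iff_contDiffAt.2 fun x => (NormedSpace.exp_analytic (𝕂 := ℂ) x).contDiffAt
  · have := norm_exp_le_of_dissipative (M := y) (μ := μ - i) fun z => ?_
    · simpa using this
    · have e : y z = M z + (y - M) z := by simp
      rw [e, inner_add_left, Complex.add_re]
      have h1 : (inner ℂ ((y - M) z) z).re ≤ i * ‖z‖ ^ 2 := by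
        calc (inner ℂ ((y - M) z) z).re ≤ ‖inner ℂ ((y - M) z) z‖ := Complex.re_le_norm _
          _ ≤ ‖(y - M) z‖ * ‖z‖ := norm_inner_le_norm _ _
          _ ≤ (i * ‖z‖) * ‖z‖ := by
            gcongr
            exact ((y - M).le_opNorm z).trans (by gcongr)
          _ = _ := by ring
      have := h z
      nlinarith

theorem pow_mul_exp_neg_pow_bounded {r : ℕ} (hr : 1 ≤ r) {c : ℝ} (hc : 0 < c) (p : ℕ) :
    ∃ C, ∀ s : ℝ, 0 ≤ s → (1 + s) ^ p * Real.exp (-(c * s ^ r)) ≤ C := by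
  refine ⟨p.factorial / c ^ p * Real.exp (2 * c), fun s hs => ?_⟩
  have h1 : s ≤ 1 + s ^ r := by
    rcases le_total s 1 with h | h
    · nlinarith [pow_nonneg hs r]
    · linarith [le_self_pow₀ h (by omega : r ≠ 0)]
  have h2 := Real.pow_div_factorial_le_exp (c * (1 + s)) (by positivity) p
  have h3 : (1 + s) ^ p ≤ p.factorial / c ^ p * Real.exp (c * (1 + s)) := by
    rw [div_mul_eq_mul_div, le_div_iff₀ (by positivity)]
    rw [div_le_iff₀ (by positivity), mul_pow] at h2
    linarith
  calc (1 + s) ^ p * Real.exp (-(c * s ^ r))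
      ≤ (p.factorial / c ^ p * Real.exp (c * (1 + s))) * Real.exp (-(c * s ^ r)) := by gcongr
    _ = p.factorial / c ^ p * Real.exp (c * (1 + s) + -(c * s ^ r)) := by
        rw [Real.exp_add]; ring
    _ ≤ _ := by
        gcongr
        nlinarith

variable {V : Type} [NormedAddCommGroup V] [NormedSpace ℝ V]

theorem exists_schwartz_exp [NormedSpace ℝ E] [IsScalarTower ℝ ℂ E] {P : V → (E →L[ℂ] E)}
    (hP : P.HasTemperateGrowth) {r : ℕ} (hr : 1 ≤ r) {c : ℝ} (hc : 0 < c)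
    (h : ∀ ξ z, (inner ℂ (P ξ z) z).re ≤ -(c * ‖ξ‖ ^ r) * ‖z‖ ^ 2) :
    ∃ g : SchwartzMap V (E →L[ℂ] E), ∀ ξ, g ξ = NormedSpace.exp (P ξ) := by
  have hexp : ContDiff ℝ (⊤ : ℕ∞) (NormedSpace.exp : (E →L[ℂ] E) → (E →L[ℂ] E)) :=
    (contDiff_iff_contDiffAt.2 fun x =>
      (NormedSpace.exp_analytic (𝕂 := ℂ) x).contDiffAt).restrict_scalars ℝ
  refine ⟨⟨fun ξ => NormedSpace.exp (P ξ), hexp.comp hP.1, fun k i => ?_⟩, fun ξ => rfl⟩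
  obtain ⟨N, C, hC, hN⟩ := hP.norm_iteratedFDeriv_le_uniform i
  obtain ⟨K, hK⟩ := pow_mul_exp_neg_pow_bounded hr hc (k + N * i)
  refine ⟨i.factorial * (1 + C) ^ i * Real.exp i * K, fun ξ => ?_⟩
  have h1 := norm_iteratedFDeriv_comp_le (n := i) hexp hP.1 (by exact_mod_cast le_top) ξ
    (C := Real.exp (i - c * ‖ξ‖ ^ r)) (D := (1 + C) * (1 + ‖ξ‖) ^ N)
    (fun j hj => (norm_iteratedFDeriv_exp_le j (h ξ)).trans (by gcongr))
    (fun j hj hji => by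
      have hb : 1 ≤ (1 + C) * (1 + ‖ξ‖) ^ N :=
        one_le_mul_of_one_le_of_one_le (by linarith)
          (one_le_pow₀ (by linarith [norm_nonneg ξ]))
      refine (hN j hji ξ).trans (le_trans ?_ (le_self_pow₀ hb (by omega)))
      gcongr
      linarith)
  calc ‖ξ‖ ^ k * ‖iteratedFDeriv ℝ i (fun ξ => NormedSpace.exp (P ξ)) ξ‖
      ≤ (1 + ‖ξ‖) ^ k * (i.factorial * Real.exp (i - c * ‖ξ‖ ^ r)
          * ((1 + C) * (1 + ‖ξ‖) ^ N) ^ i) := by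
        gcongr
        · linarith
        · exact h1
    _ = i.factorial * (1 + C) ^ i * Real.exp i
        * ((1 + ‖ξ‖) ^ (k + N * i) * Real.exp (-(c * ‖ξ‖ ^ r))) := by
        rw [sub_eq_add_neg, Real.exp_add, pow_add, pow_mul, mul_pow]; ring
    _ ≤ _ := by
        gcongr
        exact hK _ (norm_nonneg _)
end Exp

section Kernel
variable {V : Type} [NormedAddCommGroup V] [InnerProductSpace ℝ V] [FiniteDimensional ℝ V]
  [MeasurableSpace V] [BorelSpace V]
variable {A : Type} [NormedRing A] [NormedAlgebra ℂ A] [CompleteSpace A]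

theorem fourier_iteratedLineDerivOp {F : Type} [NormedAddCommGroup F] [NormedSpace ℂ F] (r : ℕ) :
    ∀ (m : Fin r → V) (h : 𝓢(V, F)) (ξ : V), 𝓕 (∂^{m} h) ξ
      = ((2 * Real.pi * Complex.I) ^ r * ∏ j, ((inner ℝ ξ (m j) : ℝ) : ℂ)) • 𝓕 h ξ := by
  induction r with
  | zero => intro m h ξ; simp
  | succ r ih =>
    intro m h ξ
    rw [LineDeriv.iteratedLineDerivOp_succ_left, SchwartzMap.fourier_lineDerivOp_eq,
      smul_apply, SchwartzMap.smulLeftCLM_apply_apply (by fun_prop), ih]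
    rw [Fin.prod_univ_succ, pow_succ]
    rw [← Complex.coe_smul, smul_smul, smul_smul]
    congr 1
    simp only [Fin.tail]
    ring

theorem fourier_postcompCLM {F G : Type} [NormedAddCommGroup F] [NormedSpace ℂ F] [CompleteSpace F]
    [NormedAddCommGroup G] [NormedSpace ℂ G] [CompleteSpace G] (L : F →L[ℂ] G) (f : 𝓢(V, F)) :
    𝓕 (SchwartzMap.postcompCLM L f) = SchwartzMap.postcompCLM L (𝓕 f) := by
  ext ξ
  rw [SchwartzMap.fourier_coe, SchwartzMap.postcompCLM_apply, SchwartzMap.fourier_coe,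
    Real.fourier_eq, Real.fourier_eq, ← L.integral_comp_comm]
  · simp [Circle.smul_def]
  · exact (Real.fourierIntegral_convergent_iff ξ).2 f.integrable

theorem sum_inner_smul_apply {F : Type} [NormedAddCommGroup F] [NormedSpace ℝ F] {n : ℕ}
    (b : OrthonormalBasis (Fin n) ℝ V) (L : V →L[ℝ] F) (x : V) :
    ∑ i, (inner ℝ x (b i) : ℝ) • L (b i) = L x := by
  have h : L x = L (∑ i, inner ℝ (b i) x • b i) := by rw [b.sum_repr' x]
  rw [h, map_sum]
  simp [real_inner_comm]

theorem kernel_profile {n r : ℕ} (hr : 1 ≤ r) (b : OrthonormalBasis (Fin n) ℝ V)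
    (a : (Fin r → Fin n) → A) {P : V → A}
    (hP : ∀ ξ, P ξ = ∑ J : Fin r → Fin n,
      ((2 * Real.pi * Complex.I) ^ r * ∏ j, ((inner ℝ ξ (b (J j)) : ℝ) : ℂ)) • a J)
    {g : 𝓢(V, A)} (hg : ∀ ξ, g ξ = NormedSpace.exp (P ξ)) :
    (∫ x, (𝓕⁻ g : 𝓢(V, A)) x = 1) ∧
    ∀ x, n • (𝓕⁻ g : 𝓢(V, A)) x + fderiv ℝ (𝓕⁻ g : 𝓢(V, A)) x x
      = -(r : ℝ) • ∑ J : Fin r → Fin n, (∂^{fun j => b (J j)} (𝓕⁻ g : 𝓢(V, A))) x * a J := by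
  have hP0 : P 0 = 0 := by
    rw [hP]
    refine Finset.sum_eq_zero fun J _ => ?_
    have : ∏ j : Fin r, ((inner ℝ (0 : V) (b (J j)) : ℝ) : ℂ) = 0 :=
      Finset.prod_eq_zero (Finset.mem_univ (⟨0, hr⟩ : Fin r)) (by simp)
    rw [this]; simp
  have hhom : ∀ (t : ℝ) ξ, P (t • ξ) = ((t : ℂ) ^ r) • P ξ := by
    intro t ξ
    rw [hP, hP, Finset.smul_sum]
    refine Finset.sum_congr rfl fun J _ => ?_
    rw [smul_smul]
    congr 1
    simp only [inner_smul_left, Complex.ofReal_mul, Finset.prod_mul_distrib]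
    simp
    ring
  constructor
  · have h1 : 𝓕 (𝓕⁻ g : 𝓢(V, A)) = g := FourierTransform.fourier_fourierInv_eq g
    have h2 : (𝓕 (𝓕⁻ g : 𝓢(V, A)) : 𝓢(V, A)) 0 = 1 := by
      rw [h1, hg, hP0, NormedSpace.exp_zero]
    rw [SchwartzMap.fourier_coe, Real.fourier_eq] at h2
    simpa using h2
  · have hrad : ∀ ξ, fderiv ℝ g ξ ξ = (r : ℂ) • (g ξ * P ξ) := by
      intro ξ
      have h1 : HasDerivAt (fun t : ℝ => g (t • ξ)) (fderiv ℝ g ξ ξ) 1 := by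
        have hl : HasDerivAt (fun t : ℝ => t • ξ) ξ 1 := by
          simpa using (hasDerivAt_id (1 : ℝ)).smul_const ξ
        have h3 : HasFDerivAt g (fderiv ℝ g ξ) ((1 : ℝ) • ξ) := by
          simpa using (g.differentiableAt (x := ξ)).hasFDerivAt
        exact h3.comp_hasDerivAt (1 : ℝ) hl
      have h2 : HasDerivAt (fun t : ℝ => g (t • ξ)) ((r : ℂ) • (g ξ * P ξ)) 1 := by
        have e : (fun t : ℝ => g (t • ξ))
            = (fun z : ℂ => NormedSpace.exp (z ^ r • P ξ)) ∘ (Complex.ofReal) := by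
          ext t; simp [hg, hhom]
        rw [e]
        have h4 := (hasDerivAt_exp_smul_const (𝕂 := ℂ) (P ξ) ((1 : ℂ) ^ r))
        have h5 : HasDerivAt (fun z : ℂ => z ^ r) ((r : ℂ)) (1 : ℂ) := by
          simpa using hasDerivAt_pow r (1 : ℂ)
        have h6 := h4.scomp (1 : ℂ) h5
        have h7 := h6.scomp (h := Complex.ofReal) (1 : ℝ) Complex.ofRealCLM.hasDerivAt
        rw [Complex.ofRealCLM_apply, Complex.ofReal_one, one_smul, one_pow, one_smul, ← hg] at h7
        exact h7
      exact h1.unique h2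
    intro x
    set k := 𝓕⁻ g with hk
    have hx : ∀ i, ∀ y, fderiv ℝ (fun z => (inner ℝ z (b i) : ℝ) • k z) y (b i)
        = k y + (inner ℝ y (b i) : ℝ) • fderiv ℝ k y (b i) := by
      intro i y
      have h1 : HasFDerivAt (fun z => (inner ℝ z (b i) : ℝ)) (innerSL ℝ (b i)) y := by
        have := (innerSL ℝ (b i)).hasFDerivAt (x := y)
        simpa [real_inner_comm] using this
      erw [(h1.smul (k.differentiableAt (x := y)).hasFDerivAt).fderiv]
      simp [add_comm]
    -- the Fourier side of `∂_i (x_i k)`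
    have hc : (2 * Real.pi * Complex.I : ℂ) ≠ 0 := Complex.two_pi_I_ne_zero
    have hmul : ∀ i, SchwartzMap.smulLeftCLM A (inner ℝ · (b i)) k
        = 𝓕⁻ ((-(2 * Real.pi * Complex.I)⁻¹ : ℂ) • ∂_{b i} g) := by
      intro i
      rw [FourierTransform.fourierInv_smul, SchwartzMap.fourierInv_lineDerivOp_eq, smul_smul]
      rw [neg_mul_neg, inv_mul_cancel₀ hc, one_smul]
    have hdi : ∀ i, ∂_{b i} (SchwartzMap.smulLeftCLM A (inner ℝ · (b i)) k)
        = 𝓕⁻ (-(SchwartzMap.smulLeftCLM A (inner ℝ · (b i)) (∂_{b i} g))) := by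
      intro i
      rw [hmul, SchwartzMap.lineDerivOp_fourierInv_eq]
      congr 1
      ext ξ
      simp only [smul_apply, neg_apply,
        SchwartzMap.smulLeftCLM_apply_apply (show (inner ℝ · (b i)).HasTemperateGrowth by fun_prop)]
      rw [smul_comm (_ : ℝ), smul_smul, mul_neg, mul_inv_cancel₀ hc, neg_one_smul]
    have hsum : ∑ i, ∂_{b i} (SchwartzMap.smulLeftCLM A (inner ℝ · (b i)) k)
        = -((r : ℂ) • ∑ J : Fin r → Fin n, SchwartzMap.postcompCLM
          ((ContinuousLinearMap.mul ℂ A).flip (a J)) (∂^{fun j => b (J j)} k)) := by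
      apply (FourierTransform.fourierCLE ℂ 𝓢(V, A)).injective
      rw [map_sum, map_neg, map_smul, map_sum]
      simp only [FourierTransform.fourierCLE_apply, hdi, FourierTransform.fourier_fourierInv_eq,
        fourier_postcompCLM]
      ext ξ
      have hk' : 𝓕 k = g := FourierTransform.fourier_fourierInv_eq g
      simp only [sum_apply, neg_apply, smul_apply,
        SchwartzMap.postcompCLM_apply, fourier_iteratedLineDerivOp, hk']
      rw [Finset.sum_neg_distrib]
      congr 1
      calc ∑ i, (SchwartzMap.smulLeftCLM A (inner ℝ · (b i)) (∂_{b i} g)) ξ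
          = fderiv ℝ g ξ ξ := by
            rw [← sum_inner_smul_apply b]
            refine Finset.sum_congr rfl fun i _ => ?_
            rw [SchwartzMap.smulLeftCLM_apply_apply (by fun_prop),
              SchwartzMap.lineDerivOp_apply_eq_fderiv]
        _ = _ := by
          rw [hrad, hP, Finset.mul_sum]
          simp
    have h1 := congrArg (fun f : 𝓢(V, A) => f x) hsum
    simp only [sum_apply, neg_apply, smul_apply] at h1
    have h2 : ∀ i, (∂_{b i} (SchwartzMap.smulLeftCLM A (inner ℝ · (b i)) k)) x
        = k x + (inner ℝ x (b i) : ℝ) • fderiv ℝ k x (b i) := by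
      intro i
      rw [SchwartzMap.lineDerivOp_apply_eq_fderiv, ← hx]
      congr 1
      congr 1
      ext z
      rw [SchwartzMap.smulLeftCLM_apply_apply (by fun_prop)]
    simp only [h2, Finset.sum_add_distrib, Finset.sum_const, Finset.card_univ, Fintype.card_fin]
      at h1
    rw [sum_inner_smul_apply] at h1
    rw [h1, Nat.cast_smul_eq_nsmul, neg_smul, Nat.cast_smul_eq_nsmul]
    simp
end Kernel

section Complexify
variable {X : Type} [NormedAddCommGroup X] [InnerProductSpace ℝ X] {d : ℕ}

/-- The complex-linear extension of a real operator, in the coordinates of an orthonormal basis. -/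
def complexify (e : OrthonormalBasis (Fin d) ℝ X) (N : X →L[ℝ] X) :
    EuclideanSpace ℂ (Fin d) →L[ℂ] EuclideanSpace ℂ (Fin d) :=
  Matrix.toEuclideanCLM (n := Fin d) (𝕜 := ℂ)
    (Matrix.of fun i j => ((inner ℝ (e i) (N (e j)) : ℝ) : ℂ))

theorem complexify_apply (e : OrthonormalBasis (Fin d) ℝ X) (N : X →L[ℝ] X)
    (z : EuclideanSpace ℂ (Fin d)) (i : Fin d) :
    complexify e N z i = ∑ j, ((inner ℝ (e i) (N (e j)) : ℝ) : ℂ) * z j := by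
  simp [complexify, Matrix.mulVec, dotProduct]

theorem complexify_sum_smul {κ : Type} (s : Finset κ) (e : OrthonormalBasis (Fin d) ℝ X)
    (c : κ → ℝ) (N : κ → (X →L[ℝ] X)) :
    complexify e (∑ j ∈ s, c j • N j) = ∑ j ∈ s, (c j : ℂ) • complexify e (N j) := by
  ext z i
  simp [complexify_apply, inner_sum, inner_smul_right, Finset.sum_mul]
  simp only [Finset.mul_sum]
  rw [Finset.sum_comm]
  refine Finset.sum_congr rfl fun _ _ => Finset.sum_congr rfl fun _ _ => by ring

theorem re_inner_complexify (e : OrthonormalBasis (Fin d) ℝ X) {N : X →L[ℝ] X} {μ : ℝ}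
    (h : ∀ v, inner ℝ (N v) v ≤ -μ * ‖v‖ ^ 2) (z : EuclideanSpace ℂ (Fin d)) :
    (inner ℂ (complexify e N z) z).re ≤ -μ * ‖z‖ ^ 2 := by
  have key : ∀ c : Fin d → ℝ, ∑ i, ∑ j, inner ℝ (e i) (N (e j)) * c j * c i
      ≤ -μ * ∑ i, c i ^ 2 := by
    intro c
    have h1 := h (∑ i, c i • e i)
    have h2 : ‖∑ i, c i • e i‖ ^ 2 = ∑ i, c i ^ 2 := by
      rw [← real_inner_self_eq_norm_sq, Orthonormal.inner_sum e.orthonormal]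
      simp [sq]
    rw [h2] at h1
    refine le_trans (le_of_eq ?_) h1
    simp only [map_sum, map_smul, sum_inner, inner_sum, inner_smul_left, inner_smul_right]
    refine Finset.sum_congr rfl fun i _ => ?_
    rw [Finset.mul_sum]
    refine Finset.sum_congr rfl fun j _ => ?_
    rw [real_inner_comm (e i)]
    simp
    ring
  have h1 := key (fun i => (z i).re)
  have h2 := key (fun i => (z i).im)
  have h3 : ‖z‖ ^ 2 = ∑ i, (z i).re ^ 2 + ∑ i, (z i).im ^ 2 := by
    rw [EuclideanSpace.norm_sq_eq, ← Finset.sum_add_distrib]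
    refine Finset.sum_congr rfl fun i _ => ?_
    rw [← Complex.normSq_eq_norm_sq, Complex.normSq_apply]; ring
  rw [h3, mul_add]
  refine le_trans (le_of_eq ?_) (add_le_add h1 h2)
  rw [PiLp.inner_apply, Complex.re_sum, ← Finset.sum_add_distrib]
  refine Finset.sum_congr rfl fun i _ => ?_
  rw [complexify_apply, ← Finset.sum_add_distrib]
  simp only [RCLike.inner_apply, map_sum, Finset.mul_sum, Complex.re_sum]
  refine Finset.sum_congr rfl fun j _ => ?_
  simp
  ring

/-- The real part of the restriction of a complex operator to real vectors. -/
def realPart (e : OrthonormalBasis (Fin d) ℝ X) :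
    (EuclideanSpace ℂ (Fin d) →L[ℂ] EuclideanSpace ℂ (Fin d)) →L[ℝ] (X →L[ℝ] X) :=
  let ι : X →L[ℝ] EuclideanSpace ℂ (Fin d) :=
    ((PiLp.continuousLinearEquiv 2 ℝ (fun _ : Fin d => ℂ)).symm : (Fin d → ℂ) →L[ℝ] _) ∘L
      ContinuousLinearMap.pi fun i => Complex.ofRealCLM ∘L innerSL ℝ (e i)
  let re : EuclideanSpace ℂ (Fin d) →L[ℝ] X :=
    ∑ i, (Complex.reCLM ∘L ((EuclideanSpace.proj i :
      EuclideanSpace ℂ (Fin d) →L[ℂ] ℂ).restrictScalars ℝ)).smulRight (e i)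
  (ContinuousLinearMap.compL ℝ X (EuclideanSpace ℂ (Fin d)) X re) ∘L
    ((ContinuousLinearMap.compL ℝ X (EuclideanSpace ℂ (Fin d))
      (EuclideanSpace ℂ (Fin d))).flip ι) ∘L
    ContinuousLinearMap.restrictScalarsL ℂ (EuclideanSpace ℂ (Fin d))
      (EuclideanSpace ℂ (Fin d)) ℝ ℝ

theorem realPart_apply (e : OrthonormalBasis (Fin d) ℝ X)
    (T : EuclideanSpace ℂ (Fin d) →L[ℂ] EuclideanSpace ℂ (Fin d)) (x : X) :
    realPart e T x
      = ∑ i, (T (WithLp.toLp 2 fun j => ((inner ℝ (e j) x : ℝ) : ℂ)) i).re • e i := by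
  simp [realPart]

theorem realPart_mul_complexify (e : OrthonormalBasis (Fin d) ℝ X)
    (T : EuclideanSpace ℂ (Fin d) →L[ℂ] EuclideanSpace ℂ (Fin d)) (N : X →L[ℝ] X) :
    realPart e (T * complexify e N) = realPart e T ∘L N := by
  ext x
  rw [ContinuousLinearMap.comp_apply, realPart_apply, realPart_apply]
  have : complexify e N (WithLp.toLp 2 fun j => ((inner ℝ (e j) x : ℝ) : ℂ))
      = WithLp.toLp 2 fun j => ((inner ℝ (e j) (N x) : ℝ) : ℂ) := by
    ext i
    rw [complexify_apply]
    conv_rhs => rw [← e.sum_repr' x]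
    simp [inner_sum, inner_smul_right, mul_comm]
  rw [← this]
  rfl

theorem realPart_one (e : OrthonormalBasis (Fin d) ℝ X) :
    realPart e 1 = 1 := by
  ext x
  rw [realPart_apply]
  simp [e.sum_repr' x]

end Complexify

theorem hasTemperateGrowth_prod {V : Type} [NormedAddCommGroup V] [NormedSpace ℝ V] (r : ℕ) :
    ∀ f : Fin r → V → ℝ, (∀ j, (f j).HasTemperateGrowth) →
      (fun x => ∏ j, f j x).HasTemperateGrowth := by
  induction r with
  | zero => intro f _; simp
  | succ r ih =>
    intro f hf
    simp only [Fin.prod_univ_succ]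
    exact (hf 0).mul (ih _ fun j => hf j.succ)

theorem exists_kernel {V : Type} [NormedAddCommGroup V] [InnerProductSpace ℝ V]
    [FiniteDimensional ℝ V] [MeasurableSpace V] [BorelSpace V]
    {X : Type} [NormedAddCommGroup X] [InnerProductSpace ℝ X] [FiniteDimensional ℝ X]
    {n r : ℕ} (hr : 1 ≤ r) (hrev : Even r) (b : OrthonormalBasis (Fin n) ℝ V)
    (A : (Fin r → Fin n) → X →L[ℝ] X) {lam : ℝ} (hlam : 0 < lam)
    (hA : ∀ ξ v, (-1 : ℝ) ^ (r / 2) * ∑ J : Fin r → Fin n,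
      (∏ j, inner ℝ ξ (b (J j))) * inner ℝ (A J v) v ≤ -lam * ‖ξ‖ ^ r * ‖v‖ ^ 2) :
    ∃ k : 𝓢(V, X →L[ℝ] X), (∫ x, k x = 1) ∧
      ∀ x, n • k x + fderiv ℝ k x x
        = -(r : ℝ) • ∑ J : Fin r → Fin n, (∂^{fun j => b (J j)} k) x ∘L A J := by
  set d := Module.finrank ℝ X
  let e : OrthonormalBasis (Fin d) ℝ X := stdOrthonormalBasis ℝ X
  let N : V → (X →L[ℝ] X) := fun ξ =>
    ∑ J : Fin r → Fin n, ((2 * Real.pi) ^ r * (-1) ^ (r / 2) * ∏ j, inner ℝ ξ (b (J j))) • A J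
  let P : V → (EuclideanSpace ℂ (Fin d) →L[ℂ] EuclideanSpace ℂ (Fin d)) :=
    fun ξ => complexify e (N ξ)
  have hI : (2 * Real.pi * Complex.I : ℂ) ^ r = (((2 * Real.pi) ^ r * (-1) ^ (r / 2) : ℝ) : ℂ) := by
    obtain ⟨m, rfl⟩ := hrev
    have : (m + m) / 2 = m := by omega
    rw [this, mul_pow, ← two_mul, pow_mul Complex.I]
    simp
  have hP : ∀ ξ, P ξ = ∑ J : Fin r → Fin n,
      ((2 * Real.pi * Complex.I) ^ r * ∏ j, ((inner ℝ ξ (b (J j)) : ℝ) : ℂ)) •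
        complexify e (A J) := by
    intro ξ
    simp only [P, N]
    rw [complexify_sum_smul]
    refine Finset.sum_congr rfl fun J _ => ?_
    rw [hI]
    push_cast
    rfl
  have hPg : P.HasTemperateGrowth := by
    have e1 : P = fun ξ => ∑ J : Fin r → Fin n, (∏ j, inner ℝ ξ (b (J j))) •
        ((2 * Real.pi * Complex.I : ℂ) ^ r • complexify e (A J)) := by
      ext1 ξ
      rw [hP]
      refine Finset.sum_congr rfl fun J _ => ?_
      ext z i
      simp
      ring
    rw [e1]
    refine Function.HasTemperateGrowth.sum fun J _ => ?_
    exact (hasTemperateGrowth_prod r _ fun j => by fun_prop).smul (.const _)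
  have hd : ∀ ξ z, (inner ℂ (P ξ z) z).re ≤ -((2 * Real.pi) ^ r * lam * ‖ξ‖ ^ r) * ‖z‖ ^ 2 := by
    intro ξ z
    refine re_inner_complexify e (fun v => ?_) z
    have h1 := mul_le_mul_of_nonneg_left (hA ξ v) (by positivity : 0 ≤ (2 * Real.pi) ^ r)
    refine le_trans (le_of_eq ?_) (h1.trans (le_of_eq ?_))
    · simp only [N, sum_apply, sum_inner, Finset.mul_sum,
        smul_apply, inner_smul_left]
      refine Finset.sum_congr rfl fun J _ => ?_
      simp
      ring
    · ring
  obtain ⟨g, hg⟩ := exists_schwartz_exp hPg hr (by positivity : 0 < (2 * Real.pi) ^ r * lam) hd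
  obtain ⟨h1, h2⟩ := kernel_profile hr b (fun J => complexify e (A J)) hP hg
  set k0 : 𝓢(V, EuclideanSpace ℂ (Fin d) →L[ℂ] EuclideanSpace ℂ (Fin d)) := 𝓕⁻ g
  have hdiff : ∀ x, DifferentiableAt ℝ k0 x := fun x => k0.differentiableAt
  refine ⟨SchwartzMap.postcompCLM (realPart e) k0, ?_, fun x => ?_⟩
  · simp only [SchwartzMap.postcompCLM_apply]
    rw [(realPart e).integral_comp_comm k0.integrable, h1, realPart_one]
  · have h3 := congrArg (realPart e) (h2 x)
    have h4 : ∀ y, fderiv ℝ (SchwartzMap.postcompCLM (realPart e) k0) y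
        = (realPart e) ∘L fderiv ℝ k0 y := fun y =>
      ((realPart e).hasFDerivAt.comp y (hdiff y).hasFDerivAt).fderiv
    rw [h4, SchwartzMap.postcompCLM_apply, ContinuousLinearMap.comp_apply, ← map_nsmul, ← map_add,
      h3, map_smul, map_sum]
    congr 1
    refine Finset.sum_congr rfl fun J _ => ?_
    rw [realPart_mul_complexify]
    congr 1
    rw [SchwartzMap.iteratedLineDerivOp_eq_iteratedFDeriv,
      SchwartzMap.iteratedLineDerivOp_eq_iteratedFDeriv]
    have h5 := (realPart e).iteratedFDeriv_comp_left ((k0.smooth ⊤).contDiffAt (x := x)) (i := r)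
      (by exact_mod_cast le_top)
    have h6 : (⇑(SchwartzMap.postcompCLM (realPart e) k0)) = (realPart e) ∘ k0 := by
      ext1 y; simp
    rw [h6, h5]
    rfl

section LineDerivatives
variable {V : Type} [NormedAddCommGroup V] [InnerProductSpace ℝ V] [FiniteDimensional ℝ V]
  {Y : Type} [NormedAddCommGroup Y] [NormedSpace ℝ Y]

theorem fderiv_lineDerivOp_apply (κ : 𝓢(V, Y)) (v w x : V) :
    fderiv ℝ (∂_{v} κ : 𝓢(V, Y)) x w = fderiv ℝ (fderiv ℝ κ) x w v := by
  have h : ⇑(∂_{v} κ : 𝓢(V, Y)) = fun y => fderiv ℝ κ y v := rfl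
  have hd : DifferentiableAt ℝ (fderiv ℝ κ) x :=
    ((κ.smooth 2).fderiv_right (m := 1) (by norm_num)).differentiable (by norm_num) x
  rw [h, fderiv_clm_apply hd (by fun_prop)]
  simp

theorem fderiv_fderiv_symm (κ : 𝓢(V, Y)) (v w x : V) :
    fderiv ℝ (fderiv ℝ κ) x w v = fderiv ℝ (fderiv ℝ κ) x v w :=
  ((κ.smooth 2).contDiffAt.isSymmSndFDerivAt (by simp)) w v

theorem lineDerivOp_comm (κ : 𝓢(V, Y)) (v w : V) : ∂_{v} (∂_{w} κ) = ∂_{w} (∂_{v} κ) := by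
  ext x
  change fderiv ℝ (∂_{w} κ : 𝓢(V, Y)) x v = fderiv ℝ (∂_{v} κ : 𝓢(V, Y)) x w
  rw [fderiv_lineDerivOp_apply, fderiv_lineDerivOp_apply, fderiv_fderiv_symm]

theorem lineDerivOp_iterated_comm (κ : 𝓢(V, Y)) (v : V) {m : ℕ} (J : Fin m → V) :
    ∂^{J} (∂_{v} κ) = ∂_{v} (∂^{J} κ) := by
  induction m with
  | zero => rfl
  | succ m ih =>
    rw [LineDeriv.iteratedLineDerivOp_succ_left, ih, lineDerivOp_comm,
      ← LineDeriv.iteratedLineDerivOp_succ_left]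

end LineDerivatives

section Profile
variable {V : Type} [NormedAddCommGroup V] [InnerProductSpace ℝ V] [FiniteDimensional ℝ V]
  {X : Type} [NormedAddCommGroup X] [InnerProductSpace ℝ X] [FiniteDimensional ℝ X]
  {n r : ℕ}

/-- The self-similar profile equation, of homogeneity `c`. -/
def IsProfile (b : Fin n → V) (A : (Fin r → Fin n) → X →L[ℝ] X) (c : ℕ)
    (κ : 𝓢(V, X →L[ℝ] X)) : Prop :=
  ∀ x, c • κ x + fderiv ℝ κ x x
    = -(r : ℝ) • ∑ J : Fin r → Fin n, (∂^{fun j => b (J j)} κ) x ∘L A J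

theorem IsProfile.lineDerivOp {b : Fin n → V} {A : (Fin r → Fin n) → X →L[ℝ] X} {c : ℕ}
    {κ : 𝓢(V, X →L[ℝ] X)} (h : IsProfile b A c κ) (v : V) :
    IsProfile b A (c + 1) (∂_{v} κ) := by
  intro x
  have hf : (fun x => c • κ x + fderiv ℝ κ x x)
      = fun x => -(r : ℝ) • ∑ J : Fin r → Fin n, (∂^{fun j => b (J j)} κ) x ∘L A J :=
    funext h
  have hd : DifferentiableAt ℝ (fderiv ℝ κ) x :=
    ((κ.smooth 2).fderiv_right (m := 1) (by norm_num)).differentiable (by norm_num) x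
  have hκ : HasFDerivAt κ (fderiv ℝ κ x) x := κ.differentiableAt.hasFDerivAt
  have h1 : HasFDerivAt (fun x => c • κ x + fderiv ℝ κ x x) _ x :=
    (hκ.const_smul c).add (hd.hasFDerivAt.clm_apply (hasFDerivAt_id x))
  have h2 : HasFDerivAt
      (fun x => -(r : ℝ) • ∑ J : Fin r → Fin n, (∂^{fun j => b (J j)} κ) x ∘L A J) _ x :=
    (HasFDerivAt.fun_sum fun J _ => ((SchwartzMap.differentiableAt
      (∂^{fun j => b (J j)} κ)).hasFDerivAt.clm_comp (hasFDerivAt_const (A J) x))).fun_const_smul _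
  rw [hf] at h1
  have h3 := congrArg (fun L => L v) (h1.unique h2)
  simp only [add_apply, smul_apply, sum_apply, ContinuousLinearMap.comp_apply,
    ContinuousLinearMap.flip_apply, id_eq, ContinuousLinearMap.id_apply] at h3
  rw [fderiv_lineDerivOp_apply, ← fderiv_fderiv_symm]
  have h4 : ∀ J : Fin r → Fin n, (∂^{fun j => b (J j)} (∂_{v} κ)) x
      = fderiv ℝ (∂^{fun j => b (J j)} κ : 𝓢(V, X →L[ℝ] X)) x v := fun J => by
    rw [lineDerivOp_iterated_comm]; rfl
  simp only [h4]
  have h5 : (∂_{v} κ) x = fderiv ℝ κ x v := rfl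
  rw [h5, add_smul, one_smul]
  simp at h3 ⊢
  rw [← h3]
  abel

theorem IsProfile.iteratedLineDerivOp {b : Fin n → V} {A : (Fin r → Fin n) → X →L[ℝ] X} {c : ℕ}
    {κ : 𝓢(V, X →L[ℝ] X)} (h : IsProfile b A c κ) {m : ℕ} (I : Fin m → V) :
    IsProfile b A (c + m) (∂^{I} κ) := by
  induction m with
  | zero => exact h
  | succ m ih =>
    rw [LineDeriv.iteratedLineDerivOp_succ_left]
    exact (ih _).lineDerivOp _

end Profile

section Mollification
variable {V : Type} [NormedAddCommGroup V] [InnerProductSpace ℝ V] [FiniteDimensional ℝ V]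
  [MeasurableSpace V] [BorelSpace V]
  {X : Type} [NormedAddCommGroup X] [InnerProductSpace ℝ X] [FiniteDimensional ℝ X]

/-- Convolution of `g` with the kernel `κ` at scale `ρ`. -/
def mconv (κ : 𝓢(V, X →L[ℝ] X)) (ρ : ℝ) (g : V → X) (x : V) : X :=
  ∫ z, κ z (g (x - ρ • z))

theorem integrable_kernel_apply (κ : 𝓢(V, X →L[ℝ] X)) {g : V → X} (hg : Continuous g) {B : ℝ}
    (hB : ∀ x, ‖g x‖ ≤ B) : Integrable fun z => κ z (g z) := by
  refine (κ.integrable.norm.mul_const B).mono'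
    ((κ.continuous.clm_apply hg).aestronglyMeasurable) (.of_forall fun z => ?_)
  exact (ContinuousLinearMap.le_opNorm _ _).trans (by gcongr; exact hB z)

theorem integrable_mconv (κ : 𝓢(V, X →L[ℝ] X)) (ρ : ℝ) {g : V → X} (hg : Continuous g) {B : ℝ}
    (hB : ∀ x, ‖g x‖ ≤ B) (x : V) : Integrable fun z => κ z (g (x - ρ • z)) :=
  integrable_kernel_apply κ (g := fun z => g (x - ρ • z)) (by fun_prop) fun _ => hB _

theorem mconv_lineDerivOp (κ : 𝓢(V, X →L[ℝ] X)) (ρ : ℝ) {g : V → X} (v : V)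
    (hg : Differentiable ℝ g) {B B' : ℝ} (hB : ∀ x, ‖g x‖ ≤ B)
    (hc : Continuous fun x => fderiv ℝ g x v) (hB' : ∀ x, ‖fderiv ℝ g x v‖ ≤ B') (x : V) :
    mconv (∂_{v} κ) ρ g x = ρ • mconv κ ρ (fun y => fderiv ℝ g y v) x := by
  have hg2 : ∀ z, HasFDerivAt (fun z => g (x - ρ • z))
      ((fderiv ℝ g (x - ρ • z)) ∘L (-(ρ • ContinuousLinearMap.id ℝ V))) z := fun z => by
    refine (hg _).hasFDerivAt.comp z ?_
    simpa using ((hasFDerivAt_id z).const_smul ρ).const_sub x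
  have h := integral_bilinear_hasLineDerivAt_right_eq_neg_left_of_integrable (μ := volume)
    (f := κ) (f' := (∂_{v} κ : 𝓢(V, X →L[ℝ] X))) (g := fun z => g (x - ρ • z))
    (g' := fun z => -(ρ • fderiv ℝ g (x - ρ • z) v)) (v := v)
    (B := ContinuousLinearMap.id ℝ (X →L[ℝ] X))
    (integrable_mconv (∂_{v} κ) ρ hg.continuous hB x)
    (by
      simp only [ContinuousLinearMap.id_apply, map_neg, map_smul]
      exact ((integrable_mconv κ ρ hc hB' x).smul ρ).neg)
    (integrable_mconv κ ρ hg.continuous hB x)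
    (fun z _ => κ.differentiableAt.hasFDerivAt.hasLineDerivAt v)
    (fun z _ => by
      have := (hg2 z).hasLineDerivAt v
      simpa using this)
  simp only [ContinuousLinearMap.id_apply, map_neg, map_smul, integral_neg, integral_smul] at h
  exact (neg_injective h).symm

theorem bounded_of_compact_support {Y : Type} [NormedAddCommGroup Y] {g : V → Y}
    (hg : Continuous g) (hs : HasCompactSupport g) : ∃ B, ∀ x, ‖g x‖ ≤ B :=
  hs.exists_bound_of_continuous hg

theorem mconv_iteratedLineDerivOp (κ : 𝓢(V, X →L[ℝ] X)) (ρ : ℝ) {m : ℕ} {g : V → X}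
    (J : Fin m → V) (hg : ContDiff ℝ m g) (hs : HasCompactSupport g) (x : V) :
    mconv (∂^{J} κ) ρ g x = ρ ^ m • mconv κ ρ (fun y => iteratedFDeriv ℝ m g y J) x := by
  induction m generalizing κ with
  | zero => simp
  | succ m ih =>
    have h1 : ContDiff ℝ 1 (fun y => iteratedFDeriv ℝ m g y (Fin.tail J)) :=
      (ContinuousMultilinearMap.apply ℝ (fun _ : Fin m => V) X (Fin.tail J)).contDiff.comp
        (hg.iteratedFDeriv_right (m := 1) (i := m) (by norm_cast; omega))
    have hs1 : HasCompactSupport (fun y => iteratedFDeriv ℝ m g y (Fin.tail J)) :=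
      (hs.iteratedFDeriv (𝕜 := ℝ) m).comp_left (g := fun M : V [×m]→L[ℝ] X => M (Fin.tail J)) rfl
    have h2 : ∀ y, fderiv ℝ (fun y => iteratedFDeriv ℝ m g y (Fin.tail J)) y (J 0)
        = iteratedFDeriv ℝ (m + 1) g y J := fun y => by
      rw [iteratedFDeriv_succ_apply_left]
      have hd : DifferentiableAt ℝ (iteratedFDeriv ℝ m g) y :=
        (hg.differentiable_iteratedFDeriv (by norm_cast; omega)) y
      have h := ((ContinuousMultilinearMap.apply ℝ (fun _ : Fin m => V) X
        (Fin.tail J)).hasFDerivAt.comp y hd.hasFDerivAt).fderiv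
      exact congrArg (fun L => L (J 0)) h
    have hc : Continuous fun y => fderiv ℝ (fun y => iteratedFDeriv ℝ m g y (Fin.tail J)) y (J 0) :=
      (h1.continuous_fderiv (by norm_num)).clm_apply continuous_const
    have hs2 : HasCompactSupport
        fun y => fderiv ℝ (fun y => iteratedFDeriv ℝ m g y (Fin.tail J)) y (J 0) :=
      hs1.fderiv_apply ℝ (J 0)
    obtain ⟨B, hB⟩ := bounded_of_compact_support h1.continuous hs1
    obtain ⟨B', hB'⟩ := bounded_of_compact_support hc hs2
    have h3 := mconv_lineDerivOp κ ρ (J 0) (h1.differentiable (by norm_num)) hB hc hB' x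
    simp only [h2] at h3
    rw [LineDeriv.iteratedLineDerivOp_succ_left, ← lineDerivOp_iterated_comm,
      ih (∂_{J 0} κ) (Fin.tail J) (hg.of_le (by norm_cast; omega)), h3, smul_smul, pow_succ]

theorem integral_lineDerivOp_apply (κ : 𝓢(V, X →L[ℝ] X)) (v : V) (c : X) :
    ∫ z, (∂_{v} κ : 𝓢(V, X →L[ℝ] X)) z c = 0 := by
  have := mconv_lineDerivOp κ 1 (g := fun _ => c) v (by fun_prop) (fun _ => le_rfl)
    (by simpa using continuous_const) (B' := 0) (by simp) 0
  simpa [mconv] using this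

theorem integral_iteratedLineDerivOp_apply (κ : 𝓢(V, X →L[ℝ] X)) {m : ℕ} (hm : 1 ≤ m)
    (J : Fin m → V) (c : X) : ∫ z, (∂^{J} κ : 𝓢(V, X →L[ℝ] X)) z c = 0 := by
  obtain ⟨m, rfl⟩ : ∃ m', m = m' + 1 := ⟨m - 1, by omega⟩
  rw [LineDeriv.iteratedLineDerivOp_succ_left]
  exact integral_lineDerivOp_apply _ _ _

theorem integrable_norm_mul_one_add (κ : 𝓢(V, X →L[ℝ] X)) :
    Integrable fun z => ‖κ z‖ * (1 + ‖z‖) := by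
  refine (κ.integrable.norm.add (κ.integrable_pow_mul volume 1)).congr (.of_forall fun z => ?_)
  simp
  ring

theorem rpow_le_one_add {a α : ℝ} (ha : 0 ≤ a) (h0 : 0 ≤ α) (h1 : α ≤ 1) : a ^ α ≤ 1 + a := by
  rcases le_total a 1 with h | h
  · exact (Real.rpow_le_one ha h h0).trans (by linarith)
  · exact (Real.rpow_le_rpow_of_exponent_le h h1).trans (by simp)

theorem holder_shift_bound {g : V → X} {M α : ℝ} (hα0 : 0 ≤ α) (hα1 : α ≤ 1)
    (hM : 0 ≤ M) (hH : ∀ x x', ‖g x - g x'‖ ≤ M * ‖x - x'‖ ^ α) {ρ : ℝ} (hρ : 0 ≤ ρ) (x z : V) :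
    ‖g (x - ρ • z) - g x‖ ≤ M * ρ ^ α * (1 + ‖z‖) := by
  refine (hH _ _).trans ?_
  rw [sub_sub_cancel_left, norm_neg, norm_smul, Real.norm_of_nonneg hρ,
    Real.mul_rpow hρ (norm_nonneg _), mul_assoc]
  gcongr
  exact rpow_le_one_add (norm_nonneg _) hα0 hα1

theorem norm_mconv_sub_le (κ : 𝓢(V, X →L[ℝ] X)) {g : V → X} (hg : Continuous g) {B : ℝ}
    (hB : ∀ x, ‖g x‖ ≤ B) {M α : ℝ} (hα0 : 0 ≤ α) (hα1 : α ≤ 1)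
    (hM : 0 ≤ M) (hH : ∀ x x', ‖g x - g x'‖ ≤ M * ‖x - x'‖ ^ α) {ρ : ℝ} (hρ : 0 ≤ ρ) (x : V) :
    ‖mconv κ ρ g x - ∫ z, κ z (g x)‖ ≤ (∫ z, ‖κ z‖ * (1 + ‖z‖)) * (M * ρ ^ α) := by
  rw [mconv, ← integral_sub (integrable_mconv κ ρ hg hB x)
    (integrable_kernel_apply κ continuous_const (fun _ => le_rfl)), ← integral_mul_const]
  refine norm_integral_le_of_norm_le ((integrable_norm_mul_one_add κ).mul_const _)
    (.of_forall fun z => ?_)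
  rw [← map_sub]
  refine (ContinuousLinearMap.le_opNorm _ _).trans ?_
  have := holder_shift_bound hα0 hα1 hM hH hρ x z
  calc ‖κ z‖ * ‖g (x - ρ • z) - g x‖ ≤ ‖κ z‖ * (M * ρ ^ α * (1 + ‖z‖)) := by gcongr
    _ = _ := by ring

theorem norm_mconv_le (κ : 𝓢(V, X →L[ℝ] X)) (hκ : ∀ c, ∫ z, κ z c = 0) {g : V → X}
    (hg : Continuous g) {B : ℝ}
    (hB : ∀ x, ‖g x‖ ≤ B) {M α : ℝ} (hα0 : 0 ≤ α) (hα1 : α ≤ 1)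
    (hM : 0 ≤ M) (hH : ∀ x x', ‖g x - g x'‖ ≤ M * ‖x - x'‖ ^ α) {ρ : ℝ} (hρ : 0 ≤ ρ) (x : V) :
    ‖mconv κ ρ g x‖ ≤ (∫ z, ‖κ z‖ * (1 + ‖z‖)) * (M * ρ ^ α) := by
  simpa [hκ] using norm_mconv_sub_le κ hg hB hα0 hα1 hM hH hρ x

/-- Decay of the translation differences of a Schwartz function. -/
theorem exists_translation_bound (κ : 𝓢(V, X →L[ℝ] X)) :
    ∃ C, 0 ≤ C ∧ ∀ z e : V, ‖e‖ ≤ 1 → ‖κ (z + e) - κ z‖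
      ≤ C * ‖e‖ * ((1 + ‖z‖) ^ (Module.finrank ℝ V + 2))⁻¹ := by
  set N := Module.finrank ℝ V + 2
  obtain ⟨C, hC⟩ : ∃ C, ∀ x, (1 + ‖x‖) ^ N * ‖iteratedFDeriv ℝ 1 κ x‖ ≤ C :=
    ⟨_, fun x => SchwartzMap.one_add_le_sup_seminorm_apply (𝕜 := ℝ) (m := (N, 1)) le_rfl le_rfl κ x⟩
  have hC0 : 0 ≤ C := le_trans (by positivity) (hC 0)
  refine ⟨C * 2 ^ N, by positivity, fun z e he => ?_⟩
  have key : ∀ y ∈ segment ℝ z (z + e), ‖fderiv ℝ κ y‖ ≤ C * 2 ^ N * ((1 + ‖z‖) ^ N)⁻¹ := by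
    intro y hy
    have hyz : ‖y - z‖ ≤ 1 := by
      obtain ⟨θ, hθ, rfl⟩ := by simpa [segment_eq_image'] using hy
      simp only [add_sub_cancel_left, norm_smul, Real.norm_of_nonneg hθ.1]
      exact mul_le_one₀ hθ.2 (norm_nonneg _) he
    have h1 : 1 + ‖z‖ ≤ 2 * (1 + ‖y‖) := by
      have : ‖z‖ ≤ ‖y‖ + ‖y - z‖ := by
        have := norm_sub_le y (y - z); simpa using this
      linarith [norm_nonneg y]
    have h2 := hC y
    rw [norm_iteratedFDeriv_one] at h2
    have h3 : (1 + ‖z‖) ^ N ≤ 2 ^ N * (1 + ‖y‖) ^ N := by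
      rw [← mul_pow]; gcongr
    rw [← div_eq_mul_inv, le_div_iff₀ (by positivity)]
    calc ‖fderiv ℝ κ y‖ * (1 + ‖z‖) ^ N ≤ ‖fderiv ℝ κ y‖ * (2 ^ N * (1 + ‖y‖) ^ N) := by gcongr
      _ = ((1 + ‖y‖) ^ N * ‖fderiv ℝ κ y‖) * 2 ^ N := by ring
      _ ≤ _ := by gcongr
  have := (convex_segment z (z + e)).norm_image_sub_le_of_norm_fderiv_le
    (fun y _ => κ.differentiableAt) key (left_mem_segment ..) (right_mem_segment ..)
  refine this.trans (le_of_eq ?_)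
  simp
  ring

theorem exists_mconv_shift_bound (κ : 𝓢(V, X →L[ℝ] X)) {α : ℝ} (hα0 : 0 ≤ α) (hα1 : α ≤ 1) :
    ∃ C, 0 ≤ C ∧ ∀ (g : V → X) (M B : ℝ), Continuous g → (∀ x, ‖g x‖ ≤ B) → 0 ≤ M →
      (∀ x x', ‖g x - g x'‖ ≤ M * ‖x - x'‖ ^ α) → ∀ (ρ : ℝ), 0 < ρ → ∀ x x', ‖x - x'‖ ≤ ρ →
        ‖mconv κ ρ g x - mconv κ ρ g x'‖ ≤ C * (M * ρ ^ α * (‖x - x'‖ / ρ)) := by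
  obtain ⟨C, hC0, hC⟩ := exists_translation_bound κ
  set N := Module.finrank ℝ V
  have h_int : Integrable fun z : V => (1 + ‖z‖) ^ (-((N : ℝ) + 1)) :=
    integrable_one_add_norm (by simp [N])
  refine ⟨(∫ z : V, (1 + ‖z‖) ^ (-((N : ℝ) + 1))) * C, by positivity, ?_⟩
  intro g M B hg hB hM hH ρ hρ x x' hxx
  set e : V := ρ⁻¹ • (x' - x)
  have he : ‖e‖ = ‖x - x'‖ / ρ := by
    simp [e, norm_smul, abs_of_pos hρ, norm_sub_rev, div_eq_inv_mul]
  have he1 : ‖e‖ ≤ 1 := by rw [he]; exact div_le_one_of_le₀ hxx hρ.le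
  have hpt : ∀ z, x' - ρ • (z + e) = x - ρ • z := fun z => by
    simp only [e, smul_add, smul_inv_smul₀ hρ.ne']
    abel
  have hx' : mconv κ ρ g x' = ∫ z, κ (z + e) (g (x - ρ • z)) := by
    rw [mconv, ← integral_add_right_eq_self _ e]
    simp only [hpt]
  have i1 := integrable_mconv κ ρ hg hB x
  have i2 : Integrable fun z => κ (z + e) (g (x - ρ • z)) := by
    have := (integrable_mconv κ ρ hg hB x').comp_add_right e
    simpa only [hpt] using this
  have j1 : Integrable fun z => κ z (g x) :=
    integrable_kernel_apply κ continuous_const (fun _ => le_rfl)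
  have j2 : Integrable fun z => κ (z + e) (g x) := j1.comp_add_right e
  have j12 : ∫ z, κ (z + e) (g x) = ∫ z, κ z (g x) :=
    integral_add_right_eq_self (fun z => κ z (g x)) e
  have hdiff : mconv κ ρ g x - mconv κ ρ g x'
      = ∫ z, (κ z - κ (z + e)) (g (x - ρ • z) - g x) := by
    have : ∀ z, (κ z - κ (z + e)) (g (x - ρ • z) - g x)
        = (κ z (g (x - ρ • z)) - κ (z + e) (g (x - ρ • z))) - (κ z (g x) - κ (z + e) (g x)) :=
      fun z => by simp only [map_sub, sub_apply]
    simp only [this]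
    have h4 := integral_sub (i1.sub i2) (j1.sub j2)
    simp only [Pi.sub_apply] at h4
    rw [h4, integral_sub i1 i2, integral_sub j1 j2, j12, hx']
    simp [mconv]
  rw [hdiff, mul_assoc, ← integral_mul_const]
  refine norm_integral_le_of_norm_le (h_int.mul_const _) (.of_forall fun z => ?_)
  refine (ContinuousLinearMap.le_opNorm _ _).trans ?_
  have h1 : ‖κ z - κ (z + e)‖ ≤ C * ‖e‖ * ((1 + ‖z‖) ^ (N + 2))⁻¹ := by
    rw [norm_sub_rev]; exact hC z e he1
  have h2 := holder_shift_bound hα0 hα1 hM hH hρ.le x z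
  have h3 : (1 + ‖z‖) ^ (-((N : ℝ) + 1)) = ((1 + ‖z‖) ^ (N + 2))⁻¹ * (1 + ‖z‖) := by
    rw [Real.rpow_neg (by positivity), show ((N : ℝ) + 1) = ((N + 1 : ℕ) : ℝ) by push_cast; ring,
      Real.rpow_natCast, pow_succ (1 + ‖z‖) (N + 1)]
    have : (1 + ‖z‖) ≠ 0 := by positivity
    field_simp
  calc ‖κ z - κ (z + e)‖ * ‖g (x - ρ • z) - g x‖
      ≤ (C * ‖e‖ * ((1 + ‖z‖) ^ (N + 2))⁻¹) * (M * ρ ^ α * (1 + ‖z‖)) := by gcongr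
    _ = _ := by rw [h3, he]; ring

theorem mconv_eq_integral (κ : 𝓢(V, X →L[ℝ] X)) {σ : ℝ} (hσ : 0 < σ) (g : V → X) (x : V) :
    mconv κ σ⁻¹ g x = σ ^ Module.finrank ℝ V • ∫ y, κ (σ • (x - y)) (g y) := by
  have h1 : ∫ y, κ (σ • (x - y)) (g y) = ∫ y, κ (σ • y) (g (x - y)) := by
    rw [← integral_sub_left_eq_self _ volume x]
    simp
  have h2 := Measure.integral_comp_smul (volume : Measure V)
    (fun z => κ z (g (x - σ⁻¹ • z))) σ
  simp only [inv_smul_smul₀ hσ.ne'] at h2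
  rw [h1, h2, smul_smul, abs_of_pos (by positivity), mul_inv_cancel₀ (by positivity), one_smul,
    mconv]

end Mollification

section Duhamel
variable {V : Type} [NormedAddCommGroup V] [InnerProductSpace ℝ V] [FiniteDimensional ℝ V]
  [MeasurableSpace V] [BorelSpace V]
  {X : Type} [NormedAddCommGroup X] [InnerProductSpace ℝ X] [FiniteDimensional ℝ X]
  {n r : ℕ}

/-- A spatially compactly supported evolution `w` with time derivative `w'`. -/
structure CompactEvolution (r : ℕ) (K : Set V) (T : ℝ) (w w' : ℝ → V → X) : Prop where
  isCompact : IsCompact K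
  contDiff : ∀ t ∈ Set.Icc 0 T, ContDiff ℝ r (w t)
  zero : ∀ t ∈ Set.Icc 0 T, ∀ x ∉ K, w t x = 0
  zero' : ∀ t ∈ Set.Icc 0 T, ∀ x ∉ K, w' t x = 0
  bdd : ∃ B, ∀ t ∈ Set.Icc 0 T, ∀ x, ‖w t x‖ ≤ B
  bdd' : ∃ B, ∀ t ∈ Set.Icc 0 T, ∀ x, ‖w' t x‖ ≤ B
  continuousOn : ∀ I : Fin r → V,
    ContinuousOn (fun p : ℝ × V => iteratedFDeriv ℝ r (w p.1) p.2 I) (Set.Icc 0 T ×ˢ Set.univ)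
  continuous' : ∀ t ∈ Set.Icc 0 T, Continuous (w' t)
  hasDerivAt : ∀ t ∈ Set.Ioo 0 T, ∀ x, HasDerivAt (fun s => w s x) (w' t x) t

variable {K : Set V} {T : ℝ} {w w' : ℝ → V → X}

theorem CompactEvolution.hasCompactSupport (h : CompactEvolution r K T w w') {t : ℝ}
    (ht : t ∈ Set.Icc 0 T) : HasCompactSupport (w t) :=
  HasCompactSupport.intro h.isCompact (h.zero t ht)

theorem hasDerivAt_scale (hr : 1 ≤ r) {t s : ℝ} (hs : s < t) :
    HasDerivAt (fun s => (t - s) ^ (-(1 / (r : ℝ)))) ((r : ℝ)⁻¹ *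
      ((t - s) ^ (-(1 / (r : ℝ)))) ^ (r + 1)) s := by
  have h0 : 0 < t - s := by linarith
  have h1 : HasDerivAt (fun s => t - s) (-1) s := by
    simpa using (hasDerivAt_id s).const_sub t
  have h2 := h1.rpow_const (p := -(1 / (r : ℝ))) (Or.inl h0.ne')
  have hr0 : (r : ℝ) ≠ 0 := by positivity
  convert h2 using 1
  rw [← Real.rpow_natCast, ← Real.rpow_mul h0.le,
    show (-(1 / (r : ℝ)) * ((r + 1 : ℕ) : ℝ)) = -(1 / (r : ℝ)) - 1 by push_cast; field_simp; ring]
  ring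

theorem hasDerivAt_scaled_kernel {b : Fin n → V} {A : (Fin r → Fin n) → X →L[ℝ] X} (hr : 1 ≤ r)
    {c : ℕ} (hc : 1 ≤ c) {κ : 𝓢(V, X →L[ℝ] X)} (hκ : IsProfile b A c κ) {σ : ℝ → ℝ} {s : ℝ}
    (hσ : HasDerivAt σ ((r : ℝ)⁻¹ * σ s ^ (r + 1)) s) (ζ : V) :
    HasDerivAt (fun s => σ s ^ c • κ (σ s • ζ))
      (-(σ s ^ (c + r)) • ∑ J : Fin r → Fin n,
        (∂^{fun j => b (J j)} κ : 𝓢(V, X →L[ℝ] X)) (σ s • ζ) ∘L A J) s := by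
  have hr0 : (r : ℝ) ≠ 0 := by positivity
  have h1 := hσ.pow c
  have h2 : HasDerivAt (fun s => κ (σ s • ζ))
      (fderiv ℝ κ (σ s • ζ) (((r : ℝ)⁻¹ * σ s ^ (r + 1)) • ζ)) s :=
    (κ.differentiableAt (x := σ s • ζ)).hasFDerivAt.comp_hasDerivAt s (hσ.smul_const ζ)
  have h3 := h1.fun_smul h2
  refine h3.congr_deriv ?_
  have h4 := hκ (σ s • ζ)
  have h5 : ∑ J : Fin r → Fin n,
      (∂^{fun j => b (J j)} κ : 𝓢(V, X →L[ℝ] X)) (σ s • ζ) ∘L A J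
      = -(r : ℝ)⁻¹ • (c • κ (σ s • ζ) + fderiv ℝ κ (σ s • ζ) (σ s • ζ)) := by
    rw [h4, smul_smul]; field_simp; simp
  obtain ⟨c, rfl⟩ : ∃ c', c = c' + 1 := ⟨c - 1, by omega⟩
  rw [h5]
  simp only [map_smul, smul_add, smul_smul, ← Nat.cast_smul_eq_nsmul ℝ, Pi.pow_apply]
  rw [add_comm]
  congr 1
  · congr 1
    simp
    ring
  · congr 1
    ring

/-- The constant coefficient operator `∂_t - Σ_J A_J ∂_J` applied to `w`. -/
def residual (b : Fin n → V) (A : (Fin r → Fin n) → X →L[ℝ] X) (w w' : ℝ → V → X) (t : ℝ)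
    (x : V) : X :=
  w' t x - ∑ J : Fin r → Fin n, A J (iteratedFDeriv ℝ r (w t) x fun j => b (J j))

theorem iteratedFDeriv_clm_comp_apply {m : ℕ} {g : V → X} (hg : ContDiff ℝ m g) (L : X →L[ℝ] X)
    (x : V) (I : Fin m → V) :
    iteratedFDeriv ℝ m (fun y => L (g y)) x I = L (iteratedFDeriv ℝ m g x I) := by
  have := L.iteratedFDeriv_comp_left hg.contDiffAt (i := m) (x := x) le_rfl
  exact congrArg (fun M => M I) this

theorem CompactEvolution.continuous_deriv (h : CompactEvolution r K T w w') {t : ℝ}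
    (ht : t ∈ Set.Icc 0 T) (I : Fin r → V) : Continuous fun x => iteratedFDeriv ℝ r (w t) x I :=
  (ContinuousMultilinearMap.apply ℝ (fun _ : Fin r => V) X I).continuous.comp
    ((h.contDiff t ht).continuous_iteratedFDeriv le_rfl)

theorem CompactEvolution.deriv_zero (h : CompactEvolution r K T w w') {t : ℝ}
    (ht : t ∈ Set.Icc 0 T) (I : Fin r → V) {x : V} (hx : x ∉ K) :
    iteratedFDeriv ℝ r (w t) x I = 0 := by
  have : w t =ᶠ[nhds x] fun _ => 0 := by
    filter_upwards [h.isCompact.isClosed.isOpen_compl.mem_nhds hx] with y hy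
    exact h.zero t ht y hy
  rw [this.iteratedFDeriv ℝ r |>.eq_of_nhds]
  rw [iteratedFDeriv_fun_zero]; rfl

theorem CompactEvolution.deriv_compactSupport (h : CompactEvolution r K T w w') {t : ℝ}
    (ht : t ∈ Set.Icc 0 T) (I : Fin r → V) :
    HasCompactSupport fun x => iteratedFDeriv ℝ r (w t) x I :=
  HasCompactSupport.intro h.isCompact fun _ hx => h.deriv_zero ht I hx

theorem CompactEvolution.deriv_bdd (h : CompactEvolution r K T w w') (I : Fin r → V) :
    ∃ B, ∀ t ∈ Set.Icc 0 T, ∀ x, ‖iteratedFDeriv ℝ r (w t) x I‖ ≤ B := by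
  obtain ⟨B, hB⟩ := (isCompact_Icc.prod h.isCompact).exists_bound_of_continuousOn
    ((h.continuousOn I).mono (Set.prod_mono le_rfl (Set.subset_univ _)))
  refine ⟨max B 0, fun t ht x => ?_⟩
  by_cases hx : x ∈ K
  · exact (hB (t, x) ⟨ht, hx⟩).trans (le_max_left _ _)
  · rw [h.deriv_zero ht I hx]; simp

theorem CompactEvolution.continuous_residual (h : CompactEvolution r K T w w') {t : ℝ}
    (ht : t ∈ Set.Icc 0 T) (b : Fin n → V) (A : (Fin r → Fin n) → X →L[ℝ] X) :
    Continuous (residual b A w w' t) :=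
  (h.continuous' t ht).sub (continuous_finsetSum _ fun J _ =>
    (A J).continuous.comp (h.continuous_deriv ht _))

theorem CompactEvolution.residual_bdd (h : CompactEvolution r K T w w') {t : ℝ}
    (ht : t ∈ Set.Icc 0 T) (b : Fin n → V) (A : (Fin r → Fin n) → X →L[ℝ] X) :
    ∃ B, ∀ x, ‖residual b A w w' t x‖ ≤ B := by
  refine bounded_of_compact_support (h.continuous_residual ht b A)
    (HasCompactSupport.intro h.isCompact fun x hx => ?_)
  simp [residual, h.zero' t ht x hx, h.deriv_zero ht _ hx]

theorem mconv_residual (h : CompactEvolution r K T w w') {t : ℝ} (ht : t ∈ Set.Icc 0 T)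
    (b : Fin n → V) (A : (Fin r → Fin n) → X →L[ℝ] X) (κ : 𝓢(V, X →L[ℝ] X)) (ρ : ℝ) (x : V) :
    mconv κ ρ (residual b A w w' t) x = mconv κ ρ (w' t) x - ∑ J : Fin r → Fin n,
      mconv κ ρ (fun y => A J (iteratedFDeriv ℝ r (w t) y fun j => b (J j))) x := by
  have hJ : ∀ J ∈ (Finset.univ : Finset (Fin r → Fin n)), Integrable fun z =>
      κ z (A J (iteratedFDeriv ℝ r (w t) (x - ρ • z) fun j => b (J j))) := fun J _ => by
    have hc := (A J).continuous.comp (h.continuous_deriv ht fun j => b (J j))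
    obtain ⟨B, hB⟩ := bounded_of_compact_support hc
      ((h.deriv_compactSupport ht fun j => b (J j)).comp_left (map_zero (A J)))
    exact integrable_mconv κ ρ hc hB x
  obtain ⟨B, hB⟩ := h.bdd'
  have hi := integrable_mconv κ ρ (h.continuous' t ht) (hB t ht) x
  simp only [mconv, residual, map_sub, map_sum]
  rw [integral_sub hi (integrable_finsetSum _ hJ), integral_finsetSum _ hJ]

theorem hasDerivAt_mconv {b : Fin n → V} {A : (Fin r → Fin n) → X →L[ℝ] X} (hr : 1 ≤ r)
    {κ : 𝓢(V, X →L[ℝ] X)} (hκ : IsProfile b A (Module.finrank ℝ V + r) κ)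
    (h : CompactEvolution r K T w w') {t s : ℝ} (ht : t ≤ T) (hs0 : 0 < s) (hst : s < t) (x : V) :
    HasDerivAt (fun s => ((t - s) ^ (-(1 / (r : ℝ)))) ^ r •
        mconv κ ((t - s) ^ (-(1 / (r : ℝ))))⁻¹ (w s) x)
      (((t - s) ^ (-(1 / (r : ℝ)))) ^ r •
        mconv κ ((t - s) ^ (-(1 / (r : ℝ))))⁻¹ (residual b A w w' s) x) s := by
  set σ : ℝ → ℝ := fun s => (t - s) ^ (-(1 / (r : ℝ)))
  set d := Module.finrank ℝ V
  have hσ : ∀ s < t, HasDerivAt σ ((r : ℝ)⁻¹ * σ s ^ (r + 1)) s := fun s hs =>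
    hasDerivAt_scale hr hs
  have hσ0 : ∀ s < t, 0 < σ s := fun s hs => Real.rpow_pos_of_pos (by linarith) _
  set s1 := (s + t) / 2
  have hs1 : s < s1 ∧ s1 < t := ⟨by simp only [s1]; linarith, by simp only [s1]; linarith⟩
  have hσ1 : ∀ s' < s1, σ s' ≤ σ s1 := fun s' hs' =>
    Real.rpow_le_rpow_of_nonpos (by linarith) (by linarith)
      (by simp)
  have hIcc : ∀ s' ∈ Set.Ioo 0 s1, s' ∈ Set.Icc 0 T := fun s' hs' =>
    ⟨hs'.1.le, by linarith [hs'.2]⟩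
  have hsI : s ∈ Set.Ioo 0 s1 := ⟨hs0, hs1.1⟩
  set G : ℝ → V → X := fun s y => (σ s ^ (d + r) • κ (σ s • (x - y))) (w s y)
  set G' : ℝ → V → X := fun s y => (-(σ s ^ (d + r + r)) • ∑ J : Fin r → Fin n,
        (∂^{fun j => b (J j)} κ : 𝓢(V, X →L[ℝ] X)) (σ s • (x - y)) ∘L A J) (w s y)
        + (σ s ^ (d + r) • κ (σ s • (x - y))) (w' s y)
  obtain ⟨B, hB⟩ := h.bdd
  obtain ⟨B', hB'⟩ := h.bdd'
  have hB0 : 0 ≤ B := (norm_nonneg _).trans (hB s (hIcc s hsI) 0)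
  have hB0' : 0 ≤ B' := (norm_nonneg _).trans (hB' s (hIcc s hsI) 0)
  have hbd : ∀ η : 𝓢(V, X →L[ℝ] X), ∃ C, ∀ z, ‖η z‖ ≤ C := fun η =>
    ⟨_, fun z => SchwartzMap.norm_le_seminorm ℝ η z⟩
  obtain ⟨C, hC⟩ := hbd κ
  choose D hD using fun J : Fin r → Fin n => hbd (∂^{fun j => b (J j)} κ)
  have hC0 : 0 ≤ C := (norm_nonneg _).trans (hC 0)
  have hD0 : ∀ J, 0 ≤ D J := fun J => (norm_nonneg _).trans (hD J 0)
  set M := σ s1 ^ (d + r + r) * (∑ J, D J * ‖A J‖) * B + σ s1 ^ (d + r) * C * B'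
  have hbound : ∀ y, ∀ s' ∈ Set.Ioo 0 s1, ‖G' s' y‖ ≤ K.indicator (fun _ => M) y := by
    intro y s' hs'
    by_cases hy : y ∈ K
    · rw [Set.indicator_of_mem hy]
      have p0 := hσ0 s' (hs'.2.trans hs1.2)
      have p1 := hσ1 s' hs'.2
      have q1 : ‖∑ J : Fin r → Fin n,
          (∂^{fun j => b (J j)} κ : 𝓢(V, X →L[ℝ] X)) (σ s' • (x - y)) ∘L A J‖
          ≤ ∑ J, D J * ‖A J‖ := by
        refine (norm_sum_le _ _).trans (Finset.sum_le_sum fun J _ => ?_)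
        refine (ContinuousLinearMap.opNorm_comp_le _ _).trans ?_
        gcongr
        exact hD J _
      have q2 : ‖-(σ s' ^ (d + r + r))‖ ≤ σ s1 ^ (d + r + r) := by
        rw [norm_neg, norm_pow, Real.norm_of_nonneg p0.le]; gcongr
      have q3 : ‖σ s' ^ (d + r)‖ ≤ σ s1 ^ (d + r) := by
        rw [norm_pow, Real.norm_of_nonneg p0.le]; gcongr
      refine (norm_add_le _ _).trans (add_le_add ?_ ?_)
      · refine (ContinuousLinearMap.le_opNorm _ _).trans ?_
        rw [norm_smul]
        have := hB _ (hIcc s' hs') y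
        have h0 : 0 ≤ ∑ J, D J * ‖A J‖ :=
          Finset.sum_nonneg fun J _ => mul_nonneg (hD0 J) (norm_nonneg _)
        have p1 := p0.le.trans p1
        gcongr
      · refine (ContinuousLinearMap.le_opNorm _ _).trans ?_
        rw [norm_smul]
        have := hB' _ (hIcc s' hs') y
        have p1 := p0.le.trans p1
        gcongr
        exact hC _
    · rw [Set.indicator_of_notMem hy]
      simp [G', h.zero s' (hIcc s' hs') y hy, h.zero' s' (hIcc s' hs') y hy]
  have hG_cont : ∀ s' ∈ Set.Ioo 0 s1, Continuous (G s') := fun s' hs' => by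
    have := (h.contDiff s' (hIcc s' hs')).continuous
    have := κ.continuous
    simp only [G]
    fun_prop
  have hG_int : Integrable (G s) := by
    refine (hG_cont s hsI).integrable_of_hasCompactSupport
      (HasCompactSupport.intro h.isCompact fun y hy => ?_)
    simp [G, h.zero s (hIcc s hsI) y hy]
  have hG'_cont : Continuous (G' s) := by
    have h1 := (h.contDiff s (hIcc s hsI)).continuous
    have h2 := h.continuous' s (hIcc s hsI)
    have h3 := κ.continuous
    have h4 := fun J : Fin r → Fin n => (∂^{fun j => b (J j)} κ : 𝓢(V, X →L[ℝ] X)).continuous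
    simp only [G']
    fun_prop
  have hmain := hasDerivAt_integral_of_dominated_loc_of_deriv_le (μ := (volume : Measure V))
    (F := G) (F' := G') (x₀ := s) (s := Set.Ioo 0 s1) (bound := K.indicator fun _ => M)
    (Ioo_mem_nhds hs0 hs1.1)
    (by
      filter_upwards [Ioo_mem_nhds hs0 hs1.1] with s' hs'
      exact (hG_cont s' hs').aestronglyMeasurable)
    hG_int hG'_cont.aestronglyMeasurable
    (.of_forall fun y s' hs' => hbound y s' hs')
    ((integrable_indicator_iff h.isCompact.measurableSet).2
      (integrableOn_const h.isCompact.measure_lt_top.ne))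
    (.of_forall fun y s' hs' =>
      (hasDerivAt_scaled_kernel hr (by omega) hκ (hσ s' (hs'.2.trans hs1.2)) (x - y)).clm_apply
        (h.hasDerivAt s' ⟨hs'.1, by linarith [hs'.2]⟩ y))
  have e1 : ∀ s' < t, σ s' ^ r • mconv κ (σ s')⁻¹ (w s') x = ∫ y, G s' y := fun s' hs' => by
    rw [mconv_eq_integral κ (hσ0 s' hs'), smul_smul, ← integral_smul]
    simp only [G, smul_apply]
    congr 1; ext1 y; congr 1; simp only [d]; ring
  have e2 : σ s ^ r • mconv κ (σ s)⁻¹ (residual b A w w' s) x = ∫ y, G' s y := by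
    have p0 := hσ0 s hst
    have hsT := hIcc s hsI
    rw [mconv_residual h hsT]
    have e3 : ∀ J : Fin r → Fin n,
        mconv κ (σ s)⁻¹ (fun y => A J (iteratedFDeriv ℝ r (w s) y fun j => b (J j))) x
        = σ s ^ (d + r) • ∫ y, (∂^{fun j => b (J j)} κ : 𝓢(V, X →L[ℝ] X)) (σ s • (x - y))
          (A J (w s y)) := fun J => by
      have hcd : ContDiff ℝ r fun y => A J (w s y) := (A J).contDiff.comp (h.contDiff s hsT)
      have := mconv_iteratedLineDerivOp κ (σ s)⁻¹ (fun j => b (J j)) hcd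
        ((h.hasCompactSupport hsT).comp_left (map_zero (A J))) x
      simp only [iteratedFDeriv_clm_comp_apply (h.contDiff s hsT)] at this
      rw [mconv_eq_integral _ p0] at this
      rw [pow_add, mul_comm, mul_smul, this, smul_smul, ← mul_pow, mul_inv_cancel₀ p0.ne',
        one_pow, one_smul]
    simp only [e3]
    rw [mconv_eq_integral κ p0]
    have i1 : ∀ J ∈ (Finset.univ : Finset (Fin r → Fin n)), Integrable fun y =>
        (∂^{fun j => b (J j)} κ : 𝓢(V, X →L[ℝ] X)) (σ s • (x - y)) (A J (w s y)) := fun J _ => by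
      have h1 := (h.contDiff s hsT).continuous
      have h4 := (∂^{fun j => b (J j)} κ : 𝓢(V, X →L[ℝ] X)).continuous
      refine Continuous.integrable_of_hasCompactSupport (by fun_prop)
        (HasCompactSupport.intro h.isCompact fun y hy => ?_)
      simp [h.zero s hsT y hy]
    have i2 : Integrable fun y => κ (σ s • (x - y)) (w' s y) := by
      have h1 := h.continuous' s hsT
      have h4 := κ.continuous
      refine Continuous.integrable_of_hasCompactSupport (by fun_prop)
        (HasCompactSupport.intro h.isCompact fun y hy => ?_)
      simp [h.zero' s hsT y hy]
    have e4 : G' s = fun y => -(σ s ^ (d + r + r)) • (∑ J : Fin r → Fin n,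
        (∂^{fun j => b (J j)} κ : 𝓢(V, X →L[ℝ] X)) (σ s • (x - y)) (A J (w s y)))
        + σ s ^ (d + r) • κ (σ s • (x - y)) (w' s y) := by
      ext1 y
      simp only [G', smul_apply, sum_apply, ContinuousLinearMap.comp_apply]
    have e5 := integral_add ((integrable_finsetSum _ i1).smul (-(σ s ^ (d + r + r))))
      (i2.smul (σ s ^ (d + r)))
    simp only [Pi.smul_apply] at e5
    rw [e4, e5, integral_smul, integral_smul, integral_finsetSum _ i1, ← Finset.smul_sum, smul_sub, smul_smul, smul_smul,
      neg_smul, sub_eq_neg_add]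
    congr 3 <;> simp only [d] <;> ring
  change HasDerivAt (fun s => σ s ^ r • mconv κ (σ s)⁻¹ (w s) x)
    (σ s ^ r • mconv κ (σ s)⁻¹ (residual b A w w' s) x) s
  rw [e2]
  refine hmain.2.congr_of_eventuallyEq ?_
  filter_upwards [Iio_mem_nhds hst] with s' hs'
  exact e1 s' hs'

end Duhamel

theorem norm_sub_le_of_norm_deriv_le {E : Type} [NormedAddCommGroup E] [NormedSpace ℝ E]
    {f f' : ℝ → E} {B B' : ℝ → ℝ} {a b : ℝ} (hab : a ≤ b) (hf : ContinuousOn f (Set.Icc a b))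
    (hf' : ∀ s ∈ Set.Ioo a b, HasDerivAt f (f' s) s) (hB : ContinuousOn B (Set.Icc a b))
    (hB' : ∀ s ∈ Set.Ioo a b, HasDerivAt B (B' s) s)
    (hbd : ∀ s ∈ Set.Ioo a b, ‖f' s‖ ≤ B' s) : ‖f b - f a‖ ≤ B b - B a := by
  rcases hab.eq_or_lt with rfl | hab
  · simp
  have key : ∀ a' ∈ Set.Ioo a b, ‖f b - f a'‖ ≤ B b - B a' := by
    intro a' ha'
    have hsub : Set.Icc a' b ⊆ Set.Icc a b := Set.Icc_subset_Icc_left ha'.1.le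
    have hI : ∀ s ∈ Set.Ico a' b, s ∈ Set.Ioo a b := fun s hs => ⟨ha'.1.trans_le hs.1, hs.2⟩
    refine image_norm_le_of_norm_deriv_right_le_deriv_boundary' (f := fun s => f s - f a')
      (f' := f') (B := fun s => B s - B a') (B' := B') (a := a') (b := b)
      ((hf.mono hsub).sub continuousOn_const)
      (fun s hs => ((hf' s (hI s hs)).sub_const _).hasDerivWithinAt) (by simp)
      ((hB.mono hsub).sub continuousOn_const)
      (fun s hs => ((hB' s (hI s hs)).sub_const _).hasDerivWithinAt)
      (fun s hs => hbd s (hI s hs)) ⟨ha'.2.le, le_rfl⟩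
  have hIoo : Set.Ioo a b ⊆ Set.Icc a b := Set.Ioo_subset_Icc_self
  have hne : (nhdsWithin a (Set.Ioo a b)).NeBot := by
    rw [nhdsWithin_Ioo_eq_nhdsGT hab]; infer_instance
  have h1 : Filter.Tendsto f (nhdsWithin a (Set.Ioo a b)) (nhds (f a)) :=
    (hf a ⟨le_rfl, hab.le⟩).mono_left (nhdsWithin_mono _ hIoo)
  have h2 : Filter.Tendsto B (nhdsWithin a (Set.Ioo a b)) (nhds (B a)) :=
    (hB a ⟨le_rfl, hab.le⟩).mono_left (nhdsWithin_mono _ hIoo)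
  exact le_of_tendsto_of_tendsto (h1.const_sub (f b)).norm (h2.const_sub (B b))
    (by filter_upwards [self_mem_nhdsWithin] with s hs using key s hs)

section Schauder
variable {V : Type} [NormedAddCommGroup V] [InnerProductSpace ℝ V] [FiniteDimensional ℝ V]
  {X : Type} [NormedAddCommGroup X] [InnerProductSpace ℝ X] [FiniteDimensional ℝ X]
  {n r : ℕ}

theorem multilinear_norm_le_sum_basis {Y : Type} [NormedAddCommGroup Y] [NormedSpace ℝ Y]
    (b : OrthonormalBasis (Fin n) ℝ V) {m : ℕ} (f : ContinuousMultilinearMap ℝ (fun _ : Fin m => V) Y) :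
    ‖f‖ ≤ ∑ J : Fin m → Fin n, ‖f fun j => b (J j)‖ := by
  refine f.opNorm_le_bound (Finset.sum_nonneg fun _ _ => norm_nonneg _) fun v => ?_
  have h1 : f v = ∑ J : Fin m → Fin n, (∏ j, inner ℝ (b (J j)) (v j)) • f fun j => b (J j) := by
    conv_lhs => rw [show v = fun j => ∑ i, inner ℝ (b i) (v j) • b i from
      funext fun j => (b.sum_repr' (v j)).symm]
    rw [f.map_sum]
    exact Finset.sum_congr rfl fun J _ => f.map_smul_univ _ _
  rw [h1, Finset.sum_mul]
  refine (norm_sum_le _ _).trans (Finset.sum_le_sum fun J _ => ?_)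
  rw [norm_smul, mul_comm, norm_prod]
  gcongr with j
  refine (norm_inner_le_norm _ _).trans ?_
  simp

variable [MeasurableSpace V] [BorelSpace V] {K : Set V} {T : ℝ} {w w' : ℝ → V → X}

theorem CompactEvolution.continuousOn_mconv (h : CompactEvolution r K T w w')
    (κ : 𝓢(V, X →L[ℝ] X)) (I : Fin r → V) {t : ℝ} (ht : t ≤ T) {ρ : ℝ → ℝ} (hρ : Continuous ρ)
    (x : V) : ContinuousOn
      (fun s => mconv κ (ρ s) (fun y => iteratedFDeriv ℝ r (w s) y I) x) (Set.Icc 0 t) := by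
  obtain ⟨B, hB⟩ := h.deriv_bdd I
  have hm : ∀ s ∈ Set.Icc 0 t, s ∈ Set.Icc 0 T := fun s hs => ⟨hs.1, hs.2.trans ht⟩
  refine continuousOn_of_dominated (bound := fun z => ‖κ z‖ * B) (fun s hs => ?_)
    (fun s hs => .of_forall fun z => ?_) (κ.integrable.norm.mul_const _) (.of_forall fun z => ?_)
  · exact (integrable_mconv κ (ρ s) (h.continuous_deriv (hm s hs) I) (hB s (hm s hs)) x).1
  · refine (ContinuousLinearMap.le_opNorm _ _).trans ?_
    gcongr
    exact hB s (hm s hs) _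
  · refine (κ z).continuous.comp_continuousOn ?_
    refine (h.continuousOn I).comp (f := fun s => (s, x - ρ s • z)) (by fun_prop)
      fun s hs => ⟨hm s hs, Set.mem_univ _⟩

theorem mconv_zero_radius (κ : 𝓢(V, X →L[ℝ] X)) (hκ : ∫ x, κ x = 1) (g : V → X) (x : V) :
    mconv κ 0 g x = g x := by
  simp only [mconv, zero_smul, sub_zero]
  rw [← ContinuousLinearMap.integral_apply κ.integrable, hκ]; rfl

theorem exists_schauder_component (hr : 1 ≤ r) (hrev : Even r) (b : OrthonormalBasis (Fin n) ℝ V)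
    (A : (Fin r → Fin n) → X →L[ℝ] X) {lam : ℝ} (hlam : 0 < lam)
    (hA : ∀ (ξ : V) (v : X), (-1 : ℝ) ^ (r / 2) * ∑ J : Fin r → Fin n,
      (∏ j, inner ℝ ξ (b (J j))) * inner ℝ (A J v) v ≤ -lam * ‖ξ‖ ^ r * ‖v‖ ^ 2)
    {α : ℝ} (hα0 : 0 < α) (hα1 : α < 1) (I : Fin r → V) :
    ∃ C, 0 ≤ C ∧ ∀ (K : Set V) (T : ℝ) (w w' : ℝ → V → X) (M : ℝ),
      CompactEvolution r K T w w' → 0 ≤ M →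
      (∀ t ∈ Set.Icc 0 T, ∀ x x', ‖residual b A w w' t x - residual b A w w' t x'‖
        ≤ M * ‖x - x'‖ ^ α) →
      (∀ x x', ‖iteratedFDeriv ℝ r (w 0) x I - iteratedFDeriv ℝ r (w 0) x' I‖
        ≤ M * ‖x - x'‖ ^ α) →
      ∀ t ∈ Set.Icc 0 T, ∀ x x', ‖iteratedFDeriv ℝ r (w t) x I - iteratedFDeriv ℝ r (w t) x' I‖
        ≤ C * M * ‖x - x'‖ ^ α := by
  obtain ⟨k, hk1, hk2⟩ := exists_kernel hr hrev b A hlam hA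
  have hn : n = Module.finrank ℝ V := by
    rw [Module.finrank_eq_card_basis b.toBasis, Fintype.card_fin]
  set κ : 𝓢(V, X →L[ℝ] X) := ∂^{I} k with hκdef
  have hκ : IsProfile b A (Module.finrank ℝ V + r) κ := by
    rw [← hn]; exact IsProfile.iteratedLineDerivOp hk2 I
  have hκ0 : ∀ c, ∫ z, κ z c = 0 := integral_iteratedLineDerivOp_apply k hr I
  obtain ⟨C1, hC10, hC1⟩ := exists_mconv_shift_bound κ hα0.le hα1.le
  set C2 := ∫ z, ‖κ z‖ * (1 + ‖z‖)
  have hC20 : 0 ≤ C2 := integral_nonneg fun z => by positivity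
  set C3 := ∫ z, ‖k z‖
  have hC30 : 0 ≤ C3 := integral_nonneg fun z => by positivity
  have hr0 : (0 : ℝ) < r := by positivity
  set p := (1 - α) / r
  have hp : 0 < p := div_pos (by linarith) hr0
  set q := α / r
  have hq : 0 < q := div_pos hα0 hr0
  refine ⟨C3 + C1 / p + 2 * C2 / q, by positivity, ?_⟩
  intro K T w w' M h hM hres hinit t ht x x'
  set H := ‖x - x'‖
  rcases (norm_nonneg (x - x')).eq_or_lt with hH | hH
  · have : x = x' := by rwa [eq_comm, norm_eq_zero, sub_eq_zero] at hH
    subst this; simp only [sub_self, norm_zero]; positivity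
  change 0 < H at hH
  set ρ : ℝ → ℝ := fun s => (t - s) ^ (1 / (r : ℝ))
  have hρc : Continuous ρ := by
    refine Continuous.rpow_const (by fun_prop) fun _ => Or.inr (by positivity)
  have hρ0 : ∀ s < t, 0 < ρ s := fun s hs => Real.rpow_pos_of_pos (by linarith) _
  have hσρ : ∀ s < t, ((t - s) ^ (-(1 / (r : ℝ))))⁻¹ = ρ s := fun s hs => by
    rw [Real.rpow_neg (by linarith), inv_inv]
  have hσr : ∀ s < t, ((t - s) ^ (-(1 / (r : ℝ)))) ^ r = (t - s)⁻¹ := fun s hs => by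
    rw [← Real.rpow_natCast, ← Real.rpow_mul (by linarith), neg_mul, one_div,
      inv_mul_cancel₀ hr0.ne', Real.rpow_neg_one]
  have hρα : ∀ s < t, ρ s ^ α = (t - s) ^ q := fun s hs => by
    rw [← Real.rpow_mul (by linarith)]; congr 1; simp only [q]; ring
  have hm : ∀ s ∈ Set.Icc 0 t, s ∈ Set.Icc 0 T := fun s hs => ⟨hs.1, hs.2.trans ht.2⟩
  set Φ : V → ℝ → X := fun x s => mconv k (ρ s) (fun y => iteratedFDeriv ℝ r (w s) y I) x
  set θ : ℝ → X := fun s => Φ x s - Φ x' s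
  have hθc : ContinuousOn θ (Set.Icc 0 t) :=
    (h.continuousOn_mconv k I ht.2 hρc x).sub (h.continuousOn_mconv k I ht.2 hρc x')
  have hθt : θ t = iteratedFDeriv ℝ r (w t) x I - iteratedFDeriv ℝ r (w t) x' I := by
    simp only [θ, Φ, ρ, sub_self]
    rw [Real.zero_rpow (by positivity), mconv_zero_radius k hk1, mconv_zero_radius k hk1]
  have hΦ : ∀ s ∈ Set.Ico 0 t, ∀ x, Φ x s = ((t - s) ^ (-(1 / (r : ℝ)))) ^ r •
      mconv κ ((t - s) ^ (-(1 / (r : ℝ))))⁻¹ (w s) x := by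
    intro s hs x
    have hs' := hm s ⟨hs.1, hs.2.le⟩
    rw [hκdef, mconv_iteratedLineDerivOp k _ I (h.contDiff s hs') (h.hasCompactSupport hs'),
      smul_smul, ← mul_pow, mul_inv_cancel₀ (Real.rpow_pos_of_pos (by linarith [hs.2]) _).ne',
      one_pow, one_smul, hσρ s hs.2]
  set f := residual b A w w'
  have hΦ' : ∀ s ∈ Set.Ioo 0 t, ∀ x, HasDerivAt (Φ x) ((t - s)⁻¹ • mconv κ (ρ s) (f s) x) s := by
    intro s hs x
    have h1 := hasDerivAt_mconv hr hκ h ht.2 hs.1 hs.2 x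
    rw [hσρ s hs.2, hσr s hs.2] at h1
    refine h1.congr_of_eventuallyEq ?_
    filter_upwards [Ioo_mem_nhds hs.1 hs.2] with s' hs'
    exact hΦ s' ⟨hs'.1.le, hs'.2⟩ x
  set θ' : ℝ → X := fun s => (t - s)⁻¹ • mconv κ (ρ s) (f s) x - (t - s)⁻¹ • mconv κ (ρ s) (f s) x'
  have hθ' : ∀ s ∈ Set.Ioo 0 t, HasDerivAt θ (θ' s) s := fun s hs =>
    (hΦ' s hs x).sub (hΦ' s hs x')
  have near : ∀ s ∈ Set.Ioo 0 t, ‖θ' s‖ ≤ 2 * C2 * M * (t - s) ^ (q - 1) := by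
    intro s hs
    have hs' := hm s ⟨hs.1.le, hs.2.le⟩
    have hts : 0 < t - s := by linarith [hs.2]
    obtain ⟨B, hB⟩ := h.residual_bdd hs' b A
    have h1 := fun x => norm_mconv_le κ hκ0 (h.continuous_residual hs' b A) hB hα0.le hα1.le hM
      (hres s hs') (hρ0 s hs.2).le x
    rw [hρα s hs.2] at h1
    simp only [θ']
    rw [← smul_sub, norm_smul, Real.norm_of_nonneg (by positivity), Real.rpow_sub hts, Real.rpow_one]
    calc (t - s)⁻¹ * ‖_‖ ≤ (t - s)⁻¹ * (C2 * (M * (t - s) ^ q) + C2 * (M * (t - s) ^ q)) := by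
          gcongr
          exact (norm_sub_le _ _).trans (add_le_add (h1 x) (h1 x'))
      _ = _ := by ring
  have far : ∀ s ∈ Set.Ioo 0 t, H ≤ ρ s → ‖θ' s‖ ≤ C1 * M * H * (t - s) ^ (-p - 1) := by
    intro s hs hHρ
    have hs' := hm s ⟨hs.1.le, hs.2.le⟩
    have hts : 0 < t - s := by linarith [hs.2]
    obtain ⟨B, hB⟩ := h.residual_bdd hs' b A
    have h1 := hC1 (f s) M B (h.continuous_residual hs' b A) hB hM (hres s hs') (ρ s)
      (hρ0 s hs.2) x x' hHρ
    rw [hρα s hs.2] at h1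
    simp only [θ']
    rw [← smul_sub, norm_smul, Real.norm_of_nonneg (by positivity),
      show -p - 1 = q - 1 / r - 1 by simp only [p, q]; ring,
      Real.rpow_sub hts, Real.rpow_one, Real.rpow_sub hts]
    calc (t - s)⁻¹ * ‖_‖ ≤ (t - s)⁻¹ * (C1 * (M * (t - s) ^ q * (H / ρ s))) := by
          gcongr
      _ = _ := by simp only [ρ]; ring
  set s0 := max 0 (t - H ^ r)
  have hs0 : s0 ∈ Set.Icc 0 t := ⟨le_max_left _ _, max_le ht.1 (by
    have := pow_pos hH r; linarith)⟩
  have hHα : (H ^ r) ^ q = H ^ α := by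
    rw [← Real.rpow_natCast, ← Real.rpow_mul hH.le]; congr 1; simp only [q]; field_simp
  have step1 : ‖θ t - θ s0‖ ≤ 2 * C2 / q * M * H ^ α := by
    have := norm_sub_le_of_norm_deriv_le (f := θ) (f' := θ')
      (B := fun s => - (2 * C2 * M / q) * (t - s) ^ q)
      (B' := fun s => 2 * C2 * M * (t - s) ^ (q - 1)) hs0.2
      (hθc.mono (Set.Icc_subset_Icc_left hs0.1))
      (fun s hs => hθ' s ⟨hs0.1.trans_lt hs.1, hs.2⟩)
      ((continuous_const.mul (Continuous.rpow_const (by fun_prop)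
        fun _ => Or.inr hq.le)).continuousOn) (fun s hs => ?_)
      (fun s hs => near s ⟨hs0.1.trans_lt hs.1, hs.2⟩)
    · refine this.trans ?_
      simp only [sub_self, Real.zero_rpow hq.ne']
      have h2 : (t - s0) ^ q ≤ H ^ α := by
        rw [← hHα]
        exact Real.rpow_le_rpow (by linarith [hs0.2]) (by
          have := le_max_right 0 (t - H ^ r); simp only [s0]; linarith) hq.le
      have h3 : 0 ≤ 2 * C2 * M / q := by positivity
      calc _ = (2 * C2 * M / q) * (t - s0) ^ q := by ring
        _ ≤ (2 * C2 * M / q) * H ^ α := by gcongr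
        _ = _ := by ring
    · have h1 : HasDerivAt (fun s => t - s) (-1) s := by
        simpa using (hasDerivAt_id s).const_sub t
      have h2 := (h1.rpow_const (p := q) (Or.inl (by linarith [hs.2]))).const_mul
        (-(2 * C2 * M / q))
      refine h2.congr_deriv ?_
      field_simp
  have step2 : ‖θ s0 - θ 0‖ ≤ C1 / p * M * H ^ α := by
    rcases le_total (t - H ^ r) 0 with hle | hle
    · have : s0 = 0 := max_eq_left hle
      rw [this, sub_self, norm_zero]; positivity
    have hs0' : t - s0 = H ^ r := by simp only [s0]; rw [max_eq_right hle]; ring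
    have hHr := pow_pos hH r
    have := norm_sub_le_of_norm_deriv_le (f := θ) (f' := θ')
      (B := fun s => (C1 * M * H / p) * (t - s) ^ (-p))
      (B' := fun s => C1 * M * H * (t - s) ^ (-p - 1)) hs0.1
      (hθc.mono (Set.Icc_subset_Icc_right hs0.2))
      (fun s hs => hθ' s ⟨hs.1, hs.2.trans_le hs0.2⟩)
      (continuousOn_const.mul (ContinuousOn.rpow_const (by fun_prop)
        fun s hs => Or.inl (by linarith [hs.2]))) (fun s hs => ?_)
      (fun s hs => far s ⟨hs.1, hs.2.trans_le hs0.2⟩ ?_)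
    · refine this.trans ?_
      simp only [hs0', sub_zero]
      have h2 : 0 ≤ t ^ (-p) := Real.rpow_nonneg ht.1 _
      have h4 : (H ^ r) ^ (-p) * H = H ^ α := by
        rw [← Real.rpow_natCast, ← Real.rpow_mul hH.le]
        nth_rewrite 2 [← Real.rpow_one H]
        rw [← Real.rpow_add hH]; congr 1; simp only [p]; field_simp; ring
      have h3 : 0 ≤ C1 * M * H / p := by positivity
      calc _ ≤ (C1 * M * H / p) * (H ^ r) ^ (-p) := by nlinarith
        _ = C1 / p * M * ((H ^ r) ^ (-p) * H) := by ring
        _ = _ := by rw [h4]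
    · have h1 : HasDerivAt (fun s => t - s) (-1) s := by
        simpa using (hasDerivAt_id s).const_sub t
      have h2 := (h1.rpow_const (p := -p) (Or.inl (by linarith [hs.2]))).const_mul
        (C1 * M * H / p)
      refine h2.congr_deriv ?_
      field_simp
    · have h1 : (H ^ r) ^ (1 / (r : ℝ)) = H := by
        rw [← Real.rpow_natCast, ← Real.rpow_mul hH.le]; field_simp; simp
      calc H = (H ^ r) ^ (1 / (r : ℝ)) := h1.symm
        _ ≤ ρ s := Real.rpow_le_rpow hHr.le (by linarith [hs.2]) (by positivity)
  have step3 : ‖θ 0‖ ≤ C3 * M * H ^ α := by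
    have h0 : (0 : ℝ) ∈ Set.Icc 0 T := hm 0 ⟨le_rfl, ht.1⟩
    obtain ⟨B, hB⟩ := h.deriv_bdd I
    have hi := fun x => integrable_mconv k (ρ 0) (h.continuous_deriv h0 I) (hB 0 h0) x
    simp only [θ, Φ, mconv]
    rw [← integral_sub (hi x) (hi x')]
    refine (norm_integral_le_integral_norm _).trans ?_
    calc _ ≤ ∫ z, ‖k z‖ * (M * H ^ α) := by
          refine integral_mono_of_nonneg (.of_forall fun _ => norm_nonneg _)
            (k.integrable.norm.mul_const _) (.of_forall fun z => ?_)
          simp only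
          rw [← map_sub]
          refine (ContinuousLinearMap.le_opNorm _ _).trans ?_
          gcongr
          refine (hinit _ _).trans_eq ?_
          rw [sub_sub_sub_cancel_right]
      _ = _ := by rw [integral_mul_const]; ring
  rw [← hθt]
  calc ‖θ t‖ = ‖(θ t - θ s0) + (θ s0 - θ 0) + θ 0‖ := by congr 1; abel
    _ ≤ ‖θ t - θ s0‖ + ‖θ s0 - θ 0‖ + ‖θ 0‖ := norm_add₃_le
    _ ≤ 2 * C2 / q * M * H ^ α + C1 / p * M * H ^ α + C3 * M * H ^ α := by gcongr
    _ = _ := by ring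

/-- Spatial Schauder estimate for the constant coefficient parabolic operator. -/
theorem exists_schauder_bound (hr : 1 ≤ r) (hrev : Even r) (b : OrthonormalBasis (Fin n) ℝ V)
    (A : (Fin r → Fin n) → X →L[ℝ] X) {lam : ℝ} (hlam : 0 < lam)
    (hA : ∀ (ξ : V) (v : X), (-1 : ℝ) ^ (r / 2) * ∑ J : Fin r → Fin n,
      (∏ j, inner ℝ ξ (b (J j))) * inner ℝ (A J v) v ≤ -lam * ‖ξ‖ ^ r * ‖v‖ ^ 2)
    {α : ℝ} (hα0 : 0 < α) (hα1 : α < 1) :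
    ∃ C, 0 ≤ C ∧ ∀ (K : Set V) (T : ℝ) (w w' : ℝ → V → X) (M : ℝ),
      CompactEvolution r K T w w' → 0 ≤ M →
      (∀ t ∈ Set.Icc 0 T, ∀ x x', ‖residual b A w w' t x - residual b A w w' t x'‖
        ≤ M * ‖x - x'‖ ^ α) →
      (∀ x x', ‖iteratedFDeriv ℝ r (w 0) x - iteratedFDeriv ℝ r (w 0) x'‖
        ≤ M * ‖x - x'‖ ^ α) →
      ∀ t ∈ Set.Icc 0 T, ∀ x x', ‖iteratedFDeriv ℝ r (w t) x - iteratedFDeriv ℝ r (w t) x'‖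
        ≤ C * M * ‖x - x'‖ ^ α := by
  choose C hC0 hC using fun J : Fin r → Fin n =>
    exists_schauder_component hr hrev b A hlam hA hα0 hα1 fun j => b (J j)
  refine ⟨∑ J, C J, Finset.sum_nonneg fun J _ => hC0 J, ?_⟩
  intro K T w w' M h hM hres hinit t ht x x'
  refine (multilinear_norm_le_sum_basis b _).trans ?_
  rw [Finset.sum_mul, Finset.sum_mul]
  refine Finset.sum_le_sum fun J _ => ?_
  refine hC J K T w w' M h hM hres (fun x x' => ?_) t ht x x'
  refine le_trans ?_ (hinit x x')
  refine ((iteratedFDeriv ℝ r (w 0) x - iteratedFDeriv ℝ r (w 0) x').le_opNorm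
    fun j => b (J j)).trans ?_
  simp
end Schauder

section TimeInterpolation
variable {V : Type} [NormedAddCommGroup V] [InnerProductSpace ℝ V] [FiniteDimensional ℝ V]
  [MeasurableSpace V] [BorelSpace V]
  {X : Type} [NormedAddCommGroup X] [InnerProductSpace ℝ X] [FiniteDimensional ℝ X]
  {n r : ℕ} {K : Set V} {T : ℝ} {w w' : ℝ → V → X}

theorem CompactEvolution.hasDerivAt_mconv_fixed (h : CompactEvolution r K T w w')
    (κ : 𝓢(V, X →L[ℝ] X)) (ρ : ℝ) {s : ℝ} (hs : s ∈ Set.Ioo 0 T) (x : V) :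
    HasDerivAt (fun s => mconv κ ρ (w s) x) (mconv κ ρ (w' s) x) s := by
  obtain ⟨B, hB⟩ := h.bdd
  obtain ⟨B', hB'⟩ := h.bdd'
  have hI : ∀ s ∈ Set.Ioo 0 T, s ∈ Set.Icc 0 T := fun s hs => ⟨hs.1.le, hs.2.le⟩
  refine (hasDerivAt_integral_of_dominated_loc_of_deriv_le (s := Set.Ioo 0 T)
    (F := fun s z => κ z (w s (x - ρ • z))) (F' := fun s z => κ z (w' s (x - ρ • z)))
    (bound := fun z => ‖κ z‖ * B') (Ioo_mem_nhds hs.1 hs.2) ?_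
    (integrable_mconv κ ρ (h.contDiff s (hI s hs)).continuous (hB s (hI s hs)) x)
    (integrable_mconv κ ρ (h.continuous' s (hI s hs)) (hB' s (hI s hs)) x).1
    (.of_forall fun z τ hτ => ?_) (κ.integrable.norm.mul_const _)
    (.of_forall fun z τ hτ => ?_)).2
  · filter_upwards [Ioo_mem_nhds hs.1 hs.2] with τ hτ
    exact (integrable_mconv κ ρ (h.contDiff τ (hI τ hτ)).continuous (hB τ (hI τ hτ)) x).1
  · refine (ContinuousLinearMap.le_opNorm _ _).trans ?_
    gcongr
    exact hB' τ (hI τ hτ) _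
  · exact (κ z).hasFDerivAt.comp_hasDerivAt τ (h.hasDerivAt τ hτ (x - ρ • z))

/-- Interpolation: spatial Hölder bounds on `D^r w` and `∂_t w` give a time Hölder bound. -/
theorem exists_time_holder_bound (hr : 1 ≤ r) (k : 𝓢(V, X →L[ℝ] X)) (hk : ∫ x, k x = 1)
    {α : ℝ} (hα0 : 0 < α) (hα1 : α < 1) (I : Fin r → V) :
    ∃ C, 0 ≤ C ∧ ∀ (K : Set V) (T : ℝ) (w w' : ℝ → V → X) (M : ℝ),
      CompactEvolution r K T w w' → 0 ≤ M →
      (∀ t ∈ Set.Icc 0 T, ∀ x x', ‖w' t x - w' t x'‖ ≤ M * ‖x - x'‖ ^ α) →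
      (∀ t ∈ Set.Icc 0 T, ∀ x x',
        ‖iteratedFDeriv ℝ r (w t) x I - iteratedFDeriv ℝ r (w t) x' I‖ ≤ M * ‖x - x'‖ ^ α) →
      ∀ t ∈ Set.Icc 0 T, ∀ s ∈ Set.Icc 0 T, ∀ x,
        ‖iteratedFDeriv ℝ r (w t) x I - iteratedFDeriv ℝ r (w s) x I‖
        ≤ C * M * |t - s| ^ (α / r) := by
  set κ : 𝓢(V, X →L[ℝ] X) := ∂^{I} k with hκdef
  have hκ0 : ∀ c, ∫ z, κ z c = 0 := integral_iteratedLineDerivOp_apply k hr I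
  set C2 := ∫ z, ‖κ z‖ * (1 + ‖z‖)
  have hC20 : 0 ≤ C2 := integral_nonneg fun z => by positivity
  set C3 := ∫ z, ‖k z‖ * (1 + ‖z‖)
  have hC30 : 0 ≤ C3 := integral_nonneg fun z => by positivity
  have hr0 : (0 : ℝ) < r := by positivity
  refine ⟨C2 + 2 * C3, by positivity, ?_⟩
  intro K T w w' M h hM hw' hw
  have key : ∀ t ∈ Set.Icc 0 T, ∀ s ∈ Set.Icc 0 T, s < t → ∀ x,
      ‖iteratedFDeriv ℝ r (w t) x I - iteratedFDeriv ℝ r (w s) x I‖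
        ≤ (C2 + 2 * C3) * M * |t - s| ^ (α / r) := by
    intro t ht s hs hst x
    have hts : 0 < t - s := by linarith
    set ρ := (t - s) ^ (1 / (r : ℝ))
    have hρ : 0 < ρ := Real.rpow_pos_of_pos hts _
    have hρr : ρ ^ r = t - s := by
      rw [← Real.rpow_natCast, ← Real.rpow_mul hts.le]; field_simp; simp
    have hρα : ρ ^ α = |t - s| ^ (α / r) := by
      rw [abs_of_pos hts, ← Real.rpow_mul hts.le]; congr 1; ring
    have hmem : ∀ τ ∈ Set.Icc s t, τ ∈ Set.Icc 0 T := fun τ hτ =>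
      ⟨hs.1.trans hτ.1, hτ.2.trans ht.2⟩
    have hΦ : ∀ τ ∈ Set.Icc s t, mconv κ ρ (w τ) x
        = (t - s) • mconv k ρ (fun y => iteratedFDeriv ℝ r (w τ) y I) x := fun τ hτ => by
      rw [hκdef, mconv_iteratedLineDerivOp k _ I (h.contDiff τ (hmem τ hτ))
        (h.hasCompactSupport (hmem τ hτ)), hρr]
    have hΦc : ContinuousOn (fun τ => mconv κ ρ (w τ) x) (Set.Icc s t) := by
      refine ContinuousOn.congr ?_ hΦ
      exact ((h.continuousOn_mconv k I ht.2 (ρ := fun _ => ρ) continuous_const x).mono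
        (Set.Icc_subset_Icc_left hs.1)).const_smul (t - s)
    obtain ⟨B', hB'⟩ := h.bdd'
    have h1 := norm_sub_le_of_norm_deriv_le (f := fun τ => mconv κ ρ (w τ) x)
      (f' := fun τ => mconv κ ρ (w' τ) x) (B := fun τ => C2 * (M * ρ ^ α) * τ)
      (B' := fun τ => C2 * (M * ρ ^ α)) hst.le hΦc
      (fun τ hτ => h.hasDerivAt_mconv_fixed κ ρ
        ⟨hs.1.trans_lt hτ.1, hτ.2.trans_le ht.2⟩ x)
      (by fun_prop) (fun τ hτ => by simpa using (hasDerivAt_id τ).const_mul (C2 * (M * ρ ^ α)))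
      (fun τ hτ => norm_mconv_le κ hκ0
        (h.continuous' τ (hmem τ ⟨hτ.1.le, hτ.2.le⟩)) (hB' τ (hmem τ ⟨hτ.1.le, hτ.2.le⟩))
        hα0.le hα1.le hM (hw' τ (hmem τ ⟨hτ.1.le, hτ.2.le⟩)) hρ.le x)
    simp only [hΦ t ⟨hst.le, le_rfl⟩, hΦ s ⟨le_rfl, hst.le⟩] at h1
    rw [← smul_sub, norm_smul, Real.norm_of_nonneg hts.le, ← mul_sub, mul_comm,
      mul_le_mul_iff_left₀ hts] at h1
    obtain ⟨B, hB⟩ := h.deriv_bdd I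
    have h2 : ∀ τ ∈ Set.Icc 0 T, ‖mconv k ρ (fun y => iteratedFDeriv ℝ r (w τ) y I) x -
        iteratedFDeriv ℝ r (w τ) x I‖ ≤ C3 * (M * ρ ^ α) := fun τ hτ => by
      have := norm_mconv_sub_le k (h.continuous_deriv hτ I) (hB τ hτ) hα0.le hα1.le hM (hw τ hτ)
        hρ.le x
      rwa [← ContinuousLinearMap.integral_apply k.integrable, hk] at this
    have h3 := h2 t ht
    have h4 := h2 s hs
    rw [← hρα]
    set a := mconv k ρ (fun y => iteratedFDeriv ℝ r (w t) y I) x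
    set a' := mconv k ρ (fun y => iteratedFDeriv ℝ r (w s) y I) x
    set c := iteratedFDeriv ℝ r (w t) x I
    set c' := iteratedFDeriv ℝ r (w s) x I
    calc ‖c - c'‖ = ‖(a - a') - (a - c) + (a' - c')‖ := by congr 1; abel
      _ ≤ ‖a - a'‖ + ‖a - c‖ + ‖a' - c'‖ :=
        (norm_add_le _ _).trans (add_le_add_left (norm_sub_le _ _) _)
      _ ≤ C2 * (M * ρ ^ α) + C3 * (M * ρ ^ α) + C3 * (M * ρ ^ α) := by gcongr
      _ = _ := by ring
  intro t ht s hs x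
  rcases lt_trichotomy s t with hst | rfl | hst
  · exact key t ht s hs hst x
  · simp only [sub_self, norm_zero]; positivity
  · rw [norm_sub_rev, abs_sub_comm]; exact key s hs t ht hst x
end TimeInterpolation

section Holder
variable {V : Type} [NormedAddCommGroup V] [NormedSpace ℝ V]
  {Y : Type} [NormedAddCommGroup Y] [NormedSpace ℝ Y]
  {Z : Type} [NormedAddCommGroup Z] [NormedSpace ℝ Z]
  {W : Type} [NormedAddCommGroup W] [NormedSpace ℝ W]

/-- Boundedness and `α`-Hölder continuity on `U` with the common constant `C`. -/
def HolB (U : Set V) (α C : ℝ) (f : V → Y) : Prop :=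
  (∀ x ∈ U, ‖f x‖ ≤ C) ∧ ∀ x ∈ U, ∀ x' ∈ U, ‖f x - f x'‖ ≤ C * ‖x - x'‖ ^ α

variable {U U' : Set V} {α C C' : ℝ} {f g : V → Y}

theorem HolB.mono (h : HolB U α C f) (hU : U' ⊆ U) (hC : C ≤ C') : HolB U' α C' f :=
  ⟨fun x hx => (h.1 x (hU hx)).trans hC, fun x hx x' hx' =>
    (h.2 x (hU hx) x' (hU hx')).trans (by gcongr)⟩

theorem HolB.congr (h : HolB U α C f) (he : ∀ x ∈ U, g x = f x) : HolB U α C g :=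
  ⟨fun x hx => by rw [he x hx]; exact h.1 x hx,
    fun x hx x' hx' => by rw [he x hx, he x' hx']; exact h.2 x hx x' hx'⟩

theorem HolB.add (h : HolB U α C f) (h' : HolB U α C' g) :
    HolB U α (C + C') fun x => f x + g x := by
  refine ⟨fun x hx => (norm_add_le _ _).trans (add_le_add (h.1 x hx) (h'.1 x hx)),
    fun x hx x' hx' => ?_⟩
  rw [add_sub_add_comm, add_mul]
  exact (norm_add_le _ _).trans (add_le_add (h.2 x hx x' hx') (h'.2 x hx x' hx'))

theorem HolB.clm (h : HolB U α C f) (L : Y →L[ℝ] Z) : HolB U α (‖L‖ * C) fun x => L (f x) := by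
  refine ⟨fun x hx => (L.le_opNorm _).trans (by gcongr; exact h.1 x hx), fun x hx x' hx' => ?_⟩
  rw [← map_sub, mul_assoc]
  exact (L.le_opNorm _).trans (by gcongr; exact h.2 x hx x' hx')

theorem holB_const {c : Y} (hc : ‖c‖ ≤ C) : HolB U α C fun _ => c :=
  ⟨fun _ _ => hc, fun x _ x' _ => by
    have : 0 ≤ C := (norm_nonneg c).trans hc
    simp only [sub_self, norm_zero]; positivity⟩

theorem HolB.sum {ι : Type} (s : Finset ι) {f : ι → V → Y} {C : ι → ℝ}
    (h : ∀ i ∈ s, HolB U α (C i) (f i)) : HolB U α (∑ i ∈ s, C i) fun x => ∑ i ∈ s, f i x := by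
  classical
  induction s using Finset.induction_on with
  | empty => simpa using holB_const (U := U) (α := α) (c := (0 : Y)) (C := 0) (by simp)
  | insert i s hi ih =>
    simp only [Finset.sum_insert hi]
    exact (h i (by simp)).add (ih fun j hj => h j (by simp [hj]))

theorem HolB.isometry (L : Y →ₗᵢ[ℝ] Z) : HolB U α C (fun x => L (f x)) ↔ HolB U α C f := by
  simp only [HolB, ← map_sub, L.norm_map]

theorem HolB.bilinear (B : Y →L[ℝ] Z →L[ℝ] W) {g : V → Z} (hC : 0 ≤ C)
    (h : HolB U α C f) (h' : HolB U α C' g) :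
    HolB U α (2 * ‖B‖ * C * C') fun x => B (f x) (g x) := by
  refine ⟨fun x hx => ?_, fun x hx x' hx' => ?_⟩
  · have h1 := h.1 x hx
    have h2 := h'.1 x hx
    have := (norm_nonneg _).trans h2
    have h3 : 0 ≤ ‖B‖ * C * C' := by positivity
    calc ‖B (f x) (g x)‖ ≤ ‖B‖ * ‖f x‖ * ‖g x‖ := B.le_opNorm₂ _ _
      _ ≤ ‖B‖ * C * C' := by gcongr
      _ ≤ _ := by linarith
  · have h1 := h.1 x hx
    have h2 := h'.1 x' hx'
    have h3 := h.2 x hx x' hx'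
    have h4 := h'.2 x hx x' hx'
    have := (norm_nonneg _).trans h2
    have e : B (f x) (g x) - B (f x') (g x') = B (f x) (g x - g x') + B (f x - f x') (g x') := by
      simp
    rw [e]
    calc _ ≤ ‖B‖ * ‖f x‖ * ‖g x - g x'‖ + ‖B‖ * ‖f x - f x'‖ * ‖g x'‖ :=
          (norm_add_le _ _).trans (add_le_add (B.le_opNorm₂ _ _) (B.le_opNorm₂ _ _))
      _ ≤ ‖B‖ * C * (C' * ‖x - x'‖ ^ α) + ‖B‖ * (C * ‖x - x'‖ ^ α) * C' := by gcongr
      _ = _ := by ring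

/-- `C^{m,α}` on the open set `U`, all derivatives being controlled by `C`. -/
structure CH (U : Set V) (α : ℝ) (m : ℕ) (C : ℝ) (f : V → Y) : Prop where
  contDiffOn : ContDiffOn ℝ m f U
  hol : ∀ k ≤ m, HolB U α C (iteratedFDeriv ℝ k f)

theorem CH.holB {m : ℕ} (h : CH U α m C f) : HolB U α C f := by
  have := h.hol 0 (Nat.zero_le _)
  rw [iteratedFDeriv_zero_eq_comp] at this
  exact (HolB.isometry (continuousMultilinearCurryFin0 ℝ V Y).symm.toLinearIsometry).1 this

theorem ch_zero_iff : CH U α 0 C f ↔ ContinuousOn f U ∧ HolB U α C f := by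
  refine ⟨fun h => ⟨h.contDiffOn.continuousOn, h.holB⟩, fun h => ⟨by simpa using h.1, ?_⟩⟩
  intro k hk
  obtain rfl : k = 0 := by omega
  rw [iteratedFDeriv_zero_eq_comp]
  exact (HolB.isometry (continuousMultilinearCurryFin0 ℝ V Y).symm.toLinearIsometry).2 h.2

theorem holB_iteratedFDeriv_succ {m : ℕ} : HolB U α C (iteratedFDeriv ℝ (m + 1) f) ↔
    HolB U α C (iteratedFDeriv ℝ m (fderiv ℝ f)) := by
  have e : ∀ x, iteratedFDeriv ℝ (m + 1) f x = (continuousMultilinearCurryRightEquiv' ℝ m V Y).symm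
      (iteratedFDeriv ℝ m (fderiv ℝ f) x) := fun x => iteratedFDeriv_succ_eq_comp_right
  have e1 : ∀ x, ‖iteratedFDeriv ℝ (m + 1) f x‖ = ‖iteratedFDeriv ℝ m (fderiv ℝ f) x‖ := fun x => by
    rw [e]; exact LinearIsometryEquiv.norm_map _ _
  have e2 : ∀ x x', ‖iteratedFDeriv ℝ (m + 1) f x - iteratedFDeriv ℝ (m + 1) f x'‖
      = ‖iteratedFDeriv ℝ m (fderiv ℝ f) x - iteratedFDeriv ℝ m (fderiv ℝ f) x'‖ := fun x x' => by
    rw [e, e]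
    exact (congrArg norm (LinearIsometryEquiv.map_sub _ _ _).symm).trans
      (LinearIsometryEquiv.norm_map _ _)
  simp only [HolB, e1, e2]

theorem ch_succ_iff (hU : IsOpen U) {m : ℕ} : CH U α (m + 1) C f ↔
    DifferentiableOn ℝ f U ∧ HolB U α C f ∧ CH U α m C (fderiv ℝ f) := by
  constructor
  · intro h
    have h1 : ContDiffOn ℝ (m + 1) f U := by exact_mod_cast h.contDiffOn
    have h2 := (contDiffOn_succ_iff_fderiv_of_isOpen hU).1 h1
    exact ⟨h2.1, h.holB, h2.2.2, fun k hk => holB_iteratedFDeriv_succ.1 (h.hol (k + 1) (by omega))⟩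
  · rintro ⟨h1, h2, h3⟩
    refine ⟨?_, fun k hk => ?_⟩
    · have := (contDiffOn_succ_iff_fderiv_of_isOpen (n := (m : ℕ∞)) hU).2 ⟨h1, by simp, h3.contDiffOn⟩
      exact_mod_cast this
    · cases k with
      | zero =>
        rw [iteratedFDeriv_zero_eq_comp]
        exact (HolB.isometry (continuousMultilinearCurryFin0 ℝ V Y).symm.toLinearIsometry).2 h2
      | succ k => exact holB_iteratedFDeriv_succ.2 (h3.hol k (by omega))

theorem CH.mono {m m' : ℕ} (h : CH U α m C f) (hm : m' ≤ m) (hU : U' ⊆ U) (hC : C ≤ C') :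
    CH U' α m' C' f :=
  ⟨(h.contDiffOn.mono hU).of_le (by exact_mod_cast hm),
    fun k hk => (h.hol k (hk.trans hm)).mono hU hC⟩

theorem CH.congr {m : ℕ} (hU : IsOpen U) (h : CH U α m C f) (he : ∀ x ∈ U, g x = f x) :
    CH U α m C g := by
  refine ⟨h.contDiffOn.congr he, fun k hk => (h.hol k hk).congr fun x hx => ?_⟩
  have : g =ᶠ[nhds x] f := by filter_upwards [hU.mem_nhds hx] with y hy using he y hy
  exact (this.iteratedFDeriv ℝ k).eq_of_nhds

theorem CH.contDiffAt {m : ℕ} (hU : IsOpen U) (h : CH U α m C f) {x : V} (hx : x ∈ U) :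
    ContDiffAt ℝ m f x := h.contDiffOn.contDiffAt (hU.mem_nhds hx)

theorem CH.add {m : ℕ} (hU : IsOpen U) (h : CH U α m C f) (h' : CH U α m C' g) :
    CH U α m (C + C') fun x => f x + g x := by
  refine ⟨h.contDiffOn.add h'.contDiffOn, fun k hk => ?_⟩
  refine ((h.hol k hk).add (h'.hol k hk)).congr fun x hx => ?_
  exact iteratedFDeriv_add_apply ((h.contDiffAt hU hx).of_le (by exact_mod_cast hk))
    ((h'.contDiffAt hU hx).of_le (by exact_mod_cast hk))

theorem CH.clm {m : ℕ} (hU : IsOpen U) (h : CH U α m C f) (L : Y →L[ℝ] Z) :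
    CH U α m (‖L‖ * C) fun x => L (f x) := by
  refine ⟨L.contDiff.comp_contDiffOn h.contDiffOn, fun k hk => ?_⟩
  have e : ∀ x ∈ U, iteratedFDeriv ℝ k (fun x => L (f x)) x
      = L.compContinuousMultilinearMap (iteratedFDeriv ℝ k f x) := fun x hx =>
    L.iteratedFDeriv_comp_left ((h.contDiffAt hU hx).of_le (by exact_mod_cast hk)) le_rfl
  refine ⟨fun x hx => ?_, fun x hx x' hx' => ?_⟩
  · rw [e x hx]
    refine (L.norm_compContinuousMultilinearMap_le _).trans ?_
    gcongr
    exact (h.hol k hk).1 x hx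
  · rw [e x hx, e x' hx', show L.compContinuousMultilinearMap (iteratedFDeriv ℝ k f x) -
      L.compContinuousMultilinearMap (iteratedFDeriv ℝ k f x') = L.compContinuousMultilinearMap
        (iteratedFDeriv ℝ k f x - iteratedFDeriv ℝ k f x') by ext; simp, mul_assoc]
    refine (L.norm_compContinuousMultilinearMap_le _).trans ?_
    gcongr
    exact (h.hol k hk).2 x hx x' hx'

theorem CH.nonneg {m : ℕ} (h : CH U α m C f) {x : V} (hx : x ∈ U) : 0 ≤ C :=
  (norm_nonneg _).trans (h.holB.1 x hx)

theorem ch_const {m : ℕ} {c : Y} (hc : ‖c‖ ≤ C) : CH U α m C fun _ => c := by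
  refine ⟨contDiffOn_const, fun k hk => ?_⟩
  cases k with
  | zero =>
    rw [iteratedFDeriv_zero_eq_comp]
    exact (HolB.isometry (continuousMultilinearCurryFin0 ℝ V Y).symm.toLinearIsometry).2
      (holB_const hc)
  | succ k =>
    rw [iteratedFDeriv_const_of_ne (by omega)]
    have : HolB U α C fun _ : V => (0 : V [×(k + 1)]→L[ℝ] Y) :=
      holB_const (by rw [norm_zero]; exact (norm_nonneg c).trans hc)
    exact this

theorem CH.bilinear (hU : IsOpen U) (m : ℕ) : ∀ {Y Z W : Type}
    [NormedAddCommGroup Y] [NormedSpace ℝ Y] [NormedAddCommGroup Z] [NormedSpace ℝ Z]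
    [NormedAddCommGroup W] [NormedSpace ℝ W] (B : Y →L[ℝ] Z →L[ℝ] W) {f : V → Y} {g : V → Z}
    {C C' : ℝ}, 0 ≤ C → CH U α m C f → CH U α m C' g →
    CH U α m (2 ^ (m + 1) * ‖B‖ * C * C') fun x => B (f x) (g x) := by
  rcases U.eq_empty_or_nonempty with rfl | ⟨x₀, hx₀⟩
  · intros; exact ⟨by simp, by simp [HolB]⟩
  induction m with
  | zero =>
    intro Y Z W _ _ _ _ _ _ B f g C C' hC h h'
    rw [ch_zero_iff] at h h' ⊢
    exact ⟨(B.continuous.comp_continuousOn h.1).clm_apply h'.1, by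
      simpa using h.2.bilinear B hC h'.2⟩
  | succ m ih =>
    intro Y Z W _ _ _ _ _ _ B f g C C' hC h h'
    have hC' := h'.nonneg hx₀
    have hd := (ch_succ_iff hU).1 h
    have hd' := (ch_succ_iff hU).1 h'
    have hder : ∀ x ∈ U, HasFDerivAt (fun x => B (f x) (g x))
        (B.precompR V (f x) (fderiv ℝ g x) + B.precompL V (fderiv ℝ f x) (g x)) x := fun x hx =>
      B.hasFDerivAt_of_bilinear ((hd.1 x hx).differentiableAt (hU.mem_nhds hx)).hasFDerivAt
        ((hd'.1 x hx).differentiableAt (hU.mem_nhds hx)).hasFDerivAt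
    refine (ch_succ_iff hU).2 ⟨fun x hx => (hder x hx).differentiableAt.differentiableWithinAt,
      ?_, ?_⟩
    · refine (hd.2.1.bilinear B hC hd'.2.1).mono le_rfl ?_
      gcongr
      exact le_self_pow₀ (by norm_num) (by omega)
    · have h1 := ih (B.precompR V) hC (h.mono (by omega) le_rfl le_rfl) hd'.2.2
      have h2 := ih (B.precompL V) hC hd.2.2 (h'.mono (Nat.le_succ m) le_rfl le_rfl)
      refine ((h1.add hU h2).congr hU fun x hx => (hder x hx).fderiv).mono le_rfl le_rfl ?_
      have e1 := B.norm_precompR_le V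
      have e2 := B.norm_precompL_le V
      calc _ ≤ 2 ^ (m + 1) * ‖B‖ * C * C' + 2 ^ (m + 1) * ‖B‖ * C * C' := by gcongr
        _ = _ := by ring

/-- Difference quotient in the direction `y`. -/
def dq (y : V) (f : V → Y) (x : V) : Y := ‖y‖⁻¹ • (f (x + y) - f x)

theorem HolB.dq (hU : IsOpen U) (hc : Convex ℝ U) (hC : 0 ≤ C) (hd : DifferentiableOn ℝ f U)
    (h : HolB U α C (fderiv ℝ f)) {y : V} (hU' : ∀ x ∈ U', x ∈ U ∧ x + y ∈ U) :
    HolB U' α C (dq y f) := by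
  have hda : ∀ x ∈ U, DifferentiableAt ℝ f x := fun x hx =>
    (hd x hx).differentiableAt (hU.mem_nhds hx)
  have hy : ‖y‖⁻¹ * ‖y‖ ≤ 1 := inv_mul_le_one
  refine ⟨fun x hx => ?_, fun x hx x' hx' => ?_⟩
  · have := hc.norm_image_sub_le_of_norm_fderiv_le hda h.1 (hU' x hx).1 (hU' x hx).2
    rw [add_sub_cancel_left] at this
    rw [ParabolicBootstrap.dq, norm_smul, norm_inv, norm_norm]
    calc _ ≤ ‖y‖⁻¹ * (C * ‖y‖) := by gcongr
      _ = C * (‖y‖⁻¹ * ‖y‖) := by ring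
      _ ≤ C * 1 := by gcongr
      _ = C := mul_one C
  · have hseg : ∀ z ∈ segment ℝ x (x + y), z ∈ U ∧ z + (x' - x) ∈ U := by
      rintro z ⟨a, b, ha, hb, hab, rfl⟩
      refine ⟨hc (hU' x hx).1 (hU' x hx).2 ha hb hab, ?_⟩
      have := hc (hU' x' hx').1 (hU' x' hx').2 ha hb hab
      convert this using 1
      obtain rfl : a = 1 - b := by linarith
      module
    have hder : ∀ z ∈ segment ℝ x (x + y), HasFDerivWithinAt (fun z => f z - f (z + (x' - x)))
        (fderiv ℝ f z - fderiv ℝ f (z + (x' - x))) (segment ℝ x (x + y)) z := fun z hz => by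
      have h2 := (hda _ (hseg z hz).2).hasFDerivAt
      exact ((hda z (hseg z hz).1).hasFDerivAt.sub
        ((hasFDerivAt_comp_add_right (x' - x)).2 h2)).hasFDerivWithinAt
    have := (convex_segment x (x + y)).norm_image_sub_le_of_norm_hasFDerivWithin_le hder
      (C := C * ‖x - x'‖ ^ α) (fun z hz => by
        have := h.2 z (hseg z hz).1 _ (hseg z hz).2
        rwa [show z - (z + (x' - x)) = x - x' by abel] at this)
      (left_mem_segment ℝ x (x + y)) (right_mem_segment ℝ x (x + y))
    rw [add_sub_cancel_left] at this
    rw [ParabolicBootstrap.dq, ParabolicBootstrap.dq, ← smul_sub, norm_smul, norm_inv, norm_norm]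
    have e : f (x + y) - f x - (f (x' + y) - f x')
        = f (x + y) - f (x + y + (x' - x)) - (f x - f (x + (x' - x))) := by
      rw [show x + y + (x' - x) = x' + y by abel, show x + (x' - x) = x' by abel]; abel
    rw [e]
    calc _ ≤ ‖y‖⁻¹ * (C * ‖x - x'‖ ^ α * ‖y‖) := by gcongr
      _ = C * ‖x - x'‖ ^ α * (‖y‖⁻¹ * ‖y‖) := by ring
      _ ≤ C * ‖x - x'‖ ^ α * 1 := by gcongr
      _ = _ := mul_one _

theorem iteratedFDeriv_dq {y : V} {m : ℕ} {x : V} (h : ContDiffAt ℝ m f x)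
    (h' : ContDiffAt ℝ m f (x + y)) :
    iteratedFDeriv ℝ m (dq y f) x = dq y (iteratedFDeriv ℝ m f) x := by
  have h2 : ContDiffAt ℝ m (fun x => f (x + y)) x :=
    ContDiffAt.comp x (f := fun x => x + y) h' (by fun_prop)
  have h3 := iteratedFDeriv_const_smul_apply' (a := ‖y‖⁻¹) (h2.sub h)
  have h4 := iteratedFDeriv_sub_apply h2 h
  rw [iteratedFDeriv_comp_add_right] at h4
  unfold dq
  rw [h3]
  exact congrArg (‖y‖⁻¹ • ·) h4

theorem CH.dq (hU : IsOpen U) (hU'o : IsOpen U') (hc : Convex ℝ U) {m : ℕ}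
    (h : CH U α (m + 1) C f) {y : V} (hU' : ∀ x ∈ U', x ∈ U ∧ x + y ∈ U) :
    CH U' α m C (dq y f) := by
  rcases U.eq_empty_or_nonempty with rfl | ⟨x₀, hx₀⟩
  · obtain rfl : U' = ∅ := by
      ext x; simp only [Set.mem_empty_iff_false, iff_false]; exact fun hx => (hU' x hx).1
    exact ⟨by simp, by simp [HolB]⟩
  have hC := h.nonneg hx₀
  have hle : ∀ k ≤ m + 1, ∀ x ∈ U, ContDiffAt ℝ k f x := fun k hk x hx =>
    (h.contDiffAt hU hx).of_le (by exact_mod_cast hk)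
  refine ⟨fun x hx => ContDiffAt.contDiffWithinAt ?_, fun k hk => ?_⟩
  · refine ContDiffAt.const_smul _ (ContDiffAt.sub ?_ (hle m (by omega) x (hU' x hx).1))
    exact ContDiffAt.comp x (f := fun x => x + y) (hle m (by omega) _ (hU' x hx).2) (by fun_prop)
  · have h1 : HolB U α C (fderiv ℝ (iteratedFDeriv ℝ k f)) := by
      have := h.hol (k + 1) (by omega)
      rw [iteratedFDeriv_succ_eq_comp_left] at this
      exact (HolB.isometry
        (continuousMultilinearCurryLeftEquiv ℝ (fun _ => V) Y).symm.toLinearIsometry).1 this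
    have h2 : DifferentiableOn ℝ (iteratedFDeriv ℝ k f) U := fun x hx =>
      ((hle (m + 1) le_rfl x hx).differentiableAt_iteratedFDeriv
        (by exact_mod_cast Nat.lt_succ_of_le hk)).differentiableWithinAt
    refine (HolB.dq hU hc hC h2 h1 hU').congr fun x hx => ?_
    exact iteratedFDeriv_dq (hle k (by omega) x (hU' x hx).1) (hle k (by omega) _ (hU' x hx).2)

end Holder

section Reg
variable {V : Type} [NormedAddCommGroup V] [NormedSpace ℝ V]
  {Y : Type} [NormedAddCommGroup Y] [NormedSpace ℝ Y]
  {Z : Type} [NormedAddCommGroup Z] [NormedSpace ℝ Z]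
  {W : Type} [NormedAddCommGroup W] [NormedSpace ℝ W]

/-- Spatial `C^{m,α}` regularity on `U`, uniform in `t ∈ [0,T]`, with jointly continuous spatial
derivatives. -/
structure Reg (U : Set V) (α T : ℝ) (m : ℕ) (f : ℝ → V → Y) : Prop where
  bound : ∃ C, 0 ≤ C ∧ ∀ t ∈ Set.Icc 0 T, CH U α m C (f t)
  cont : ∀ k ≤ m, ContinuousOn (fun p : ℝ × V => iteratedFDeriv ℝ k (f p.1) p.2)
    (Set.Icc 0 T ×ˢ U)

variable {U U' : Set V} {α T T' : ℝ} {f g : ℝ → V → Y} {m : ℕ}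

theorem Reg.mono {m' : ℕ} (h : Reg U α T m f) (hm : m' ≤ m) (hU : U' ⊆ U) (hT : T' ≤ T) :
    Reg U' α T' m' f := by
  obtain ⟨C, hC, h1⟩ := h.bound
  exact ⟨⟨C, hC, fun t ht => (h1 t ⟨ht.1, ht.2.trans hT⟩).mono hm hU le_rfl⟩,
    fun k hk => (h.cont k (hk.trans hm)).mono (Set.prod_mono (Set.Icc_subset_Icc_right hT) hU)⟩

theorem Reg.continuousOn (h : Reg U α T m f) :
    ContinuousOn (fun p : ℝ × V => f p.1 p.2) (Set.Icc 0 T ×ˢ U) := by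
  have := h.cont 0 (Nat.zero_le _)
  simp only [iteratedFDeriv_zero_eq_comp] at this
  have h2 := (continuousMultilinearCurryFin0 ℝ V Y).continuous.comp_continuousOn this
  simpa [Function.comp_def] using h2

theorem reg_zero_iff : Reg U α T 0 f ↔
    ContinuousOn (fun p : ℝ × V => f p.1 p.2) (Set.Icc 0 T ×ˢ U) ∧
      ∃ C, 0 ≤ C ∧ ∀ t ∈ Set.Icc 0 T, HolB U α C (f t) := by
  constructor
  · intro h
    obtain ⟨C, hC, h1⟩ := h.bound
    exact ⟨h.continuousOn, C, hC, fun t ht => (h1 t ht).holB⟩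
  · rintro ⟨h1, C, hC, h2⟩
    refine ⟨⟨C, hC, fun t ht => ch_zero_iff.2 ⟨?_, h2 t ht⟩⟩, fun k hk => ?_⟩
    · exact h1.comp (f := fun x => (t, x)) (by fun_prop) fun x hx => ⟨ht, hx⟩
    · obtain rfl : k = 0 := by omega
      simp only [iteratedFDeriv_zero_eq_comp]
      exact (continuousMultilinearCurryFin0 ℝ V Y).symm.continuous.comp_continuousOn h1

theorem Reg.differentiableOn (hU : IsOpen U) (h : Reg U α T (m + 1) f) {t : ℝ}
    (ht : t ∈ Set.Icc 0 T) : DifferentiableOn ℝ (f t) U := by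
  obtain ⟨C, hC, h1⟩ := h.bound
  exact ((ch_succ_iff hU).1 (h1 t ht)).1

theorem reg_succ_iff (hU : IsOpen U) : Reg U α T (m + 1) f ↔
    (∀ t ∈ Set.Icc 0 T, DifferentiableOn ℝ (f t) U) ∧ Reg U α T 0 f ∧
      Reg U α T m (fun t => fderiv ℝ (f t)) := by
  have e : ∀ k, (fun p : ℝ × V => iteratedFDeriv ℝ (k + 1) (f p.1) p.2)
      = fun p => (continuousMultilinearCurryRightEquiv' ℝ k V Y).symm
      (iteratedFDeriv ℝ k (fderiv ℝ (f p.1)) p.2) := fun k =>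
    funext fun p => iteratedFDeriv_succ_eq_comp_right
  have e' : ∀ k, (fun p : ℝ × V => iteratedFDeriv ℝ k (fderiv ℝ (f p.1)) p.2)
      = fun p => (continuousMultilinearCurryRightEquiv' ℝ k V Y)
      (iteratedFDeriv ℝ (k + 1) (f p.1) p.2) := fun k => by
    funext p; rw [congrFun (e k) p]
    exact ((continuousMultilinearCurryRightEquiv' ℝ k V Y).apply_symm_apply _).symm
  constructor
  · intro h
    obtain ⟨C, hC, h1⟩ := h.bound
    refine ⟨fun t ht => h.differentiableOn hU ht, h.mono (Nat.zero_le _) le_rfl le_rfl,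
      ⟨C, hC, fun t ht => ((ch_succ_iff hU).1 (h1 t ht)).2.2⟩, fun k hk => ?_⟩
    rw [e']
    exact (continuousMultilinearCurryRightEquiv' ℝ k V Y).continuous.comp_continuousOn
      (h.cont (k + 1) (by omega))
  · rintro ⟨h1, h2, h3⟩
    obtain ⟨C, hC, h4⟩ := h2.bound
    obtain ⟨C', hC', h5⟩ := h3.bound
    refine ⟨⟨max C C', le_max_of_le_left hC, fun t ht => (ch_succ_iff hU).2 ⟨h1 t ht,
      (h4 t ht).holB.mono le_rfl (le_max_left _ _),
      (h5 t ht).mono le_rfl le_rfl (le_max_right _ _)⟩⟩, fun k hk => ?_⟩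
    cases k with
    | zero => exact h2.cont 0 le_rfl
    | succ k =>
      rw [e]
      exact (continuousMultilinearCurryRightEquiv' ℝ k V Y).symm.continuous.comp_continuousOn
        (h3.cont k (by omega))

theorem Reg.congr (hU : IsOpen U) (h : Reg U α T m f)
    (he : ∀ t ∈ Set.Icc 0 T, ∀ x ∈ U, g t x = f t x) : Reg U α T m g := by
  obtain ⟨C, hC, h1⟩ := h.bound
  refine ⟨⟨C, hC, fun t ht => (h1 t ht).congr hU (he t ht)⟩, fun k hk => (h.cont k hk).congr ?_⟩
  rintro ⟨t, x⟩ ⟨ht, hx⟩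
  have : g t =ᶠ[nhds x] f t := by filter_upwards [hU.mem_nhds hx] with y hy using he t ht y hy
  exact (this.iteratedFDeriv ℝ k).eq_of_nhds

theorem Reg.add (hU : IsOpen U) (h : Reg U α T m f) (h' : Reg U α T m g) :
    Reg U α T m fun t x => f t x + g t x := by
  obtain ⟨C, hC, h1⟩ := h.bound
  obtain ⟨C', hC', h2⟩ := h'.bound
  refine ⟨⟨C + C', by positivity, fun t ht => (h1 t ht).add hU (h2 t ht)⟩, fun k hk => ?_⟩
  refine ((h.cont k hk).add (h'.cont k hk)).congr ?_
  rintro ⟨t, x⟩ ⟨ht, hx⟩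
  exact iteratedFDeriv_add_apply (((h1 t ht).contDiffAt hU hx).of_le (by exact_mod_cast hk))
    (((h2 t ht).contDiffAt hU hx).of_le (by exact_mod_cast hk))

theorem Reg.clm (hU : IsOpen U) (h : Reg U α T m f) (L : Y →L[ℝ] Z) :
    Reg U α T m fun t x => L (f t x) := by
  obtain ⟨C, hC, h1⟩ := h.bound
  refine ⟨⟨‖L‖ * C, by positivity, fun t ht => (h1 t ht).clm hU L⟩, fun k hk => ?_⟩
  have h2 := (ContinuousLinearMap.compContinuousMultilinearMapL ℝ (fun _ : Fin k => V) Y Z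
    L).continuous.comp_continuousOn (h.cont k hk)
  refine h2.congr ?_
  rintro ⟨t, x⟩ ⟨ht, hx⟩
  exact L.iteratedFDeriv_comp_left (((h1 t ht).contDiffAt hU hx).of_le (by exact_mod_cast hk))
    le_rfl

theorem reg_const_space {c : ℝ → Y} (hc : ContinuousOn c (Set.Icc 0 T)) :
    Reg U α T m fun t _ => c t := by
  obtain ⟨C, hC⟩ := isCompact_Icc.exists_bound_of_continuousOn hc
  refine ⟨⟨max C 0, le_max_right _ _, fun t ht => ch_const ((hC t ht).trans (le_max_left _ _))⟩,
    fun k hk => ?_⟩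
  have h1 : ContinuousOn (fun p : ℝ × V => c p.1) (Set.Icc 0 T ×ˢ U) :=
    hc.comp continuousOn_fst fun p hp => hp.1
  cases k with
  | zero =>
    simp only [iteratedFDeriv_zero_eq_comp]
    exact (continuousMultilinearCurryFin0 ℝ V Y).symm.continuous.comp_continuousOn h1
  | succ k =>
    have : (fun p : ℝ × V => iteratedFDeriv ℝ (k + 1) (fun _ : V => c p.1) p.2) = fun _ => 0 := by
      funext p; rw [iteratedFDeriv_const_of_ne (by omega)]; rfl
    rw [this]; exact continuousOn_const

theorem Reg.sum {ι : Type} (hU : IsOpen U) (s : Finset ι) {f : ι → ℝ → V → Y}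
    (h : ∀ i ∈ s, Reg U α T m (f i)) : Reg U α T m fun t x => ∑ i ∈ s, f i t x := by
  classical
  induction s using Finset.induction_on with
  | empty =>
    simpa using reg_const_space (U := U) (α := α) (T := T) (m := m) (c := fun _ => (0 : Y))
      continuousOn_const
  | insert i s hi ih =>
    simp only [Finset.sum_insert hi]
    exact (h i (by simp)).add hU (ih fun j hj => h j (by simp [hj]))

theorem Reg.bilinear (hU : IsOpen U) (m : ℕ) : ∀ {Y Z W : Type}
    [NormedAddCommGroup Y] [NormedSpace ℝ Y] [NormedAddCommGroup Z] [NormedSpace ℝ Z]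
    [NormedAddCommGroup W] [NormedSpace ℝ W] (B : Y →L[ℝ] Z →L[ℝ] W) {f : ℝ → V → Y}
    {g : ℝ → V → Z}, Reg U α T m f → Reg U α T m g →
    Reg U α T m fun t x => B (f t x) (g t x) := by
  induction m with
  | zero =>
    intro Y Z W _ _ _ _ _ _ B f g h h'
    rw [reg_zero_iff] at h h' ⊢
    obtain ⟨h1, C, hC, h2⟩ := h
    obtain ⟨h1', C', hC', h2'⟩ := h'
    exact ⟨(B.continuous.comp_continuousOn h1).clm_apply h1', 2 * ‖B‖ * C * C', by positivity,
      fun t ht => (h2 t ht).bilinear B hC (h2' t ht)⟩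
  | succ m ih =>
    intro Y Z W _ _ _ _ _ _ B f g h h'
    have hd := (reg_succ_iff hU).1 h
    have hd' := (reg_succ_iff hU).1 h'
    have hder : ∀ t ∈ Set.Icc 0 T, ∀ x ∈ U, HasFDerivAt (fun x => B (f t x) (g t x))
        (B.precompR V (f t x) (fderiv ℝ (g t) x) + B.precompL V (fderiv ℝ (f t) x) (g t x)) x :=
      fun t ht x hx => B.hasFDerivAt_of_bilinear
        ((hd.1 t ht x hx).differentiableAt (hU.mem_nhds hx)).hasFDerivAt
        ((hd'.1 t ht x hx).differentiableAt (hU.mem_nhds hx)).hasFDerivAt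
    refine (reg_succ_iff hU).2 ⟨fun t ht x hx =>
      (hder t ht x hx).differentiableAt.differentiableWithinAt, ?_, ?_⟩
    · obtain ⟨h1, C, hC, h2⟩ := reg_zero_iff.1 hd.2.1
      obtain ⟨h1', C', hC', h2'⟩ := reg_zero_iff.1 hd'.2.1
      exact reg_zero_iff.2 ⟨(B.continuous.comp_continuousOn h1).clm_apply h1',
        2 * ‖B‖ * C * C', by positivity, fun t ht => (h2 t ht).bilinear B hC (h2' t ht)⟩
    · have h1 := ih (B.precompR V) (h.mono (Nat.le_succ m) le_rfl le_rfl) hd'.2.2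
      have h2 := ih (B.precompL V) hd.2.2 (h'.mono (Nat.le_succ m) le_rfl le_rfl)
      exact (h1.add hU h2).congr hU fun t ht x hx => (hder t ht x hx).fderiv

theorem Reg.iteratedFDeriv_reg (hU : IsOpen U) (k : ℕ) : ∀ {m : ℕ}, Reg U α T (m + k) f →
    Reg U α T m (fun t => iteratedFDeriv ℝ k (f t)) := by
  induction k with
  | zero =>
    intro m h
    simp only [iteratedFDeriv_zero_eq_comp]
    exact h.clm hU ((continuousMultilinearCurryFin0 ℝ V Y).symm.toContinuousLinearEquiv :
      Y →L[ℝ] V [×0]→L[ℝ] Y)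
  | succ k ih =>
    intro m h
    have h1 : Reg U α T (m + 1) (fun t => iteratedFDeriv ℝ k (f t)) :=
      ih (by convert h using 1; omega)
    have h2 := ((reg_succ_iff hU).1 h1).2.2
    simp only [iteratedFDeriv_succ_eq_comp_left]
    exact h2.clm hU ((continuousMultilinearCurryLeftEquiv ℝ (fun _ : Fin (k + 1) => V)
      Y).symm.toContinuousLinearEquiv : (V →L[ℝ] V [×k]→L[ℝ] Y) →L[ℝ] V [×(k + 1)]→L[ℝ] Y)

theorem reg_of_iteratedFDeriv (hU : IsOpen U) (m : ℕ) : ∀ {Y : Type} [NormedAddCommGroup Y]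
    [NormedSpace ℝ Y] {f : ℝ → V → Y}, Reg U α T m f →
    Reg U α T 1 (fun t => iteratedFDeriv ℝ m (f t)) → Reg U α T (m + 1) f := by
  induction m with
  | zero =>
    intro Y _ _ f _ h
    have := h.clm hU ((continuousMultilinearCurryFin0 ℝ V Y).toContinuousLinearEquiv :
      (V [×0]→L[ℝ] Y) →L[ℝ] Y)
    simpa using this
  | succ m ih =>
    intro Y _ _ f h h'
    have hd := (reg_succ_iff hU).1 h
    refine (reg_succ_iff hU).2 ⟨hd.1, hd.2.1, ih hd.2.2 ?_⟩
    refine (h'.clm hU ((continuousMultilinearCurryRightEquiv' ℝ m V Y).toContinuousLinearEquiv :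
      (V [×(m + 1)]→L[ℝ] Y) →L[ℝ] V [×m]→L[ℝ] V →L[ℝ] Y)).congr hU fun t ht x hx => ?_
    rw [iteratedFDeriv_succ_eq_comp_right]
    exact ((continuousMultilinearCurryRightEquiv' ℝ m V Y).apply_symm_apply _).symm

theorem reg_comp (hU : IsOpen U) {E : Type} [NormedAddCommGroup E] [NormedSpace ℝ E]
    {S : Set E} (hSc : IsCompact S) (hScv : Convex ℝ S) (hSu : UniqueDiffOn ℝ S) (m : ℕ) :
    ∀ {Y : Type} [NormedAddCommGroup Y] [NormedSpace ℝ Y] {G : E → Y} {q : ℝ → V → E},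
    ContDiffOn ℝ (m + 1) G S → Reg U α T m q → (∀ t ∈ Set.Icc 0 T, ∀ x ∈ U, q t x ∈ S) →
    Reg U α T m fun t x => G (q t x) := by
  have base : ∀ {Y : Type} [NormedAddCommGroup Y] [NormedSpace ℝ Y] {G : E → Y} {q : ℝ → V → E},
    ContDiffOn ℝ 1 G S → Reg U α T 0 q → (∀ t ∈ Set.Icc 0 T, ∀ x ∈ U, q t x ∈ S) →
    Reg U α T 0 fun t x => G (q t x) := by
    intro Y _ _ G q hG hq hS
    obtain ⟨h1, C, hC, h2⟩ := reg_zero_iff.1 hq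
    obtain ⟨B, hB⟩ := hSc.exists_bound_of_continuousOn hG.continuousOn
    obtain ⟨L, hL⟩ := hSc.exists_bound_of_continuousOn (hG.continuousOn_fderivWithin hSu le_rfl)
    have hlip : ∀ p ∈ S, ∀ p' ∈ S, ‖G p - G p'‖ ≤ max L 0 * ‖p - p'‖ := fun p hp p' hp' =>
      hScv.norm_image_sub_le_of_norm_fderivWithin_le (hG.differentiableOn (by simp))
        (fun z hz => (hL z hz).trans (le_max_left _ _)) hp' hp
    refine reg_zero_iff.2 ⟨hG.continuousOn.comp h1 fun p hp => hS p.1 hp.1 p.2 hp.2,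
      max B 0 + max L 0 * C, by positivity, fun t ht => ⟨fun x hx => ?_, fun x hx x' hx' => ?_⟩⟩
    · have h3 : 0 ≤ max L 0 * C := by positivity
      have := (hB _ (hS t ht x hx)).trans (le_max_left B 0)
      linarith
    · refine (hlip _ (hS t ht x hx) _ (hS t ht x' hx')).trans ?_
      calc _ ≤ max L 0 * (C * ‖x - x'‖ ^ α) := by
            gcongr; exact (h2 t ht).2 x hx x' hx'
        _ ≤ max B 0 * ‖x - x'‖ ^ α + max L 0 * (C * ‖x - x'‖ ^ α) := by
            have : 0 ≤ max B 0 * ‖x - x'‖ ^ α := by positivity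
            linarith
        _ = _ := by ring
  induction m with
  | zero =>
    intro Y _ _ G q hG hq hS
    exact base (by simpa using hG) hq hS
  | succ m ih =>
    intro Y _ _ G q hG hq hS
    have hd := (reg_succ_iff hU).1 hq
    have hG1 : ContDiffOn ℝ 1 G S := hG.of_le (by exact_mod_cast Nat.le_add_left 1 (m + 1))
    have hG' : ContDiffOn ℝ (m + 1) (fderivWithin ℝ G S) S :=
      hG.fderivWithin hSu (by exact_mod_cast le_rfl)
    have hder : ∀ t ∈ Set.Icc 0 T, ∀ x ∈ U, HasFDerivAt (fun x => G (q t x))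
        ((fderivWithin ℝ G S (q t x)).comp (fderiv ℝ (q t) x)) x := fun t ht x hx => by
      have h1 := (hG1.differentiableOn (by simp) _ (hS t ht x hx)).hasFDerivWithinAt
      have h2 := ((hd.1 t ht x hx).differentiableAt (hU.mem_nhds hx)).hasFDerivAt
      exact (h1.comp x (h2.hasFDerivWithinAt (s := U)) (hS t ht)).hasFDerivAt (hU.mem_nhds hx)
    refine (reg_succ_iff hU).2 ⟨fun t ht x hx =>
      (hder t ht x hx).differentiableAt.differentiableWithinAt, base hG1 hd.2.1 hS, ?_⟩
    exact (Reg.bilinear hU m (ContinuousLinearMap.compL ℝ V E Y)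
      (ih hG' (hq.mono (Nat.le_succ m) le_rfl le_rfl) hS) hd.2.2).congr hU
      fun t ht x hx => (hder t ht x hx).fderiv

theorem Reg.prodMk (hU : IsOpen U) {g : ℝ → V → Z} (h : Reg U α T m f) (h' : Reg U α T m g) :
    Reg U α T m fun t x => (f t x, g t x) := by
  simpa using (h.clm hU (ContinuousLinearMap.inl ℝ Y Z)).add hU
    (h'.clm hU (ContinuousLinearMap.inr ℝ Y Z))

theorem reg_id (hU : IsOpen U) (hUb : Bornology.IsBounded U) (hα0 : 0 ≤ α) (hα1 : α ≤ 1) :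
    Reg U α T m fun _ x => x := by
  obtain ⟨d, hd⟩ := hUb.exists_norm_le
  have h0 : Reg U α T 0 fun _ x => x := by
    refine reg_zero_iff.2 ⟨continuousOn_snd, 1 + (max d 0 + max d 0), by positivity,
      fun t ht => ⟨fun x hx => ?_, fun x hx x' hx' => ?_⟩⟩
    · have := hd x hx
      have h1 := le_max_left d 0
      have h2 := le_max_right d 0
      linarith
    · have h1 : ‖x - x'‖ ≤ max d 0 + max d 0 := (norm_sub_le _ _).trans
        (add_le_add ((hd x hx).trans (le_max_left _ _)) ((hd x' hx').trans (le_max_left _ _)))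
      rcases (norm_nonneg (x - x')).eq_or_lt with h2 | h2
      · rw [← h2]; positivity
      · have h3 := rpow_le_one_add (α := 1 - α) h2.le (by linarith) (by linarith)
        calc ‖x - x'‖ = ‖x - x'‖ ^ (1 - α) * ‖x - x'‖ ^ α := by
              rw [← Real.rpow_add h2]; simp
          _ ≤ _ := by gcongr; linarith
  cases m with
  | zero => exact h0
  | succ m =>
    refine (reg_succ_iff hU).2 ⟨fun t ht => differentiableOn_id, h0, ?_⟩
    have := reg_const_space (U := U) (α := α) (T := T) (m := m)
      (c := fun _ => ContinuousLinearMap.id ℝ V) continuousOn_const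
    refine this.congr hU fun t ht x hx => ?_
    exact fderiv_fun_id

end Reg

section Increment
open Filter Topology
variable {V : Type} [NormedAddCommGroup V] [InnerProductSpace ℝ V] [FiniteDimensional ℝ V]
  {Y : Type} [NormedAddCommGroup Y] [NormedSpace ℝ Y]
  {c : V} {R R' δ α C T : ℝ} {g : V → Y}

/-- All difference quotients with small increments are bounded and Hölder on the ball. -/
def IncBound (c : V) (R δ α C : ℝ) (g : V → Y) : Prop :=
  ∀ y, 0 < ‖y‖ → ‖y‖ < δ → HolB (Metric.ball c R) α C (dq y g)

theorem smul_dq {y : V} (hy : 0 < ‖y‖) (x : V) : ‖y‖ • dq y g x = g (x + y) - g x := by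
  rw [dq, smul_smul, mul_inv_cancel₀ hy.ne', one_smul]

theorem mem_ball_add {x y : V} (hR : R' + δ ≤ R) (hx : x ∈ Metric.ball c R') (hy : ‖y‖ < δ) :
    x + y ∈ Metric.ball c R := by
  rw [mem_ball_iff_norm] at *
  calc ‖x + y - c‖ = ‖(x - c) + y‖ := by congr 1; abel
    _ ≤ ‖x - c‖ + ‖y‖ := norm_add_le _ _
    _ < R := by linarith

theorem IncBound.telescope (h : IncBound c R δ α C g) (hα : 0 ≤ α) (hC : 0 ≤ C) (hR : R' + δ ≤ R)
    {x y : V} (hx : x ∈ Metric.ball c R') (hy0 : 0 < ‖y‖) (hy : ‖y‖ < δ) {m : ℕ} (hm : 0 < m) :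
    ‖g (x + y) - g x - (m : ℝ) • (g (x + (m : ℝ)⁻¹ • y) - g x)‖ ≤ C * ‖y‖ * ‖y‖ ^ α := by
  have hm' : (0 : ℝ) < m := by exact_mod_cast hm
  have hR' : x ∈ Metric.ball c R := by simpa using mem_ball_add hR hx (y := 0) (by simpa using hy0.trans hy)
  set e := (m : ℝ)⁻¹ • y with he
  have hen : ‖e‖ = (m : ℝ)⁻¹ * ‖y‖ := by rw [he, norm_smul, Real.norm_of_nonneg (by positivity)]
  have he0 : 0 < ‖e‖ := by rw [hen]; positivity
  have h1m : (1 : ℝ) ≤ m := by exact_mod_cast hm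
  have hed : ‖e‖ < δ := by
    rw [hen]; refine lt_of_le_of_lt ?_ hy
    exact mul_le_of_le_one_left hy0.le (inv_le_one_of_one_le₀ h1m)
  have hsum : g (x + y) - g x = ∑ i ∈ Finset.range m,
      (g (x + (i : ℝ) • e + e) - g (x + (i : ℝ) • e)) := by
    have := Finset.sum_range_sub (fun i : ℕ => g (x + (i : ℝ) • e)) m
    simp only [Nat.cast_zero, zero_smul, add_zero] at this
    rw [he, smul_smul, mul_inv_cancel₀ hm'.ne', one_smul, ← he] at this
    rw [← this]
    refine Finset.sum_congr rfl fun i _ => ?_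
    push_cast
    rw [add_smul, one_smul, add_assoc]
  have hconst : (m : ℝ) • (g (x + e) - g x) = ∑ i ∈ Finset.range m, (g (x + e) - g x) := by
    rw [Finset.sum_const, Finset.card_range, Nat.cast_smul_eq_nsmul]
  rw [hsum, hconst, ← Finset.sum_sub_distrib]
  refine (norm_sum_le_of_le (f := _) (n := fun _ => ‖e‖ * (C * ‖y‖ ^ α)) _ fun i hi => ?_).trans ?_
  · rw [← smul_dq he0, ← smul_dq he0, ← smul_sub, norm_smul, norm_norm]
    have hi' : (i : ℝ) ≤ m := by exact_mod_cast (Finset.mem_range.1 hi).le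
    have hie : ‖(i : ℝ) • e‖ ≤ ‖y‖ := by
      rw [norm_smul, hen, Real.norm_of_nonneg (by positivity), ← mul_assoc]
      refine mul_le_of_le_one_left hy0.le ?_
      rw [← div_eq_mul_inv]; exact div_le_one_of_le₀ hi' hm'.le
    refine mul_le_mul_of_nonneg_left (((h e he0 hed).2 _ (mem_ball_add hR hx
      (hie.trans_lt hy)) x hR').trans ?_) (norm_nonneg _)
    rw [add_sub_cancel_left]
    gcongr
  · rw [Finset.sum_const, Finset.card_range, nsmul_eq_mul, hen]
    apply le_of_eq; field_simp

theorem IncBound.lipschitz (h : IncBound c R δ α C g) (hC : 0 ≤ C) {x y : V}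
    (hx : x ∈ Metric.ball c R) (hy : ‖y‖ < δ) : ‖g (x + y) - g x‖ ≤ C * ‖y‖ := by
  rcases (norm_nonneg y).eq_or_lt with h0 | h0
  · have : y = 0 := by simpa using h0.symm
    simp [this]
  · rw [← smul_dq h0, norm_smul, norm_norm, mul_comm]
    gcongr
    exact (h y h0 hy).1 x hx

theorem tendsto_smul_slope {x y : V} {L : V →L[ℝ] Y} (hd : HasFDerivAt g L x) :
    Tendsto (fun m : ℕ => (m : ℝ) • (g (x + (m : ℝ)⁻¹ • y) - g x)) atTop (𝓝 (L y)) :=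
  (hd.lim_real y).comp tendsto_natCast_atTop_atTop

theorem IncBound.taylor (h : IncBound c R δ α C g) (hα : 0 ≤ α) (hC : 0 ≤ C) (hR : R' + δ ≤ R)
    {x y : V} (hx : x ∈ Metric.ball c R') (hy : ‖y‖ < δ) {L : V →L[ℝ] Y}
    (hd : HasFDerivAt g L x) : ‖g (x + y) - g x - L y‖ ≤ C * ‖y‖ * ‖y‖ ^ α := by
  rcases (norm_nonneg y).eq_or_lt with h0 | h0
  · have : y = 0 := by simpa using h0.symm
    simp only [this, add_zero, sub_self, map_zero, norm_zero, mul_zero, zero_mul, le_refl]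
  · refine le_of_tendsto ((tendsto_const_nhds.sub (tendsto_smul_slope (y := y) hd)).norm) ?_
    filter_upwards [eventually_gt_atTop 0] with m hm
    exact h.telescope hα hC hR hx h0 hy hm

theorem IncBound.fderiv_sub_le (h : IncBound c R δ α C g) (hδ : 0 < δ) (hC : 0 ≤ C)
    {x x' : V} (hx : x ∈ Metric.ball c R) (hx' : x' ∈ Metric.ball c R) {L L' : V →L[ℝ] Y}
    (hd : HasFDerivAt g L x) (hd' : HasFDerivAt g L' x') : ‖L - L'‖ ≤ C * ‖x - x'‖ ^ α := by
  refine ContinuousLinearMap.opNorm_le_bound _ (by positivity) fun y => ?_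
  rcases (norm_nonneg y).eq_or_lt with h0 | h0
  · have : y = 0 := by simpa using h0.symm
    simp [this]
  have hlim : Tendsto (fun m : ℕ => (m : ℝ)⁻¹ * ‖y‖) atTop (𝓝 (0 * ‖y‖)) :=
    tendsto_inv_atTop_nhds_zero_nat.mul_const _
  rw [zero_mul] at hlim
  refine le_of_tendsto ((tendsto_smul_slope (y := y) hd).sub (tendsto_smul_slope (y := y) hd')).norm ?_
  filter_upwards [hlim.eventually_lt_const hδ, eventually_gt_atTop 0] with m hm hm0
  have hm' : (0 : ℝ) < m := by exact_mod_cast hm0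
  have hen : ‖(m : ℝ)⁻¹ • y‖ = (m : ℝ)⁻¹ * ‖y‖ := by
    rw [norm_smul, Real.norm_of_nonneg (by positivity)]
  have he0 : 0 < ‖(m : ℝ)⁻¹ • y‖ := by rw [hen]; positivity
  rw [← smul_sub, ← smul_dq he0, ← smul_dq he0, ← smul_sub, norm_smul, norm_smul, norm_norm, hen,
    Real.norm_of_nonneg hm'.le, ← mul_assoc, mul_inv_cancel_left₀ hm'.ne', mul_comm]
  gcongr
  exact (h _ he0 (by rwa [hen])).2 x hx x' hx'

theorem IncBound.fderiv_le (h : IncBound c R δ α C g) (hδ : 0 < δ) (hC : 0 ≤ C)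
    {x : V} (hx : x ∈ Metric.ball c R) {L : V →L[ℝ] Y} (hd : HasFDerivAt g L x) : ‖L‖ ≤ C := by
  refine ContinuousLinearMap.opNorm_le_bound _ (by positivity) fun y => ?_
  have hlim : Tendsto (fun m : ℕ => (m : ℝ)⁻¹ * ‖y‖) atTop (𝓝 (0 * ‖y‖)) :=
    tendsto_inv_atTop_nhds_zero_nat.mul_const _
  rw [zero_mul] at hlim
  refine le_of_tendsto (tendsto_smul_slope (y := y) hd).norm ?_
  filter_upwards [hlim.eventually_lt_const hδ, eventually_gt_atTop 0] with m hm hm0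
  have hm' : (0 : ℝ) < m := by exact_mod_cast hm0
  have hen : ‖(m : ℝ)⁻¹ • y‖ = (m : ℝ)⁻¹ * ‖y‖ := by
    rw [norm_smul, Real.norm_of_nonneg (by positivity)]
  rw [norm_smul, Real.norm_of_nonneg hm'.le]
  calc _ ≤ (m : ℝ) * (C * ‖(m : ℝ)⁻¹ • y‖) := by
        gcongr; exact h.lipschitz hC hx (by rwa [hen])
    _ = _ := by rw [hen]; field_simp

theorem IncBound.hasFDerivAt_of_bound (hα : 0 < α) (hδ : 0 < δ) {x : V} {L : V →L[ℝ] Y}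
    (h : ∀ y, ‖y‖ < δ → ‖g (x + y) - g x - L y‖ ≤ C * ‖y‖ * ‖y‖ ^ α) : HasFDerivAt g L x := by
  rw [hasFDerivAt_iff_isLittleO_nhds_zero]
  have h1 : (fun y => g (x + y) - g x - L y) =O[𝓝 0] fun y => ‖y‖ ^ α * ‖y‖ := by
    refine Asymptotics.IsBigO.of_bound C ?_
    filter_upwards [Metric.ball_mem_nhds (0 : V) hδ] with y hy
    refine (h y (by simpa using hy)).trans (le_of_eq ?_)
    rw [norm_mul, norm_norm, Real.norm_of_nonneg (by positivity)]; ring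
  refine h1.trans_isLittleO ?_
  have h2 : (fun y : V => ‖y‖ ^ α) =o[𝓝 0] fun _ => (1 : ℝ) := by
    rw [Asymptotics.isLittleO_one_iff]
    have : Tendsto (fun y : V => ‖y‖ ^ α) (𝓝 0) (𝓝 (‖(0 : V)‖ ^ α)) :=
      (continuous_norm.tendsto 0).rpow_const (Or.inr hα.le)
    simpa [Real.zero_rpow hα.ne'] using this
  have h3 := h2.mul_isBigO (Asymptotics.isBigO_refl (fun y : V => ‖y‖) (𝓝 0))
  simp only [one_mul] at h3
  exact h3.of_norm_right

variable [FiniteDimensional ℝ Y]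

theorem IncBound.differentiableAt (h : IncBound c R δ α C g) (hα : 0 < α) (hδ : 0 < δ)
    (hC : 0 ≤ C) (hR : R' + δ ≤ R) {x : V} (hx : x ∈ Metric.ball c R') :
    DifferentiableAt ℝ g x := by
  letI : MeasurableSpace V := borel V
  haveI : BorelSpace V := ⟨rfl⟩
  haveI : CompleteSpace Y := FiniteDimensional.complete ℝ Y
  have hsub : Metric.ball c R' ⊆ Metric.ball c R := Metric.ball_subset_ball (by linarith)
  obtain ⟨ε, hε, hεx⟩ := Metric.isOpen_iff.1 Metric.isOpen_ball x hx
  have hρ : 0 < min ε (δ / 2) := by positivity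
  set ρ := min ε (δ / 2)
  have hball : Metric.ball x ρ ⊆ Metric.ball c R' :=
    (Metric.ball_subset_ball (min_le_left _ _)).trans hεx
  have hlip : LipschitzOnWith ⟨C, hC⟩ g (Metric.ball x ρ) := by
    refine LipschitzOnWith.of_dist_le_mul fun a ha b hb => ?_
    have hab : ‖a - b‖ < δ := by
      rw [← dist_eq_norm]
      have h1 := Metric.mem_ball.1 ha
      have h2 := Metric.mem_ball.1 hb
      have h3 := dist_triangle_right a b x
      have h4 : ρ ≤ δ / 2 := min_le_right _ _
      linarith
    have := h.lipschitz hC (hsub (hball hb)) hab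
    rwa [add_sub_cancel, ← dist_eq_norm, ← dist_eq_norm] at this
  have hae := hlip.ae_differentiableWithinAt_of_mem (μ := (volume : Measure V))
  have hdense := Measure.dense_of_ae hae
  have hseq : x ∈ closure (Metric.ball x ρ ∩ {z | z ∈ Metric.ball x ρ →
      DifferentiableWithinAt ℝ g (Metric.ball x ρ) z}) :=
    hdense.open_subset_closure_inter Metric.isOpen_ball (Metric.mem_ball_self hρ)
  obtain ⟨z, hz, hzx⟩ := mem_closure_iff_seq_limit.1 hseq
  have hzd : ∀ k, HasFDerivAt g (fderiv ℝ g (z k)) (z k) := fun k =>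
    (((hz k).2 (hz k).1).differentiableAt (Metric.isOpen_ball.mem_nhds (hz k).1)).hasFDerivAt
  have hzR : ∀ k, z k ∈ Metric.ball c R := fun k => hsub (hball (hz k).1)
  have hcau : CauchySeq fun k => fderiv ℝ g (z k) := by
    rw [Metric.cauchySeq_iff']
    intro e he
    have hlim : Tendsto (fun p : ℕ × ℕ => C * ‖z p.1 - z p.2‖ ^ α) atTop (𝓝 0) := by
      have h1 : Tendsto (fun p : ℕ × ℕ => C * ‖z p.1 - z p.2‖ ^ α) atTop
          (𝓝 (C * ‖x - x‖ ^ α)) := by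
        rw [← prod_atTop_atTop_eq]
        exact tendsto_const_nhds.mul ((((hzx.comp tendsto_fst).sub
          (hzx.comp tendsto_snd)).norm).rpow_const (Or.inr hα.le))
      simpa [Real.zero_rpow hα.ne'] using h1
    obtain ⟨⟨N, N'⟩, hN⟩ := eventually_atTop.1 (hlim.eventually_lt_const he)
    refine ⟨max N N', fun k hk => ?_⟩
    rw [dist_eq_norm]
    exact (h.fderiv_sub_le hδ hC (hzR _) (hzR _) (hzd _) (hzd _)).trans_lt
      (hN (k, max N N') ⟨(le_max_left _ _).trans hk, le_max_right _ _⟩)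
  obtain ⟨L, hL⟩ := cauchySeq_tendsto_of_complete hcau
  have hcont : ∀ a ∈ Metric.ball c R, ContinuousAt g a := by
    intro a ha
    rw [Metric.continuousAt_iff]
    intro e he
    refine ⟨min δ (e / (C + 1)), by positivity, fun {b} hb => ?_⟩
    have hb1 : ‖b - a‖ < δ := by rw [← dist_eq_norm]; exact hb.trans_le (min_le_left _ _)
    have hb2 : ‖b - a‖ < e / (C + 1) := by
      rw [← dist_eq_norm]; exact hb.trans_le (min_le_right _ _)
    have := h.lipschitz hC ha hb1
    rw [add_sub_cancel] at this
    rw [dist_eq_norm]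
    rw [lt_div_iff₀ (by positivity)] at hb2
    nlinarith [norm_nonneg (b - a)]
  refine (IncBound.hasFDerivAt_of_bound (C := C) (δ := δ) (L := L) hα hδ fun y hy => ?_).differentiableAt
  refine le_of_tendsto (f := fun k => ‖g (z k + y) - g (z k) - fderiv ℝ g (z k) y‖) (x := atTop) ?_
    (Eventually.of_forall fun k => h.taylor hα.le hC hR (hball (hz k).1) hy (hzd k))
  refine (Tendsto.sub (Tendsto.sub ?_ ?_) ?_).norm
  · exact (hcont _ (mem_ball_add hR hx hy)).tendsto.comp (hzx.add_const y)
  · exact (hcont _ (hsub hx)).tendsto.comp hzx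
  · exact (ContinuousLinearMap.apply ℝ Y y).continuous.tendsto L |>.comp hL

theorem reg_one_of_incBound {g : ℝ → V → Y} (h : ∀ t ∈ Set.Icc 0 T, IncBound c R δ α C (g t))
    (hα : 0 < α) (hδ : 0 < δ) (hC : 0 ≤ C) (hR : R' + δ ≤ R)
    (hg : Reg (Metric.ball c R) α T 0 g) : Reg (Metric.ball c R') α T 1 g := by
  have hsub : Metric.ball c R' ⊆ Metric.ball c R := Metric.ball_subset_ball (by linarith)
  have hd : ∀ t ∈ Set.Icc 0 T, ∀ x ∈ Metric.ball c R', HasFDerivAt (g t) (fderiv ℝ (g t) x) x :=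
    fun t ht x hx => ((h t ht).differentiableAt hα hδ hC hR hx).hasFDerivAt
  refine (reg_succ_iff Metric.isOpen_ball).2 ⟨fun t ht x hx =>
    (hd t ht x hx).differentiableAt.differentiableWithinAt, hg.mono le_rfl hsub le_rfl,
    reg_zero_iff.2 ⟨?_, C, hC, fun t ht => ⟨fun x hx => ?_, fun x hx x' hx' => ?_⟩⟩⟩
  · rw [continuousOn_clm_apply]
    intro y
    obtain ⟨N, hN⟩ := exists_nat_gt (‖y‖ / δ)
    have hN0 : (0 : ℝ) < N := lt_of_le_of_lt (by positivity) hN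
    have hlim : Tendsto (fun m : ℕ => C * ‖y‖ * ((m : ℝ)⁻¹ * ‖y‖) ^ α) atTop (𝓝 0) := by
      have h1 : Tendsto (fun m : ℕ => C * ‖y‖ * ((m : ℝ)⁻¹ * ‖y‖) ^ α) atTop
          (𝓝 (C * ‖y‖ * (0 * ‖y‖) ^ α)) := tendsto_const_nhds.mul
        ((tendsto_inv_atTop_nhds_zero_nat.mul_const _).rpow_const (Or.inr hα.le))
      simpa [Real.zero_rpow hα.ne'] using h1
    have hyN : ∀ m : ℕ, N ≤ m → ‖(m : ℝ)⁻¹ • y‖ < δ := fun m hm => by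
      have hm' : (0 : ℝ) < m := hN0.trans_le (by exact_mod_cast hm)
      rw [norm_smul, Real.norm_of_nonneg (by positivity), inv_mul_lt_iff₀ hm', ← div_lt_iff₀ hδ]
      exact hN.trans_le (by exact_mod_cast hm)
    have hu : TendstoUniformlyOn (fun (m : ℕ) (p : ℝ × V) =>
        (m : ℝ) • (g p.1 (p.2 + (m : ℝ)⁻¹ • y) - g p.1 p.2)) (fun p => fderiv ℝ (g p.1) p.2 y) atTop
        (Set.Icc 0 T ×ˢ Metric.ball c R') := by
      rw [Metric.tendstoUniformlyOn_iff]
      intro e he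
      filter_upwards [hlim.eventually_lt_const he, eventually_ge_atTop N] with m hm hmN p hp
      have hm' : (0 : ℝ) < m := hN0.trans_le (by exact_mod_cast hmN)
      refine lt_of_le_of_lt ?_ hm
      have h1 := (h p.1 hp.1).taylor hα.le hC hR hp.2 (hyN m hmN) (hd p.1 hp.1 p.2 hp.2)
      have e1 : (m : ℝ) • (g p.1 (p.2 + (m : ℝ)⁻¹ • y) - g p.1 p.2)
          - fderiv ℝ (g p.1) p.2 y = (m : ℝ) • (g p.1 (p.2 + (m : ℝ)⁻¹ • y) - g p.1 p.2
            - fderiv ℝ (g p.1) p.2 ((m : ℝ)⁻¹ • y)) := by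
        rw [map_smul, smul_sub (m : ℝ) _ ((m : ℝ)⁻¹ • _), smul_smul _ _ (fderiv ℝ (g p.1) p.2 y),
          mul_inv_cancel₀ hm'.ne', one_smul]
      rw [dist_comm, dist_eq_norm, e1, norm_smul, Real.norm_of_nonneg hm'.le]
      have hen : ‖(m : ℝ)⁻¹ • y‖ = (m : ℝ)⁻¹ * ‖y‖ := by
        rw [norm_smul, Real.norm_of_nonneg (by positivity)]
      rw [hen] at h1
      calc _ ≤ (m : ℝ) * (C * ((m : ℝ)⁻¹ * ‖y‖) * ((m : ℝ)⁻¹ * ‖y‖) ^ α) := by gcongr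
        _ = _ := by field_simp
    refine hu.continuousOn (Eventually.frequently ?_)
    filter_upwards [eventually_ge_atTop N] with m hmN
    refine ((hg.continuousOn.comp (f := fun p : ℝ × V => (p.1, p.2 + (m : ℝ)⁻¹ • y))
      (by fun_prop) fun p hp => ⟨hp.1, mem_ball_add hR hp.2 (hyN m hmN)⟩).sub
      (hg.continuousOn.mono (Set.prod_mono le_rfl hsub))).const_smul _
  · exact (h t ht).fderiv_le hδ hC (hsub hx) (hd t ht x hx)
  · exact (h t ht).fderiv_sub_le hδ hC (hsub hx) (hsub hx') (hd t ht x hx) (hd t ht x' hx')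

end Increment

section Extend
variable {V : Type} [NormedAddCommGroup V] [NormedSpace ℝ V]
  {Y : Type} [NormedAddCommGroup Y] [NormedSpace ℝ Y]
  {c : V} {ρ σ α C T : ℝ}

theorem hol_extend (hρσ : ρ < σ) {f : V → Y} (hf : ∀ x ∉ Metric.closedBall c ρ, f x = 0)
    (hC : 0 ≤ C) (hα : 0 ≤ α)
    (h : ∀ x ∈ Metric.ball c σ, ∀ x' ∈ Metric.ball c σ, ‖f x - f x'‖ ≤ C * ‖x - x'‖ ^ α)
    (x x' : V) : ‖f x - f x'‖ ≤ C * ‖x - x'‖ ^ α := by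
  have hsub : Metric.closedBall c ρ ⊆ Metric.ball c σ := Metric.closedBall_subset_ball hρσ
  have aux : ∀ x ∈ Metric.closedBall c ρ, ∀ x' ∉ Metric.ball c σ, ‖f x‖ ≤ C * ‖x - x'‖ ^ α := by
    intro x hx x' hx'
    have hcont : ContinuousOn (fun s : ℝ => ‖x + s • (x' - x) - c‖) (Set.Icc 0 1) := by fun_prop
    have h0 : ‖x - c‖ ≤ ρ := by rwa [mem_closedBall_iff_norm] at hx
    have h1 : σ ≤ ‖x' - c‖ := by rwa [mem_ball_iff_norm, not_lt] at hx'
    obtain ⟨s, hs, hs'⟩ := intermediate_value_Icc zero_le_one hcont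
      (show (ρ + σ) / 2 ∈ Set.Icc _ _ by
        constructor
        · simp only [zero_smul, add_zero]; linarith
        · simp only [one_smul, add_sub_cancel]; linarith)
    simp only at hs'
    have hz : f (x + s • (x' - x)) = 0 := hf _ (by rw [mem_closedBall_iff_norm]; linarith)
    have := h x (hsub hx) (x + s • (x' - x)) (by rw [mem_ball_iff_norm]; linarith)
    rw [hz, sub_zero] at this
    refine this.trans ?_
    gcongr
    rw [show x - (x + s • (x' - x)) = s • (x - x') by module, norm_smul,
      Real.norm_of_nonneg hs.1]
    exact mul_le_of_le_one_left (norm_nonneg _) hs.2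
  by_cases hx : x ∈ Metric.closedBall c ρ
  · by_cases hx' : x' ∈ Metric.ball c σ
    · exact h x (hsub hx) x' hx'
    · rw [hf x' fun h => hx' (hsub h), sub_zero]
      exact aux x hx x' hx'
  · by_cases hx' : x' ∈ Metric.closedBall c ρ
    · by_cases hx2 : x ∈ Metric.ball c σ
      · exact h x hx2 x' (hsub hx')
      · rw [hf x hx, zero_sub, norm_neg, norm_sub_rev]
        exact aux x' hx' x hx2
    · rw [hf x hx, hf x' hx', sub_zero, norm_zero]
      positivity

theorem sup_le_of_hol [Nontrivial V] (hρ : 0 < ρ) {f : V → Y}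
    (hf : ∀ x ∉ Metric.closedBall c ρ, f x = 0) (hC : 0 ≤ C) (hα : 0 ≤ α)
    (h : ∀ x x', ‖f x - f x'‖ ≤ C * ‖x - x'‖ ^ α) (x : V) : ‖f x‖ ≤ C * (3 * ρ) ^ α := by
  by_cases hx : x ∈ Metric.closedBall c ρ
  · obtain ⟨e, he⟩ := exists_norm_eq V (c := 2 * ρ) (by positivity)
    have h0 : f (c + e) = 0 := hf _ (by
      rw [mem_closedBall_iff_norm, add_sub_cancel_left, he]; linarith)
    have := h x (c + e)
    rw [h0, sub_zero] at this
    refine this.trans ?_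
    gcongr
    rw [mem_closedBall_iff_norm] at hx
    calc ‖x - (c + e)‖ = ‖(x - c) - e‖ := by congr 1; abel
      _ ≤ ‖x - c‖ + ‖e‖ := norm_sub_le _ _
      _ ≤ _ := by linarith
  · rw [hf x hx, norm_zero]; positivity

theorem iteratedFDeriv_eq_zero_of_notMem {f : V → Y} (hf : ∀ x ∉ Metric.closedBall c ρ, f x = 0)
    (k : ℕ) : ∀ x ∉ Metric.closedBall c ρ, iteratedFDeriv ℝ k f x = 0 := by
  intro x hx
  have h1 : f =ᶠ[nhds x] fun _ => 0 := by
    filter_upwards [Metric.isClosed_closedBall.isOpen_compl.mem_nhds hx] with y hy using hf y hy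
  rw [(h1.iteratedFDeriv ℝ k).eq_of_nhds]
  simp

theorem CH.extend {m : ℕ} {f : V → Y} (h : CH (Metric.ball c σ) α m C f) (hρσ : ρ < σ)
    (hf : ∀ x ∉ Metric.closedBall c ρ, f x = 0) (hC : 0 ≤ C) (hα : 0 ≤ α) :
    CH Set.univ α m C f := by
  have hsub : Metric.closedBall c ρ ⊆ Metric.ball c σ := Metric.closedBall_subset_ball hρσ
  refine ⟨fun x _ => ContDiffAt.contDiffWithinAt ?_, fun k hk => ⟨fun x _ => ?_,
    fun x _ x' _ => ?_⟩⟩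
  · by_cases hx : x ∈ Metric.closedBall c ρ
    · exact h.contDiffAt Metric.isOpen_ball (hsub hx)
    · have h1 : f =ᶠ[nhds x] fun _ => 0 := by
        filter_upwards [Metric.isClosed_closedBall.isOpen_compl.mem_nhds hx] with y hy using hf y hy
      exact contDiffAt_const.congr_of_eventuallyEq h1
  · by_cases hx : x ∈ Metric.closedBall c ρ
    · exact (h.hol k hk).1 x (hsub hx)
    · rw [iteratedFDeriv_eq_zero_of_notMem hf k x hx, norm_zero]; exact hC
  · exact hol_extend hρσ (iteratedFDeriv_eq_zero_of_notMem hf k) hC hα (h.hol k hk).2 x x'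

theorem Reg.extend {m : ℕ} {f : ℝ → V → Y} (h : Reg (Metric.ball c σ) α T m f) (hρσ : ρ < σ)
    (hf : ∀ t ∈ Set.Icc 0 T, ∀ x ∉ Metric.closedBall c ρ, f t x = 0) (hα : 0 ≤ α) :
    Reg Set.univ α T m f := by
  obtain ⟨C, hC, h1⟩ := h.bound
  refine ⟨⟨C, hC, fun t ht => (h1 t ht).extend hρσ (hf t ht) hC hα⟩, fun k hk => ?_⟩
  refine continuousOn_of_locally_continuousOn fun p hp => ?_
  by_cases hx : p.2 ∈ Metric.closedBall c ρ
  · refine ⟨Set.univ ×ˢ Metric.ball c σ, isOpen_univ.prod Metric.isOpen_ball,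
      ⟨trivial, Metric.closedBall_subset_ball hρσ hx⟩, ?_⟩
    exact (h.cont k hk).mono fun q hq => ⟨hq.1.1, hq.2.2⟩
  · refine ⟨Set.univ ×ˢ (Metric.closedBall c ρ)ᶜ,
      isOpen_univ.prod Metric.isClosed_closedBall.isOpen_compl, ⟨trivial, hx⟩, ?_⟩
    refine (continuousOn_const (c := 0)).congr fun q hq => ?_
    exact iteratedFDeriv_eq_zero_of_notMem (hf q.1 hq.1.1) k q.2 hq.2.2

theorem exists_cutoff [FiniteDimensional ℝ V] (c : V) (hρ : 0 < ρ) (hα0 : 0 ≤ α) (hα1 : α ≤ 1) :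
    ∃ η : V → ℝ, (∀ x ∈ Metric.ball c (ρ / 2), η x = 1) ∧
      (∀ x ∉ Metric.closedBall c ρ, η x = 0) ∧
      ∀ m σ T, Reg (Metric.ball c σ) α T m fun _ => η := by
  let η : ContDiffBump c := ⟨ρ / 2, ρ, by positivity, by linarith⟩
  refine ⟨η, fun x hx => η.one_of_mem_closedBall (Metric.ball_subset_closedBall hx),
    fun x hx => ?_, fun m σ T => ?_⟩
  · refine η.zero_of_le_dist ?_
    rw [Metric.mem_closedBall, not_le] at hx
    exact hx.le
  · have hσ : 0 < |σ| + 1 := by positivity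
    have hsub : Metric.ball c σ ⊆ Metric.ball c (|σ| + 1) :=
      Metric.ball_subset_ball (by have := le_abs_self σ; linarith)
    have hu : UniqueDiffOn ℝ (Metric.closedBall c (|σ| + 1)) := by
      refine uniqueDiffOn_convex (convex_closedBall _ _) ?_
      rw [interior_closedBall _ hσ.ne']
      exact ⟨c, Metric.mem_ball_self hσ⟩
    refine reg_comp (S := Metric.closedBall c (|σ| + 1)) (G := fun x => η x) (q := fun _ x => x)
      Metric.isOpen_ball (isCompact_closedBall _ _) (convex_closedBall _ _) hu m
      η.contDiff.contDiffOn
      (reg_id Metric.isOpen_ball Metric.isBounded_ball hα0 hα1) fun t _ x hx => ?_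
    exact Metric.ball_subset_closedBall (hsub hx)

end Extend

section Commutator
variable {V : Type} [NormedAddCommGroup V] [NormedSpace ℝ V] {U : Set V} {α Cη C : ℝ}

theorem iteratedFDeriv_succ_smul (hU : IsOpen U) {Y : Type} [NormedAddCommGroup Y]
    [NormedSpace ℝ Y] {η : V → ℝ} {f : V → Y} {k : ℕ} (hη : ContDiffOn ℝ (k + 1) η U)
    (hf : ContDiffOn ℝ (k + 1) f U) {x : V} (hx : x ∈ U) :
    iteratedFDeriv ℝ (k + 1) (fun x => η x • f x) x
      = (continuousMultilinearCurryRightEquiv' ℝ k V Y).symm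
        (iteratedFDeriv ℝ k (fun x => η x • fderiv ℝ f x) x +
          iteratedFDeriv ℝ k (fun x => (fderiv ℝ η x).smulRight (f x)) x) := by
  have hfd : DifferentiableOn ℝ f U := hf.differentiableOn (by simp)
  have hηd : DifferentiableOn ℝ η U := hη.differentiableOn (by simp)
  have h1 : fderiv ℝ (fun x => η x • f x) =ᶠ[nhds x] (fun x => η x • fderiv ℝ f x) +
      fun x => (fderiv ℝ η x).smulRight (f x) := by
    filter_upwards [hU.mem_nhds hx] with z hz
    exact fderiv_fun_smul ((hηd z hz).differentiableAt (hU.mem_nhds hz))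
      ((hfd z hz).differentiableAt (hU.mem_nhds hz))
  have hfa : ContDiffAt ℝ (k + 1) f x := hf.contDiffAt (hU.mem_nhds hx)
  have hηa : ContDiffAt ℝ (k + 1) η x := hη.contDiffAt (hU.mem_nhds hx)
  have hle : (k : WithTop ℕ∞) ≤ k + 1 := by exact_mod_cast Nat.le_succ k
  rw [iteratedFDeriv_succ_eq_comp_right, Function.comp_apply, (h1.iteratedFDeriv ℝ k).eq_of_nhds]
  congr 1
  exact iteratedFDeriv_add_apply ((hηa.of_le hle).smul (hfa.fderiv_right le_rfl))
    ((hηa.fderiv_right le_rfl).smulRight (hfa.of_le hle))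

theorem CH.smulRight_fderiv (hU : IsOpen U) {Y : Type} [NormedAddCommGroup Y]
    [NormedSpace ℝ Y] {η : V → ℝ} {f : V → Y} {m : ℕ} (hCη : 0 ≤ Cη) (hC : 0 ≤ C)
    (hη : CH U α (m + 1) Cη η) (hf : CH U α m C f) :
    CH U α m (2 ^ (m + 1) * 1 * Cη * C) fun x => (fderiv ℝ η x).smulRight (f x) := by
  refine (CH.bilinear hU m (ContinuousLinearMap.smulRightL ℝ V Y) hCη
    ((ch_succ_iff hU).1 hη).2.2 hf).mono le_rfl le_rfl ?_
  gcongr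
  exact ContinuousLinearMap.norm_smulRightL_le

theorem exists_commutator_bound (hU : IsOpen U) {η : V → ℝ} (hCη : 0 ≤ Cη) (hC : 0 ≤ C) (m : ℕ)
    (hη : CH U α (m + 1) Cη η) : ∃ D, 0 ≤ D ∧
      ∀ {Y : Type} [NormedAddCommGroup Y] [NormedSpace ℝ Y]
      {f : V → Y}, ContDiffOn ℝ (m + 1) f U → CH U α m C f →
      HolB U α D fun x => iteratedFDeriv ℝ (m + 1) (fun x => η x • f x) x
        - η x • iteratedFDeriv ℝ (m + 1) f x := by
  induction m with
  | zero =>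
    refine ⟨2 ^ (0 + 1) * 1 * Cη * C, by positivity, fun {Y _ _ f} hf h => ?_⟩
    have h1 := (hη.smulRight_fderiv hU hCη hC h).hol 0 le_rfl
    refine ((HolB.isometry ((continuousMultilinearCurryRightEquiv' ℝ 0 V Y).symm
      ).toLinearIsometry).2 h1).congr fun x hx => ?_
    rw [iteratedFDeriv_succ_smul hU hη.contDiffOn (by exact_mod_cast hf) hx,
      iteratedFDeriv_succ_eq_comp_right]
    ext v
    simp
  | succ m ih =>
    obtain ⟨D, hD, h0⟩ := ih (hη.mono (Nat.le_succ _) le_rfl le_rfl)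
    refine ⟨D + 2 ^ (m + 1 + 1) * 1 * Cη * C, by positivity, fun {Y _ _ f} hf h => ?_⟩
    have h1 := (hη.smulRight_fderiv hU hCη hC h).hol (m + 1) le_rfl
    have h2 := h0 (hf.fderiv_of_isOpen hU (by exact_mod_cast le_rfl)) ((ch_succ_iff hU).1 h).2.2
    refine ((HolB.isometry ((continuousMultilinearCurryRightEquiv' ℝ (m + 1) V Y).symm
      ).toLinearIsometry).2 (h2.add h1)).congr fun x hx => ?_
    rw [iteratedFDeriv_succ_smul hU hη.contDiffOn (by exact_mod_cast hf) hx,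
      iteratedFDeriv_succ_eq_comp_right (f := f)]
    ext v
    simp
    abel

end Commutator

section Shift
variable {V : Type} [NormedAddCommGroup V] [NormedSpace ℝ V]
  {Y : Type} [NormedAddCommGroup Y] [NormedSpace ℝ Y] {U U' : Set V} {α T C : ℝ} {m : ℕ}

theorem Reg.shift {f : ℝ → V → Y} (h : Reg U α T m f) {y : V} (hU' : ∀ x ∈ U', x + y ∈ U) :
    Reg U' α T m fun t x => f t (x + y) := by
  obtain ⟨C, hC, h1⟩ := h.bound
  refine ⟨⟨C, hC, fun t ht => ⟨?_, fun k hk => ⟨fun x hx => ?_, fun x hx x' hx' => ?_⟩⟩⟩,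
    fun k hk => ?_⟩
  · exact (h1 t ht).contDiffOn.comp (f := fun x => x + y) (by fun_prop) hU'
  · rw [iteratedFDeriv_comp_add_right]
    exact ((h1 t ht).hol k hk).1 _ (hU' x hx)
  · rw [iteratedFDeriv_comp_add_right, iteratedFDeriv_comp_add_right]
    have := ((h1 t ht).hol k hk).2 _ (hU' x hx) _ (hU' x' hx')
    rwa [add_sub_add_right_eq_sub] at this
  · simp only [iteratedFDeriv_comp_add_right]
    exact (h.cont k hk).comp (f := fun p : ℝ × V => (p.1, p.2 + y)) (by fun_prop)
      fun p hp => ⟨hp.1, hU' p.2 hp.2⟩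

theorem Reg.dq_fixed (hU : IsOpen U') {f : ℝ → V → Y} (h : Reg U α T m f) {y : V}
    (hU' : ∀ x ∈ U', x ∈ U ∧ x + y ∈ U) : Reg U' α T m fun t => dq y (f t) := by
  have h1 := (h.shift fun x hx => (hU' x hx).2).clm hU (‖y‖⁻¹ • ContinuousLinearMap.id ℝ Y)
  have h2 := (h.mono (U' := U') le_rfl (fun x hx => (hU' x hx).1) le_rfl).clm hU
    (-(‖y‖⁻¹ • ContinuousLinearMap.id ℝ Y))
  refine (h1.add hU h2).congr hU fun t ht x hx => ?_
  simp [dq, smul_sub, sub_eq_add_neg]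

end Shift

section Step
variable {V : Type} [NormedAddCommGroup V] [InnerProductSpace ℝ V] [FiniteDimensional ℝ V]
  {X : Type} [NormedAddCommGroup X] [InnerProductSpace ℝ X] [FiniteDimensional ℝ X]
  {n r : ℕ} {c : V} {ρ σ α T : ℝ} {v v' : ℝ → V → X} {η : V → ℝ}

theorem Reg.cutoff {Y : Type} [NormedAddCommGroup Y] [NormedSpace ℝ Y] {v : ℝ → V → Y} {m : ℕ}
    (hv : Reg (Metric.ball c σ) α T m v) (hη : Reg (Metric.ball c σ) α T m fun _ => η)
    (hη0 : ∀ x ∉ Metric.closedBall c ρ, η x = 0) (hρσ : ρ < σ) (hα : 0 ≤ α) :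
    Reg Set.univ α T m fun t x => η x • v t x := by
  refine Reg.extend (c := c) (ρ := ρ) (σ := σ) ?_ hρσ (fun t ht x hx => by simp [hη0 x hx]) hα
  exact Reg.bilinear Metric.isOpen_ball m (ContinuousLinearMap.lsmul ℝ ℝ : ℝ →L[ℝ] Y →L[ℝ] Y) hη hv

theorem compactEvolution_cutoff (hv : Reg (Metric.ball c σ) α T r v)
    (hv' : Reg (Metric.ball c σ) α T 0 v')
    (hder : ∀ t ∈ Set.Ioo 0 T, ∀ x ∈ Metric.ball c σ, HasDerivAt (fun s => v s x) (v' t x) t)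
    (hη : Reg (Metric.ball c σ) α T r fun _ => η)
    (hη0 : ∀ x ∉ Metric.closedBall c ρ, η x = 0) (hρσ : ρ < σ) (hα : 0 ≤ α) :
    CompactEvolution r (Metric.closedBall c ρ) T (fun t x => η x • v t x)
      (fun t x => η x • v' t x) := by
  have h1 := hv.cutoff hη hη0 hρσ hα
  have h2 := hv'.cutoff (hη.mono (Nat.zero_le _) le_rfl le_rfl) hη0 hρσ hα
  obtain ⟨C, hC, h3⟩ := h1.bound
  obtain ⟨C', hC', h4⟩ := h2.bound
  refine ⟨isCompact_closedBall _ _, fun t ht => contDiffOn_univ.1 (h3 t ht).contDiffOn,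
    fun t _ x hx => by simp [hη0 x hx], fun t _ x hx => by simp [hη0 x hx],
    ⟨C, fun t ht x => (h3 t ht).holB.1 x trivial⟩, ⟨C', fun t ht x => (h4 t ht).holB.1 x trivial⟩,
    fun I => ?_, fun t ht => ?_, fun t ht x => ?_⟩
  · exact (ContinuousMultilinearMap.apply ℝ (fun _ : Fin r => V) X I).continuous.comp_continuousOn
      (h1.cont r le_rfl)
  · exact continuousOn_univ.1 (h4 t ht).contDiffOn.continuousOn
  · by_cases hx : x ∈ Metric.closedBall c ρ
    · exact (hder t ht x (Metric.closedBall_subset_ball hρσ hx)).const_smul (η x)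
    · simp only [hη0 x hx, zero_smul]
      exact hasDerivAt_const _ _

theorem le_two_mul_of_contraction {P : ℝ → Prop} {N D : ℝ} (hN : 0 ≤ N) (hD : 0 ≤ D) (h0 : P N)
    (hP : ∀ N, 0 ≤ N → P N → P (N / 2 + D))
    (hcl : ∀ s : ℕ → ℝ, ∀ L, (∀ k, P (s k)) → Filter.Tendsto s Filter.atTop (nhds L) → P L) :
    P (2 * D) := by
  have h1 : ∀ k : ℕ, 0 ≤ N * (1 / 2) ^ k + 2 * D * (1 - (1 / 2) ^ k) ∧
      P (N * (1 / 2) ^ k + 2 * D * (1 - (1 / 2) ^ k)) := by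
    intro k
    refine ⟨?_, ?_⟩
    · have : (1 / 2 : ℝ) ^ k ≤ 1 := pow_le_one₀ (by norm_num) (by norm_num)
      have h2 : 0 ≤ 2 * D * (1 - (1 / 2) ^ k) := mul_nonneg (by positivity) (by linarith)
      positivity
    · induction k with
      | zero => simpa using h0
      | succ k ih =>
        have hk : 0 ≤ N * (1 / 2) ^ k + 2 * D * (1 - (1 / 2) ^ k) := by
          have : (1 / 2 : ℝ) ^ k ≤ 1 := pow_le_one₀ (by norm_num) (by norm_num)
          have h2 : 0 ≤ 2 * D * (1 - (1 / 2) ^ k) := mul_nonneg (by positivity) (by linarith)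
          positivity
        convert hP _ hk ih using 1
        rw [pow_succ]; ring
  refine hcl _ _ (fun k => (h1 k).2) ?_
  have h2 : Filter.Tendsto (fun k : ℕ => (1 / 2 : ℝ) ^ k) Filter.atTop (nhds 0) :=
    tendsto_pow_atTop_nhds_zero_of_lt_one (by norm_num) (by norm_num)
  simpa using (h2.const_mul N).add ((h2.const_sub 1).const_mul (2 * D))

theorem apply_basis_le {Y : Type} [NormedAddCommGroup Y] [NormedSpace ℝ Y]
    (b : OrthonormalBasis (Fin n) ℝ V) (f : V [×r]→L[ℝ] Y) (J : Fin r → Fin n) :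
    ‖f fun j => b (J j)‖ ≤ ‖f‖ := by
  simpa using f.le_opNorm fun j => b (J j)

theorem HolB.apply_basis {Y : Type} [NormedAddCommGroup Y] [NormedSpace ℝ Y] {U : Set V} {C : ℝ}
    (b : OrthonormalBasis (Fin n) ℝ V) {f : V → V [×r]→L[ℝ] Y} (h : HolB U α C f)
    (J : Fin r → Fin n) : HolB U α C fun x => f x fun j => b (J j) := by
  refine ⟨fun x hx => (apply_basis_le b _ J).trans (h.1 x hx), fun x hx x' hx' => ?_⟩
  have := apply_basis_le b (f x - f x') J
  rw [sub_apply] at this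
  exact this.trans (h.2 x hx x' hx')

variable [Nontrivial V]

/-- Schauder estimate for a cut-off solution of an equation with slightly varying coefficients. -/
theorem schauder_cutoff (b : OrthonormalBasis (Fin n) ℝ V) (A : (Fin r → Fin n) → X →L[ℝ] X)
    {CS : ℝ} (hCS : 0 ≤ CS) (hS : ∀ (K : Set V) (T : ℝ) (w w' : ℝ → V → X) (M : ℝ),
      CompactEvolution r K T w w' → 0 ≤ M →
      (∀ t ∈ Set.Icc 0 T, ∀ x x', ‖residual b A w w' t x - residual b A w w' t x'‖
        ≤ M * ‖x - x'‖ ^ α) →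
      (∀ x x', ‖iteratedFDeriv ℝ r (w 0) x - iteratedFDeriv ℝ r (w 0) x'‖
        ≤ M * ‖x - x'‖ ^ α) →
      ∀ t ∈ Set.Icc 0 T, ∀ x x', ‖iteratedFDeriv ℝ r (w t) x - iteratedFDeriv ℝ r (w t) x'‖
        ≤ CS * M * ‖x - x'‖ ^ α)
    (hα : 0 ≤ α) (hρ : 0 < ρ) (hρσ : ρ < σ)
    (hv : Reg (Metric.ball c σ) α T r v) (hv' : Reg (Metric.ball c σ) α T 0 v')
    (hder : ∀ t ∈ Set.Ioo 0 T, ∀ x ∈ Metric.ball c σ, HasDerivAt (fun s => v s x) (v' t x) t)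
    (hη : Reg (Metric.ball c σ) α T r fun _ => η)
    (hη0 : ∀ x ∉ Metric.closedBall c ρ, η x = 0)
    {a : (Fin r → Fin n) → ℝ → V → X →L[ℝ] X} {g : ℝ → V → X} {ε Ca Cg Cη D Di : ℝ}
    (hε : 0 ≤ ε) (hCa : 0 ≤ Ca) (hCg : 0 ≤ Cg) (hCη : 0 ≤ Cη) (hD : 0 ≤ D) (hDi : 0 ≤ Di)
    (ha : ∀ J, ∀ t ∈ Set.Icc 0 T, HolB (Metric.ball c σ) α Ca (a J t))
    (haA : ∀ J, ∀ t ∈ Set.Icc 0 T, ∀ x ∈ Metric.ball c σ, ‖a J t x - A J‖ ≤ ε)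
    (hg : ∀ t ∈ Set.Icc 0 T, HolB (Metric.ball c σ) α Cg (g t))
    (hηB : HolB (Metric.ball c σ) α Cη η)
    (heq : ∀ t ∈ Set.Icc 0 T, ∀ x ∈ Metric.ball c σ,
      v' t x = ∑ J, a J t x (iteratedFDeriv ℝ r (v t) x fun j => b (J j)) + g t x)
    (hcomm : ∀ t ∈ Set.Icc 0 T, HolB (Metric.ball c σ) α D fun x =>
      iteratedFDeriv ℝ r (fun x => η x • v t x) x - η x • iteratedFDeriv ℝ r (v t) x)
    (hinit : HolB (Metric.ball c σ) α Di (iteratedFDeriv ℝ r fun x => η x • v 0 x))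
    (hsmall : CS * (Fintype.card (Fin r → Fin n) * (ε + Ca * (3 * ρ) ^ α)) ≤ 1 / 2) :
    ∀ t ∈ Set.Icc 0 T, ∀ x x', ‖iteratedFDeriv ℝ r (fun x => η x • v t x) x
      - iteratedFDeriv ℝ r (fun x => η x • v t x) x'‖
      ≤ 2 * (CS * (Fintype.card (Fin r → Fin n) * (2 * Ca * D) + 2 * Cη * Cg + Di))
        * ‖x - x'‖ ^ α := by
  set κ : ℝ := ((Fintype.card (Fin r → Fin n) : ℕ) : ℝ) with hκ
  set w : ℝ → V → X := fun t x => η x • v t x with hw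
  set w' : ℝ → V → X := fun t x => η x • v' t x with hw'
  have hκ0 : 0 ≤ κ := by positivity
  have hev : CompactEvolution r (Metric.closedBall c ρ) T w w' :=
    compactEvolution_cutoff hv hv' hder hη hη0 hρσ hα
  have hw0 : ∀ t, ∀ x ∉ Metric.closedBall c ρ, iteratedFDeriv ℝ r (w t) x = 0 := fun t =>
    iteratedFDeriv_eq_zero_of_notMem (fun x hx => by simp [hw, hη0 x hx]) r
  obtain ⟨N, hN, hN'⟩ := (hv.cutoff hη hη0 hρσ hα).bound
  refine le_two_mul_of_contraction (P := fun N => ∀ t ∈ Set.Icc 0 T, ∀ x x',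
    ‖iteratedFDeriv ℝ r (w t) x - iteratedFDeriv ℝ r (w t) x'‖ ≤ N * ‖x - x'‖ ^ α) hN
    (by positivity) (fun t ht x x' => ((hN' t ht).hol r le_rfl).2 x trivial x' trivial) ?_ ?_
  · intro N hN h
    set E := κ * (2 * Ca * D) + 2 * Cη * Cg with hE
    have hE0 : 0 ≤ E := by positivity
    have hres : ∀ t ∈ Set.Icc 0 T, ∀ x x', ‖residual b A w w' t x - residual b A w w' t x'‖
        ≤ (κ * (ε + Ca * (3 * ρ) ^ α) * N + E + Di) * ‖x - x'‖ ^ α := by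
      intro t ht x x'
      refine hol_extend (c := c) hρσ (f := residual b A w w' t) (fun x hx => ?_) (by positivity) hα ?_ x x'
      · simp [residual, hw0 t x hx, hw', hη0 x hx]
      have hdw : ∀ J : Fin r → Fin n, ∀ x x', ‖(iteratedFDeriv ℝ r (w t) x fun j => b (J j))
          - iteratedFDeriv ℝ r (w t) x' fun j => b (J j)‖ ≤ N * ‖x - x'‖ ^ α := by
        intro J x x'
        have := apply_basis_le b (iteratedFDeriv ℝ r (w t) x - iteratedFDeriv ℝ r (w t) x') J
        rw [sub_apply] at this
        exact this.trans (h t ht x x')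
      have hsw : ∀ J : Fin r → Fin n, ∀ x, ‖iteratedFDeriv ℝ r (w t) x fun j => b (J j)‖
          ≤ N * (3 * ρ) ^ α := fun J x =>
        (apply_basis_le b _ J).trans (sup_le_of_hol hρ (hw0 t) hN hα (h t ht) x)
      have hlow : HolB (Metric.ball c σ) α E fun x =>
          ∑ J, a J t x (-((iteratedFDeriv ℝ r (w t) x - η x • iteratedFDeriv ℝ r (v t) x)
            fun j => b (J j))) + η x • g t x := by
        refine HolB.mono (HolB.add (HolB.sum Finset.univ fun J _ =>
          HolB.bilinear (ContinuousLinearMap.id ℝ (X →L[ℝ] X)) hCa (ha J t ht)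
            (((hcomm t ht).apply_basis b J).clm (-ContinuousLinearMap.id ℝ X)))
          (HolB.bilinear (ContinuousLinearMap.lsmul ℝ ℝ : ℝ →L[ℝ] X →L[ℝ] X) hCη hηB (hg t ht)))
          le_rfl ?_
        rw [Finset.sum_const, Finset.card_univ, nsmul_eq_mul, ← hκ, hE, norm_neg]
        have e1 : ‖ContinuousLinearMap.id ℝ (X →L[ℝ] X)‖ ≤ 1 := ContinuousLinearMap.norm_id_le
        have e2 : ‖ContinuousLinearMap.id ℝ X‖ ≤ 1 := ContinuousLinearMap.norm_id_le
        have e3 : ‖(ContinuousLinearMap.lsmul ℝ ℝ : ℝ →L[ℝ] X →L[ℝ] X)‖ ≤ 1 :=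
          ContinuousLinearMap.opNorm_lsmul_le
        calc κ * (2 * ‖ContinuousLinearMap.id ℝ (X →L[ℝ] X)‖ * Ca *
              (‖ContinuousLinearMap.id ℝ X‖ * D)) +
              2 * ‖(ContinuousLinearMap.lsmul ℝ ℝ : ℝ →L[ℝ] X →L[ℝ] X)‖ * Cη * Cg
            ≤ κ * (2 * 1 * Ca * (1 * D)) + 2 * 1 * Cη * Cg := by gcongr
          _ = _ := by ring
      have hdec : ∀ x ∈ Metric.ball c σ, residual b A w w' t x =
          ∑ J, (a J t x - A J) (iteratedFDeriv ℝ r (w t) x fun j => b (J j)) +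
          (∑ J, a J t x (-((iteratedFDeriv ℝ r (w t) x - η x • iteratedFDeriv ℝ r (v t) x)
            fun j => b (J j))) + η x • g t x) := by
        intro x hx
        rw [residual, hw', ← add_assoc, ← Finset.sum_add_distrib]
        simp only [heq t ht x hx, smul_add, Finset.smul_sum]
        rw [add_sub_right_comm, ← Finset.sum_sub_distrib]
        congr 1
        refine Finset.sum_congr rfl fun J _ => ?_
        simp only [sub_apply, smul_apply, map_neg, map_sub, map_smul]
        abel
      intro x hx x' hx'
      rw [hdec x hx, hdec x' hx', add_sub_add_comm]
      refine (norm_add_le _ _).trans ?_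
      have h1 : ‖∑ J, (a J t x - A J) (iteratedFDeriv ℝ r (w t) x fun j => b (J j)) -
          ∑ J, (a J t x' - A J) (iteratedFDeriv ℝ r (w t) x' fun j => b (J j))‖
          ≤ κ * (ε + Ca * (3 * ρ) ^ α) * N * ‖x - x'‖ ^ α := by
        rw [← Finset.sum_sub_distrib]
        refine (norm_sum_le_of_le _ (n := fun _ => (ε + Ca * (3 * ρ) ^ α) * N * ‖x - x'‖ ^ α)
          fun J _ => ?_).trans (le_of_eq ?_)
        · have e : (a J t x - A J) (iteratedFDeriv ℝ r (w t) x fun j => b (J j)) -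
              (a J t x' - A J) (iteratedFDeriv ℝ r (w t) x' fun j => b (J j)) =
              (a J t x - A J) ((iteratedFDeriv ℝ r (w t) x fun j => b (J j)) -
                iteratedFDeriv ℝ r (w t) x' fun j => b (J j)) +
              (a J t x - a J t x') (iteratedFDeriv ℝ r (w t) x' fun j => b (J j)) := by
            simp only [sub_apply, map_sub]; abel
          rw [e]
          refine (norm_add_le _ _).trans ?_
          calc _ ≤ ε * (N * ‖x - x'‖ ^ α) + (Ca * ‖x - x'‖ ^ α) * (N * (3 * ρ) ^ α) := by
                refine add_le_add ((ContinuousLinearMap.le_opNorm _ _).trans ?_)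
                  ((ContinuousLinearMap.le_opNorm _ _).trans ?_)
                · gcongr
                  · exact haA J t ht x hx
                  · exact hdw J x x'
                · gcongr
                  · exact (ha J t ht).2 x hx x' hx'
                  · exact hsw J x'
            _ = _ := by ring
        · rw [Finset.sum_const, Finset.card_univ, nsmul_eq_mul, ← hκ]; ring
      have h2 := hlow.2 x hx x' hx'
      have h3 : 0 ≤ Di * ‖x - x'‖ ^ α := by positivity
      calc _ ≤ κ * (ε + Ca * (3 * ρ) ^ α) * N * ‖x - x'‖ ^ α + E * ‖x - x'‖ ^ α :=
            add_le_add h1 h2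
        _ ≤ _ := by linarith
    have hi : ∀ x x', ‖iteratedFDeriv ℝ r (w 0) x - iteratedFDeriv ℝ r (w 0) x'‖
        ≤ (κ * (ε + Ca * (3 * ρ) ^ α) * N + E + Di) * ‖x - x'‖ ^ α := by
      intro x x'
      refine (hol_extend hρσ (hw0 0) hDi hα hinit.2 x x').trans ?_
      have : 0 ≤ κ * (ε + Ca * (3 * ρ) ^ α) * N + E := by positivity
      gcongr
      linarith
    intro t ht x x'
    refine (hS _ T w w' _ hev (by positivity) hres hi t ht x x').trans ?_
    gcongr
    have : CS * (κ * (ε + Ca * (3 * ρ) ^ α)) * N ≤ 1 / 2 * N := by gcongr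
    calc _ = CS * (κ * (ε + Ca * (3 * ρ) ^ α)) * N + CS * (E + Di) := by ring
      _ ≤ _ := by linarith
  · intro s L hs hL t ht x x'
    exact ge_of_tendsto (hL.mul_const _) (.of_forall fun k => hs k t ht x x')

end Step

section LocalPerturbation

theorem finiteDimensional_continuousMultilinearMap {V : Type} [NormedAddCommGroup V]
    [NormedSpace ℝ V] [FiniteDimensional ℝ V] {X : Type} [NormedAddCommGroup X] [NormedSpace ℝ X]
    [FiniteDimensional ℝ X] (r : ℕ) : FiniteDimensional ℝ (V [×r]→L[ℝ] X) :=
  FiniteDimensional.of_injective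
    (ContinuousMultilinearMap.toMultilinearMapLinear :
      (V [×r]→L[ℝ] X) →ₗ[ℝ] MultilinearMap ℝ (fun _ : Fin r => V) X)
    ContinuousMultilinearMap.toMultilinearMap_injective

variable {V : Type} [NormedAddCommGroup V] [InnerProductSpace ℝ V] [FiniteDimensional ℝ V]
  [MeasurableSpace V] [BorelSpace V] [Nontrivial V]
  {X : Type} [NormedAddCommGroup X] [InnerProductSpace ℝ X] [FiniteDimensional ℝ X]
  {n r : ℕ} {c : V} {α T : ℝ}

theorem exists_small_radius {B α : ℝ} (hα : 0 < α) {ρ₁ : ℝ} (hρ₁ : 0 < ρ₁) {e : ℝ} (he : 0 < e) :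
    ∃ ρ, 0 < ρ ∧ ρ ≤ ρ₁ ∧ B * (3 * ρ) ^ α ≤ e := by
  have h : Filter.Tendsto (fun ρ : ℝ => B * (3 * ρ) ^ α) (nhdsWithin 0 (Set.Ioi 0)) (nhds 0) := by
    have : Continuous fun ρ : ℝ => B * (3 * ρ) ^ α :=
      continuous_const.mul ((continuous_const.mul continuous_id).rpow_const fun _ => Or.inr hα.le)
    have h2 := this.tendsto 0
    rw [mul_zero, Real.zero_rpow hα.ne', mul_zero] at h2
    exact h2.mono_left nhdsWithin_le_nhds
  have h1 := (h.eventually_lt_const he).and (Ioc_mem_nhdsGT hρ₁)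
  obtain ⟨ρ, h2, h3⟩ := h1.exists
  exact ⟨ρ, h3.1, h3.2, h2.le⟩

/-- Gain of one spatial derivative for a solution whose difference quotients solve linear
equations with uniformly Hölder coefficients. -/
theorem regularity_step (hr : 1 ≤ r) (hrev : Even r) (b : OrthonormalBasis (Fin n) ℝ V)
    (A : (Fin r → Fin n) → X →L[ℝ] X) {lam : ℝ} (hlam : 0 < lam)
    (hA : ∀ (ξ : V) (v : X), (-1 : ℝ) ^ (r / 2) * ∑ J : Fin r → Fin n,
      (∏ j, inner ℝ ξ (b (J j))) * inner ℝ (A J v) v ≤ -lam * ‖ξ‖ ^ r * ‖v‖ ^ 2)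
    (hα0 : 0 < α) (hα1 : α < 1) {R R0 δ : ℝ} (hT : 0 < T) (hR : 0 < R) (hδ : 0 < δ)
    (hR0 : R + δ ≤ R0) {u u' : ℝ → V → X}
    (hu : Reg (Metric.ball c R0) α T r u) (hu' : Reg (Metric.ball c R0) α T 0 u')
    (hder : ∀ t ∈ Set.Ioo 0 T, ∀ x ∈ Metric.ball c R0, HasDerivAt (fun s => u s x) (u' t x) t)
    {C0 : ℝ} (hC0 : 0 ≤ C0) (h0 : CH (Metric.ball c R0) α (r + 1) C0 (u 0))
    {a : V → (Fin r → Fin n) → ℝ → V → X →L[ℝ] X} {g : V → ℝ → V → X} {Ca Cg : ℝ}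
    (hCa : 0 ≤ Ca) (hCg : 0 ≤ Cg)
    (ha : ∀ y, 0 < ‖y‖ → ‖y‖ < δ → ∀ J, ∀ t ∈ Set.Icc 0 T, HolB (Metric.ball c R) α Ca (a y J t))
    (hg : ∀ y, 0 < ‖y‖ → ‖y‖ < δ → ∀ t ∈ Set.Icc 0 T, HolB (Metric.ball c R) α Cg (g y t))
    (heq : ∀ y, 0 < ‖y‖ → ‖y‖ < δ → ∀ t ∈ Set.Icc 0 T, ∀ x ∈ Metric.ball c R,
      dq y (u' t) x =
        ∑ J, a y J t x (dq y (iteratedFDeriv ℝ r (u t)) x fun j => b (J j)) + g y t x)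
    (hsmall : ∀ ε > 0, ∃ ρ > 0, ∀ y, 0 < ‖y‖ → ‖y‖ < ρ → ∀ t ∈ Set.Icc 0 T, t < ρ →
      ∀ x ∈ Metric.ball c ρ, ∀ J, ‖a y J t x - A J‖ ≤ ε) :
    ∃ ρ > 0, ∃ τ > 0, τ ≤ T ∧ ρ ≤ R0 ∧ Reg (Metric.ball c ρ) α τ (r + 1) u := by
  obtain ⟨CS, hCS, hS⟩ := exists_schauder_bound hr hrev b A hlam hA hα0 hα1
  obtain ⟨Cu, hCu, hu1⟩ := hu.bound
  set κ : ℝ := ((Fintype.card (Fin r → Fin n) : ℕ) : ℝ) with hκ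
  have hκ0 : 0 ≤ κ := by positivity
  set ε : ℝ := 1 / (4 * (CS * κ + 1)) with hε
  have hε0 : 0 < ε := by positivity
  have hε1 : CS * κ * ε ≤ 1 / 4 := by
    rw [hε, mul_one_div, div_le_div_iff₀ (by positivity) (by norm_num)]
    linarith
  obtain ⟨ρ₁, hρ₁, hsm⟩ := hsmall ε hε0
  obtain ⟨ρ, hρ, hρle, hρs⟩ := exists_small_radius (B := CS * κ * Ca) hα0
    (ρ₁ := min (ρ₁ / 2) (R / 2)) (by positivity) (e := 1 / 4) (by norm_num)
  have hσ1 : 2 * ρ ≤ ρ₁ := by have := hρle.trans (min_le_left _ _); linarith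
  have hσR : 2 * ρ ≤ R := by have := hρle.trans (min_le_right _ _); linarith
  have hρσ : ρ < 2 * ρ := by linarith
  have hσ0 : Metric.ball c (2 * ρ) ⊆ Metric.ball c R0 := Metric.ball_subset_ball (by linarith)
  set τ := min T (ρ₁ / 2) with hτ
  have hτT : τ ≤ T := min_le_left _ _
  have hτ0 : 0 < τ := by positivity
  have hIcc : Set.Icc 0 τ ⊆ Set.Icc 0 T := Set.Icc_subset_Icc_right hτT
  obtain ⟨η, hη1, hη0, hηR⟩ := exists_cutoff c hρ hα0.le hα1.le
  obtain ⟨Cη, hCη, hηC⟩ := (hηR r (2 * ρ) τ).bound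
  have hηC : CH (Metric.ball c (2 * ρ)) α r Cη η := hηC 0 ⟨le_rfl, hτ0.le⟩
  obtain ⟨m, rfl⟩ : ∃ m, r = m + 1 := ⟨r - 1, by omega⟩
  obtain ⟨D, hD, hcomm⟩ := exists_commutator_bound Metric.isOpen_ball hCη hCu m hηC
  set Di := 2 ^ (m + 1 + 1) * ‖(ContinuousLinearMap.lsmul ℝ ℝ : ℝ →L[ℝ] X →L[ℝ] X)‖ * Cη * C0
    with hDi
  have hDi0 : 0 ≤ Di := by positivity
  set M := 2 * (CS * (κ * (2 * Ca * D) + 2 * Cη * Cg + Di)) with hM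
  have hM0 : 0 ≤ M := by positivity
  set δ' := min (min δ ρ₁) (ρ / 4) with hδ'
  have hδ'0 : 0 < δ' := by positivity
  have hδ'δ : δ' ≤ δ := (min_le_left _ _).trans (min_le_left _ _)
  have hδ'ρ : δ' ≤ ρ₁ := (min_le_left _ _).trans (min_le_right _ _)
  have hinc : ∀ t ∈ Set.Icc 0 τ, IncBound c (ρ / 2) δ' α (M * (1 + (3 * ρ) ^ α))
      (iteratedFDeriv ℝ (m + 1) (u t)) := by
    intro t ht y hy hyδ
    have hyd : ‖y‖ < δ := hyδ.trans_le hδ'δ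
    have hyU : ∀ x ∈ Metric.ball c (2 * ρ), x ∈ Metric.ball c R0 ∧ x + y ∈ Metric.ball c R0 :=
      fun x hx => ⟨hσ0 hx, mem_ball_add hR0 (Metric.ball_subset_ball hσR hx) hyd⟩
    have hv : Reg (Metric.ball c (2 * ρ)) α τ (m + 1) fun t => dq y (u t) :=
      (hu.mono le_rfl le_rfl hτT).dq_fixed Metric.isOpen_ball hyU
    have hdqu : ∀ t ∈ Set.Icc 0 T, ∀ x ∈ Metric.ball c (2 * ρ),
        iteratedFDeriv ℝ (m + 1) (dq y (u t)) x = dq y (iteratedFDeriv ℝ (m + 1) (u t)) x :=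
      fun t ht x hx => iteratedFDeriv_dq ((hu1 t ht).contDiffAt Metric.isOpen_ball (hyU x hx).1)
        ((hu1 t ht).contDiffAt Metric.isOpen_ball (hyU x hx).2)
    have hw := schauder_cutoff (c := c) (ρ := ρ) (σ := 2 * ρ) (T := τ) (v := fun t => dq y (u t))
      (v' := fun t => dq y (u' t)) (η := η) (a := a y) (g := g y) b A hCS hS hα0.le hρ hρσ hv
      ((hu'.mono le_rfl le_rfl hτT).dq_fixed Metric.isOpen_ball hyU)
      (fun t ht x hx => (((hder t ⟨ht.1, ht.2.trans_le hτT⟩ _ (hyU x hx).2).sub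
        (hder t ⟨ht.1, ht.2.trans_le hτT⟩ _ (hyU x hx).1)).const_smul _))
      (hηR _ _ _) hη0 hε0.le hCa hCg hCη hD hDi0
      (fun J t ht => (ha y hy hyd J t (hIcc ht)).mono (Metric.ball_subset_ball hσR) le_rfl)
      (fun J t ht x hx => hsm y hy (hyδ.trans_le hδ'ρ) t (hIcc ht)
        (lt_of_le_of_lt (ht.2.trans (min_le_right _ _)) (by linarith)) x
        (Metric.ball_subset_ball hσ1 hx) J)
      (fun t ht => (hg y hy hyd t (hIcc ht)).mono (Metric.ball_subset_ball hσR) le_rfl)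
      hηC.holB
      (fun t ht x hx => by
        rw [heq y hy hyd t (hIcc ht) x (Metric.ball_subset_ball hσR hx), hdqu t (hIcc ht) x hx])
      (fun t ht => hcomm (by
          obtain ⟨_, _, h⟩ := hv.bound
          exact_mod_cast (h t ht).contDiffOn)
        (CH.dq Metric.isOpen_ball Metric.isOpen_ball (convex_ball _ _) (hu1 t (hIcc ht)) hyU))
      ((CH.bilinear Metric.isOpen_ball (m + 1)
        (ContinuousLinearMap.lsmul ℝ ℝ : ℝ →L[ℝ] X →L[ℝ] X) hCη hηC
        (CH.dq Metric.isOpen_ball Metric.isOpen_ball (convex_ball _ _) h0 hyU)).hol _ le_rfl)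
      (by
        rw [← hκ]
        calc _ = CS * κ * ε + CS * κ * Ca * (3 * ρ) ^ α := by ring
          _ ≤ _ := by linarith)
      t ht
    rw [← hκ, ← hM] at hw
    have hsup := sup_le_of_hol (c := c) hρ (iteratedFDeriv_eq_zero_of_notMem (fun x hx => by
      simp [hη0 x hx]) (m + 1)) hM0 hα0.le hw
    have hloc : ∀ x ∈ Metric.ball c (ρ / 2), dq y (iteratedFDeriv ℝ (m + 1) (u t)) x =
        iteratedFDeriv ℝ (m + 1) (fun x => η x • dq y (u t) x) x := by
      intro x hx
      rw [← hdqu t (hIcc ht) x (Metric.ball_subset_ball (by linarith) hx)]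
      refine (Filter.EventuallyEq.iteratedFDeriv ℝ ?_ _).eq_of_nhds
      filter_upwards [Metric.isOpen_ball.mem_nhds hx] with z hz
      simp [hη1 z hz]
    have hp : 0 ≤ (3 * ρ) ^ α := by positivity
    refine HolB.congr ⟨fun x hx => (hsup x).trans ?_, fun x hx x' hx' => (hw x x').trans ?_⟩ hloc
    · exact mul_le_mul_of_nonneg_left (by linarith) hM0
    · gcongr
      exact le_mul_of_one_le_right hM0 (by linarith)
  have := finiteDimensional_continuousMultilinearMap (V := V) (X := X) (m + 1)
  have hsub : Metric.ball c (ρ / 2) ⊆ Metric.ball c R0 :=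
    (Metric.ball_subset_ball (by linarith)).trans hσ0
  have hsub' : Metric.ball c (ρ / 4) ⊆ Metric.ball c R0 :=
    (Metric.ball_subset_ball (by linarith)).trans hσ0
  have h1 := reg_one_of_incBound (R' := ρ / 4) hinc hα0 hδ'0 (by positivity)
    (by have := min_le_right (min δ ρ₁) (ρ / 4); linarith)
    (Reg.iteratedFDeriv_reg Metric.isOpen_ball (m + 1)
      (hu.mono (by omega) hsub hτT))
  exact ⟨ρ / 4, by positivity, τ, hτ0, hτT, by linarith,
    reg_of_iteratedFDeriv Metric.isOpen_ball _ (hu.mono le_rfl hsub' hτT) h1⟩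

end LocalPerturbation

section TimeDerivative
variable {V : Type} [NormedAddCommGroup V] [NormedSpace ℝ V] {U : Set V} {α T : ℝ}

/-- Space and time derivatives commute. -/
theorem hasDerivAt_fderiv (hU : IsOpen U) {Y : Type} [NormedAddCommGroup Y] [NormedSpace ℝ Y]
    [CompleteSpace Y] {f f' : ℝ → V → Y} (hf : Reg U α T 1 f) (hf' : Reg U α T 1 f')
    (h : ∀ t ∈ Set.Ioo 0 T, ∀ x ∈ U, HasDerivAt (fun s => f s x) (f' t x) t)
    {t : ℝ} (ht : t ∈ Set.Ioo 0 T) {x : V} (hx : x ∈ U) :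
    HasDerivAt (fun s => fderiv ℝ (f s) x) (fderiv ℝ (f' t) x) t := by
  have hIcc : Set.Ioo 0 T ⊆ Set.Icc 0 T := Set.Ioo_subset_Icc_self
  obtain ⟨C, hC, hC'⟩ := ((reg_succ_iff hU).1 hf').2.2.bound
  have hsub : ∀ {s}, s ∈ Set.Ioo 0 T → Set.uIcc t s ⊆ Set.Ioo 0 T := fun hs =>
    Set.OrdConnected.uIcc_subset Set.ordConnected_Ioo ht hs
  have hc : ∀ z ∈ U, ContinuousOn (fun s => f' s z) (Set.Icc 0 T) := fun z hz =>
    hf'.continuousOn.comp (f := fun s : ℝ => (s, z)) (by fun_prop) fun s hs => ⟨hs, hz⟩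
  have hcd : ContinuousOn (fun s => fderiv ℝ (f' s) x) (Set.Icc 0 T) :=
    ((reg_succ_iff hU).1 hf').2.2.continuousOn.comp (f := fun s : ℝ => (s, x)) (by fun_prop)
      fun s hs => ⟨hs, hx⟩
  have h_int : ∀ {s}, s ∈ Set.Ioo 0 T → ∀ z ∈ U,
      IntervalIntegrable (fun s => f' s z) volume t s := fun hs z hz =>
    ((hc z hz).mono ((hsub hs).trans hIcc)).intervalIntegrable
  have hFTC : ∀ s ∈ Set.Ioo 0 T, ∀ z ∈ U, f s z = f t z + ∫ q in t..s, f' q z := by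
    intro s hs z hz
    rw [intervalIntegral.integral_eq_sub_of_hasDerivAt
      (fun q hq => h q (hsub hs hq) z hz) (h_int hs z hz)]
    abel
  have hD : ∀ s ∈ Set.Ioo 0 T,
      fderiv ℝ (f s) x = fderiv ℝ (f t) x + ∫ q in t..s, fderiv ℝ (f' q) x := by
    intro s hs
    have h1 : HasFDerivAt (fun z => ∫ q in t..s, f' q z) (∫ q in t..s, fderiv ℝ (f' q) x) x := by
      refine intervalIntegral.hasFDerivAt_integral_of_dominated_of_fderiv_le
        (F := fun z q => f' q z) (F' := fun z q => fderiv ℝ (f' q) z) (bound := fun _ => C)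
        (hU.mem_nhds hx) ?_ (h_int hs x hx) ?_ ?_ (by simp) ?_
      · filter_upwards [hU.mem_nhds hx] with z hz
        exact (h_int hs z hz).def'.aestronglyMeasurable
      · exact ((hcd.mono ((hsub hs).trans hIcc)).intervalIntegrable).def'.aestronglyMeasurable
      · refine .of_forall fun q hq z hz => (hC' q ?_).holB.1 z hz
        exact hIcc (hsub hs (Set.uIoc_subset_uIcc hq))
      · refine .of_forall fun q hq z hz => ?_
        exact ((hf'.differentiableOn hU (hIcc (hsub hs (Set.uIoc_subset_uIcc hq)))).differentiableAt
          (hU.mem_nhds hz)).hasFDerivAt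
    have h2 := ((hf.differentiableOn hU (hIcc ht)).differentiableAt
      (hU.mem_nhds hx)).hasFDerivAt.add h1
    refine (h2.congr_of_eventuallyEq ?_).fderiv
    filter_upwards [hU.mem_nhds hx] with z hz
    exact hFTC s hs z hz
  have h3 : HasDerivAt (fun s => ∫ q in t..s, fderiv ℝ (f' q) x) (fderiv ℝ (f' t) x) t := by
    have hn : Set.Icc 0 T ∈ nhds t := Icc_mem_nhds ht.1 ht.2
    refine intervalIntegral.integral_hasDerivAt_right (by simp) ?_ (hcd.continuousAt hn)
    exact hcd.stronglyMeasurableAtFilter_nhdsWithin measurableSet_Icc t |>.filter_mono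
      (by rw [nhdsWithin_eq_nhds.2 hn])
  refine (h3.const_add (fderiv ℝ (f t) x)).congr_of_eventuallyEq ?_
  filter_upwards [Ioo_mem_nhds ht.1 ht.2] with s hs
  exact hD s hs

theorem hasDerivAt_iteratedFDeriv (hU : IsOpen U) (m : ℕ) : ∀ {Y : Type} [NormedAddCommGroup Y]
    [NormedSpace ℝ Y] [CompleteSpace Y] {f f' : ℝ → V → Y}, Reg U α T m f → Reg U α T m f' →
    (∀ t ∈ Set.Ioo 0 T, ∀ x ∈ U, HasDerivAt (fun s => f s x) (f' t x) t) →
    ∀ t ∈ Set.Ioo 0 T, ∀ x ∈ U, HasDerivAt (fun s => iteratedFDeriv ℝ m (f s) x)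
      (iteratedFDeriv ℝ m (f' t) x) t := by
  induction m with
  | zero =>
    intro Y _ _ _ f f' _ _ h t ht x hx
    simp only [iteratedFDeriv_zero_eq_comp, Function.comp_def]
    exact (continuousMultilinearCurryFin0 ℝ V Y).symm.toContinuousLinearEquiv.hasFDerivAt.comp_hasDerivAt t (h t ht x hx)
  | succ m ih =>
    intro Y _ _ _ f f' hf hf' h t ht x hx
    simp only [iteratedFDeriv_succ_eq_comp_right, Function.comp_def]
    have := ih ((reg_succ_iff hU).1 hf).2.2 ((reg_succ_iff hU).1 hf').2.2
      (fun t ht x hx => hasDerivAt_fderiv hU (hf.mono (by omega) le_rfl le_rfl)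
        (hf'.mono (by omega) le_rfl le_rfl) h ht hx) t ht x hx
    exact (continuousMultilinearCurryRightEquiv'
      ℝ m V Y).symm.toContinuousLinearEquiv.hasFDerivAt.comp_hasDerivAt t this

end TimeDerivative

/-- Mean value coefficient of a `C^2` function on a compact convex set. -/
theorem exists_mean_value_coefficient {E : Type} [NormedAddCommGroup E] [NormedSpace ℝ E]
    {S : Set E} (hSc : IsCompact S) (hScv : Convex ℝ S) (hSu : UniqueDiffOn ℝ S)
    {Y : Type} [NormedAddCommGroup Y] [NormedSpace ℝ Y] [CompleteSpace Y] {G : E → Y}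
    (hG : ContDiffOn ℝ 2 G S) :
    ∃ (H : E → E → E →L[ℝ] Y) (L : ℝ), 0 ≤ L ∧
      (∀ p ∈ S, ∀ q ∈ S, G q - G p = H p q (q - p)) ∧
      (∀ p ∈ S, ∀ q ∈ S, ‖H p q‖ ≤ L) ∧
      (∀ p ∈ S, ∀ q ∈ S, ∀ p' ∈ S, ∀ q' ∈ S, ‖H p q - H p' q'‖ ≤ L * (‖p - p'‖ + ‖q - q'‖)) ∧
      ∀ p ∈ S, H p p = fderivWithin ℝ G S p := by
  have hG1 : ContDiffOn ℝ 1 (fderivWithin ℝ G S) S := hG.fderivWithin hSu (by norm_num)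
  obtain ⟨B, hB⟩ := hSc.exists_bound_of_continuousOn hG1.continuousOn
  obtain ⟨L, hL⟩ := hSc.exists_bound_of_continuousOn (hG1.continuousOn_fderivWithin hSu le_rfl)
  have hlip : ∀ p ∈ S, ∀ p' ∈ S, ‖fderivWithin ℝ G S p - fderivWithin ℝ G S p'‖
      ≤ max (max B L) 0 * ‖p - p'‖ := fun p hp p' hp' =>
    hScv.norm_image_sub_le_of_norm_fderivWithin_le (hG1.differentiableOn (by simp))
      (fun z hz => (hL z hz).trans ((le_max_right _ _).trans (le_max_left _ _))) hp' hp
  have hseg : ∀ p ∈ S, ∀ q ∈ S, ∀ s ∈ Set.Icc (0 : ℝ) 1, p + s • (q - p) ∈ S :=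
    fun p hp q hq s hs => hScv.add_smul_sub_mem hp hq hs
  have hcont : ∀ p ∈ S, ∀ q ∈ S,
      ContinuousOn (fun s : ℝ => fderivWithin ℝ G S (p + s • (q - p))) (Set.Icc 0 1) :=
    fun p hp q hq => hG1.continuousOn.comp (f := fun s : ℝ => p + s • (q - p)) (by fun_prop)
      (hseg p hp q hq)
  have h_int : ∀ p ∈ S, ∀ q ∈ S,
      IntervalIntegrable (fun s : ℝ => fderivWithin ℝ G S (p + s • (q - p))) volume 0 1 :=
    fun p hp q hq => (by simpa using hcont p hp q hq : ContinuousOn _ (Set.uIcc (0 : ℝ) 1)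
      ).intervalIntegrable
  refine ⟨fun p q => ∫ s in (0 : ℝ)..1, fderivWithin ℝ G S (p + s • (q - p)),
    max (max B L) 0, le_max_right _ _, fun p hp q hq => ?_, fun p hp q hq => ?_,
    fun p hp q hq p' hp' q' hq' => ?_, fun p hp => by simp⟩
  · have h1 : ∫ s in (0 : ℝ)..1, fderivWithin ℝ G S (p + s • (q - p)) (q - p) =
        G (p + (1 : ℝ) • (q - p)) - G (p + (0 : ℝ) • (q - p)) := by
      refine intervalIntegral.integral_eq_sub_of_hasDeriv_right
        (f := fun s : ℝ => G (p + s • (q - p))) ?_ ?_ ?_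
      · rw [Set.uIcc_of_le zero_le_one]
        exact hG.continuousOn.comp (f := fun s : ℝ => p + s • (q - p))
          (s := Set.Icc (0 : ℝ) 1) (by fun_prop) (hseg p hp q hq)
      · intro s hs
        simp only [zero_le_one, inf_of_le_left, sup_of_le_right] at hs
        have h2 := ((hG.differentiableOn (by simp)) _
          (hseg p hp q hq s ⟨hs.1.le, hs.2.le⟩)).hasFDerivWithinAt
        have h3 : HasDerivWithinAt (fun s : ℝ => p + s • (q - p)) (q - p) (Set.Icc 0 1) s := by
          simpa using (((hasDerivAt_id s).smul_const (q - p)).const_add p).hasDerivWithinAt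
        exact ((h2.comp_hasDerivWithinAt s h3 (hseg p hp q hq)).hasDerivAt
          (Icc_mem_nhds hs.1 hs.2)).hasDerivWithinAt
      · refine ContinuousOn.intervalIntegrable ?_
        rw [Set.uIcc_of_le zero_le_one]
        exact (hcont p hp q hq).clm_apply continuousOn_const
    beta_reduce
    rw [ContinuousLinearMap.intervalIntegral_apply (h_int p hp q hq), h1]
    simp
  · refine (intervalIntegral.norm_integral_le_of_norm_le_const (C := max (max B L) 0)
      fun s hs => ?_).trans (by simp)
    rw [Set.uIoc_of_le zero_le_one] at hs
    exact (hB _ (hseg p hp q hq s ⟨hs.1.le, hs.2⟩)).trans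
      ((le_max_left _ _).trans (le_max_left _ _))
  · rw [← intervalIntegral.integral_sub (h_int p hp q hq) (h_int p' hp' q' hq')]
    refine (intervalIntegral.norm_integral_le_of_norm_le_const
      (C := max (max B L) 0 * (‖p - p'‖ + ‖q - q'‖)) fun s hs => ?_).trans (by simp)
    rw [Set.uIoc_of_le zero_le_one] at hs
    refine (hlip _ (hseg p hp q hq s ⟨hs.1.le, hs.2⟩) _
      (hseg p' hp' q' hq' s ⟨hs.1.le, hs.2⟩)).trans ?_
    gcongr
    calc ‖p + s • (q - p) - (p' + s • (q' - p'))‖ = ‖(1 - s) • (p - p') + s • (q - q')‖ := by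
          congr 1; module
      _ ≤ ‖(1 - s) • (p - p')‖ + ‖s • (q - q')‖ := norm_add_le _ _
      _ = (1 - s) * ‖p - p'‖ + s * ‖q - q'‖ := by
          rw [norm_smul, norm_smul, Real.norm_of_nonneg (by linarith [hs.2]),
            Real.norm_of_nonneg hs.1.le]
      _ ≤ 1 * ‖p - p'‖ + 1 * ‖q - q'‖ := by
          gcongr
          · linarith [hs.1]
          · exact hs.2
      _ = _ := by ring

section Pi
variable {V : Type} [NormedAddCommGroup V] [NormedSpace ℝ V] {U : Set V} {α T C : ℝ} {m : ℕ}
  {ι : Type} [Fintype ι] [DecidableEq ι] {Y : ι → Type} [∀ i, NormedAddCommGroup (Y i)]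
  [∀ i, NormedSpace ℝ (Y i)]

theorem Reg.pi (hU : IsOpen U) {f : ∀ i, ℝ → V → Y i} (h : ∀ i, Reg U α T m (f i)) :
    Reg U α T m fun t x i => f i t x := by
  refine (Reg.sum hU Finset.univ fun i _ =>
    (h i).clm hU (ContinuousLinearMap.single ℝ Y i)).congr hU fun t _ x _ => ?_
  ext j
  simp [Finset.sum_apply, Pi.single_apply]

end Pi

section Jets
variable {V : Type} [NormedAddCommGroup V] [NormedSpace ℝ V]

theorem iteratedFDeriv_fderiv_apply (k : ℕ) : ∀ {Y : Type} [NormedAddCommGroup Y]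
    [NormedSpace ℝ Y] {f : V → Y} {U : Set V}, IsOpen U → ContDiffOn ℝ (k + 1) f U →
    ∀ (y : V), ∀ x ∈ U, iteratedFDeriv ℝ k (fun x => fderiv ℝ f x y) x
      = fderiv ℝ (iteratedFDeriv ℝ k f) x y := by
  induction k with
  | zero =>
    intro Y _ _ f U hU hf y x hx
    simp only [iteratedFDeriv_zero_eq_comp]
    rw [LinearIsometryEquiv.comp_fderiv]
    rfl
  | succ k ih =>
    intro Y _ _ f U hU hf y x hx
    have hf1 : ContDiffOn ℝ (k + 1) (fderiv ℝ f) U :=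
      hf.fderiv_of_isOpen hU (by exact_mod_cast le_rfl)
    have hsymm : ∀ z ∈ U, fderiv ℝ (fun x => fderiv ℝ f x y) z = fderiv ℝ (fderiv ℝ f) z y := by
      intro z hz
      have hd : DifferentiableAt ℝ (fderiv ℝ f) z :=
        (hf1.contDiffAt (hU.mem_nhds hz)).differentiableAt (by simp)
      have hs : IsSymmSndFDerivAt ℝ f z :=
        (hf.contDiffAt (hU.mem_nhds hz)).isSymmSndFDerivAt (by
          simp only [minSmoothness_of_isRCLikeNormedField]
          exact_mod_cast (by omega : 2 ≤ k + 1 + 1))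
      ext w
      rw [fderiv_clm_apply hd (by fun_prop)]
      simpa using hs w y
    have hcurry : iteratedFDeriv ℝ (k + 1) f = (continuousMultilinearCurryRightEquiv' ℝ k V Y).symm
        ∘ iteratedFDeriv ℝ k (fderiv ℝ f) := funext fun _ => iteratedFDeriv_succ_eq_comp_right
    have hd : DifferentiableAt ℝ (iteratedFDeriv ℝ k (fderiv ℝ f)) x :=
      (hf1.contDiffAt (hU.mem_nhds hx)).differentiableAt_iteratedFDeriv
        (by exact_mod_cast Nat.lt_succ_self k)
    have hc : HasFDerivAt (iteratedFDeriv ℝ (k + 1) f)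
        ((((continuousMultilinearCurryRightEquiv' ℝ k V Y).symm.toContinuousLinearEquiv :
          _ ≃L[ℝ] _) : _ →L[ℝ] _).comp (fderiv ℝ (iteratedFDeriv ℝ k (fderiv ℝ f)) x)) x := by
      rw [hcurry]
      exact (continuousMultilinearCurryRightEquiv'
        ℝ k V Y).symm.toContinuousLinearEquiv.hasFDerivAt.comp x hd.hasFDerivAt
    rw [hc.fderiv, iteratedFDeriv_succ_eq_comp_right]
    simp only [Function.comp_apply]
    have h1 : iteratedFDeriv ℝ k (fderiv ℝ fun x => fderiv ℝ f x y) x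
        = iteratedFDeriv ℝ k (fun x => fderiv ℝ (fderiv ℝ f) x y) x := by
      refine (Filter.EventuallyEq.iteratedFDeriv ℝ ?_ _).eq_of_nhds
      filter_upwards [hU.mem_nhds hx] with z hz using hsymm z hz
    rw [h1, ih hU hf1 y x hx]
    rfl

end Jets

/-- The space of `r`-jets in coordinates. -/
abbrev Jt (n r : ℕ) (X : Type) := (k : Fin (r + 1)) → (Fin (k : ℕ) → Fin n) → X

section Generic
variable {V E W Y : Type} [NormedAddCommGroup V] [NormedSpace ℝ V] [NormedAddCommGroup E]
  [NormedSpace ℝ E] [NormedAddCommGroup W] [NormedSpace ℝ W] [NormedAddCommGroup Y]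
  [NormedSpace ℝ Y] {U : Set V} {α T C C' : ℝ} {m : ℕ}

theorem HolB.comp_right {f : V → E →L[ℝ] W} (h : HolB U α C f) (L : Y →L[ℝ] E) :
    HolB U α (‖L‖ * C) fun x => (f x).comp L := by
  constructor
  · intro x hx
    refine (ContinuousLinearMap.opNorm_comp_le _ _).trans ?_
    rw [mul_comm]
    exact mul_le_mul_of_nonneg_left (h.1 x hx) (norm_nonneg _)
  · intro x hx x' hx'
    rw [← ContinuousLinearMap.sub_comp]
    refine (ContinuousLinearMap.opNorm_comp_le _ _).trans ?_
    rw [mul_comm, mul_assoc]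
    exact mul_le_mul_of_nonneg_left (h.2 x hx x' hx') (norm_nonneg _)

theorem HolB.clm_apply {f : V → E →L[ℝ] W} {g : V → E} (hC : 0 ≤ C) (h : HolB U α C f)
    (h' : HolB U α C' g) : HolB U α (2 * C * C') fun x => f x (g x) := by
  constructor
  · intro x hx
    have h0 : 0 ≤ C' := (norm_nonneg _).trans (h'.1 x hx)
    calc _ ≤ C * C' := ContinuousLinearMap.le_of_opNorm_le_of_le _ (h.1 x hx) (h'.1 x hx)
      _ ≤ _ := by nlinarith [mul_nonneg hC h0]
  · intro x hx x' hx'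
    calc ‖f x (g x) - f x' (g x')‖ = ‖f x (g x - g x') + (f x - f x') (g x')‖ := by
          congr 1
          simp
      _ ≤ C * (C' * ‖x - x'‖ ^ α) + C * ‖x - x'‖ ^ α * C' := (norm_add_le _ _).trans (add_le_add
          (ContinuousLinearMap.le_of_opNorm_le_of_le _ (h.1 x hx) (h'.2 x hx x' hx'))
          (ContinuousLinearMap.le_of_opNorm_le_of_le _ (h.2 x hx x' hx') (h'.1 x' hx')))
      _ = _ := by ring

theorem Reg.clm_apply (hU : IsOpen U) {f : ℝ → V → E →L[ℝ] W} {g : ℝ → V → E}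
    (h : Reg U α T m f) (h' : Reg U α T m g) : Reg U α T m fun t x => f t x (g t x) :=
  Reg.bilinear hU m (ContinuousLinearMap.id ℝ (E →L[ℝ] W)) h h'

theorem Reg.comp_right (hU : IsOpen U) {f : ℝ → V → E →L[ℝ] W} (h : Reg U α T m f)
    (L : Y →L[ℝ] E) : Reg U α T m fun t x => (f t x).comp L :=
  h.clm hU ((ContinuousLinearMap.compL ℝ Y E W).flip L)

end Generic

section JetSpace
variable {n r : ℕ} {X : Type} [NormedAddCommGroup X] [NormedSpace ℝ X]

/-- Inclusion of a jet component. -/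
def jetInj (k : Fin (r + 1)) (I : Fin (k : ℕ) → Fin n) : X →L[ℝ] Jt n r X :=
  (ContinuousLinearMap.single ℝ (fun k : Fin (r + 1) => (Fin (k : ℕ) → Fin n) → X) k).comp
    (ContinuousLinearMap.single ℝ (fun _ : Fin (k : ℕ) → Fin n => X) I)

/-- Inclusion of a component of top order. -/
abbrev topInj (J : Fin r → Fin n) : X →L[ℝ] Jt n r X := jetInj (Fin.last r) J

theorem sum_jetInj (z : Jt n r X) : z = ∑ k, ∑ I, jetInj k I (z k I) := by
  ext k I
  rw [Finset.sum_apply, Finset.sum_apply, Finset.sum_eq_single k, Finset.sum_apply,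
    Finset.sum_apply, Finset.sum_eq_single I]
  · simp [jetInj]
  · intro I' _ h
    simp [jetInj, Pi.single_apply, h.symm]
  · simp
  · intro k' _ h
    rw [Finset.sum_apply, Finset.sum_apply]
    refine Finset.sum_eq_zero fun I' _ => ?_
    simp [jetInj, Pi.single_apply, h.symm]
  · simp

theorem clm_jet_apply {W : Type} [NormedAddCommGroup W] [NormedSpace ℝ W] (L : Jt n r X →L[ℝ] W)
    (z : Jt n r X) : L z = (∑ J : Fin r → Fin n, L (topInj J (z (Fin.last r) J))) +
      ∑ k : Fin r, ∑ I, L (jetInj k.castSucc I (z k.castSucc I)) := by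
  conv_lhs => rw [sum_jetInj z]
  rw [Fin.sum_univ_castSucc, map_add, add_comm]
  simp only [map_sum]
  rfl

variable {V : Type} [NormedAddCommGroup V] [NormedSpace ℝ V] {U : Set V} {α T : ℝ} {m : ℕ}

/-- The `r`-jet of a function in the directions `b`. -/
def jet (b : Fin n → V) (r : ℕ) (f : V → X) (x : V) : Jt n r X :=
  fun k I => iteratedFDeriv ℝ (k : ℕ) f x fun j => b (I j)

theorem Reg.iteratedFDeriv_apply (hU : IsOpen U) {k : ℕ} {f : ℝ → V → X}
    (h : Reg U α T (m + k) f) (v : Fin k → V) :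
    Reg U α T m fun t x => iteratedFDeriv ℝ k (f t) x v :=
  (h.iteratedFDeriv_reg hU k).clm hU (ContinuousMultilinearMap.apply ℝ (fun _ => V) X v)

theorem Reg.jet_reg (hU : IsOpen U) {b : Fin n → V} {f : ℝ → V → X} (h : Reg U α T (m + r) f) :
    Reg U α T m fun t => jet b r (f t) :=
  Reg.pi hU (f := fun k t x => jet b r (f t) x k) fun k =>
    Reg.pi hU (f := fun I t x => jet b r (f t) x k I) fun I =>
      (h.mono (by have := k.2; omega : m + (k : ℕ) ≤ m + r) subset_rfl le_rfl).iteratedFDeriv_apply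
        hU fun j => b (I j)

end JetSpace

section Step
variable {V : Type} [NormedAddCommGroup V] [InnerProductSpace ℝ V] [FiniteDimensional ℝ V]
  [MeasurableSpace V] [BorelSpace V] [Nontrivial V]
  {X : Type} [NormedAddCommGroup X] [InnerProductSpace ℝ X] [FiniteDimensional ℝ X]
  {n r : ℕ} {c : V} {α T : ℝ}

/-- Ellipticity of the principal part of a linear map on jets. -/
def JetElliptic (b : OrthonormalBasis (Fin n) ℝ V) (lam : ℝ) (L : Jt n r X →L[ℝ] X) : Prop :=
  ∀ (ξ : V) (v : X), (-1 : ℝ) ^ (r / 2) * ∑ J : Fin r → Fin n,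
    (∏ j, inner ℝ ξ (b (J j))) * inner ℝ (L (topInj J v)) v ≤ -lam * ‖ξ‖ ^ r * ‖v‖ ^ 2

theorem jet_regularity_step (hr : 1 ≤ r) (hrev : Even r) (b : OrthonormalBasis (Fin n) ℝ V)
    {A : Jt n r X →L[ℝ] X} {lam : ℝ} (hlam : 0 < lam) (hA : JetElliptic b lam A)
    (hα0 : 0 < α) (hα1 : α < 1) {R R0 δ : ℝ} (hT : 0 < T) (hR : 0 < R) (hδ : 0 < δ)
    (hR0 : R + δ ≤ R0) {u u' : ℝ → V → X}
    (hu : Reg (Metric.ball c R0) α T r u) (hu' : Reg (Metric.ball c R0) α T 0 u')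
    (hder : ∀ t ∈ Set.Ioo 0 T, ∀ x ∈ Metric.ball c R0, HasDerivAt (fun s => u s x) (u' t x) t)
    {C0 : ℝ} (hC0 : 0 ≤ C0) (h0 : CH (Metric.ball c R0) α (r + 1) C0 (u 0))
    {a : V → ℝ → V → Jt n r X →L[ℝ] X} {g : V → ℝ → V → X} {Ca Cg : ℝ}
    (hCa : 0 ≤ Ca) (hCg : 0 ≤ Cg)
    (ha : ∀ y, 0 < ‖y‖ → ‖y‖ < δ → ∀ t ∈ Set.Icc 0 T, HolB (Metric.ball c R) α Ca (a y t))
    (hg : ∀ y, 0 < ‖y‖ → ‖y‖ < δ → ∀ t ∈ Set.Icc 0 T, HolB (Metric.ball c R) α Cg (g y t))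
    (heq : ∀ y, 0 < ‖y‖ → ‖y‖ < δ → ∀ t ∈ Set.Icc 0 T, ∀ x ∈ Metric.ball c R,
      dq y (u' t) x = a y t x (dq y (jet b r (u t)) x) + g y t x)
    (hsmall : ∀ ε > 0, ∃ ρ > 0, ∀ y, 0 < ‖y‖ → ‖y‖ < ρ → ∀ t ∈ Set.Icc 0 T, t < ρ →
      ∀ x ∈ Metric.ball c ρ, ‖a y t x - A‖ ≤ ε) :
    ∃ ρ > 0, ∃ τ > 0, τ ≤ T ∧ ρ ≤ R0 ∧ Reg (Metric.ball c ρ) α τ (r + 1) u := by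
  have hlow : ∀ (k : Fin r) (I : Fin (k : ℕ) → Fin n), ∃ C, 0 ≤ C ∧ ∀ t ∈ Set.Icc 0 T,
      CH (Metric.ball c R0) α 1 C fun x => iteratedFDeriv ℝ (k : ℕ) (u t) x fun j => b (I j) :=
    fun k I => ((hu.mono (by have := k.2; omega : 1 + (k : ℕ) ≤ r) subset_rfl
      le_rfl).iteratedFDeriv_apply Metric.isOpen_ball fun j => b (I j)).bound
  choose Cl hCl0 hCl using hlow
  have hmem : ∀ y : V, ‖y‖ < δ → ∀ x ∈ Metric.ball c R,
      x ∈ Metric.ball c R0 ∧ x + y ∈ Metric.ball c R0 := by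
    intro y hy x hx
    rw [mem_ball_iff_norm] at hx
    refine ⟨mem_ball_iff_norm.2 (by linarith), mem_ball_iff_norm.2 ?_⟩
    calc ‖x + y - c‖ = ‖(x - c) + y‖ := by congr 1; abel
      _ ≤ ‖x - c‖ + ‖y‖ := norm_add_le _ _
      _ < R0 := by linarith
  refine regularity_step hr hrev b (fun J => A.comp (topInj J)) hlam hA hα0 hα1 hT hR hδ hR0
    hu hu' hder hC0 h0
    (a := fun y J t x => (a y t x).comp (topInj J))
    (g := fun y t x => (∑ k : Fin r, ∑ I, a y t x (jetInj k.castSucc I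
      (dq y (fun z => iteratedFDeriv ℝ (k : ℕ) (u t) z fun j => b (I j)) x))) + g y t x)
    (Ca := (∑ J : Fin r → Fin n, ‖(topInj J : X →L[ℝ] Jt n r X)‖) * Ca)
    (Cg := (∑ k : Fin r, ∑ I : Fin (k : ℕ) → Fin n,
      2 * (‖(jetInj k.castSucc I : X →L[ℝ] Jt n r X)‖ * Ca) * Cl k I) + Cg)
    (mul_nonneg (Finset.sum_nonneg fun _ _ => ContinuousLinearMap.opNorm_nonneg _) hCa)
    (add_nonneg (Finset.sum_nonneg fun k _ => Finset.sum_nonneg fun I _ =>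
      mul_nonneg (mul_nonneg zero_le_two
        (mul_nonneg (ContinuousLinearMap.opNorm_nonneg _) hCa)) (hCl0 k I)) hCg) ?_ ?_ ?_ ?_
  · intro y hy0 hy J t ht
    refine ((ha y hy0 hy t ht).comp_right (topInj J)).mono subset_rfl
      (mul_le_mul_of_nonneg_right ?_ hCa)
    exact Finset.single_le_sum (f := fun J : Fin r → Fin n => ‖(topInj J : X →L[ℝ] Jt n r X)‖)
      (fun _ _ => ContinuousLinearMap.opNorm_nonneg _) (Finset.mem_univ J)
  · intro y hy0 hy t ht
    refine HolB.add (HolB.sum _ fun k _ => HolB.sum _ fun I _ => ?_) (hg y hy0 hy t ht)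
    exact HolB.clm_apply (f := fun x => (a y t x).comp (jetInj k.castSucc I))
      (mul_nonneg (ContinuousLinearMap.opNorm_nonneg _) hCa)
      ((ha y hy0 hy t ht).comp_right (jetInj k.castSucc I)) ((hCl k I t ht).dq Metric.isOpen_ball Metric.isOpen_ball (convex_ball _ _) (hmem y hy)).holB
  · intro y hy0 hy t ht x hx
    rw [heq y hy0 hy t ht x hx, clm_jet_apply (a y t x), add_assoc]
    rfl
  · intro ε hε
    set N : ℝ := ∑ J : Fin r → Fin n, ‖(topInj J : X →L[ℝ] Jt n r X)‖ with hN
    have hN0 : 0 ≤ N := Finset.sum_nonneg fun _ _ => ContinuousLinearMap.opNorm_nonneg _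
    obtain ⟨ρ, hρ, h⟩ := hsmall (ε / (N + 1)) (by positivity)
    refine ⟨ρ, hρ, fun y hy0 hy t ht htρ x hx J => ?_⟩
    rw [← ContinuousLinearMap.sub_comp]
    refine (ContinuousLinearMap.opNorm_comp_le _ _).trans ?_
    calc _ ≤ ε / (N + 1) * N := by
          gcongr
          · exact h y hy0 hy t ht htρ x hx
          · exact Finset.single_le_sum (f := fun J : Fin r → Fin n => ‖(topInj J : X →L[ℝ] Jt n r X)‖)
              (fun _ _ => ContinuousLinearMap.opNorm_nonneg _) (Finset.mem_univ J)
      _ ≤ ε := by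
          rw [div_mul_eq_mul_div, div_le_iff₀ (by positivity)]
          nlinarith

end Step

section Tools
variable {V : Type} [NormedAddCommGroup V] [NormedSpace ℝ V]
  {Y : Type} [NormedAddCommGroup Y] [NormedSpace ℝ Y] {c : V} {α T R0 : ℝ}

theorem Reg.exists_small {f : ℝ → V → Y} (h : Reg (Metric.ball c R0) α T 0 f) (hT : 0 < T)
    (hR0 : 0 < R0) {ε : ℝ} (hε : 0 < ε) : ∃ ρ > 0, ρ ≤ R0 ∧ ∀ t ∈ Set.Icc 0 T, t < ρ →
      ∀ x ∈ Metric.ball c ρ, ‖f t x - f 0 c‖ ≤ ε := by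
  have h1 := Metric.continuousWithinAt_iff.1
    (h.continuousOn ((0 : ℝ), c) ⟨⟨le_rfl, hT.le⟩, Metric.mem_ball_self hR0⟩) ε hε
  obtain ⟨d, hd, h2⟩ := h1
  refine ⟨min d R0, lt_min hd hR0, min_le_right _ _, fun t ht htρ x hx => ?_⟩
  have h3 := h2 (x := (t, x)) ⟨ht, Metric.ball_subset_ball (min_le_right _ _) hx⟩ (by
    rw [Prod.dist_eq]
    refine max_lt ?_ ((Metric.mem_ball.1 hx).trans_le (min_le_left _ _))
    simp only [Real.dist_eq, sub_zero, abs_of_nonneg ht.1]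
    exact htρ.trans_le (min_le_left _ _))
  rw [dist_eq_norm] at h3
  exact h3.le

theorem exists_pos_le_all {ι : Type} [Finite ι] {f : ι → ℝ} (h : ∀ i, 0 < f i) {s : ℝ}
    (hs : 0 < s) : ∃ x, 0 < x ∧ x ≤ s ∧ ∀ i, x ≤ f i := by
  obtain ⟨x, h1, h2⟩ := ((Filter.eventually_all.2 fun i =>
    (Ioc_mem_nhdsGT (h i) : ∀ᶠ x in nhdsWithin (0 : ℝ) (Set.Ioi 0), x ∈ Set.Ioc 0 (f i))).and
      (Ioc_mem_nhdsGT hs)).exists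
  exact ⟨x, h2.1, h2.2, fun i => (h1 i).2⟩

theorem hasFDerivAt_jet {n r : ℕ} (b : Fin n → V) {f : V → Y} {U : Set V} (hU : IsOpen U)
    (hf : ContDiffOn ℝ (r + 1) f U) {x : V} (hx : x ∈ U) :
    ∃ D : V →L[ℝ] Jt n r Y, HasFDerivAt (jet b r f) D x ∧
      ∀ y, D y = jet b r (fun z => fderiv ℝ f z y) x := by
  have hd : ∀ k : Fin (r + 1), DifferentiableAt ℝ (iteratedFDeriv ℝ (k : ℕ) f) x := fun k =>
    (hf.contDiffAt (hU.mem_nhds hx)).differentiableAt_iteratedFDeriv (by exact_mod_cast k.2)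
  refine ⟨ContinuousLinearMap.pi fun k => ContinuousLinearMap.pi fun I =>
    (ContinuousMultilinearMap.apply ℝ (fun _ => V) Y fun j => b (I j)).comp
      (fderiv ℝ (iteratedFDeriv ℝ (k : ℕ) f) x), ?_, fun y => ?_⟩
  · refine hasFDerivAt_pi.2 fun k => hasFDerivAt_pi.2 fun I => ?_
    exact (ContinuousMultilinearMap.apply ℝ (fun _ => V) Y
      fun j => b (I j)).hasFDerivAt.comp x (hd k).hasFDerivAt
  · ext k I
    simp only [ContinuousLinearMap.pi_apply, jet]
    rw [iteratedFDeriv_fderiv_apply (k : ℕ) hU (hf.of_le (by exact_mod_cast k.2)) y x hx]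
    rfl

end Tools

section Partials
variable {V : Type} [NormedAddCommGroup V] [InnerProductSpace ℝ V]
  {Y : Type} [NormedAddCommGroup Y] [NormedSpace ℝ Y] {U : Set V} {α T : ℝ} {n m : ℕ}

theorem Reg.fderiv_apply (hU : IsOpen U) {f : ℝ → V → Y} (h : Reg U α T (m + 1) f) (y : V) :
    Reg U α T m fun t x => fderiv ℝ (f t) x y :=
  ((reg_succ_iff hU).1 h).2.2.clm hU (ContinuousLinearMap.apply ℝ Y y)

theorem reg_succ_of_partials (hU : IsOpen U) (b : OrthonormalBasis (Fin n) ℝ V) {f : ℝ → V → Y}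
    (h : Reg U α T 1 f) (h' : ∀ i, Reg U α T m fun t x => fderiv ℝ (f t) x (b i)) :
    Reg U α T (m + 1) f := by
  refine (reg_succ_iff hU).2 ⟨((reg_succ_iff hU).1 h).1, h.mono (by simp) subset_rfl le_rfl, ?_⟩
  refine (Reg.sum hU Finset.univ fun i _ => (h' i).clm hU
    (ContinuousLinearMap.smulRightL ℝ V Y (innerSL ℝ (b i)))).congr hU fun t _ x _ => ?_
  ext y
  conv_lhs => rw [← b.sum_repr' y]
  simp

theorem CH.fderiv_apply (hU : IsOpen U) {f : V → Y} {C : ℝ} (hC : 0 ≤ C)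
    (h : CH U α (m + 1) C f) (y : V) :
    ∃ C', 0 ≤ C' ∧ CH U α m C' fun x => fderiv ℝ f x y :=
  ⟨_, mul_nonneg (norm_nonneg _) hC,
    ((ch_succ_iff hU).1 h).2.2.clm hU (ContinuousLinearMap.apply ℝ Y y)⟩

end Partials

section Linear
variable {V : Type} [NormedAddCommGroup V] [InnerProductSpace ℝ V] [FiniteDimensional ℝ V]
  [MeasurableSpace V] [BorelSpace V] [Nontrivial V]
  {X : Type} [NormedAddCommGroup X] [InnerProductSpace ℝ X] [FiniteDimensional ℝ X]
  {n r : ℕ} {c : V} {α : ℝ}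

/-- Gain of one derivative for linear equations with Hölder differentiable coefficients. -/
theorem linear_regularity_step (hr : 1 ≤ r) (hrev : Even r) (b : OrthonormalBasis (Fin n) ℝ V)
    {lam : ℝ} (hlam : 0 < lam) (hα0 : 0 < α) (hα1 : α < 1) {T R0 : ℝ} (hT : 0 < T) (hR0 : 0 < R0)
    {a : ℝ → V → Jt n r X →L[ℝ] X} {g v v' : ℝ → V → X}
    (ha : Reg (Metric.ball c R0) α T 1 a) (hg : Reg (Metric.ball c R0) α T 1 g)
    (hv : Reg (Metric.ball c R0) α T r v) (hv' : Reg (Metric.ball c R0) α T 0 v')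
    (hder : ∀ t ∈ Set.Ioo 0 T, ∀ x ∈ Metric.ball c R0, HasDerivAt (fun s => v s x) (v' t x) t)
    {C0 : ℝ} (hC0 : 0 ≤ C0) (h0 : CH (Metric.ball c R0) α (r + 1) C0 (v 0))
    (heq : ∀ t ∈ Set.Icc 0 T, ∀ x ∈ Metric.ball c R0, v' t x = a t x (jet b r (v t) x) + g t x)
    (hell : JetElliptic b lam (a 0 c)) :
    ∃ ρ > 0, ∃ τ > 0, τ ≤ T ∧ ρ ≤ R0 ∧ Reg (Metric.ball c ρ) α τ (r + 1) v := by
  have hU : IsOpen (Metric.ball c R0) := Metric.isOpen_ball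
  obtain ⟨Ca, hCa, hCa'⟩ := ha.bound
  obtain ⟨Cg, hCg, hCg'⟩ := hg.bound
  obtain ⟨Cj, hCj, hCj'⟩ := (Reg.jet_reg (m := 0) (b := b) hU (by simpa using hv)).bound
  have hmem : ∀ y : V, ‖y‖ < R0 / 2 → ∀ x ∈ Metric.ball c (R0 / 2),
      x ∈ Metric.ball c R0 ∧ x + y ∈ Metric.ball c R0 := by
    intro y hy x hx
    rw [mem_ball_iff_norm] at hx
    refine ⟨mem_ball_iff_norm.2 (by linarith), mem_ball_iff_norm.2 ?_⟩
    calc ‖x + y - c‖ = ‖(x - c) + y‖ := by congr 1; abel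
      _ ≤ ‖x - c‖ + ‖y‖ := norm_add_le _ _
      _ < R0 := by linarith
  have hsub : Metric.ball c (R0 / 2) ⊆ Metric.ball c R0 :=
    Metric.ball_subset_ball (by linarith)
  refine jet_regularity_step hr hrev b hlam hell hα0 hα1 hT (half_pos hR0) (half_pos hR0)
    (by linarith) hv hv' hder hC0 h0 (a := fun _ t x => a t x)
    (g := fun y t x => dq y (a t) x (jet b r (v t) (x + y)) + dq y (g t) x) hCa
    (Cg := 2 * Ca * Cj + Cg)
    (by positivity) ?_ ?_ ?_ ?_
  · exact fun y _ _ t ht => (hCa' t ht).holB.mono hsub le_rfl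
  · intro y _ hy t ht
    have hj : HolB (Metric.ball c (R0 / 2)) α Cj fun x => jet b r (v t) (x + y) :=
      ⟨fun x hx => (hCj' t ht).holB.1 _ (hmem y hy x hx).2, fun x hx x' hx' => by
        simpa using (hCj' t ht).holB.2 _ (hmem y hy x hx).2 _ (hmem y hy x' hx').2⟩
    exact (((hCa' t ht).dq hU Metric.isOpen_ball (convex_ball _ _)
      (hmem y hy)).holB.clm_apply hCa hj).add
        ((hCg' t ht).dq hU Metric.isOpen_ball (convex_ball _ _) (hmem y hy)).holB
  · intro y _ hy t ht x hx
    simp only [dq]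
    rw [heq t ht _ (hmem y hy x hx).1, heq t ht _ (hmem y hy x hx).2]
    simp only [map_smul, map_sub, smul_apply, sub_apply]
    module
  · intro ε hε
    obtain ⟨ρ, hρ, -, h⟩ := (ha.mono (Nat.zero_le 1) subset_rfl le_rfl).exists_small hT hR0 hε
    exact ⟨ρ, hρ, fun _ _ _ => h⟩

theorem linear_regularity (hr : 1 ≤ r) (hrev : Even r) (b : OrthonormalBasis (Fin n) ℝ V)
    {lam : ℝ} (hlam : 0 < lam) (hα0 : 0 < α) (hα1 : α < 1) (m : ℕ) : ∀ {T R0 : ℝ}, 0 < T →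
    0 < R0 → ∀ {a : ℝ → V → Jt n r X →L[ℝ] X} {g v v' : ℝ → V → X},
    Reg (Metric.ball c R0) α T m a → Reg (Metric.ball c R0) α T m g →
    Reg (Metric.ball c R0) α T r v → Reg (Metric.ball c R0) α T 0 v' →
    (∀ t ∈ Set.Ioo 0 T, ∀ x ∈ Metric.ball c R0, HasDerivAt (fun s => v s x) (v' t x) t) →
    (∃ C0, 0 ≤ C0 ∧ CH (Metric.ball c R0) α (r + m) C0 (v 0)) →
    (∀ t ∈ Set.Icc 0 T, ∀ x ∈ Metric.ball c R0, v' t x = a t x (jet b r (v t) x) + g t x) →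
    JetElliptic b lam (a 0 c) →
    ∃ ρ > 0, ∃ τ > 0, τ ≤ T ∧ ρ ≤ R0 ∧ Reg (Metric.ball c ρ) α τ (r + m) v := by
  induction m with
  | zero =>
    intro T R0 hT hR0 a g v v' _ _ hv _ _ _ _ _
    exact ⟨R0, hR0, T, hT, le_rfl, le_rfl, hv⟩
  | succ m ih =>
    intro T R0 hT hR0 a g v v' ha hg hv hv' hder h0 heq hell
    obtain ⟨C0, hC0, h0⟩ := h0
    obtain ⟨ρ₁, hρ₁, τ₁, hτ₁, hτT, hρR, hstep⟩ := linear_regularity_step hr hrev b hlam hα0 hα1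
      hT hR0 (ha.mono (by omega) subset_rfl le_rfl) (hg.mono (by omega) subset_rfl le_rfl) hv hv'
      hder hC0 (h0.mono (by omega) subset_rfl le_rfl) heq hell
    obtain ⟨ρ₂, hρ₂, τ₂, hτ₂, hτT₂, hρR₂, hih⟩ := ih hT hR0 (ha.mono (by omega) subset_rfl le_rfl)
      (hg.mono (by omega) subset_rfl le_rfl) hv hv' hder
      ⟨C0, hC0, h0.mono (by omega) subset_rfl le_rfl⟩ heq hell
    set R : ℝ := min ρ₁ ρ₂
    set S : ℝ := min τ₁ τ₂
    have hR : 0 < R := lt_min hρ₁ hρ₂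
    have hS : 0 < S := lt_min hτ₁ hτ₂
    have hRR : R ≤ R0 := (min_le_left _ _).trans hρR
    have hST : S ≤ T := (min_le_left _ _).trans hτT
    have hU : IsOpen (Metric.ball c R) := Metric.isOpen_ball
    have hUs : Metric.ball c R ⊆ Metric.ball c R0 := Metric.ball_subset_ball hRR
    have hv1 : Reg (Metric.ball c R) α S (r + 1) v :=
      hstep.mono le_rfl (Metric.ball_subset_ball (min_le_left _ _)) (min_le_left _ _)
    have hvm : Reg (Metric.ball c R) α S (m + r) v :=
      hih.mono (by omega) (Metric.ball_subset_ball (min_le_right _ _)) (min_le_right _ _)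
    have ha' := ha.mono (le_refl (m + 1)) hUs hST
    have hg' := hg.mono (le_refl (m + 1)) hUs hST
    have hv'1 : Reg (Metric.ball c R) α S 1 v' :=
      (((ha'.mono (by omega : 1 ≤ m + 1) subset_rfl le_rfl).clm_apply hU
        (Reg.jet_reg (m := 1) (b := b) hU (hv1.mono (by omega) subset_rfl le_rfl))).add hU
        (hg'.mono (by omega) subset_rfl le_rfl)).congr hU
        fun t ht x hx => heq t ⟨ht.1, ht.2.trans hST⟩ x (hUs hx)
    have hvi : ∀ i, ∃ ρ > 0, ∃ τ > 0, τ ≤ S ∧ ρ ≤ R ∧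
        Reg (Metric.ball c ρ) α τ (r + m) fun t x => fderiv ℝ (v t) x (b i) := by
      intro i
      refine ih hS hR (a := a) (g := fun t x => fderiv ℝ (a t) x (b i) (jet b r (v t) x) +
        fderiv ℝ (g t) x (b i)) (v' := fun t x => fderiv ℝ (v' t) x (b i))
        (ha'.mono (by omega) subset_rfl le_rfl)
        (((ha'.fderiv_apply hU (b i)).clm_apply hU (hvm.jet_reg hU)).add hU
          (hg'.fderiv_apply hU (b i)))
        (hv1.fderiv_apply hU (b i)) (Reg.fderiv_apply (m := 0) hU hv'1 (b i)) ?_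
        ((h0.mono (m' := r + m + 1) (by omega) hUs le_rfl).fderiv_apply hU hC0 (b i)) ?_ hell
      · intro t ht x hx
        have h1 := hasDerivAt_fderiv hU (hv1.mono (by omega) subset_rfl le_rfl) hv'1
          (fun t ht x hx => hder t ⟨ht.1, ht.2.trans_le hST⟩ x (hUs hx)) ht hx
        exact ((ContinuousLinearMap.apply ℝ X (b i)).hasFDerivAt.comp_hasDerivAt t h1)
      · intro t ht x hx
        have htT : t ∈ Set.Icc 0 T := ⟨ht.1, ht.2.trans hST⟩
        obtain ⟨Cv, _, hCv⟩ := hv1.bound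
        obtain ⟨D, hD, hDy⟩ := hasFDerivAt_jet b hU (hCv t ht).contDiffOn hx
        have h1 : HasFDerivAt (v' t) _ x :=
          ((((ha'.differentiableOn hU ht).differentiableAt (hU.mem_nhds hx)).hasFDerivAt.clm_apply
            hD).add ((hg'.differentiableOn hU ht).differentiableAt
              (hU.mem_nhds hx)).hasFDerivAt).congr_of_eventuallyEq (by
            filter_upwards [hU.mem_nhds hx] with z hz using heq t htT z (hUs hz))
        rw [h1.fderiv]
        simp only [add_apply, ContinuousLinearMap.comp_apply, ContinuousLinearMap.flip_apply, hDy]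
        abel
    choose ρ hρ τ hτ hτS hρR' hreg using hvi
    obtain ⟨ρ', hρ', hρ'R, hρ'i⟩ := exists_pos_le_all hρ hR
    obtain ⟨τ', hτ', hτ'S, hτ'i⟩ := exists_pos_le_all hτ hS
    exact ⟨ρ', hρ', τ', hτ', hτ'S.trans hST, hρ'R.trans hRR,
      reg_succ_of_partials Metric.isOpen_ball b
        (hv1.mono (by omega) (Metric.ball_subset_ball hρ'R) hτ'S)
        fun i => (hreg i).mono le_rfl (Metric.ball_subset_ball (hρ'i i)) (hτ'i i)⟩

end Linear

section Nonlinear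
variable {V : Type} [NormedAddCommGroup V] [InnerProductSpace ℝ V] [FiniteDimensional ℝ V]
  [MeasurableSpace V] [BorelSpace V] [Nontrivial V]
  {X : Type} [NormedAddCommGroup X] [InnerProductSpace ℝ X] [FiniteDimensional ℝ X]
  {n r : ℕ} {c : V} {α : ℝ}

/-- The inclusion of the jet variables. -/
abbrev jetIncl (V : Type) [NormedAddCommGroup V] [NormedSpace ℝ V] (n r : ℕ) (X : Type)
    [NormedAddCommGroup X] [NormedSpace ℝ X] : Jt n r X →L[ℝ] V × ℝ × Jt n r X :=
  (ContinuousLinearMap.inr ℝ V (ℝ × Jt n r X)).comp (ContinuousLinearMap.inr ℝ ℝ (Jt n r X))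

/-- The prolongation `(x, t, j_r u(x, t))`. -/
def prolong (b : Fin n → V) (r : ℕ) (u : ℝ → V → X) (t : ℝ) (x : V) : V × ℝ × Jt n r X :=
  (x, t, jet b r (u t) x)

theorem Reg.prolong_reg {U : Set V} {T : ℝ} {m : ℕ} (hU : IsOpen U) (hUb : Bornology.IsBounded U)
    (hα0 : 0 < α) (hα1 : α < 1) {b : Fin n → V} {u : ℝ → V → X} (h : Reg U α T (m + r) u) :
    Reg U α T m (prolong b r u) :=
  (reg_id hU hUb hα0.le hα1.le).prodMk hU
    ((reg_const_space (c := fun t => t) continuousOn_id).prodMk hU (h.jet_reg hU))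

theorem nonlinear_regularity_step (hr : 1 ≤ r) (hrev : Even r)
    (b : OrthonormalBasis (Fin n) ℝ V)
    {lam : ℝ} (hlam : 0 < lam) (hα0 : 0 < α) (hα1 : α < 1)
    {S : Set (V × ℝ × Jt n r X)} (hSc : IsCompact S) (hScv : Convex ℝ S) (hSu : UniqueDiffOn ℝ S)
    {G : V × ℝ × Jt n r X → X} (hG : ContDiffOn ℝ 2 G S) {T R0 : ℝ} (hT : 0 < T) (hR0 : 0 < R0)
    {u u' : ℝ → V → X}
    (hu : Reg (Metric.ball c R0) α T r u) (hu' : Reg (Metric.ball c R0) α T 0 u')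
    (hder : ∀ t ∈ Set.Ioo 0 T, ∀ x ∈ Metric.ball c R0, HasDerivAt (fun s => u s x) (u' t x) t)
    {C0 : ℝ} (hC0 : 0 ≤ C0) (h0 : CH (Metric.ball c R0) α (r + 1) C0 (u 0))
    (hS : ∀ t ∈ Set.Icc 0 T, ∀ x ∈ Metric.ball c R0, prolong b r u t x ∈ S)
    (heq : ∀ t ∈ Set.Icc 0 T, ∀ x ∈ Metric.ball c R0, u' t x = G (prolong b r u t x))
    (hell : JetElliptic b lam ((fderivWithin ℝ G S (prolong b r u 0 c)).comp (jetIncl V n r X))) :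
    ∃ ρ > 0, ∃ τ > 0, τ ≤ T ∧ ρ ≤ R0 ∧ Reg (Metric.ball c ρ) α τ (r + 1) u := by
  have hU : IsOpen (Metric.ball c R0) := Metric.isOpen_ball
  obtain ⟨H, L, hL0, hHeq, hHb, hHl, hHd⟩ := exists_mean_value_coefficient hSc hScv hSu hG
  have hp : Reg (Metric.ball c R0) α T 0 (prolong b r u) :=
    Reg.prolong_reg hU Metric.isBounded_ball hα0 hα1 (by simpa using hu)
  obtain ⟨Cp, hCp, hCp'⟩ := hp.bound
  have hmem : ∀ y : V, ‖y‖ < R0 / 2 → ∀ x ∈ Metric.ball c (R0 / 2),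
      x ∈ Metric.ball c R0 ∧ x + y ∈ Metric.ball c R0 := by
    intro y hy x hx
    rw [mem_ball_iff_norm] at hx
    refine ⟨mem_ball_iff_norm.2 (by linarith), mem_ball_iff_norm.2 ?_⟩
    calc ‖x + y - c‖ = ‖(x - c) + y‖ := by congr 1; abel
      _ ≤ ‖x - c‖ + ‖y‖ := norm_add_le _ _
      _ < R0 := by linarith
  have hHol : ∀ y, ‖y‖ < R0 / 2 → ∀ t ∈ Set.Icc 0 T, HolB (Metric.ball c (R0 / 2)) α
      (L + L * (Cp + Cp)) fun x => H (prolong b r u t x) (prolong b r u t (x + y)) := by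
    intro y hy t ht
    constructor
    · intro x hx
      refine (hHb _ (hS t ht _ (hmem y hy x hx).1) _ (hS t ht _ (hmem y hy x hx).2)).trans ?_
      exact le_add_of_nonneg_right (by positivity)
    · intro x hx x' hx'
      refine (hHl _ (hS t ht _ (hmem y hy x hx).1) _ (hS t ht _ (hmem y hy x hx).2)
        _ (hS t ht _ (hmem y hy x' hx').1) _ (hS t ht _ (hmem y hy x' hx').2)).trans ?_
      have h1 := (hCp' t ht).holB.2 _ (hmem y hy x hx).1 _ (hmem y hy x' hx').1
      have h2 := (hCp' t ht).holB.2 _ (hmem y hy x hx).2 _ (hmem y hy x' hx').2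
      rw [add_sub_add_right_eq_sub] at h2
      have h3 : 0 ≤ ‖x - x'‖ ^ α := Real.rpow_nonneg (norm_nonneg _) _
      calc _ ≤ L * (Cp * ‖x - x'‖ ^ α + Cp * ‖x - x'‖ ^ α) := by gcongr
        _ ≤ _ := by nlinarith [mul_nonneg hL0 h3]
  have hunit : ∀ y : V, 0 < ‖y‖ → ‖((‖y‖⁻¹ • y, 0, 0) : V × ℝ × Jt n r X)‖ ≤ 1 := by
    intro y hy
    simp [Prod.norm_def, norm_smul, hy.ne']
  refine jet_regularity_step hr hrev b hlam hell hα0 hα1 hT (half_pos hR0) (half_pos hR0)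
    (by linarith) hu hu' hder hC0 h0
    (a := fun y t x => (H (prolong b r u t x) (prolong b r u t (x + y))).comp (jetIncl V n r X))
    (g := fun y t x => H (prolong b r u t x) (prolong b r u t (x + y)) (‖y‖⁻¹ • y, 0, 0))
    (Ca := ‖jetIncl V n r X‖ * (L + L * (Cp + Cp))) (Cg := 2 * (L + L * (Cp + Cp)) * 1)
    (mul_nonneg (ContinuousLinearMap.opNorm_nonneg _) (by positivity)) (by positivity) ?_ ?_ ?_ ?_
  · exact fun y _ hy t ht => (hHol y hy t ht).comp_right _
  · exact fun y hy0 hy t ht => (hHol y hy t ht).clm_apply (by positivity) (holB_const (hunit y hy0))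
  · intro y hy0 hy t ht x hx
    have hx1 := (hmem y hy x hx).1
    have hx2 := (hmem y hy x hx).2
    have h1 : jetIncl V n r X (dq y (jet b r (u t)) x) + (‖y‖⁻¹ • y, 0, 0) =
        ‖y‖⁻¹ • (prolong b r u t (x + y) - prolong b r u t x) := by
      simp [prolong, dq]
    beta_reduce
    rw [ContinuousLinearMap.comp_apply, ← map_add, h1, map_smul, ← hHeq _ (hS t ht x hx1) _ (hS t ht _ hx2), dq, heq t ht x hx1,
      heq t ht _ hx2]
  · intro ε hε
    set N : ℝ := ‖jetIncl V n r X‖ with hN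
    have hN0 : 0 ≤ N := ContinuousLinearMap.opNorm_nonneg _
    obtain ⟨ρ, hρ, hρR, h⟩ := hp.exists_small hT hR0
      (ε := ε / ((L + 1) * 2 * (N + 1))) (by positivity)
    refine ⟨ρ / 2, half_pos hρ, fun y _ hy t ht htρ x hx => ?_⟩
    have h0S : prolong b r u 0 c ∈ S := hS 0 ⟨le_rfl, hT.le⟩ c (Metric.mem_ball_self hR0)
    have hxρ : x ∈ Metric.ball c ρ := Metric.ball_subset_ball (by linarith) hx
    have hyρ : x + y ∈ Metric.ball c ρ := by
      rw [mem_ball_iff_norm] at hx ⊢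
      calc ‖x + y - c‖ = ‖(x - c) + y‖ := by congr 1; abel
        _ ≤ ‖x - c‖ + ‖y‖ := norm_add_le _ _
        _ < ρ := by linarith
    have hsub : Metric.ball c ρ ⊆ Metric.ball c R0 := Metric.ball_subset_ball hρR
    rw [← ContinuousLinearMap.sub_comp, ← hHd _ h0S]
    refine (ContinuousLinearMap.opNorm_comp_le _ _).trans ?_
    have h1 := h t ht (by linarith) x hxρ
    have h2 := h t ht (by linarith) (x + y) hyρ
    calc _ ≤ L * (ε / ((L + 1) * 2 * (N + 1)) + ε / ((L + 1) * 2 * (N + 1))) * N := by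
          refine mul_le_mul_of_nonneg_right ?_ hN0
          refine (hHl _ (hS t ht x (hsub hxρ)) _ (hS t ht _ (hsub hyρ)) _ h0S _ h0S).trans ?_
          gcongr
      _ = (L / (L + 1)) * (N / (N + 1)) * ε := by field_simp; ring
      _ ≤ 1 * 1 * ε := by
          gcongr
          · exact (div_le_one (by positivity)).2 (by linarith)
          · exact (div_le_one (by positivity)).2 (by linarith)
      _ = ε := by ring

theorem nonlinear_regularity (hr : 1 ≤ r) (hrev : Even r) (b : OrthonormalBasis (Fin n) ℝ V)
    {lam : ℝ} (hlam : 0 < lam) (hα0 : 0 < α) (hα1 : α < 1)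
    {S : Set (V × ℝ × Jt n r X)} (hSc : IsCompact S) (hScv : Convex ℝ S) (hSu : UniqueDiffOn ℝ S)
    {G : V × ℝ × Jt n r X → X} {T R0 : ℝ} (hT : 0 < T) (hR0 : 0 < R0) {u u' : ℝ → V → X}
    (hu : Reg (Metric.ball c R0) α T r u) (hu' : Reg (Metric.ball c R0) α T 0 u')
    (hder : ∀ t ∈ Set.Ioo 0 T, ∀ x ∈ Metric.ball c R0, HasDerivAt (fun s => u s x) (u' t x) t)
    (hS : ∀ t ∈ Set.Icc 0 T, ∀ x ∈ Metric.ball c R0, prolong b r u t x ∈ S)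
    (heq : ∀ t ∈ Set.Icc 0 T, ∀ x ∈ Metric.ball c R0, u' t x = G (prolong b r u t x))
    (hell : JetElliptic b lam ((fderivWithin ℝ G S (prolong b r u 0 c)).comp (jetIncl V n r X)))
    {C0 : ℝ} (hC0 : 0 ≤ C0) (k : ℕ) (hG : ContDiffOn ℝ (2 + k) G S)
    (h0 : CH (Metric.ball c R0) α (r + k) C0 (u 0)) :
    ∃ ρ > 0, ∃ τ > 0, τ ≤ T ∧ ρ ≤ R0 ∧ Reg (Metric.ball c ρ) α τ (r + k) u := by
  induction k with
  | zero => exact ⟨R0, hR0, T, hT, le_rfl, le_rfl, hu⟩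
  | succ m ih =>
    obtain ⟨ρ₁, hρ₁, τ₁, hτ₁, hτT, hρR, hstep⟩ := nonlinear_regularity_step hr hrev b hlam hα0 hα1
      hSc hScv hSu (hG.of_le (by exact_mod_cast (by omega : 2 ≤ 2 + (m + 1)))) hT hR0 hu hu' hder
      hC0 (h0.mono (by omega) subset_rfl le_rfl) hS heq hell
    obtain ⟨ρ₂, hρ₂, τ₂, hτ₂, hτT₂, hρR₂, hih⟩ := ih
      (hG.of_le (by exact_mod_cast (by omega : 2 + m ≤ 2 + (m + 1))))
      (h0.mono (by omega) subset_rfl le_rfl)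
    set R : ℝ := min ρ₁ ρ₂
    set Q : ℝ := min τ₁ τ₂
    have hR : 0 < R := lt_min hρ₁ hρ₂
    have hQ : 0 < Q := lt_min hτ₁ hτ₂
    have hRR : R ≤ R0 := (min_le_left _ _).trans hρR
    have hQT : Q ≤ T := (min_le_left _ _).trans hτT
    have hU : IsOpen (Metric.ball c R) := Metric.isOpen_ball
    have hUs : Metric.ball c R ⊆ Metric.ball c R0 := Metric.ball_subset_ball hRR
    have hts : ∀ t ∈ Set.Icc 0 Q, t ∈ Set.Icc 0 T := fun t ht => ⟨ht.1, ht.2.trans hQT⟩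
    have hu1 : Reg (Metric.ball c R) α Q (r + 1) u :=
      hstep.mono le_rfl (Metric.ball_subset_ball (min_le_left _ _)) (min_le_left _ _)
    have hum : Reg (Metric.ball c R) α Q (m + r) u :=
      hih.mono (by omega) (Metric.ball_subset_ball (min_le_right _ _)) (min_le_right _ _)
    have hp1 : Reg (Metric.ball c R) α Q 1 (prolong b r u) :=
      Reg.prolong_reg hU Metric.isBounded_ball hα0 hα1 (hu1.mono (by omega) subset_rfl le_rfl)
    have hpm : Reg (Metric.ball c R) α Q m (prolong b r u) :=
      Reg.prolong_reg hU Metric.isBounded_ball hα0 hα1 hum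
    have hpS : ∀ t ∈ Set.Icc 0 Q, ∀ x ∈ Metric.ball c R, prolong b r u t x ∈ S :=
      fun t ht x hx => hS t (hts t ht) x (hUs hx)
    have hu'1 : Reg (Metric.ball c R) α Q 1 u' :=
      (reg_comp hU hSc hScv hSu 1 (hG.of_le
        (by exact_mod_cast (by omega : 1 + 1 ≤ 2 + (m + 1)))) hp1 hpS).congr hU
        fun t ht x hx => heq t (hts t ht) x (hUs hx)
    have hDG : ContDiffOn ℝ (m + 1) (fderivWithin ℝ G S) S :=
      hG.fderivWithin hSu (by exact_mod_cast (by omega : m + 1 + 1 ≤ 2 + (m + 1)))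
    have hDp : Reg (Metric.ball c R) α Q m fun t x => fderivWithin ℝ G S (prolong b r u t x) :=
      reg_comp hU hSc hScv hSu m hDG hpm hpS
    have hui : ∀ i, ∃ ρ > 0, ∃ τ > 0, τ ≤ Q ∧ ρ ≤ R ∧
        Reg (Metric.ball c ρ) α τ (r + m) fun t x => fderiv ℝ (u t) x (b i) := by
      intro i
      refine linear_regularity hr hrev b hlam hα0 hα1 m hQ hR
        (a := fun t x => (fderivWithin ℝ G S (prolong b r u t x)).comp (jetIncl V n r X))
        (g := fun t x => fderivWithin ℝ G S (prolong b r u t x) (b i, 0, 0))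
        (v' := fun t x => fderiv ℝ (u' t) x (b i))
        (hDp.comp_right hU _)
        (hDp.clm hU (ContinuousLinearMap.apply ℝ X ((b i, 0, 0) : V × ℝ × Jt n r X)))
        (hu1.fderiv_apply hU (b i)) (Reg.fderiv_apply (m := 0) hU hu'1 (b i)) ?_
        ((h0.mono (m' := r + m + 1) (by omega) hUs le_rfl).fderiv_apply hU hC0 (b i)) ?_ hell
      · intro t ht x hx
        have h1 := hasDerivAt_fderiv hU (hu1.mono (by omega) subset_rfl le_rfl) hu'1
          (fun t ht x hx => hder t ⟨ht.1, ht.2.trans_le hQT⟩ x (hUs hx)) ht hx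
        exact ((ContinuousLinearMap.apply ℝ X (b i)).hasFDerivAt.comp_hasDerivAt t h1)
      · intro t ht x hx
        obtain ⟨Cv, _, hCv⟩ := hu1.bound
        obtain ⟨D, hD, hDy⟩ := hasFDerivAt_jet b hU (hCv t ht).contDiffOn hx
        have hpd : HasFDerivAt (prolong b r u t) ((ContinuousLinearMap.id ℝ V).prod
            ((0 : V →L[ℝ] ℝ).prod D)) x :=
          (hasFDerivAt_id x).prodMk ((hasFDerivAt_const t x).prodMk hD)
        have hGd : HasFDerivWithinAt G (fderivWithin ℝ G S (prolong b r u t x)) S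
            (prolong b r u t x) :=
          ((hG.differentiableOn (by exact_mod_cast (by omega : 2 + (m + 1) ≠ 0))) _
            (hpS t ht x hx)).hasFDerivWithinAt
        have h1 : HasFDerivAt (u' t) _ x :=
          (hGd.comp_hasFDerivAt x hpd (by
            filter_upwards [hU.mem_nhds hx] with z hz using hpS t ht z hz)).congr_of_eventuallyEq (by
            filter_upwards [hU.mem_nhds hx] with z hz using heq t (hts t ht) z (hUs hz))
        rw [h1.fderiv]
        simp only [ContinuousLinearMap.comp_apply]
        rw [← map_add]
        congr 1
        simp [hDy]
    choose ρ hρ τ hτ hτS hρR' hreg using hui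
    obtain ⟨ρ', hρ', hρ'R, hρ'i⟩ := exists_pos_le_all hρ hR
    obtain ⟨τ', hτ', hτ'S, hτ'i⟩ := exists_pos_le_all hτ hQ
    exact ⟨ρ', hρ', τ', hτ', hτ'S.trans hQT, hρ'R.trans hRR,
      reg_succ_of_partials Metric.isOpen_ball b
        (hu1.mono (by omega) (Metric.ball_subset_ball hρ'R) hτ'S)
        fun i => (hreg i).mono le_rfl (Metric.ball_subset_ball (hρ'i i)) (hτ'i i)⟩

end Nonlinear

section TimeHolder
variable {V : Type} [NormedAddCommGroup V] [NormedSpace ℝ V]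
  {Y : Type} [NormedAddCommGroup Y] [NormedSpace ℝ Y]
  {Z : Type} [NormedAddCommGroup Z] [NormedSpace ℝ Z]

/-- Hölder continuity in time of exponent `β` of the spatial derivatives up to order `m`,
uniformly on `U`. -/
def TimeHolder (U : Set V) (β T : ℝ) (m : ℕ) (f : ℝ → V → Y) : Prop :=
  ∃ C, 0 ≤ C ∧ ∀ k ≤ m, ∀ t ∈ Set.Icc 0 T, ∀ s ∈ Set.Icc 0 T, ∀ x ∈ U,
    ‖iteratedFDeriv ℝ k (f t) x - iteratedFDeriv ℝ k (f s) x‖ ≤ C * |t - s| ^ β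

variable {U U' : Set V} {α β T T' : ℝ} {f g : ℝ → V → Y} {m : ℕ}

theorem TimeHolder.mono {m' : ℕ} (h : TimeHolder U β T m f) (hm : m' ≤ m) (hU : U' ⊆ U)
    (hT : T' ≤ T) : TimeHolder U' β T' m' f := by
  obtain ⟨C, hC, h⟩ := h
  exact ⟨C, hC, fun k hk t ht s hs x hx => h k (hk.trans hm) t ⟨ht.1, ht.2.trans hT⟩ s
    ⟨hs.1, hs.2.trans hT⟩ x (hU hx)⟩

theorem timeHolder_of_forall_le (h : ∀ k ≤ m, ∃ C, 0 ≤ C ∧ ∀ t ∈ Set.Icc 0 T, ∀ s ∈ Set.Icc 0 T,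
    ∀ x ∈ U, ‖iteratedFDeriv ℝ k (f t) x - iteratedFDeriv ℝ k (f s) x‖ ≤ C * |t - s| ^ β) :
    TimeHolder U β T m f := by
  choose! C hC h using h
  refine ⟨∑ k ∈ Finset.range (m + 1), C k,
    Finset.sum_nonneg fun k hk => hC k (Nat.lt_succ_iff.1 (Finset.mem_range.1 hk)),
    fun k hk t ht s hs x hx => (h k hk t ht s hs x hx).trans ?_⟩
  gcongr
  exact Finset.single_le_sum (fun k hk => hC k (Nat.lt_succ_iff.1 (Finset.mem_range.1 hk)))
    (Finset.mem_range.2 (Nat.lt_succ_iff.2 hk))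

theorem timeHolder_zero_iff : TimeHolder U β T 0 f ↔ ∃ C, 0 ≤ C ∧ ∀ t ∈ Set.Icc 0 T,
    ∀ s ∈ Set.Icc 0 T, ∀ x ∈ U, ‖f t x - f s x‖ ≤ C * |t - s| ^ β := by
  have e : ∀ t s x, ‖iteratedFDeriv ℝ 0 (f t) x - iteratedFDeriv ℝ 0 (f s) x‖
      = ‖f t x - f s x‖ := fun t s x => by
    simp only [iteratedFDeriv_zero_eq_comp, Function.comp_apply, ← map_sub]
    exact LinearIsometryEquiv.norm_map _ _
  constructor
  · rintro ⟨C, hC, h⟩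
    exact ⟨C, hC, fun t ht s hs x hx => e t s x ▸ h 0 le_rfl t ht s hs x hx⟩
  · rintro ⟨C, hC, h⟩
    refine ⟨C, hC, fun k hk t ht s hs x hx => ?_⟩
    obtain rfl : k = 0 := by omega
    rw [e]
    exact h t ht s hs x hx

theorem norm_iteratedFDeriv_succ_sub (f g : V → Y) (k : ℕ) (x : V) :
    ‖iteratedFDeriv ℝ (k + 1) f x - iteratedFDeriv ℝ (k + 1) g x‖
      = ‖iteratedFDeriv ℝ k (fderiv ℝ f) x - iteratedFDeriv ℝ k (fderiv ℝ g) x‖ := by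
  have e : ∀ f : V → Y, iteratedFDeriv ℝ (k + 1) f x =
      (continuousMultilinearCurryRightEquiv' ℝ k V Y).symm
      (iteratedFDeriv ℝ k (fderiv ℝ f) x) := fun f => iteratedFDeriv_succ_eq_comp_right
  rw [e, e]
  exact (congrArg norm (LinearIsometryEquiv.map_sub _ _ _).symm).trans
    (LinearIsometryEquiv.norm_map _ _)

theorem timeHolder_succ_iff : TimeHolder U β T (m + 1) f ↔
    TimeHolder U β T 0 f ∧ TimeHolder U β T m fun t => fderiv ℝ (f t) := by
  constructor
  · intro h
    obtain ⟨C, hC, h'⟩ := id h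
    refine ⟨h.mono (Nat.zero_le _) subset_rfl le_rfl, C, hC, fun k hk t ht s hs x hx => ?_⟩
    rw [← norm_iteratedFDeriv_succ_sub]
    exact h' (k + 1) (by omega) t ht s hs x hx
  · rintro ⟨⟨C, hC, h⟩, C', hC', h'⟩
    refine timeHolder_of_forall_le fun k hk => ?_
    cases k with
    | zero => exact ⟨C, hC, h 0 le_rfl⟩
    | succ k =>
      refine ⟨C', hC', fun t ht s hs x hx => ?_⟩
      rw [norm_iteratedFDeriv_succ_sub]
      exact h' k (by omega) t ht s hs x hx

theorem TimeHolder.congr (hU : IsOpen U) (h : TimeHolder U β T m f)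
    (he : ∀ t ∈ Set.Icc 0 T, ∀ x ∈ U, g t x = f t x) : TimeHolder U β T m g := by
  obtain ⟨C, hC, h⟩ := h
  have e : ∀ t ∈ Set.Icc 0 T, ∀ x ∈ U, ∀ k, iteratedFDeriv ℝ k (g t) x
      = iteratedFDeriv ℝ k (f t) x := fun t ht x hx k => by
    have : g t =ᶠ[nhds x] f t := by filter_upwards [hU.mem_nhds hx] with y hy using he t ht y hy
    exact (this.iteratedFDeriv ℝ k).eq_of_nhds
  refine ⟨C, hC, fun k hk t ht s hs x hx => ?_⟩
  rw [e t ht x hx, e s hs x hx]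
  exact h k hk t ht s hs x hx

theorem Reg.contDiffAt (hU : IsOpen U) (h : Reg U α T m f) {t : ℝ} (ht : t ∈ Set.Icc 0 T) {x : V}
    (hx : x ∈ U) : ContDiffAt ℝ m (f t) x := by
  obtain ⟨C, -, h⟩ := h.bound
  exact (h t ht).contDiffAt hU hx

theorem TimeHolder.add (hU : IsOpen U) (hf : Reg U α T m f) (hg : Reg U α T m g)
    (h : TimeHolder U β T m f) (h' : TimeHolder U β T m g) :
    TimeHolder U β T m fun t x => f t x + g t x := by
  obtain ⟨C, hC, h⟩ := h
  obtain ⟨C', hC', h'⟩ := h'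
  refine ⟨C + C', by positivity, fun k hk t ht s hs x hx => ?_⟩
  have e : ∀ t ∈ Set.Icc 0 T, iteratedFDeriv ℝ k (fun x => f t x + g t x) x
      = iteratedFDeriv ℝ k (f t) x + iteratedFDeriv ℝ k (g t) x := fun t ht =>
    iteratedFDeriv_add_apply ((hf.contDiffAt hU ht hx).of_le (by exact_mod_cast hk))
      ((hg.contDiffAt hU ht hx).of_le (by exact_mod_cast hk))
  rw [e t ht, e s hs, add_sub_add_comm, add_mul]
  exact (norm_add_le _ _).trans (add_le_add (h k hk t ht s hs x hx) (h' k hk t ht s hs x hx))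

theorem TimeHolder.clm (hU : IsOpen U) (hf : Reg U α T m f) (h : TimeHolder U β T m f)
    (L : Y →L[ℝ] Z) : TimeHolder U β T m fun t x => L (f t x) := by
  obtain ⟨C, hC, h⟩ := h
  refine ⟨‖L‖ * C, by positivity, fun k hk t ht s hs x hx => ?_⟩
  have e : ∀ t ∈ Set.Icc 0 T, iteratedFDeriv ℝ k (fun x => L (f t x)) x
      = L.compContinuousMultilinearMap (iteratedFDeriv ℝ k (f t) x) := fun t ht =>
    L.iteratedFDeriv_comp_left ((hf.contDiffAt hU ht hx).of_le (by exact_mod_cast hk)) le_rfl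
  rw [e t ht, e s hs, show L.compContinuousMultilinearMap (iteratedFDeriv ℝ k (f t) x) -
    L.compContinuousMultilinearMap (iteratedFDeriv ℝ k (f s) x) = L.compContinuousMultilinearMap
      (iteratedFDeriv ℝ k (f t) x - iteratedFDeriv ℝ k (f s) x) by ext; simp, mul_assoc]
  refine (L.norm_compContinuousMultilinearMap_le _).trans ?_
  gcongr
  exact h k hk t ht s hs x hx

theorem timeHolder_const {f : V → Y} : TimeHolder U β T m fun _ => f :=
  ⟨0, le_rfl, fun k hk t ht s hs x hx => by simp⟩

theorem TimeHolder.sum {ι : Type} (hU : IsOpen U) (s : Finset ι) {f : ι → ℝ → V → Y}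
    (hf : ∀ i ∈ s, Reg U α T m (f i)) (h : ∀ i ∈ s, TimeHolder U β T m (f i)) :
    TimeHolder U β T m fun t x => ∑ i ∈ s, f i t x := by
  classical
  induction s using Finset.induction_on with
  | empty => simpa using timeHolder_const (f := fun _ : V => (0 : Y))
  | insert i s hi ih =>
    simp only [Finset.sum_insert hi]
    exact TimeHolder.add hU (hf i (Finset.mem_insert_self i s))
      (Reg.sum hU s fun j hj => hf j (Finset.mem_insert_of_mem hj)) (h i (Finset.mem_insert_self i s))
      (ih (fun j hj => hf j (Finset.mem_insert_of_mem hj))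
        fun j hj => h j (Finset.mem_insert_of_mem hj))

theorem TimeHolder.bilinear (hU : IsOpen U) (m : ℕ) : ∀ {Y Z W : Type}
    [NormedAddCommGroup Y] [NormedSpace ℝ Y] [NormedAddCommGroup Z] [NormedSpace ℝ Z]
    [NormedAddCommGroup W] [NormedSpace ℝ W] (B : Y →L[ℝ] Z →L[ℝ] W) {f : ℝ → V → Y}
    {g : ℝ → V → Z}, Reg U α T m f → Reg U α T m g → TimeHolder U β T m f →
    TimeHolder U β T m g → TimeHolder U β T m fun t x => B (f t x) (g t x) := by
  have base : ∀ {Y Z W : Type}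
    [NormedAddCommGroup Y] [NormedSpace ℝ Y] [NormedAddCommGroup Z] [NormedSpace ℝ Z]
    [NormedAddCommGroup W] [NormedSpace ℝ W] (B : Y →L[ℝ] Z →L[ℝ] W) {f : ℝ → V → Y}
    {g : ℝ → V → Z}, Reg U α T 0 f → Reg U α T 0 g → TimeHolder U β T 0 f →
    TimeHolder U β T 0 g → TimeHolder U β T 0 fun t x => B (f t x) (g t x) := by
    intro Y Z W _ _ _ _ _ _ B f g hf hg h h'
    obtain ⟨-, Cf, hCf, hf⟩ := reg_zero_iff.1 hf
    obtain ⟨-, Cg, hCg, hg⟩ := reg_zero_iff.1 hg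
    obtain ⟨Df, hDf, h⟩ := timeHolder_zero_iff.1 h
    obtain ⟨Dg, hDg, h'⟩ := timeHolder_zero_iff.1 h'
    refine timeHolder_zero_iff.2 ⟨‖B‖ * (Cf * Dg + Df * Cg), by positivity,
      fun t ht s hs x hx => ?_⟩
    have e : B (f t x) (g t x) - B (f s x) (g s x)
        = B (f t x) (g t x - g s x) + B (f t x - f s x) (g s x) := by
      simp
    rw [e]
    have h1 := B.le_opNorm₂ (f t x) (g t x - g s x)
    have h2 := B.le_opNorm₂ (f t x - f s x) (g s x)
    have h3 : ‖B‖ * ‖f t x‖ * ‖g t x - g s x‖ ≤ ‖B‖ * Cf * (Dg * |t - s| ^ β) := by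
      gcongr
      · exact (hf t ht).1 x hx
      · exact h' t ht s hs x hx
    have h4 : ‖B‖ * ‖f t x - f s x‖ * ‖g s x‖ ≤ ‖B‖ * (Df * |t - s| ^ β) * Cg := by
      gcongr
      · exact h t ht s hs x hx
      · exact (hg s hs).1 x hx
    refine (norm_add_le _ _).trans ?_
    linarith
  induction m with
  | zero => exact base
  | succ m ih =>
    intro Y Z W _ _ _ _ _ _ B f g hf hg h h'
    have hd := (reg_succ_iff hU).1 hf
    have hd' := (reg_succ_iff hU).1 hg
    have ht := timeHolder_succ_iff.1 h
    have ht' := timeHolder_succ_iff.1 h'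
    have hm := Nat.le_succ m
    have hder : ∀ t ∈ Set.Icc 0 T, ∀ x ∈ U, HasFDerivAt (fun x => B (f t x) (g t x))
        (B.precompR V (f t x) (fderiv ℝ (g t) x) + B.precompL V (fderiv ℝ (f t) x) (g t x)) x :=
      fun t ht x hx => B.hasFDerivAt_of_bilinear
        ((hd.1 t ht x hx).differentiableAt (hU.mem_nhds hx)).hasFDerivAt
        ((hd'.1 t ht x hx).differentiableAt (hU.mem_nhds hx)).hasFDerivAt
    have hf' := hf.mono hm subset_rfl le_rfl
    have hg' := hg.mono hm subset_rfl le_rfl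
    have h1 := ih (B.precompR V) hf' hd'.2.2 (h.mono hm subset_rfl le_rfl) ht'.2
    have h2 := ih (B.precompL V) hd.2.2 hg' ht.2 (h'.mono hm subset_rfl le_rfl)
    exact timeHolder_succ_iff.2 ⟨base B hd.2.1 hd'.2.1 ht.1 ht'.1,
      (TimeHolder.add hU (Reg.bilinear hU m (B.precompR V) hf' hd'.2.2)
        (Reg.bilinear hU m (B.precompL V) hd.2.2 hg') h1 h2).congr hU
        fun t ht x hx => (hder t ht x hx).fderiv⟩

theorem timeHolder_comp (hU : IsOpen U) {E : Type} [NormedAddCommGroup E] [NormedSpace ℝ E]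
    {S : Set E} (hSc : IsCompact S) (hScv : Convex ℝ S) (hSu : UniqueDiffOn ℝ S) (m : ℕ) :
    ∀ {Y : Type} [NormedAddCommGroup Y] [NormedSpace ℝ Y] {G : E → Y} {q : ℝ → V → E},
    ContDiffOn ℝ (m + 1) G S → Reg U α T m q → (∀ t ∈ Set.Icc 0 T, ∀ x ∈ U, q t x ∈ S) →
    TimeHolder U β T m q → TimeHolder U β T m fun t x => G (q t x) := by
  have base : ∀ {Y : Type} [NormedAddCommGroup Y] [NormedSpace ℝ Y] {G : E → Y} {q : ℝ → V → E},
    ContDiffOn ℝ 1 G S → (∀ t ∈ Set.Icc 0 T, ∀ x ∈ U, q t x ∈ S) →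
    TimeHolder U β T 0 q → TimeHolder U β T 0 fun t x => G (q t x) := by
    intro Y _ _ G q hG hS h
    obtain ⟨C, hC, h⟩ := timeHolder_zero_iff.1 h
    obtain ⟨L, hL⟩ := hSc.exists_bound_of_continuousOn (hG.continuousOn_fderivWithin hSu le_rfl)
    have hlip : ∀ p ∈ S, ∀ p' ∈ S, ‖G p - G p'‖ ≤ max L 0 * ‖p - p'‖ := fun p hp p' hp' =>
      hScv.norm_image_sub_le_of_norm_fderivWithin_le (hG.differentiableOn (by simp))
        (fun z hz => (hL z hz).trans (le_max_left _ _)) hp' hp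
    refine timeHolder_zero_iff.2 ⟨max L 0 * C, by positivity, fun t ht s hs x hx => ?_⟩
    refine (hlip _ (hS t ht x hx) _ (hS s hs x hx)).trans ?_
    rw [mul_assoc]
    gcongr
    exact h t ht s hs x hx
  induction m with
  | zero =>
    intro Y _ _ G q hG hq hS h
    exact base (by simpa using hG) hS h
  | succ m ih =>
    intro Y _ _ G q hG hq hS h
    have hd := (reg_succ_iff hU).1 hq
    have hG1 : ContDiffOn ℝ 1 G S := hG.of_le (by exact_mod_cast Nat.le_add_left 1 (m + 1))
    have hG' : ContDiffOn ℝ (m + 1) (fderivWithin ℝ G S) S :=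
      hG.fderivWithin hSu (by exact_mod_cast le_rfl)
    have hder : ∀ t ∈ Set.Icc 0 T, ∀ x ∈ U, HasFDerivAt (fun x => G (q t x))
        ((fderivWithin ℝ G S (q t x)).comp (fderiv ℝ (q t) x)) x := fun t ht x hx => by
      have h1 := (hG1.differentiableOn (by simp) _ (hS t ht x hx)).hasFDerivWithinAt
      have h2 := ((hd.1 t ht x hx).differentiableAt (hU.mem_nhds hx)).hasFDerivAt
      exact (h1.comp x (h2.hasFDerivWithinAt (s := U)) (hS t ht)).hasFDerivAt (hU.mem_nhds hx)
    have ht := timeHolder_succ_iff.1 h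
    have hq' := hq.mono (Nat.le_succ m) le_rfl le_rfl
    refine timeHolder_succ_iff.2 ⟨base hG1 hS ht.1, ?_⟩
    exact (TimeHolder.bilinear hU m (ContinuousLinearMap.compL ℝ V E Y)
      (reg_comp hU hSc hScv hSu m hG' hq' hS) hd.2.2
      (ih hG' hq' hS (h.mono (Nat.le_succ m) le_rfl le_rfl)) ht.2).congr hU
      fun t ht x hx => (hder t ht x hx).fderiv

theorem TimeHolder.iteratedFDeriv_timeHolder (hU : IsOpen U) (k : ℕ) : ∀ {m : ℕ},
    Reg U α T (m + k) f → TimeHolder U β T (m + k) f →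
    TimeHolder U β T m (fun t => iteratedFDeriv ℝ k (f t)) := by
  induction k with
  | zero =>
    intro m hf h
    simp only [iteratedFDeriv_zero_eq_comp]
    exact TimeHolder.clm hU hf h ((continuousMultilinearCurryFin0 ℝ V
      Y).symm.toContinuousLinearEquiv : Y →L[ℝ] V [×0]→L[ℝ] Y)
  | succ k ih =>
    intro m hf h
    have e : m + 1 + k = m + (k + 1) := by omega
    have h1 : TimeHolder U β T (m + 1) (fun t => iteratedFDeriv ℝ k (f t)) :=
      ih (e ▸ hf) (e ▸ h)
    have hf1 := ((reg_succ_iff hU).1 (Reg.iteratedFDeriv_reg hU k (m := m + 1) (e ▸ hf))).2.2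
    have h2 := (timeHolder_succ_iff.1 h1).2
    simp only [iteratedFDeriv_succ_eq_comp_left]
    exact TimeHolder.clm hU hf1 h2 ((continuousMultilinearCurryLeftEquiv ℝ
      (fun _ : Fin (k + 1) => V) Y).symm.toContinuousLinearEquiv :
      (V →L[ℝ] V [×k]→L[ℝ] Y) →L[ℝ] V [×(k + 1)]→L[ℝ] Y)

theorem TimeHolder.iteratedFDeriv_apply (hU : IsOpen U) {k : ℕ} (hf : Reg U α T (m + k) f)
    (h : TimeHolder U β T (m + k) f) (v : Fin k → V) :
    TimeHolder U β T m fun t x => iteratedFDeriv ℝ k (f t) x v :=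
  TimeHolder.clm hU (Reg.iteratedFDeriv_reg hU k hf) (h.iteratedFDeriv_timeHolder hU k hf)
    (ContinuousMultilinearMap.apply ℝ (fun _ : Fin k => V) Y v)

theorem timeHolder_time (hβ1 : β ≤ 1) : TimeHolder U β T m fun t (_ : V) => t := by
  have h0 : ∀ m, TimeHolder U β T m fun t (_ : V) => t := fun m => by
    refine timeHolder_of_forall_le fun k _ => ?_
    cases k with
    | zero =>
      refine ⟨|T| ^ (1 - β), by positivity, fun t ht s hs x hx => ?_⟩
      have e : ‖iteratedFDeriv ℝ 0 (fun _ : V => t) x - iteratedFDeriv ℝ 0 (fun _ : V => s) x‖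
          = |t - s| := by
        simp only [iteratedFDeriv_zero_eq_comp, Function.comp_apply, ← map_sub]
        exact LinearIsometryEquiv.norm_map _ _
      rw [e]
      rcases (abs_nonneg (t - s)).eq_or_lt with h | h
      · rw [← h]; positivity
      · calc |t - s| = |t - s| ^ (1 - β) * |t - s| ^ β := by
              rw [← Real.rpow_add h]; simp
          _ ≤ _ := by
            have h1 : |t - s| ≤ |T| := by
              rw [abs_le]
              have := le_abs_self T
              constructor <;> linarith [ht.1, ht.2, hs.1, hs.2]
            have h2 : 0 ≤ 1 - β := by linarith
            gcongr
    | succ k =>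
      refine ⟨0, le_rfl, fun t ht s hs x hx => ?_⟩
      simp [iteratedFDeriv_const_of_ne (Nat.succ_ne_zero k)]
  exact h0 m

theorem TimeHolder.prodMk (hU : IsOpen U) {g : ℝ → V → Z} (hf : Reg U α T m f)
    (hg : Reg U α T m g) (h : TimeHolder U β T m f) (h' : TimeHolder U β T m g) :
    TimeHolder U β T m fun t x => (f t x, g t x) := by
  simpa using TimeHolder.add hU (hf.clm hU (ContinuousLinearMap.inl ℝ Y Z))
    (hg.clm hU (ContinuousLinearMap.inr ℝ Y Z)) (h.clm hU hf (ContinuousLinearMap.inl ℝ Y Z))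
    (h'.clm hU hg (ContinuousLinearMap.inr ℝ Y Z))

theorem TimeHolder.jet (hU : IsOpen U) {n r : ℕ} {b : Fin n → V} (hf : Reg U α T (m + r) f)
    (h : TimeHolder U β T (m + r) f) : TimeHolder U β T m fun t => jet b r (f t) := by
  have hk : ∀ k : Fin (r + 1), m + (k : ℕ) ≤ m + r := fun k => by have := k.2; omega
  have hR : ∀ (k : Fin (r + 1)) (I : Fin (k : ℕ) → Fin n), Reg U α T m fun t x =>
      iteratedFDeriv ℝ (k : ℕ) (f t) x fun j => b (I j) := fun k I =>
    (hf.mono (hk k) subset_rfl le_rfl).iteratedFDeriv_apply hU _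
  have hH : ∀ (k : Fin (r + 1)) (I : Fin (k : ℕ) → Fin n), TimeHolder U β T m fun t x =>
      iteratedFDeriv ℝ (k : ℕ) (f t) x fun j => b (I j) := fun k I =>
    TimeHolder.iteratedFDeriv_apply hU (hf.mono (hk k) subset_rfl le_rfl)
      (h.mono (hk k) subset_rfl le_rfl) _
  refine TimeHolder.congr hU (f := fun t x => ∑ k : Fin (r + 1), ∑ I : Fin (k : ℕ) → Fin n,
    jetInj k I (iteratedFDeriv ℝ (k : ℕ) (f t) x fun j => b (I j))) ?_
    fun t ht x hx => sum_jetInj (ParabolicBootstrap.jet b r (f t) x)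
  exact TimeHolder.sum hU _ (fun k _ => Reg.sum hU _ fun I _ => (hR k I).clm hU (jetInj k I))
    fun k _ => TimeHolder.sum hU _ (fun I _ => (hR k I).clm hU (jetInj k I))
      fun I _ => (hH k I).clm hU (hR k I) (jetInj k I)

end TimeHolder

section TimeRegularity
variable {V : Type} [NormedAddCommGroup V] [InnerProductSpace ℝ V] [FiniteDimensional ℝ V]
  [MeasurableSpace V] [BorelSpace V] [Nontrivial V]
  {X : Type} [NormedAddCommGroup X] [InnerProductSpace ℝ X] [FiniteDimensional ℝ X]
  {n r : ℕ} {c : V} {α ρ σ T : ℝ}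

theorem norm_le_of_fderiv_le_of_support {Y : Type} [NormedAddCommGroup Y] [NormedSpace ℝ Y]
    (hρ : 0 < ρ) {f : V → Y} (hf : Differentiable ℝ f)
    (hf0 : ∀ x ∉ Metric.closedBall c ρ, f x = 0) {C : ℝ} (hC : 0 ≤ C)
    (h : ∀ x, ‖fderiv ℝ f x‖ ≤ C) (x : V) : ‖f x‖ ≤ 3 * ρ * C := by
  by_cases hx : x ∈ Metric.closedBall c ρ
  · obtain ⟨e, he⟩ := exists_norm_eq V (by positivity : 0 ≤ 2 * ρ)
    have h0 : f (c + e) = 0 := hf0 _ fun h => by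
      rw [mem_closedBall_iff_norm, add_sub_cancel_left, he] at h
      linarith
    have h1 : ‖f x - f (c + e)‖ ≤ C * ‖x - (c + e)‖ :=
      convex_univ.norm_image_sub_le_of_norm_fderiv_le (fun x _ => hf x)
        (fun x _ => h x) (Set.mem_univ _) (Set.mem_univ _)
    have h2 : ‖x - (c + e)‖ ≤ 3 * ρ := by
      rw [mem_closedBall_iff_norm] at hx
      calc _ = ‖(x - c) - e‖ := by congr 1; abel
        _ ≤ ‖x - c‖ + ‖e‖ := norm_sub_le _ _
        _ ≤ _ := by linarith
    rw [h0, sub_zero] at h1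
    calc _ ≤ C * ‖x - (c + e)‖ := h1
      _ ≤ C * (3 * ρ) := by gcongr
      _ = _ := by ring
  · rw [hf0 x hx, norm_zero]
    positivity

theorem norm_iteratedFDeriv_le_of_support {Y : Type} [NormedAddCommGroup Y] [NormedSpace ℝ Y]
    (hρ : 0 < ρ) {f : V → Y} {m : ℕ} (hf : ContDiff ℝ m f)
    (hf0 : ∀ x ∉ Metric.closedBall c ρ, f x = 0) {C : ℝ} (hC : 0 ≤ C)
    (h : ∀ x, ‖iteratedFDeriv ℝ m f x‖ ≤ C) (j : ℕ) (hj : j ≤ m) (x : V) :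
    ‖iteratedFDeriv ℝ j f x‖ ≤ (3 * ρ) ^ (m - j) * C := by
  induction hi : m - j generalizing j x with
  | zero =>
    obtain rfl : j = m := by omega
    simpa using h x
  | succ i ih =>
    have h2 := norm_le_of_fderiv_le_of_support hρ
      (hf.differentiable_iteratedFDeriv (m := j) (by exact_mod_cast (by omega : j < m)))
      (iteratedFDeriv_eq_zero_of_notMem hf0 j) (by positivity)
      (fun x => (norm_fderiv_iteratedFDeriv (𝕜 := ℝ) (f := f) (n := j)).le.trans
        (ih (j + 1) (by omega) x (by omega))) x
    exact h2.trans (le_of_eq (by ring))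

theorem timeHolder_of_evolution (hr : 1 ≤ r) (b : OrthonormalBasis (Fin n) ℝ V)
    (k : 𝓢(V, X →L[ℝ] X)) (hk : ∫ x, k x = 1) (hα0 : 0 < α) (hα1 : α < 1) (hσ : 0 < σ)
    {v v' : ℝ → V → X} (hv : Reg (Metric.ball c σ) α T r v) (hv' : Reg (Metric.ball c σ) α T 0 v')
    (hder : ∀ t ∈ Set.Ioo 0 T, ∀ x ∈ Metric.ball c σ, HasDerivAt (fun s => v s x) (v' t x) t) :
    TimeHolder (Metric.ball c (σ / 4)) (α / r) T r v := by
  obtain ⟨η, hη1, hη0, hηR⟩ := exists_cutoff c (ρ := σ / 2) (by positivity) hα0.le hα1.le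
  have hρσ : σ / 2 < σ := by linarith
  have hw := compactEvolution_cutoff hv hv' hder (hηR r σ T) hη0 hρσ hα0.le
  have hwR := hv.cutoff (hηR r σ T) hη0 hρσ hα0.le
  have hwR' := hv'.cutoff (hηR 0 σ T) hη0 hρσ hα0.le
  obtain ⟨M, hM, hMb⟩ := hwR.bound
  obtain ⟨-, M', hM', hMb'⟩ := reg_zero_iff.1 hwR'
  choose C hC hTI using fun J : Fin r → Fin n =>
    exists_time_holder_bound (X := X) hr k hk hα0 hα1 fun j => b (J j)
  set w : ℝ → V → X := fun t x => η x • v t x with hwdef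
  have htop : ∀ t ∈ Set.Icc 0 T, ∀ s ∈ Set.Icc 0 T, ∀ x,
      ‖iteratedFDeriv ℝ r (w t) x - iteratedFDeriv ℝ r (w s) x‖
        ≤ (∑ J, C J * max M M') * |t - s| ^ (α / r) := by
    intro t ht s hs x
    refine (multilinear_norm_le_sum_basis b _).trans ?_
    rw [Finset.sum_mul]
    refine Finset.sum_le_sum fun J _ => ?_
    refine hTI J _ T w _ (max M M') hw (by positivity) (fun t ht x x' => ?_) (fun t ht x x' => ?_)
      t ht s hs x
    · refine ((hMb' t ht).2 x (Set.mem_univ _) x' (Set.mem_univ _)).trans ?_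
      gcongr
      exact le_max_right _ _
    · refine (apply_basis_le b (iteratedFDeriv ℝ r (w t) x - iteratedFDeriv ℝ r (w t) x')
        J).trans ?_
      refine (((hMb t ht).hol r le_rfl).2 x (Set.mem_univ _) x' (Set.mem_univ _)).trans ?_
      gcongr
      exact le_max_left _ _
  have hTH : TimeHolder (Metric.ball c (σ / 4)) (α / r) T r w := by
    refine timeHolder_of_forall_le fun j hj => ⟨(3 * (σ / 2)) ^ (r - j) * ∑ J, C J * max M M', ?_,
      fun t ht s hs x _ => ?_⟩
    · have : 0 ≤ ∑ J, C J * max M M' := Finset.sum_nonneg fun J _ =>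
        mul_nonneg (hC J) (by positivity)
      positivity
    · have hct := hw.contDiff t ht
      have hcs := hw.contDiff s hs
      have e : ∀ j ≤ r, ∀ x, iteratedFDeriv ℝ j (fun x => w t x - w s x) x
          = iteratedFDeriv ℝ j (w t) x - iteratedFDeriv ℝ j (w s) x := fun j hj x =>
        iteratedFDeriv_sub_apply (hct.of_le (by exact_mod_cast hj)).contDiffAt
          (hcs.of_le (by exact_mod_cast hj)).contDiffAt
      have := norm_iteratedFDeriv_le_of_support (c := c) (ρ := σ / 2) (by positivity)
        (hct.sub hcs) (fun x hx => by
          simp only [hw.zero t ht x hx, hw.zero s hs x hx, sub_zero])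
        (C := (∑ J, C J * max M M') * |t - s| ^ (α / r))
        ((norm_nonneg _).trans (htop t ht s hs x)) (fun x => by
          rw [e r le_rfl]; exact htop t ht s hs x) j hj x
      rw [e j hj] at this
      rw [mul_assoc]
      exact this
  refine hTH.congr Metric.isOpen_ball fun t ht x hx => ?_
  have : η x = 1 := hη1 x (by rwa [show σ / 2 / 2 = σ / 4 by ring])
  simp [hwdef, this]

theorem timeHolder_succ_of_partials {U : Set V} (hU : IsOpen U) {β : ℝ} {m : ℕ}
    {Y : Type} [NormedAddCommGroup Y] [NormedSpace ℝ Y]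
    (b : OrthonormalBasis (Fin n) ℝ V) {f : ℝ → V → Y} (hf : Reg U α T (m + 1) f)
    (h : TimeHolder U β T 0 f) (h' : ∀ i, TimeHolder U β T m fun t x => fderiv ℝ (f t) x (b i)) :
    TimeHolder U β T (m + 1) f := by
  refine timeHolder_succ_iff.2 ⟨h, ?_⟩
  refine (TimeHolder.sum hU Finset.univ (fun i _ => (hf.fderiv_apply hU (b i)).clm hU
    (ContinuousLinearMap.smulRightL ℝ V Y (innerSL ℝ (b i)))) fun i _ =>
    (h' i).clm hU (hf.fderiv_apply hU (b i))
    (ContinuousLinearMap.smulRightL ℝ V Y (innerSL ℝ (b i)))).congr hU fun t _ x _ => ?_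
  ext y
  conv_lhs => rw [← b.sum_repr' y]
  simp

theorem timeHolder_of_evolution_higher (hr : 1 ≤ r) (b : OrthonormalBasis (Fin n) ℝ V)
    (k : 𝓢(V, X →L[ℝ] X)) (hk : ∫ x, k x = 1) (hα0 : 0 < α) (hα1 : α < 1) (hσ : 0 < σ) (m : ℕ) :
    ∀ {v v' : ℝ → V → X}, Reg (Metric.ball c σ) α T (r + m) v → Reg (Metric.ball c σ) α T m v' →
    (∀ t ∈ Set.Ioo 0 T, ∀ x ∈ Metric.ball c σ, HasDerivAt (fun s => v s x) (v' t x) t) →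
    TimeHolder (Metric.ball c (σ / 4)) (α / r) T (r + m) v := by
  have hU : IsOpen (Metric.ball c σ) := Metric.isOpen_ball
  induction m with
  | zero => exact fun hv hv' hder => timeHolder_of_evolution hr b k hk hα0 hα1 hσ hv hv' hder
  | succ m ih =>
    intro v v' hv hv' hder
    have hsub : Metric.ball c (σ / 4) ⊆ Metric.ball c σ := Metric.ball_subset_ball (by linarith)
    refine timeHolder_succ_of_partials (m := r + m) Metric.isOpen_ball b
      (hv.mono le_rfl hsub le_rfl) ((timeHolder_of_evolution hr b k hk hα0 hα1 hσ
        (hv.mono (by omega) subset_rfl le_rfl) (hv'.mono (by omega) subset_rfl le_rfl) hder).mono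
        (Nat.zero_le _) subset_rfl le_rfl) fun i => ?_
    refine ih (v' := fun t x => fderiv ℝ (v' t) x (b i)) (Reg.fderiv_apply (m := r + m) hU hv _)
      (hv'.fderiv_apply hU _) fun t ht x hx => ?_
    have h1 := hasDerivAt_fderiv hU (hv.mono (by omega) subset_rfl le_rfl)
      (hv'.mono (by omega) subset_rfl le_rfl) hder ht hx
    exact ((ContinuousLinearMap.apply ℝ X (b i)).hasFDerivAt.comp_hasDerivAt t h1 :)

/-- Local regularity for nonlinear parabolic systems, including the time regularity of the spatial
derivatives. -/
theorem local_regularity (hr : 1 ≤ r) (hrev : Even r) (b : OrthonormalBasis (Fin n) ℝ V)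
    {lam : ℝ} (hlam : 0 < lam) (hα0 : 0 < α) (hα1 : α < 1)
    {S : Set (V × ℝ × Jt n r X)} (hSc : IsCompact S) (hScv : Convex ℝ S) (hSu : UniqueDiffOn ℝ S)
    {G : V × ℝ × Jt n r X → X} {R0 : ℝ} (hT : 0 < T) (hR0 : 0 < R0) {u u' : ℝ → V → X}
    (hu : Reg (Metric.ball c R0) α T r u) (hu' : Reg (Metric.ball c R0) α T 0 u')
    (hder : ∀ t ∈ Set.Ioo 0 T, ∀ x ∈ Metric.ball c R0, HasDerivAt (fun s => u s x) (u' t x) t)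
    (hS : ∀ t ∈ Set.Icc 0 T, ∀ x ∈ Metric.ball c R0, prolong b r u t x ∈ S)
    (heq : ∀ t ∈ Set.Icc 0 T, ∀ x ∈ Metric.ball c R0, u' t x = G (prolong b r u t x))
    (hell : JetElliptic b lam ((fderivWithin ℝ G S (prolong b r u 0 c)).comp (jetIncl V n r X)))
    {C0 : ℝ} (hC0 : 0 ≤ C0) (k : ℕ) (hG : ContDiffOn ℝ (2 + k) G S)
    (h0 : CH (Metric.ball c R0) α (r + k) C0 (u 0)) :
    ∃ ρ > 0, ∃ τ > 0, τ ≤ T ∧ ρ ≤ R0 ∧ Reg (Metric.ball c ρ) α τ (r + k) u ∧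
      Reg (Metric.ball c ρ) α τ k u' ∧ TimeHolder (Metric.ball c ρ) (α / r) τ (r + k) u ∧
      TimeHolder (Metric.ball c ρ) (α / r) τ k u' := by
  obtain ⟨κ, hκ, -⟩ := exists_kernel hr hrev b (fun J =>
    ((fderivWithin ℝ G S (prolong b r u 0 c)).comp (jetIncl V n r X)).comp (topInj J)) hlam hell
  obtain ⟨ρ, hρ, τ, hτ, hτT, hρR, hreg⟩ := nonlinear_regularity hr hrev b hlam hα0 hα1 hSc hScv hSu
    hT hR0 hu hu' hder hS heq hell hC0 k hG h0
  have hs : Metric.ball c ρ ⊆ Metric.ball c R0 := Metric.ball_subset_ball hρR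
  have hs4 : Metric.ball c (ρ / 4) ⊆ Metric.ball c ρ := Metric.ball_subset_ball (by linarith)
  have hts : ∀ t ∈ Set.Icc 0 τ, t ∈ Set.Icc 0 T := fun t ht => ⟨ht.1, ht.2.trans hτT⟩
  have hG1 : ContDiffOn ℝ (k + 1) G S := hG.of_le (by exact_mod_cast (by omega : k + 1 ≤ 2 + k))
  have hU : IsOpen (Metric.ball c ρ) := Metric.isOpen_ball
  have hU4 : IsOpen (Metric.ball c (ρ / 4)) := Metric.isOpen_ball
  have hregk : Reg (Metric.ball c ρ) α τ (k + r) u := hreg.mono (by omega) subset_rfl le_rfl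
  have hp : Reg (Metric.ball c ρ) α τ k (prolong b r u) :=
    Reg.prolong_reg hU Metric.isBounded_ball hα0 hα1 hregk
  have hreg' : Reg (Metric.ball c ρ) α τ k u' :=
    (reg_comp hU hSc hScv hSu k hG1 hp fun t ht x hx => hS t (hts t ht) x (hs hx)).congr hU
      fun t ht x hx => heq t (hts t ht) x (hs hx)
  have hTH : TimeHolder (Metric.ball c (ρ / 4)) (α / r) τ (r + k) u :=
    timeHolder_of_evolution_higher hr b κ hκ hα0 hα1 hρ k hreg hreg' fun t ht x hx =>
      hder t ⟨ht.1, ht.2.trans_le hτT⟩ x (hs hx)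
  have hr1 : (1 : ℝ) ≤ r := by exact_mod_cast hr
  have hβ : α / r ≤ 1 := by
    rw [div_le_one (by linarith)]; linarith
  have hregk4 : Reg (Metric.ball c (ρ / 4)) α τ (k + r) u := hregk.mono le_rfl hs4 le_rfl
  have htime : Reg (Metric.ball c (ρ / 4)) α τ k fun t (_ : V) => t :=
    reg_const_space (c := fun t => t) continuousOn_id
  have hTHjet := TimeHolder.jet (b := b) hU4 hregk4 (hTH.mono (by omega) subset_rfl le_rfl)
  have hTHp : TimeHolder (Metric.ball c (ρ / 4)) (α / r) τ k (prolong b r u) :=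
    TimeHolder.prodMk hU4 (reg_id hU4 Metric.isBounded_ball hα0.le hα1.le)
      (htime.prodMk hU4 (hregk4.jet_reg hU4)) timeHolder_const
      (TimeHolder.prodMk hU4 htime (hregk4.jet_reg hU4) (timeHolder_time hβ) hTHjet)
  refine ⟨ρ / 4, by positivity, τ, hτ, hτT, by linarith, hreg.mono le_rfl hs4 le_rfl,
    hreg'.mono le_rfl hs4 le_rfl, hTH, ?_⟩
  exact (timeHolder_comp hU4 hSc hScv hSu k hG1 (hp.mono le_rfl hs4 le_rfl)
    (fun t ht x hx => hS t (hts t ht) x (hs (hs4 hx))) hTHp).congr hU4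
    fun t ht x hx => heq t (hts t ht) x (hs (hs4 hx))

end TimeRegularity

section Components
variable {V : Type} [NormedAddCommGroup V] [InnerProductSpace ℝ V] [FiniteDimensional ℝ V]
  {Y : Type} [NormedAddCommGroup Y] [NormedSpace ℝ Y] {n : ℕ} {U : Set V} {α T : ℝ}

theorem ch_of_bounds (hU : IsOpen U) (hUc : Convex ℝ U) {d : ℝ} (hd : 0 ≤ d)
    (hUd : ∀ x ∈ U, ∀ x' ∈ U, ‖x - x'‖ ≤ d) (hα1 : α ≤ 1) {m : ℕ} {f : V → Y}
    (hf : ContDiffOn ℝ m f U) {B C : ℝ} (hB : 0 ≤ B) (hC : 0 ≤ C)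
    (hb : ∀ k ≤ m, ∀ x ∈ U, ‖iteratedFDeriv ℝ k f x‖ ≤ B)
    (hh : ∀ x ∈ U, ∀ x' ∈ U, ‖iteratedFDeriv ℝ m f x - iteratedFDeriv ℝ m f x'‖
      ≤ C * ‖x - x'‖ ^ α) : CH U α m (B + B * d ^ (1 - α) + C) f := by
  have hd' : 0 ≤ B * d ^ (1 - α) := by positivity
  refine ⟨hf, fun k hk => ⟨fun x hx => (hb k hk x hx).trans (by linarith), fun x hx x' hx' => ?_⟩⟩
  have hpos : 0 ≤ ‖x - x'‖ ^ α := by positivity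
  rcases hk.eq_or_lt with rfl | hk
  · refine (hh x hx x' hx').trans ?_
    gcongr
    linarith
  · have hdiff : ∀ y ∈ U, DifferentiableAt ℝ (iteratedFDeriv ℝ k f) y := fun y hy =>
      (hf.contDiffAt (hU.mem_nhds hy)).differentiableAt_iteratedFDeriv (by exact_mod_cast hk)
    have h1 : ‖iteratedFDeriv ℝ k f x - iteratedFDeriv ℝ k f x'‖ ≤ B * ‖x - x'‖ :=
      hUc.norm_image_sub_le_of_norm_fderiv_le hdiff
        (fun y hy => norm_fderiv_iteratedFDeriv.le.trans (hb (k + 1) hk y hy)) hx' hx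
    have h2 : ‖x - x'‖ ≤ d ^ (1 - α) * ‖x - x'‖ ^ α := by
      rcases (norm_nonneg (x - x')).eq_or_lt with h | h
      · rw [← h]; positivity
      · calc ‖x - x'‖ = ‖x - x'‖ ^ (1 - α) * ‖x - x'‖ ^ α := by
              rw [← Real.rpow_add h]; simp
          _ ≤ _ := by
            have h3 : 0 ≤ 1 - α := by linarith
            gcongr
            exact hUd x hx x' hx'
    calc _ ≤ B * ‖x - x'‖ := h1
      _ ≤ B * (d ^ (1 - α) * ‖x - x'‖ ^ α) := by gcongr
      _ = B * d ^ (1 - α) * ‖x - x'‖ ^ α := by ring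
      _ ≤ _ := by gcongr; linarith

theorem continuousOn_multilinear_of_basis (b : OrthonormalBasis (Fin n) ℝ V) {P : Type}
    [TopologicalSpace P] {s : Set P} {k : ℕ} {f : P → V [×k]→L[ℝ] Y}
    (h : ∀ J : Fin k → Fin n, ContinuousOn (fun p => f p fun j => b (J j)) s) :
    ContinuousOn f s := by
  intro p hp
  refine tendsto_iff_norm_sub_tendsto_zero.2 (squeeze_zero (fun _ => norm_nonneg _)
    (fun q => multilinear_norm_le_sum_basis b (f q - f p)) ?_)
  rw [show (0 : ℝ) = ∑ J : Fin k → Fin n, (0 : ℝ) by simp]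
  exact tendsto_finsetSum _ fun J _ => tendsto_iff_norm_sub_tendsto_zero.1 (h J p hp)

/-- Regularity from conditions on the partial derivatives. -/
theorem reg_of_components (hU : IsOpen U) (hUc : Convex ℝ U) (hUb : Bornology.IsBounded U)
    (hα1 : α ≤ 1) (b : OrthonormalBasis (Fin n) ℝ V) {m : ℕ} {f : ℝ → V → Y}
    (h1 : ∀ t ∈ Set.Icc 0 T, ContDiffOn ℝ m (f t) U)
    (h2 : ∀ k ≤ m, ∀ J : Fin k → Fin n, ContinuousOn
      (fun p : ℝ × V => iteratedFDeriv ℝ k (f p.1) p.2 fun j => b (J j)) (Set.Icc 0 T ×ˢ U))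
    (h3 : ∀ k ≤ m, ∀ J : Fin k → Fin n, ∃ B, ∀ t ∈ Set.Icc 0 T, ∀ x ∈ U,
      ‖iteratedFDeriv ℝ k (f t) x fun j => b (J j)‖ ≤ B)
    (h4 : ∀ J : Fin m → Fin n, ∃ C, ∀ t ∈ Set.Icc 0 T, ∀ x ∈ U, ∀ x' ∈ U,
      ‖(iteratedFDeriv ℝ m (f t) x fun j => b (J j)) -
        iteratedFDeriv ℝ m (f t) x' fun j => b (J j)‖ ≤ C * ‖x - x'‖ ^ α) :
    Reg U α T m f := by
  choose! B hB using h3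
  choose C hC using h4
  obtain ⟨d, hd⟩ := hUb.exists_norm_le
  have hd' : ∀ x ∈ U, ∀ x' ∈ U, ‖x - x'‖ ≤ max d 0 + max d 0 := fun x hx x' hx' =>
    (norm_sub_le _ _).trans (add_le_add ((hd x hx).trans (le_max_left _ _))
      ((hd x' hx').trans (le_max_left _ _)))
  set BB : ℝ := ∑ k ∈ Finset.range (m + 1), ∑ J : Fin k → Fin n, max (B k J) 0 with hBB
  set CC : ℝ := ∑ J, max (C J) 0 with hCC
  have hBB0 : 0 ≤ BB := Finset.sum_nonneg fun k _ => Finset.sum_nonneg fun J _ => le_max_right _ _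
  have hCC0 : 0 ≤ CC := Finset.sum_nonneg fun J _ => le_max_right _ _
  refine ⟨⟨_, ?_, fun t ht => ch_of_bounds hU hUc (by positivity) hd' hα1 (h1 t ht) hBB0 hCC0
    (fun k hk x hx => ?_) fun x hx x' hx' => ?_⟩,
    fun k hk => continuousOn_multilinear_of_basis b (h2 k hk)⟩
  · positivity
  · refine (multilinear_norm_le_sum_basis b _).trans ((Finset.sum_le_sum fun J _ =>
      (hB k hk J t ht x hx).trans (le_max_left _ 0)).trans ?_)
    exact Finset.single_le_sum (f := fun k => ∑ J : Fin k → Fin n, max (B k J) 0)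
      (fun k _ => Finset.sum_nonneg fun J _ => le_max_right _ _)
      (Finset.mem_range.2 (Nat.lt_succ_iff.2 hk))
  · refine (multilinear_norm_le_sum_basis b _).trans ?_
    rw [hCC, Finset.sum_mul]
    refine Finset.sum_le_sum fun J _ => ?_
    refine (hC J t ht x hx x' hx').trans ?_
    gcongr
    exact le_max_left _ _

end Components

section Translation
variable {n l r : ℕ} {α T R : ℝ} {x₀ : Vec n}

theorem pderivW_eq_iteratedFDeriv {D : Set (Vec n)} {x : Vec n} (hx : D ∈ nhds x) (k : ℕ)
    (I : Fin k → Fin n) (w : Vec n → Vec l) : pderivW D k I w x =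
      iteratedFDeriv ℝ k w x fun j => EuclideanSpace.basisFun (Fin n) ℝ (I j) := by
  have h : D =ᶠ[nhds x] Set.univ := Filter.eventuallyEq_univ.2 hx
  simp only [pderivW, EuclideanSpace.basisFun_apply]
  rw [iteratedFDerivWithin_congr_set h, iteratedFDerivWithin_univ]

theorem closure_ball_mem_nhds {x : Vec n} (hx : x ∈ Metric.ball x₀ R) :
    closure (Metric.ball x₀ R) ∈ nhds x :=
  Filter.mem_of_superset (Metric.isOpen_ball.mem_nhds hx) subset_closure

theorem isCompact_closure_ball : IsCompact (closure (Metric.ball x₀ R)) :=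
  Metric.isBounded_ball.isCompact_closure

theorem uniqueDiffOn_closure_ball (hR : 0 < R) : UniqueDiffOn ℝ (closure (Metric.ball x₀ R)) :=
  uniqueDiffOn_convex (convex_ball x₀ R).closure
    ⟨x₀, interior_mono subset_closure (by simpa [Metric.isOpen_ball.interior_eq] using hR)⟩

theorem exists_bound_of_bddAbove_holQuot {Q : Set (Vec n × ℝ)} {w : Vec n → ℝ → Vec l}
    (h : BddAbove (holQuot r α Q w)) (hα : 0 < α) : ∃ C, 0 ≤ C ∧ ∀ p ∈ Q, ∀ q ∈ Q,
      ‖w p.1 p.2 - w q.1 q.2‖ ≤ C * (‖p.1 - q.1‖ ^ α + |p.2 - q.2| ^ (α / r)) := by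
  obtain ⟨C, hC⟩ := h
  refine ⟨max C 0, le_max_right _ _, fun p hp q hq => ?_⟩
  rcases eq_or_ne p q with rfl | hne
  · simpa using mul_nonneg (le_max_right C 0) (by positivity)
  have h1 := (hC ⟨p, hp, q, hq, hne, rfl⟩).trans (le_max_left C 0)
  refine (div_le_iff₀ ?_).1 h1
  by_cases hx : p.1 = q.1
  · have : p.2 ≠ q.2 := fun h => hne (Prod.ext hx h)
    have : 0 < |p.2 - q.2| := abs_pos.2 (sub_ne_zero.2 this)
    positivity
  · have : 0 < ‖p.1 - q.1‖ := norm_pos_iff.2 (sub_ne_zero.2 hx)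
    positivity

theorem exists_bound_space {D : Set (Vec n)} {J : Set ℝ} {w : Vec n → ℝ → Vec l}
    (h : BddAbove (holQuot r α (D ×ˢ J) w)) (hr : 1 ≤ r) (hα : 0 < α) : ∃ C, 0 ≤ C ∧ ∀ t ∈ J,
      ∀ x ∈ D, ∀ x' ∈ D, ‖w x t - w x' t‖ ≤ C * ‖x - x'‖ ^ α := by
  obtain ⟨C, hC0, hC⟩ := exists_bound_of_bddAbove_holQuot h hα
  refine ⟨C, hC0, fun t ht x hx x' hx' => ?_⟩
  have h1 := hC (x, t) ⟨hx, ht⟩ (x', t) ⟨hx', ht⟩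
  have : α / r ≠ 0 := by positivity
  simpa [Real.zero_rpow this] using h1

theorem continuousOn_swap {D U : Set (Vec n)} {J : Set ℝ} {w : Vec n → ℝ → Vec l}
    (h : ContinuousOn (fun p : Vec n × ℝ => w p.1 p.2) (D ×ˢ J)) (hU : U ⊆ D) :
    ContinuousOn (fun p : ℝ × Vec n => w p.2 p.1) (J ×ˢ U) :=
  h.comp continuous_swap.continuousOn fun _ hp => ⟨hU hp.2, hp.1⟩

theorem reg_of_memPar (hr : 1 ≤ r) (hα0 : 0 < α) (hα1 : α < 1) {u : Vec n → ℝ → Vec l}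
    (hu : MemPar r α (closure (Metric.ball x₀ R)) (Set.Icc 0 T) u) :
    Reg (Metric.ball x₀ R) α T r fun t x => u x t := by
  obtain ⟨-, h1, -, h2, -, h3, -⟩ := hu
  have he : ∀ (k : ℕ) (I : Fin k → Fin n), ∀ t, ∀ x ∈ Metric.ball x₀ R,
      spDerivW (closure (Metric.ball x₀ R)) k I u x t =
        iteratedFDeriv ℝ k (fun x => u x t) x
          fun j => EuclideanSpace.basisFun (Fin n) ℝ (I j) := fun k I t x hx =>
    pderivW_eq_iteratedFDeriv (closure_ball_mem_nhds hx) k I _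
  refine reg_of_components Metric.isOpen_ball (convex_ball _ _) Metric.isBounded_ball hα1.le
    (EuclideanSpace.basisFun (Fin n) ℝ) (fun t ht => (h1 t ht).mono subset_closure) ?_ ?_ ?_
  · exact fun k hk I => (continuousOn_swap (h2 k hk I) subset_closure).congr
      fun p hp => (he k I p.1 p.2 hp.2).symm
  · intro k hk I
    obtain ⟨B, hB⟩ := (isCompact_closure_ball.prod isCompact_Icc).exists_bound_of_continuousOn
      (h2 k hk I)
    exact ⟨B, fun t ht x hx => he k I t x hx ▸ hB (x, t) ⟨subset_closure hx, ht⟩⟩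
  · intro I
    obtain ⟨C, -, hC⟩ := exists_bound_space (h3 I) hr hα0
    refine ⟨C, fun t ht x hx x' hx' => ?_⟩
    rw [← he r I t x hx, ← he r I t x' hx']
    exact hC t ht x (subset_closure hx) x' (subset_closure hx')

theorem reg_tDerivW_of_memPar (hr : 1 ≤ r) (hα0 : 0 < α) {u : Vec n → ℝ → Vec l}
    (hu : MemPar r α (closure (Metric.ball x₀ R)) (Set.Icc 0 T) u) :
    Reg (Metric.ball x₀ R) α T 0 fun t x => tDerivW (Set.Icc 0 T) u x t := by
  obtain ⟨-, -, -, -, h1, -, h2⟩ := hu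
  obtain ⟨B, hB⟩ := (isCompact_closure_ball.prod isCompact_Icc).exists_bound_of_continuousOn h1
  obtain ⟨C, hC0, hC⟩ := exists_bound_space h2 hr hα0
  refine reg_zero_iff.2 ⟨continuousOn_swap h1 subset_closure, max B C, hC0.trans (le_max_right _ _),
    fun t ht => ⟨fun x hx => (hB (x, t) ⟨subset_closure hx, ht⟩).trans (le_max_left _ _),
    fun x hx x' hx' => (hC t ht x (subset_closure hx) x' (subset_closure hx')).trans ?_⟩⟩
  gcongr
  exact le_max_right _ _

theorem ch_of_memSp {m : ℕ} (hR : 0 < R) (hα1 : α < 1) {w : Vec n → Vec l}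
    (hw : MemSp m α (closure (Metric.ball x₀ R)) w) :
    ∃ C, 0 ≤ C ∧ CH (Metric.ball x₀ R) α m C w := by
  obtain ⟨h1, h2⟩ := hw
  have he : ∀ (k : ℕ) (I : Fin k → Fin n), ∀ x ∈ Metric.ball x₀ R,
      pderivW (closure (Metric.ball x₀ R)) k I w x =
        iteratedFDeriv ℝ k w x
          fun j => EuclideanSpace.basisFun (Fin n) ℝ (I j) := fun k I x hx =>
    pderivW_eq_iteratedFDeriv (closure_ball_mem_nhds hx) k I _
  have hc : ∀ k ≤ m, ∀ I : Fin k → Fin n,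
      ContinuousOn (pderivW (closure (Metric.ball x₀ R)) k I w) (closure (Metric.ball x₀ R)) :=
    fun k hk I => (ContinuousMultilinearMap.apply ℝ (fun _ : Fin k => Vec n) (Vec l)
      fun j => EuclideanSpace.single (I j) 1).continuous.comp_continuousOn
      (h1.continuousOn_iteratedFDerivWithin (by exact_mod_cast hk) (uniqueDiffOn_closure_ball hR))
  have h : Reg (Metric.ball x₀ R) α 0 m fun _ => w := by
    refine reg_of_components Metric.isOpen_ball (convex_ball _ _) Metric.isBounded_ball hα1.le
      (EuclideanSpace.basisFun (Fin n) ℝ) (fun t ht => h1.mono subset_closure) ?_ ?_ ?_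
    · exact fun k hk I => ((hc k hk I).comp continuous_snd.continuousOn
        fun p hp => subset_closure hp.2).congr fun p hp => (he k I p.2 hp.2).symm
    · intro k hk I
      obtain ⟨B, hB⟩ := isCompact_closure_ball.exists_bound_of_continuousOn (hc k hk I)
      exact ⟨B, fun t ht x hx => he k I x hx ▸ hB x (subset_closure hx)⟩
    · intro I
      obtain ⟨C, hC⟩ := h2 I
      refine ⟨max C 0, fun t ht x hx x' hx' => ?_⟩
      rw [← he m I x hx, ← he m I x' hx']
      rcases eq_or_ne x x' with rfl | hne
      · simpa using mul_nonneg (le_max_right C 0) (by positivity)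
      · have : 0 < ‖x - x'‖ := norm_pos_iff.2 (sub_ne_zero.2 hne)
        exact (div_le_iff₀ (by positivity)).1 ((hC ⟨x, subset_closure hx, x', subset_closure hx',
          hne, rfl⟩).trans (le_max_left C 0))
  obtain ⟨C, hC0, hC⟩ := h.bound
  exact ⟨C, hC0, hC 0 ⟨le_rfl, le_rfl⟩⟩

theorem hasDerivAt_of_memPar {D : Set (Vec n)} {u : Vec n → ℝ → Vec l}
    (hu : MemPar r α D (Set.Icc 0 T) u) {t : ℝ} (ht : t ∈ Set.Ioo 0 T) {x : Vec n} (hx : x ∈ D) :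
    HasDerivAt (fun s => u x s) (tDerivW (Set.Icc 0 T) u x t) t :=
  ((hu.2.2.1 x hx t (Set.Ioo_subset_Icc_self ht)).hasDerivWithinAt).hasDerivAt
    (Icc_mem_nhds ht.1 ht.2)

end Translation

section LocalData
variable {n l r : ℕ}

/-- Jets with values in Euclidean space, in coordinates. -/
def jetCoord (n l r : ℕ) : Jt n r (Vec l) ≃L[ℝ] Jet n l r :=
  ContinuousLinearEquiv.piCongrRight fun k : Fin (r + 1) =>
    ContinuousLinearEquiv.piCongrRight fun _ : Fin (k : ℕ) → Fin n => EuclideanSpace.equiv (Fin l) ℝ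

theorem jetCoord_apply (z : Jt n r (Vec l)) (k : Fin (r + 1)) (I : Fin (k : ℕ) → Fin n)
    (b : Fin l) : jetCoord n l r z k I b = z k I b := rfl

theorem jetOf_eq_jetCoord {D : Set (Vec n)} {x : Vec n} (hx : D ∈ nhds x) (w : Vec n → Vec l) :
    jetOf D r w x = jetCoord n l r (jet (EuclideanSpace.basisFun (Fin n) ℝ) r w x) := by
  ext k I b
  rw [jetCoord_apply]
  exact congrArg (fun y : Vec l => y b) (pderivW_eq_iteratedFDeriv hx k I w)

theorem jetCoord_topInj (J : Fin r → Fin n) (b : Fin l) :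
    jetCoord n l r (topInj J (EuclideanSpace.single b 1)) = jetBasisG r r J b := by
  ext k I b'
  rw [jetCoord_apply]
  by_cases hk : k = Fin.last r
  · subst hk
    by_cases hI : I = J
    · subst hI
      simp [jetInj, jetBasisG]
    · simp only [jetInj, jetBasisG, ContinuousLinearMap.comp_apply,
        ContinuousLinearMap.single_apply, Pi.single_eq_same, Pi.single_eq_of_ne hI]
      rw [dif_pos (Fin.val_last r), if_neg fun h => hI h.1]
      rfl
  · have h' : (k : ℕ) ≠ r := fun h => hk (Fin.ext h)
    simp [jetInj, jetBasisG, h', Pi.single_eq_of_ne hk]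

theorem jetElliptic_of_coordinates (hr : 2 ≤ r) {Z : Set (Jet n l r)} {z : Jt n r (Vec l)}
    (hz : Z ∈ nhds (jetCoord n l r z)) {h : Jet n l r → Vec l} {L : Jt n r (Vec l) →L[ℝ] Vec l}
    (hL : HasFDerivAt (fun z' => h (jetCoord n l r z')) L z) {lam : ℝ}
    (hell : ∀ ξ : Vec n, ∀ v : Vec l, lam * ‖ξ‖ ^ r * ‖v‖ ^ 2 ≤ (-1 : ℝ) ^ (r / 2 - 1) *
      ∑ I : Fin r → Fin n, ∑ a : Fin l, ∑ b : Fin l,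
        (fderivWithin ℝ (fun z' => h z' a) Z (jetCoord n l r z) (jetBasisG r r I b))
          * (∏ j, ξ (I j)) * v a * v b) :
    JetElliptic (EuclideanSpace.basisFun (Fin n) ℝ) lam L := by
  have h1 : HasFDerivAt h (L.comp ((jetCoord n l r).symm : Jet n l r →L[ℝ] Jt n r (Vec l)))
      (jetCoord n l r z) := by
    have h2 : HasFDerivAt (fun z' => h (jetCoord n l r z')) L
        ((jetCoord n l r).symm (jetCoord n l r z)) := by simpa using hL
    have h3 := h2.comp (jetCoord n l r z) (jetCoord n l r).symm.hasFDerivAt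
    refine h3.congr_of_eventuallyEq (Filter.Eventually.of_forall fun y => ?_)
    simp
  have h4 : ∀ (a : Fin l) (I : Fin r → Fin n) (b : Fin l),
      fderivWithin ℝ (fun z' => h z' a) Z (jetCoord n l r z) (jetBasisG r r I b) =
        L (topInj I (EuclideanSpace.single b 1)) a := by
    intro a I b
    have h5 : HasFDerivAt (fun z' => h z' a) ((EuclideanSpace.proj a : Vec l →L[ℝ] ℝ).comp
        (L.comp ((jetCoord n l r).symm : Jet n l r →L[ℝ] Jt n r (Vec l)))) (jetCoord n l r z) :=
      (EuclideanSpace.proj a : Vec l →L[ℝ] ℝ).hasFDerivAt.comp _ h1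
    rw [fderivWithin_of_mem_nhds hz, h5.fderiv, ← jetCoord_topInj]
    simp
  intro ξ v
  have h6 := hell ξ v
  have h7 : ∀ I : Fin r → Fin n, ∑ a : Fin l, ∑ b : Fin l,
      (fderivWithin ℝ (fun z' => h z' a) Z (jetCoord n l r z) (jetBasisG r r I b))
        * (∏ j, ξ (I j)) * v a * v b = (∏ j, inner ℝ ξ (EuclideanSpace.basisFun (Fin n) ℝ (I j))) *
          inner ℝ (L (topInj I v)) v := by
    intro I
    have hv : v = ∑ b, v b • (EuclideanSpace.single b 1 : Vec l) := by
      have := ((EuclideanSpace.basisFun (Fin l) ℝ).sum_repr v).symm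
      simpa using this
    have h8 : ∀ a, L (topInj I v) a = ∑ b, v b * L (topInj I (EuclideanSpace.single b 1)) a := by
      intro a
      conv_lhs => rw [hv]
      simp [map_sum]
    rw [PiLp.inner_apply, Finset.mul_sum]
    refine Finset.sum_congr rfl fun a _ => ?_
    rw [h8 a]
    simp only [EuclideanSpace.basisFun_inner, h4, real_inner_comm, EuclideanSpace.basisFun_apply,
      EuclideanSpace.inner_single_right, RCLike.inner_apply, conj_trivial, Finset.mul_sum, one_mul]
    refine Finset.sum_congr rfl fun b _ => ?_
    ring
  simp only [h7] at h6
  have h9 : (-1 : ℝ) ^ (r / 2) = -(-1 : ℝ) ^ (r / 2 - 1) := by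
    have : r / 2 = r / 2 - 1 + 1 := by omega
    conv_lhs => rw [this, pow_succ]
    ring
  rw [h9]
  linarith

end LocalData

section LocalRegularity
variable {n l r k : ℕ} {α : ℝ}

theorem local_regularity_of_memPar (hn : 1 ≤ n) (hr : 2 ≤ r) (hrev : Even r)
    (hα0 : 0 < α) (hα1 : α < 1) {x₀ : Vec n} {R₁ : ℝ} (hR₁ : 0 < R₁) {δ : ℝ} (hδ : 0 < δ)
    {u₀ : Vec n → Vec l} (hu₀ : MemSp (r + k) α (closure (Metric.ball x₀ R₁)) u₀)
    {Z : Set (Jet n l r)} (hZn : ∀ x ∈ closure (Metric.ball x₀ R₁),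
      jetOf (closure (Metric.ball x₀ R₁)) r u₀ x ∈ interior Z)
    {F : Vec n → ℝ → Jet n l r → Vec l}
    (hF : ContDiffOn ℝ (2 + k) (fun q : Vec n × ℝ × Jet n l r => F q.1 q.2.1 q.2.2)
      (closure (Metric.ball x₀ R₁) ×ˢ Set.Icc 0 δ ×ˢ Z))
    {lam : ℝ} (hlam : 0 < lam)
    (hell : ∀ x ∈ closure (Metric.ball x₀ R₁), ∀ t ∈ Set.Icc (0 : ℝ) δ, ∀ z ∈ Z,
      ∀ ξ : Vec n, ∀ v : Vec l,
        lam * ‖ξ‖ ^ r * ‖v‖ ^ 2 ≤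
          (-1 : ℝ) ^ (r / 2 - 1) *
            ∑ I : Fin r → Fin n, ∑ a : Fin l, ∑ b : Fin l,
              (fderivWithin ℝ (fun z' => F x t z' a) Z z (jetBasisG r r I b))
                * (∏ j, ξ (I j)) * v a * v b)
    {δt : ℝ} (hδt : 0 < δt) {u : Vec n → ℝ → Vec l}
    (hu : MemPar r α (closure (Metric.ball x₀ R₁)) (Set.Icc 0 δt) u)
    (hpde : ∀ x ∈ closure (Metric.ball x₀ R₁), ∀ t ∈ Set.Icc (0 : ℝ) δt,
      tDerivW (Set.Icc 0 δt) u x t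
        = F x t (jetOf (closure (Metric.ball x₀ R₁)) r (fun y => u y t) x))
    (hinit : ∀ x ∈ closure (Metric.ball x₀ R₁), u x 0 = u₀ x)
    {c : Vec n} (hc : c ∈ Metric.ball x₀ R₁) :
    ∃ ρ > 0, ∃ τ > 0, τ ≤ min δ δt ∧ Metric.ball c ρ ⊆ Metric.ball x₀ R₁ ∧
      Reg (Metric.ball c ρ) α τ (r + k) (fun t x => u x t) ∧
      Reg (Metric.ball c ρ) α τ k (fun t x => tDerivW (Set.Icc 0 δt) u x t) ∧
      TimeHolder (Metric.ball c ρ) (α / r) τ (r + k) (fun t x => u x t) ∧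
      TimeHolder (Metric.ball c ρ) (α / r) τ k (fun t x => tDerivW (Set.Icc 0 δt) u x t) := by
  haveI : Nonempty (Fin n) := ⟨⟨0, hn⟩⟩
  haveI : Nontrivial (Vec n) := inferInstance
  set D := closure (Metric.ball x₀ R₁) with hD
  have hDn : ∀ x ∈ Metric.ball x₀ R₁, D ∈ nhds x := fun x hx => closure_ball_mem_nhds hx
  have hUD : Metric.ball x₀ R₁ ⊆ D := subset_closure
  have hreg := reg_of_memPar (by omega : 1 ≤ r) hα0 hα1 hu
  have hreg' := reg_tDerivW_of_memPar (by omega : 1 ≤ r) hα0 hu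
  obtain ⟨C0, hC0, hch⟩ := ch_of_memSp hR₁ hα1 hu₀
  set b := EuclideanSpace.basisFun (Fin n) ℝ with hb
  set zs : Jt n r (Vec l) := jet b r (fun y => u y 0) c with hzs
  have hch' : CH (Metric.ball x₀ R₁) α (r + k) C0 fun x => u x 0 :=
    hch.congr Metric.isOpen_ball fun x hx => hinit x (hUD hx)
  have hzZ : jetCoord n l r zs ∈ interior Z := by
    have h1 := hZn c (hUD hc)
    rw [jetOf_eq_jetCoord (hDn c hc)] at h1
    convert h1 using 2
    have h2 : (fun y => u y 0) =ᶠ[nhds c] u₀ :=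
      Filter.eventually_of_mem (Metric.isOpen_ball.mem_nhds hc) fun x hx => hinit x (hUD hx)
    ext j I
    simp only [hzs, jet, (h2.iteratedFDeriv ℝ _).eq_of_nhds, hb]
  have hZz : Z ∈ nhds (jetCoord n l r zs) := mem_interior_iff_mem_nhds.1 hzZ
  obtain ⟨ε₁, hε₁, hε₁Z⟩ := Metric.nhds_basis_closedBall.mem_iff.1
    ((jetCoord n l r).continuous.continuousAt.preimage_mem_nhds hZz)
  obtain ⟨ε₂, hε₂, hε₂U⟩ := Metric.nhds_basis_closedBall.mem_iff.1
    (Metric.isOpen_ball.mem_nhds hc)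
  set ε := min ε₁ (min ε₂ (min δ δt)) with hεdef
  have hε : 0 < ε := lt_min hε₁ (lt_min hε₂ (lt_min hδ hδt))
  have hεε₁ : ε ≤ ε₁ := min_le_left _ _
  have hεε₂ : ε ≤ ε₂ := (min_le_right _ _).trans (min_le_left _ _)
  have hεδ : ε ≤ min δ δt := (min_le_right _ _).trans (min_le_right _ _)
  have hεU : Metric.closedBall c ε ⊆ Metric.ball x₀ R₁ :=
    (Metric.closedBall_subset_closedBall hεε₂).trans hε₂U
  have hεZ : ∀ z ∈ Metric.closedBall zs ε, jetCoord n l r z ∈ Z := fun z hz =>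
    hε₁Z (Metric.closedBall_subset_closedBall hεε₁ hz)
  have hjr : Reg (Metric.ball c ε) α δt 0 fun t => jet b r fun y => u y t :=
    Reg.jet_reg Metric.isOpen_ball (m := 0) (f := fun t y => u y t)
      (hreg.mono (by omega) (Metric.ball_subset_closedBall.trans hεU) le_rfl)
  obtain ⟨ρ, hρ, hρε, hsmall⟩ := hjr.exists_small hδt hε hε
  have hρU : Metric.ball c ρ ⊆ Metric.ball x₀ R₁ :=
    (Metric.ball_subset_ball hρε).trans (Metric.ball_subset_closedBall.trans hεU)
  have hρδt : ρ / 2 ≤ δt := by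
    have := hεδ.trans (min_le_right _ _)
    linarith
  set S : Set (Vec n × ℝ × Jt n r (Vec l)) :=
    Metric.closedBall c ε ×ˢ Set.Icc 0 ε ×ˢ Metric.closedBall zs ε with hS
  set G : Vec n × ℝ × Jt n r (Vec l) → Vec l :=
    fun q => F q.1 q.2.1 (jetCoord n l r q.2.2) with hG
  have hSF : ∀ q ∈ S, (q.1, q.2.1, jetCoord n l r q.2.2) ∈ D ×ˢ Set.Icc 0 δ ×ˢ Z :=
    fun q hq => ⟨hUD (hεU hq.1), ⟨hq.2.1.1, hq.2.1.2.trans (hεδ.trans (min_le_left _ _))⟩,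
      hεZ _ hq.2.2⟩
  have hGs : ContDiffOn ℝ (2 + k) G S := hF.comp
    (contDiff_fst.prodMk (contDiff_snd.fst.prodMk
      ((jetCoord n l r).contDiff.comp contDiff_snd.snd))).contDiffOn hSF
  have hud : ∀ {E : Type} [NormedAddCommGroup E] [NormedSpace ℝ E] (e : E),
      UniqueDiffOn ℝ (Metric.closedBall e ε) := fun e =>
    uniqueDiffOn_convex (convex_closedBall e ε)
      ⟨e, mem_interior_iff_mem_nhds.2 (Metric.closedBall_mem_nhds e hε)⟩
  have hSu : UniqueDiffOn ℝ S := (hud c).prod ((uniqueDiffOn_Icc hε).prod (hud zs))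
  have hp0 : prolong b r (fun t x => u x t) 0 c ∈ S :=
    ⟨Metric.mem_closedBall_self hε.le, ⟨le_rfl, hε.le⟩, Metric.mem_closedBall_self hε.le⟩
  have hGd : HasFDerivAt (fun z' => F c 0 (jetCoord n l r z'))
      ((fderivWithin ℝ G S (prolong b r (fun t x => u x t) 0 c)).comp
        (jetIncl (Vec n) n r (Vec l))) zs := by
    have h1 := (hGs.differentiableOn (by simp) _ hp0).hasFDerivWithinAt
    have h2 : HasFDerivAt (fun z : Jt n r (Vec l) => ((c, 0, z) : Vec n × ℝ × Jt n r (Vec l)))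
        (jetIncl (Vec n) n r (Vec l)) zs :=
      (hasFDerivAt_prodMk_right c ((0 : ℝ), zs)).comp zs (hasFDerivAt_prodMk_right (0 : ℝ) zs)
    have h3 : Set.MapsTo (fun z : Jt n r (Vec l) => ((c, 0, z) : Vec n × ℝ × Jt n r (Vec l)))
        (Metric.closedBall zs ε) S :=
      fun z hz => ⟨Metric.mem_closedBall_self hε.le, ⟨le_rfl, hε.le⟩, hz⟩
    exact (HasFDerivWithinAt.comp zs h1 h2.hasFDerivWithinAt h3).hasFDerivAt
      (Metric.closedBall_mem_nhds zs hε)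
  have hell' := jetElliptic_of_coordinates hr hZz (h := F c 0) hGd
    (hell c (hUD hc) 0 ⟨le_rfl, hδ.le⟩ _ (interior_subset hzZ))
  obtain ⟨ρ', hρ', τ, hτ, hτT, hρ'ρ, h1, h2, h3, h4⟩ :=
    local_regularity (by omega : 1 ≤ r) hrev b hlam hα0 hα1
      ((isCompact_closedBall c ε).prod (isCompact_Icc.prod (isCompact_closedBall zs ε)))
      ((convex_closedBall c ε).prod ((convex_Icc 0 ε).prod (convex_closedBall zs ε))) hSu
      (half_pos hρ) hρ (hreg.mono le_rfl hρU hρδt) (hreg'.mono le_rfl hρU hρδt)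
      (fun t ht x hx => hasDerivAt_of_memPar hu ⟨ht.1, ht.2.trans_le hρδt⟩ (hUD (hρU hx)))
      (fun t ht x hx => ⟨Metric.closedBall_subset_closedBall hρε
          (Metric.ball_subset_closedBall hx), ⟨ht.1, ht.2.trans (by linarith)⟩,
        mem_closedBall_iff_norm.2 (hsmall t ⟨ht.1, ht.2.trans hρδt⟩ (by linarith [ht.2]) x hx)⟩)
      (fun t ht x hx => by
        rw [hpde x (hUD (hρU hx)) t ⟨ht.1, ht.2.trans hρδt⟩, jetOf_eq_jetCoord (hDn x (hρU hx))]
        rfl)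
      hell' hC0 k hGs (hch'.mono le_rfl hρU le_rfl)
  exact ⟨ρ', hρ', τ, hτ, hτT.trans ((by linarith : ρ / 2 ≤ ε).trans hεδ),
    (Metric.ball_subset_ball hρ'ρ).trans hρU, h1, h2, h3, h4⟩

end LocalRegularity

section Globalization
variable {n l r : ℕ} {α T : ℝ} {D : Set (Vec n)}

theorem hasDerivWithinAt_Icc_of_continuousOn {Y : Type} [NormedAddCommGroup Y] [NormedSpace ℝ Y]
    (hT : 0 < T) {φ φ' : ℝ → Y} (h1 : ContinuousOn φ (Set.Icc 0 T))
    (h2 : ContinuousOn φ' (Set.Icc 0 T)) (h : ∀ t ∈ Set.Ioo 0 T, HasDerivAt φ (φ' t) t) {t : ℝ}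
    (ht : t ∈ Set.Icc 0 T) : HasDerivWithinAt φ (φ' t) (Set.Icc 0 T) t := by
  have hcl : closure (Set.Ioo 0 T) = Set.Icc 0 T := closure_Ioo hT.ne
  have h3 : Filter.Tendsto (fun s => fderiv ℝ φ s) (nhdsWithin t (Set.Ioo 0 T))
      (nhds (ContinuousLinearMap.toSpanSingletonCLE (𝕜 := ℝ) (φ' t))) := by
    refine ((ContinuousLinearMap.toSpanSingletonCLE (𝕜 := ℝ) (E := Y)).continuous.continuousAt
      |>.tendsto.comp ((h2 t ht).mono_left
        (nhdsWithin_mono t Set.Ioo_subset_Icc_self))).congr' ?_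
    exact Filter.eventually_of_mem self_mem_nhdsWithin fun s hs => (h s hs).hasFDerivAt.fderiv.symm
  have h4 := hasFDerivWithinAt_closure_of_tendsto_fderiv
    (fun s hs => (h s hs).differentiableAt.differentiableWithinAt) (convex_Ioo 0 T) isOpen_Ioo
    (fun s hs => (h1 s (hcl ▸ hs)).mono Set.Ioo_subset_Icc_self) h3
  rw [hcl] at h4
  exact h4

theorem continuousOn_prod_of_local {Y : Type} [TopologicalSpace Y] {φ : ℝ → Vec n → Y} {J : Set ℝ}
    (h : ∀ c ∈ D, ∃ U, IsOpen U ∧ c ∈ U ∧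
      ContinuousOn (fun p : ℝ × Vec n => φ p.1 p.2) (J ×ˢ U)) :
    ContinuousOn (fun p : Vec n × ℝ => φ p.2 p.1) (D ×ˢ J) := by
  refine continuousOn_of_locally_continuousOn fun p hp => ?_
  obtain ⟨U, hU, hpU, hc⟩ := h p.1 hp.1
  refine ⟨U ×ˢ Set.univ, hU.prod isOpen_univ, ⟨hpU, trivial⟩, ?_⟩
  exact hc.comp continuous_swap.continuousOn fun q hq => ⟨hq.1.2, hq.2.1⟩

theorem bddAbove_holQuot_of_local (hD : IsCompact D) (hα0 : 0 < α) {w : Vec n → ℝ → Vec l}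
    {φ : ℝ → Vec n → Vec l} (hw : ∀ t ∈ Set.Icc 0 T, ∀ x ∈ D, w x t = φ t x)
    (h : ∀ c ∈ D, ∃ U, IsOpen U ∧ c ∈ U ∧ Reg U α T 0 φ ∧ TimeHolder U (α / r) T 0 φ) :
    BddAbove (holQuot r α (D ×ˢ Set.Icc 0 T) w) := by
  obtain ⟨B, hB⟩ := (hD.prod isCompact_Icc).exists_bound_of_continuousOn
    (continuousOn_prod_of_local (J := Set.Icc 0 T) fun c hc => by
      obtain ⟨U, hU, hcU, h1, -⟩ := h c hc
      exact ⟨U, hU, hcU, h1.continuousOn⟩)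
  have hmain : ∃ C, 0 ≤ C ∧ ∀ p ∈ D ×ˢ D, p ∈ D ×ˢ D → ∀ t ∈ Set.Icc 0 T, ∀ s ∈ Set.Icc 0 T,
      ‖φ t p.1 - φ s p.2‖ ≤ C * (‖p.1 - p.2‖ ^ α + |t - s| ^ (α / r)) := by
    refine (hD.prod hD).induction_on (p := fun A => ∃ C, 0 ≤ C ∧ ∀ p ∈ A, p ∈ D ×ˢ D →
      ∀ t ∈ Set.Icc 0 T, ∀ s ∈ Set.Icc 0 T,
      ‖φ t p.1 - φ s p.2‖ ≤ C * (‖p.1 - p.2‖ ^ α + |t - s| ^ (α / r)))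
      ⟨0, le_rfl, by simp⟩ ?_ ?_ ?_
    · rintro A A' hA ⟨C, hC0, hC⟩
      exact ⟨C, hC0, fun p hp => hC p (hA hp)⟩
    · rintro A A' ⟨C, hC0, hC⟩ ⟨C', hC0', hC'⟩
      refine ⟨max C C', hC0.trans (le_max_left _ _), fun p hp hpD t ht s hs => ?_⟩
      rcases hp with hp | hp
      · exact (hC p hp hpD t ht s hs).trans
          (mul_le_mul_of_nonneg_right (le_max_left _ _) (by positivity))
      · exact (hC' p hp hpD t ht s hs).trans
          (mul_le_mul_of_nonneg_right (le_max_right _ _) (by positivity))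
    · rintro ⟨c, c'⟩ ⟨hc, hc'⟩
      rcases eq_or_ne c c' with rfl | hne
      · obtain ⟨U, hU, hcU, h1, h2⟩ := h c hc
        obtain ⟨-, C, hC0, hC⟩ := reg_zero_iff.1 h1
        obtain ⟨C', hC0', hC'⟩ := timeHolder_zero_iff.1 h2
        refine ⟨U ×ˢ U, mem_nhdsWithin_of_mem_nhds ((hU.prod hU).mem_nhds ⟨hcU, hcU⟩), max C C',
          hC0.trans (le_max_left _ _), fun p hp _ t ht s hs => ?_⟩
        calc ‖φ t p.1 - φ s p.2‖ = ‖(φ t p.1 - φ t p.2) + (φ t p.2 - φ s p.2)‖ := by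
              rw [sub_add_sub_cancel]
          _ ≤ C * ‖p.1 - p.2‖ ^ α + C' * |t - s| ^ (α / r) := (norm_add_le _ _).trans
              (add_le_add ((hC t ht).2 p.1 hp.1 p.2 hp.2) (hC' t ht s hs p.2 hp.2))
          _ ≤ max C C' * ‖p.1 - p.2‖ ^ α + max C C' * |t - s| ^ (α / r) := by
              gcongr
              exacts [le_max_left _ _, le_max_right _ _]
          _ = _ := by ring
      · have hd : 0 < ‖c - c'‖ := norm_pos_iff.2 (sub_ne_zero.2 hne)
        have hA : {p : Vec n × Vec n | ‖c - c'‖ / 2 < ‖p.1 - p.2‖} ∈ nhds (c, c') :=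
          (isOpen_lt continuous_const (continuous_fst.sub continuous_snd).norm).mem_nhds
            (half_lt_self hd)
        have hB0 : 0 ≤ max B 0 := le_max_right _ _
        refine ⟨_, mem_nhdsWithin_of_mem_nhds hA, 2 * max B 0 / (‖c - c'‖ / 2) ^ α, by positivity,
          fun p hp hpD t ht s hs => ?_⟩
        have h1 : (‖c - c'‖ / 2) ^ α ≤ ‖p.1 - p.2‖ ^ α + |t - s| ^ (α / r) :=
          (Real.rpow_le_rpow (by positivity) (le_of_lt hp) hα0.le).trans
            (le_add_of_nonneg_right (by positivity))
        calc ‖φ t p.1 - φ s p.2‖ ≤ ‖φ t p.1‖ + ‖φ s p.2‖ := norm_sub_le _ _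
          _ ≤ max B 0 + max B 0 := add_le_add
              ((hB (p.1, t) ⟨hpD.1, ht⟩).trans (le_max_left _ _))
              ((hB (p.2, s) ⟨hpD.2, hs⟩).trans (le_max_left _ _))
          _ = 2 * max B 0 / (‖c - c'‖ / 2) ^ α * (‖c - c'‖ / 2) ^ α := by
              field_simp
              ring
          _ ≤ _ := mul_le_mul_of_nonneg_left h1 (by positivity)
  obtain ⟨C, hC0, hC⟩ := hmain
  refine ⟨C, ?_⟩
  rintro _ ⟨p, hp, q, hq, -, rfl⟩
  refine div_le_of_le_mul₀ (by positivity) hC0 ?_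
  rw [hw p.2 hp.2 p.1 hp.1, hw q.2 hq.2 q.1 hq.1]
  exact hC (p.1, q.1) ⟨hp.1, hq.1⟩ ⟨hp.1, hq.1⟩ p.2 hp.2 q.2 hq.2

theorem memPar_of_local (hD : IsCompact D) (hDu : UniqueDiffOn ℝ D) (hT : 0 < T) (hα0 : 0 < α)
    {w : Vec n → ℝ → Vec l} {g g' : ℝ → Vec n → Vec l}
    (h : ∀ c ∈ D, ∃ U, IsOpen U ∧ c ∈ U ∧ Reg U α T r g ∧ Reg U α T 0 g' ∧
      TimeHolder U (α / r) T r g ∧ TimeHolder U (α / r) T 0 g' ∧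
      ∀ t ∈ Set.Ioo 0 T, ∀ x ∈ U, HasDerivAt (fun s => g s x) (g' t x) t)
    (hw : ∀ t ∈ Set.Icc 0 T, ∀ x ∈ D, w x t = g t x) : MemPar r α D (Set.Icc 0 T) w := by
  have hct : ∀ t ∈ Set.Icc 0 T, ∀ x ∈ D, ContDiffAt ℝ r (g t) x := fun t ht x hx => by
    obtain ⟨U, hU, hxU, h1, -⟩ := h x hx
    exact h1.contDiffAt hU ht hxU
  have hsp : ∀ k ≤ r, ∀ I : Fin k → Fin n, ∀ t ∈ Set.Icc 0 T, ∀ x ∈ D, spDerivW D k I w x t =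
      iteratedFDeriv ℝ k (g t) x fun j => EuclideanSpace.single (I j) 1 := by
    intro k hk I t ht x hx
    simp only [spDerivW, pderivW]
    rw [iteratedFDerivWithin_congr (fun y hy => hw t ht y hy) hx,
      iteratedFDerivWithin_eq_iteratedFDeriv hDu
        ((hct t ht x hx).of_le (by exact_mod_cast hk)) hx]
  have hd : ∀ x ∈ D, ∀ t ∈ Set.Icc 0 T,
      HasDerivWithinAt (fun s => w x s) (g' t x) (Set.Icc 0 T) t := by
    intro x hx t ht
    obtain ⟨U, hU, hxU, h1, h2, -, -, h3⟩ := h x hx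
    have hm : Set.MapsTo (fun s : ℝ => (s, x)) (Set.Icc 0 T) (Set.Icc 0 T ×ˢ U) :=
      fun s hs => ⟨hs, hxU⟩
    exact (hasDerivWithinAt_Icc_of_continuousOn hT
      (h1.continuousOn.comp (by fun_prop) hm) (h2.continuousOn.comp (by fun_prop) hm)
      (fun s hs => h3 s hs x hxU) ht).congr (fun s hs => hw s hs x hx) (hw t ht x hx)
  have ht : ∀ t ∈ Set.Icc 0 T, ∀ x ∈ D, tDerivW (Set.Icc 0 T) w x t = g' t x := fun t ht x hx =>
    (hd x hx t ht).derivWithin (uniqueDiffOn_Icc hT t ht)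
  refine ⟨?_, fun t ht x hx => ?_, fun x hx t ht => (hd x hx t ht).differentiableWithinAt, ?_, ?_,
    ?_, ?_⟩
  · refine (continuousOn_prod_of_local (φ := g) (J := Set.Icc 0 T) fun c hc => ?_).congr
      fun p hp => hw p.2 hp.2 p.1 hp.1
    obtain ⟨U, hU, hcU, h1, -⟩ := h c hc
    exact ⟨U, hU, hcU, h1.continuousOn⟩
  · exact (hct t ht x hx).contDiffWithinAt.congr (fun y hy => hw t ht y hy) (hw t ht x hx)
  · intro k hk I
    refine (continuousOn_prod_of_local (J := Set.Icc 0 T) (φ := fun t x =>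
      iteratedFDeriv ℝ k (g t) x fun j => EuclideanSpace.single (I j) 1) fun c hc => ?_).congr
      fun p hp => hsp k hk I p.2 hp.2 p.1 hp.1
    obtain ⟨U, hU, hcU, h1, -⟩ := h c hc
    exact ⟨U, hU, hcU, (Reg.iteratedFDeriv_apply hU (m := 0)
      (h1.mono (by omega) subset_rfl le_rfl) _).continuousOn⟩
  · refine (continuousOn_prod_of_local (φ := g') (J := Set.Icc 0 T) fun c hc => ?_).congr
      fun p hp => ht p.2 hp.2 p.1 hp.1
    obtain ⟨U, hU, hcU, -, h1, -⟩ := h c hc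
    exact ⟨U, hU, hcU, h1.continuousOn⟩
  · intro I
    refine bddAbove_holQuot_of_local hD hα0 (hsp r le_rfl I) fun c hc => ?_
    obtain ⟨U, hU, hcU, h1, -, h2, -⟩ := h c hc
    rw [← zero_add r] at h1
    refine ⟨U, hU, hcU, Reg.iteratedFDeriv_apply hU h1 _, TimeHolder.iteratedFDeriv_apply hU h1
      (h2.mono (by omega) subset_rfl le_rfl) _⟩
  · refine bddAbove_holQuot_of_local hD hα0 ht fun c hc => ?_
    obtain ⟨U, hU, hcU, -, h1, -, h2, -⟩ := h c hc
    exact ⟨U, hU, hcU, h1, h2⟩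

end Globalization

end ParabolicBootstrap

/-- **Interior regularity bootstrap for fully nonlinear parabolic systems**
(Proposition 4.2).  `Ω = ball x₀ R₁`, `Ω' = ball x₁ R₂` with `closure Ω' ⊆ Ω`,
`u₀ ∈ C^{r+k+α}(closure Ω)`, `Z` a compact neighborhood of the range of `j_r u₀`,
`F` of class `C^{2+k}` and uniformly strongly elliptic on `closure Ω × [0,δ] × Z`.
Any solution `u ∈ C^{r+α,1+α/r}` of `∂u/∂t = F(x,t,j_r u)` with `u(⋅,0) = u₀` whose jet
stays in `Z` has all spatial derivatives of order `≤ k` in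
`C^{r+α,1+α/r}(closure Ω' × [0,δ'])` for some `δ' > 0`. -/
theorem interior_regularity_bootstrap
    (n l r k : ℕ) (hn : 1 ≤ n) (hl : 1 ≤ l) (hr : 2 ≤ r) (hrev : Even r)
    (α : ℝ) (hα0 : 0 < α) (hα1 : α < 1)
    (x₀ x₁ : Vec n) (R₁ R₂ : ℝ) (hR₁ : 0 < R₁) (hR₂ : 0 < R₂)
    (hsub : closure (Metric.ball x₁ R₂) ⊆ Metric.ball x₀ R₁)
    (δ : ℝ) (hδ : 0 < δ)
    (u₀ : Vec n → Vec l) (hu₀ : MemSp (r + k) α (closure (Metric.ball x₀ R₁)) u₀)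
    (Z : Set (Jet n l r)) (hZc : IsCompact Z)
    (hZn : ∀ x ∈ closure (Metric.ball x₀ R₁),
      jetOf (closure (Metric.ball x₀ R₁)) r u₀ x ∈ interior Z)
    (F : Vec n → ℝ → Jet n l r → Vec l)
    (hF : ContDiffOn ℝ (2 + k) (fun q : Vec n × ℝ × Jet n l r => F q.1 q.2.1 q.2.2)
      (closure (Metric.ball x₀ R₁) ×ˢ Set.Icc 0 δ ×ˢ Z))
    (lam : ℝ) (hlam : 0 < lam)
    (hell : ∀ x ∈ closure (Metric.ball x₀ R₁), ∀ t ∈ Set.Icc (0 : ℝ) δ, ∀ z ∈ Z,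
      ∀ ξ : Vec n, ∀ v : Vec l,
        lam * ‖ξ‖ ^ r * ‖v‖ ^ 2 ≤
          (-1 : ℝ) ^ (r / 2 - 1) *
            ∑ I : Fin r → Fin n, ∑ a : Fin l, ∑ b : Fin l,
              (fderivWithin ℝ (fun z' => F x t z' a) Z z (jetBasisG r r I b))
                * (∏ j, ξ (I j)) * v a * v b)
    (δt : ℝ) (hδt : 0 < δt)
    (u : Vec n → ℝ → Vec l)
    (hu : MemPar r α (closure (Metric.ball x₀ R₁)) (Set.Icc 0 δt) u)
    (hpde : ∀ x ∈ closure (Metric.ball x₀ R₁), ∀ t ∈ Set.Icc (0 : ℝ) δt,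
      tDerivW (Set.Icc 0 δt) u x t
        = F x t (jetOf (closure (Metric.ball x₀ R₁)) r (fun y => u y t) x))
    (hinit : ∀ x ∈ closure (Metric.ball x₀ R₁), u x 0 = u₀ x)
    (hjet : ∀ x ∈ closure (Metric.ball x₀ R₁), ∀ t ∈ Set.Icc 0 (min δ δt),
      jetOf (closure (Metric.ball x₀ R₁)) r (fun y => u y t) x ∈ Z) :
    ∃ δ' : ℝ, 0 < δ' ∧ δ' ≤ min δ δt ∧
      ∀ m : ℕ, m ≤ k → ∀ β : Fin m → Fin n,
        MemPar r α (closure (Metric.ball x₁ R₂)) (Set.Icc 0 δ')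
          (spDerivW (closure (Metric.ball x₀ R₁)) m β u) := by
  have hD' : IsCompact (closure (Metric.ball x₁ R₂)) := ParabolicBootstrap.isCompact_closure_ball
  obtain ⟨τ, hτ, hτδ, hloc⟩ := hD'.induction_on
    (p := fun A => ∃ τ, 0 < τ ∧ τ ≤ min δ δt ∧ ∀ c ∈ A, ∃ U, IsOpen U ∧ c ∈ U ∧
      U ⊆ Metric.ball x₀ R₁ ∧
      ParabolicBootstrap.Reg U α τ (r + k) (fun t x => u x t) ∧
      ParabolicBootstrap.Reg U α τ k (fun t x => tDerivW (Set.Icc 0 δt) u x t) ∧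
      ParabolicBootstrap.TimeHolder U (α / r) τ (r + k) (fun t x => u x t) ∧
      ParabolicBootstrap.TimeHolder U (α / r) τ k (fun t x => tDerivW (Set.Icc 0 δt) u x t))
    ⟨min δ δt, lt_min hδ hδt, le_rfl, by simp⟩
    (fun A A' hA ⟨τ, h1, h2, h3⟩ => ⟨τ, h1, h2, fun c hc => h3 c (hA hc)⟩)
    (fun A A' ⟨τ, h1, h2, h3⟩ ⟨τ', h1', h2', h3'⟩ =>
      ⟨min τ τ', lt_min h1 h1', (min_le_left _ _).trans h2, fun c hc => by
        rcases hc with hc | hc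
        · obtain ⟨U, hU, hcU, hUs, a1, a2, a3, a4⟩ := h3 c hc
          exact ⟨U, hU, hcU, hUs, a1.mono le_rfl subset_rfl (min_le_left _ _),
            a2.mono le_rfl subset_rfl (min_le_left _ _),
            a3.mono le_rfl subset_rfl (min_le_left _ _),
            a4.mono le_rfl subset_rfl (min_le_left _ _)⟩
        · obtain ⟨U, hU, hcU, hUs, a1, a2, a3, a4⟩ := h3' c hc
          exact ⟨U, hU, hcU, hUs, a1.mono le_rfl subset_rfl (min_le_right _ _),
            a2.mono le_rfl subset_rfl (min_le_right _ _),
            a3.mono le_rfl subset_rfl (min_le_right _ _),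
            a4.mono le_rfl subset_rfl (min_le_right _ _)⟩⟩)
    (fun c hc => by
      obtain ⟨ρ, hρ, τ, hτ, hτδ, hsub', a1, a2, a3, a4⟩ :=
        ParabolicBootstrap.local_regularity_of_memPar hn hr hrev hα0 hα1 hR₁ hδ hu₀ hZn hF hlam
          hell hδt hu hpde hinit (hsub hc)
      exact ⟨Metric.ball c ρ, mem_nhdsWithin_of_mem_nhds (Metric.ball_mem_nhds c hρ), τ, hτ, hτδ,
        fun c' hc' => ⟨Metric.ball c ρ, Metric.isOpen_ball, hc', hsub', a1, a2, a3, a4⟩⟩)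
  refine ⟨τ, hτ, hτδ, fun m hm β => ?_⟩
  refine ParabolicBootstrap.memPar_of_local hD'
    (ParabolicBootstrap.uniqueDiffOn_closure_ball hR₂) hτ hα0
    (g := fun t x => iteratedFDeriv ℝ m (fun y => u y t) x
      fun j => EuclideanSpace.basisFun (Fin n) ℝ (β j))
    (g' := fun t x => iteratedFDeriv ℝ m (fun y => tDerivW (Set.Icc 0 δt) u y t) x
      fun j => EuclideanSpace.basisFun (Fin n) ℝ (β j)) (fun c hc => ?_) fun t _ x hx =>
      ParabolicBootstrap.pderivW_eq_iteratedFDeriv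
        (ParabolicBootstrap.closure_ball_mem_nhds (hsub hx)) m β _
  obtain ⟨U, hU, hcU, hUs, h1, h2, h3, h4⟩ := hloc c hc
  have h1m : ParabolicBootstrap.Reg U α τ (r + m) fun t x => u x t :=
    h1.mono (by omega) subset_rfl le_rfl
  have h2m : ParabolicBootstrap.Reg U α τ (0 + m) fun t x => tDerivW (Set.Icc 0 δt) u x t :=
    h2.mono (by omega) subset_rfl le_rfl
  refine ⟨U, hU, hcU, h1m.iteratedFDeriv_apply hU _, h2m.iteratedFDeriv_apply hU _,
    ParabolicBootstrap.TimeHolder.iteratedFDeriv_apply hU h1m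
      (h3.mono (by omega) subset_rfl le_rfl) _,
    ParabolicBootstrap.TimeHolder.iteratedFDeriv_apply hU h2m
      (h4.mono (by omega) subset_rfl le_rfl) _, fun t ht x hx => ?_⟩
  have hder := ParabolicBootstrap.hasDerivAt_iteratedFDeriv hU m
    (h1m.mono (by omega) subset_rfl le_rfl) (h2m.mono (by omega) subset_rfl le_rfl)
    (fun s hs y hy => ParabolicBootstrap.hasDerivAt_of_memPar hu
      ⟨hs.1, hs.2.trans_le (hτδ.trans (min_le_right _ _))⟩ (subset_closure (hUs hy))) t ht x hx
  exact (ContinuousMultilinearMap.apply ℝ (fun _ : Fin m => Vec n) (Vec l)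
    fun j => EuclideanSpace.basisFun (Fin n) ℝ (β j)).hasFDerivAt.comp_hasDerivAt t hder
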